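/- (Maus) Assume ζ_p ∉ K and let t^1 < … < t^m be integers. There exists a totally ramified cyclic extension L/K of degree p^m with upper ramification jumps t^1,…,t^m if and only if: (i) 1 ≤ t^1 < p·e_K/(p−1) and gcd(t^1, p) = 1; (ii) for each i, if t^i < e_K/(p−1), then either t^{i+1} = p·t^i, or p·t^i < t^{i+1} < p·e_K/(p−1) and gcd(p, t^{i+1}) = 1; (iii) for each i, if t^i ≥ e_K/(p−1), then t^{i+1} = t^i + e_K. -/

import Mathlib

noncomputable section

open scoped Classical

namespace PaperRam

/-- An additive `ℤ ∪ {∞}`-valued valuation on a field is *normalized* if it is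
surjective onto `ℤ`. -/
def IsNormalized {F : Type*} [Field F] (v : AddValuation F (WithTop ℤ)) : Prop :=
  ∀ n : ℤ, ∃ x : F, v x = (n : WithTop ℤ)

/-- The normalized valuation `vF` of `F` extends the normalized valuation `vK` of `K`
with ramification index `e`, i.e. `vF(x) = e · vK(x)` for all `x ∈ K`. -/
def Extends {K F : Type*} [Field K] [Field F] [Algebra K F]
    (vK : AddValuation K (WithTop ℤ)) (vF : AddValuation F (WithTop ℤ)) (e : ℕ) : Prop :=
  0 < e ∧ ∀ x : K, vF (algebraMap K F x) = e • vK x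

/-- `v` is the normalized valuation of the `p`-adic field `K`, with (absolute)
ramification index `eK` over `ℚ_p`. -/
def IsPadicValuation (p : ℕ) [Fact p.Prime] {K : Type*} [Field K] [Algebra ℚ_[p] K]
    (v : AddValuation K (WithTop ℤ)) (eK : ℕ) : Prop :=
  IsNormalized v ∧ 0 < eK ∧
    ∀ x : ℚ_[p], x ≠ 0 → v (algebraMap ℚ_[p] K x) = ((eK * x.valuation : ℤ) : WithTop ℤ)

/-- The valuation `v` of `F` is invariant under all `K`-algebra automorphisms of `F`. -/
def GalInvariant (K : Type*) {F : Type*} [Field K] [Field F] [Algebra K F]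
    (v : AddValuation F (WithTop ℤ)) : Prop :=
  ∀ (σ : F ≃ₐ[K] F) (x : F), v (σ x) = v x

variable {K F : Type*} [Field K] [Field F] [Algebra K F]

/-- The lower-numbering ramification subgroup `G_i` of `Gal(F/K)`:
`σ ∈ G_i ↔ v(σ x − x) ≥ i + 1` for all `x` in the valuation ring of `F`. -/
def lowerRG (v : AddValuation F (WithTop ℤ)) (hv : GalInvariant K v) (i : ℤ) :
    Subgroup (F ≃ₐ[K] F) where
  carrier := {σ | ∀ x : F, 0 ≤ v x → ((i + 1 : ℤ) : WithTop ℤ) ≤ v (σ x - x)}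
  one_mem' := by
    intro x _
    simp
  mul_mem' := by
    intro a b ha hb x hx
    have h1 : ((i + 1 : ℤ) : WithTop ℤ) ≤ v (a (b x) - b x) :=
      ha (b x) (by rw [hv b x]; exact hx)
    have h2 := hb x hx
    have hrw : (a * b) x - x = (a (b x) - b x) + (b x - x) := by
      rw [AlgEquiv.mul_apply]; ring
    rw [hrw]
    exact v.map_le_add h1 h2
  inv_mem' := by
    intro a ha x hx
    have hda : a (a⁻¹ x - x) = x - a x := by
      rw [map_sub]
      congr 1
      exact a.apply_symm_apply x
    have : v (a⁻¹ x - x) = v (a x - x) := by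
      rw [← hv a (a⁻¹ x - x), hda, v.map_sub_swap]
    rw [this]
    exact ha x hx

/-- The Herbrand function `φ_{F/K}` evaluated at integers. -/
def herbrandPhi (v : AddValuation F (WithTop ℤ)) (hv : GalInvariant K v) (n : ℤ) : ℚ :=
  if n ≤ 0 then (n : ℚ)
  else (∑ i ∈ Finset.Icc (1 : ℤ) n, (Nat.card (lowerRG v hv i) : ℚ)) /
    (Nat.card (lowerRG v hv 0) : ℚ)

/-- The upper-numbering ramification subgroup `G^u = G_{ψ(u)}` of `Gal(F/K)`. -/
def upperRG (v : AddValuation F (WithTop ℤ)) (hv : GalInvariant K v) (u : ℤ) :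
    Subgroup (F ≃ₐ[K] F) :=
  lowerRG v hv (sInf {n : ℤ | (u : ℚ) ≤ herbrandPhi v hv n})

/-- `t` is an upper ramification jump of `F/K`: `G^u ≠ G^t` for every `u > t`. -/
def IsUpperJump (v : AddValuation F (WithTop ℤ)) (hv : GalInvariant K v) (t : ℤ) : Prop :=
  ∀ u : ℤ, t < u → upperRG v hv u ≠ upperRG v hv t

/-- A group is elementary abelian of exponent `p` if it is isomorphic to `(ℤ/pℤ)^k`
for some `k`. -/
def IsElemAbelian (p : ℕ) (G : Type*) [Group G] : Prop :=
  ∃ k : ℕ, Nonempty (G ≃* (Fin k → Multiplicative (ZMod p)))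

/-- The norm group `N_{L/K}(L^×)`, as a subgroup of `K^×`. -/
def normGroup (K L : Type*) [Field K] [Field L] [Algebra K L] : Subgroup Kˣ :=
  (Units.map (Algebra.norm K : L →* K)).range

/-- The residues of `c 0, …, c (f-1)` lie in the valuation ring and form a basis of
the residue field of `v` over `𝔽_p`. -/
def IsResidueBasis (p : ℕ) {K : Type*} [Field K] (v : AddValuation K (WithTop ℤ))
    {f : ℕ} (c : Fin f → K) : Prop :=
  (∀ y, 0 ≤ v (c y)) ∧
  (∀ a : Fin f → ℤ, (1 : WithTop ℤ) ≤ v (∑ y, (a y : K) * c y) → ∀ y, (p : ℤ) ∣ a y) ∧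
  (∀ x : K, 0 ≤ v x → ∃ a : Fin f → ℤ, (1 : WithTop ℤ) ≤ v (x - ∑ y, (a y : K) * c y))

/-- `v_L(𝒟_{L/K})`: the valuation of the different of `L/K`, defined through the
inverse different `{x ∈ L ∣ Tr_{L/K}(x·𝒪_L) ⊆ 𝒪_K} = 𝔪_L^{-d}`. -/
def differentVal (K : Type*) {L : Type*} [Field K] [Field L] [Algebra K L]
    (vK : AddValuation K (WithTop ℤ)) (vL : AddValuation L (WithTop ℤ)) : ℤ :=
  sSup {m : ℤ | ∃ x : L, vL x = ((-m : ℤ) : WithTop ℤ) ∧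
    ∀ y : L, 0 ≤ vL y → 0 ≤ vK (Algebra.trace K L (x * y))}

/-- The maximal elementary abelian `p`-extension `𝒞_K(p)` of `K` inside `Ω`: the
compositum of all cyclic (equivalently, normal) extensions of `K` of degree `p`. -/
def maxElemAbelian (p : ℕ) (K Ω : Type*) [Field K] [Field Ω] [Algebra K Ω] :
    IntermediateField K Ω :=
  ⨆ L ∈ {L : IntermediateField K Ω | Module.finrank K L = p ∧ Normal K L}, L

/-- The subgroup `U_K^{i+1} = 1 + 𝔪_K^{i+1}` of principal units of `K^×`
(the index is shifted by one so that `principalUnits v 0 = U_K^1`). -/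
def principalUnits {K : Type*} [Field K] (v : AddValuation K (WithTop ℤ)) (i : ℕ) :
    Subgroup Kˣ where
  carrier := {x : Kˣ | (((i : ℤ) + 1 : ℤ) : WithTop ℤ) ≤ v ((x : K) - 1)}
  one_mem' := by simp
  mul_mem' := by
    intro a b ha hb
    have hpos : (0 : WithTop ℤ) < (((i : ℤ) + 1 : ℤ) : WithTop ℤ) := by
      rw [show (0 : WithTop ℤ) = ((0 : ℤ) : WithTop ℤ) from rfl]
      exact WithTop.coe_lt_coe.mpr (by omega)
    have hva : v (a : K) = 0 := by
      have h1 : v ((1 : K)) < v ((a : K) - 1) := by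
        rw [v.map_one]; exact lt_of_lt_of_le hpos ha
      have h2 := v.map_add_eq_of_lt_right h1
      rw [sub_add_cancel] at h2
      rw [h2, v.map_one]
    have key : ((a * b : Kˣ) : K) - 1 = (a : K) * ((b : K) - 1) + ((a : K) - 1) := by
      push_cast; ring
    show (((i : ℤ) + 1 : ℤ) : WithTop ℤ) ≤ v (((a * b : Kˣ) : K) - 1)
    rw [key]
    refine v.map_le_add ?_ ha
    rw [v.map_mul, hva, zero_add]
    exact hb
  inv_mem' := by
    intro a ha
    have hpos : (0 : WithTop ℤ) < (((i : ℤ) + 1 : ℤ) : WithTop ℤ) := by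
      rw [show (0 : WithTop ℤ) = ((0 : ℤ) : WithTop ℤ) from rfl]
      exact WithTop.coe_lt_coe.mpr (by omega)
    have hva : v (a : K) = 0 := by
      have h1 : v ((1 : K)) < v ((a : K) - 1) := by
        rw [v.map_one]; exact lt_of_lt_of_le hpos ha
      have h2 := v.map_add_eq_of_lt_right h1
      rw [sub_add_cancel] at h2
      rw [h2, v.map_one]
    have key : ((a⁻¹ : Kˣ) : K) - 1 = ((a : K))⁻¹ * (1 - (a : K)) := by
      rw [mul_sub, mul_one, inv_mul_cancel₀ (Units.ne_zero a)]
      push_cast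
      ring
    show (((i : ℤ) + 1 : ℤ) : WithTop ℤ) ≤ v (((a⁻¹ : Kˣ) : K) - 1)
    rw [key, v.map_mul, v.map_inv, hva, v.map_sub_swap]
    simpa using ha

/-- The fractional ideal of elements of valuation at least `n`, as an additive subgroup. -/
def ball {F : Type*} [Field F] (v : AddValuation F (WithTop ℤ)) (n : ℤ) : AddSubgroup F where
  carrier := {x | (n : WithTop ℤ) ≤ v x}
  zero_mem' := by simp
  add_mem' := fun {a b} ha hb => v.map_le_add ha hb
  neg_mem' := fun {a} ha => by
    show (n : WithTop ℤ) ≤ v (-a)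
    rw [v.map_neg]; exact ha

section ball
variable {F : Type*} [Field F] {v : AddValuation F (WithTop ℤ)}

lemma mem_ball {n : ℤ} {x : F} : x ∈ ball v n ↔ (n : WithTop ℤ) ≤ v x := Iff.rfl

lemma ball_anti {m n : ℤ} (h : m ≤ n) {x : F} (hx : x ∈ ball v n) : x ∈ ball v m :=
  le_trans (WithTop.coe_le_coe.mpr h) (mem_ball.1 hx)

lemma ball_mul {m n k : ℤ} {x y : F} (hx : x ∈ ball v m) (hy : y ∈ ball v n) (h : k ≤ m + n) :
    x * y ∈ ball v k := by
  refine ball_anti h ?_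
  rw [mem_ball, v.map_mul, WithTop.coe_add]
  exact add_le_add hx hy

lemma ball_mul_left {n : ℤ} {x y : F} (hx : x ∈ ball v 0) (hy : y ∈ ball v n) :
    x * y ∈ ball v n := ball_mul hx hy (by omega)

lemma ball_mul_right {n : ℤ} {x y : F} (hx : x ∈ ball v n) (hy : y ∈ ball v 0) :
    x * y ∈ ball v n := ball_mul hx hy (by omega)

lemma one_mem_ball : (1 : F) ∈ ball v 0 := by simp [mem_ball]

lemma ball_pow {n : ℤ} {x : F} (hx : x ∈ ball v n) (k : ℕ) : x ^ k ∈ ball v (k * n) := by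
  induction k with
  | zero => simpa using one_mem_ball
  | succ k ih =>
    rw [pow_succ]
    exact ball_mul ih hx (by push_cast; linarith)

lemma ball_pow_zero {x : F} (hx : x ∈ ball v 0) (k : ℕ) : x ^ k ∈ ball v 0 := by
  simpa using ball_pow hx k

lemma natCast_mem_ball (k : ℕ) : (k : F) ∈ ball v 0 := by
  rw [← nsmul_one]; exact (ball v 0).nsmul_mem one_mem_ball k

lemma intCast_mem_ball (k : ℤ) : (k : F) ∈ ball v 0 := by
  rw [← zsmul_one]; exact (ball v 0).zsmul_mem one_mem_ball k

lemma exists_int_val {x : F} (hx : x ≠ 0) : ∃ n : ℤ, v x = n := by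
  have := (v.ne_top_iff).2 hx
  obtain ⟨n, hn⟩ := WithTop.ne_top_iff_exists.1 this
  exact ⟨n, hn.symm⟩

lemma ne_zero_of_val {x : F} {n : ℤ} (h : v x = n) : x ≠ 0 := by
  rintro rfl; simp at h

lemma mem_ball_of_val {x : F} {n : ℤ} (h : v x = n) : x ∈ ball v n := by
  rw [mem_ball, h]

lemma mem_ball_iff_of_val {x : F} {n k : ℤ} (h : v x = n) : x ∈ ball v k ↔ k ≤ n := by
  rw [mem_ball, h, WithTop.coe_le_coe]

lemma val_eq_iff {x : F} {n : ℤ} : v x = n ↔ x ∈ ball v n ∧ x ∉ ball v (n + 1) := by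
  constructor
  · intro h
    exact ⟨mem_ball_of_val h, by rw [mem_ball_iff_of_val h]; omega⟩
  · rintro ⟨h1, h2⟩
    by_cases hx : x = 0
    · subst hx; exact absurd (zero_mem _) h2
    obtain ⟨k, hk⟩ := exists_int_val (v := v) hx
    rw [mem_ball_iff_of_val hk] at h1 h2
    rw [hk]; congr 1; omega

lemma val_mul {x y : F} {m n : ℤ} (hx : v x = m) (hy : v y = n) :
    v (x * y) = ((m + n : ℤ) : WithTop ℤ) := by
  rw [v.map_mul, hx, hy, WithTop.coe_add]

lemma val_inv {x : F} {m : ℤ} (hx : v x = m) : v x⁻¹ = ((-m : ℤ) : WithTop ℤ) := by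
  have h0 := ne_zero_of_val hx
  obtain ⟨k, hk⟩ := exists_int_val (v := v) (inv_ne_zero h0)
  have := val_mul hx hk
  rw [mul_inv_cancel₀ h0, v.map_one] at this
  have h2 : (0 : ℤ) = m + k := by exact_mod_cast this
  rw [hk]; congr 1; omega

lemma val_div {x y : F} {m n : ℤ} (hx : v x = m) (hy : v y = n) :
    v (x / y) = ((m - n : ℤ) : WithTop ℤ) := by
  rw [div_eq_mul_inv, sub_eq_add_neg]; exact val_mul hx (val_inv hy)

lemma val_pow {x : F} {m : ℤ} (hx : v x = m) (k : ℕ) :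
    v (x ^ k) = ((k * m : ℤ) : WithTop ℤ) := by
  induction k with
  | zero => simp
  | succ k ih =>
    rw [pow_succ, val_mul ih hx]; congr 1; push_cast; ring

lemma val_zpow {x : F} {m : ℤ} (hx : v x = m) (k : ℤ) :
    v (x ^ k) = ((k * m : ℤ) : WithTop ℤ) := by
  obtain ⟨n, rfl | rfl⟩ := k.eq_nat_or_neg
  · rw [zpow_natCast]; exact val_pow hx n
  · rw [zpow_neg, zpow_natCast, val_inv (val_pow hx n)]; congr 1; ring

lemma val_one : v (1 : F) = ((0 : ℤ) : WithTop ℤ) := by simp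

lemma val_add_of_ball {x y : F} {n : ℤ} (hx : v x = n) (hy : y ∈ ball v (n + 1)) :
    v (x + y) = n := by
  rw [val_eq_iff] at hx ⊢
  refine ⟨add_mem hx.1 (ball_anti (by omega) hy), fun h => hx.2 ?_⟩
  simpa using sub_mem h hy

lemma val_of_sub_mem_ball {x y : F} {n : ℤ} (hx : v x = n) (hy : y - x ∈ ball v (n + 1)) :
    v y = n := by
  simpa using val_add_of_ball hx hy

lemma val_unique {x : F} {m n : ℤ} (h : v x = m) (h' : v x = n) : m = n := by
  rw [h] at h'; exact_mod_cast h'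

lemma ball_div {m k : ℤ} {x y : F} {n : ℤ} (hx : x ∈ ball v m) (hy : v y = n) (h : k ≤ m - n) :
    x / y ∈ ball v k := by
  rw [div_eq_mul_inv]; exact ball_mul hx (mem_ball_of_val (val_inv hy)) (by omega)

lemma eq_zero_of_forall_ball {x : F} (h : ∀ n : ℕ, x ∈ ball v n) : x = 0 := by
  by_contra hx
  obtain ⟨k, hk⟩ := exists_int_val (v := v) hx
  have := h (k.toNat + 1)
  rw [mem_ball_iff_of_val hk] at this
  push_cast at this; omega

lemma exists_unif (hn : IsNormalized v) : ∃ π : F, v π = ((1 : ℤ) : WithTop ℤ) := hn 1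

lemma val_one_add {x : F} (hx : x ∈ ball v 1) : v (1 + x) = ((0 : ℤ) : WithTop ℤ) :=
  val_add_of_ball val_one (by simpa using hx)

/-- `x` lies in the unit group `1 + 𝔪 ^ n`. -/
def IsU (v : AddValuation F (WithTop ℤ)) (n : ℤ) (x : F) : Prop := x - 1 ∈ ball v n

lemma isU_one (n : ℤ) : IsU v n 1 := by simp [IsU]

lemma IsU.val {n : ℤ} {x : F} (hn : 1 ≤ n) (h : IsU v n x) : v x = ((0 : ℤ) : WithTop ℤ) := by
  have := val_one_add (ball_anti hn h)
  simpa using this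

lemma IsU.ne_zero {n : ℤ} {x : F} (hn : 1 ≤ n) (h : IsU v n x) : x ≠ 0 :=
  ne_zero_of_val (h.val hn)

lemma IsU.anti {m n : ℤ} {x : F} (hmn : m ≤ n) (h : IsU v n x) : IsU v m x := ball_anti hmn h

lemma IsU.mul {n : ℤ} {x y : F} (hn : 1 ≤ n) (hx : IsU v n x) (hy : IsU v n y) :
    IsU v n (x * y) := by
  have : x * y - 1 = (x - 1) * y + (y - 1) := by ring
  unfold IsU; rw [this]
  exact add_mem (ball_mul hx (mem_ball_of_val (hy.val hn)) (by omega)) hy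

lemma IsU.inv {n : ℤ} {x : F} (hn : 1 ≤ n) (hx : IsU v n x) : IsU v n x⁻¹ := by
  have : x⁻¹ - 1 = -((x - 1) / x) := by field_simp [hx.ne_zero hn]; ring
  unfold IsU; rw [this]
  exact neg_mem (ball_div hx (hx.val hn) (by omega))

lemma IsU.div {n : ℤ} {x y : F} (hn : 1 ≤ n) (hx : IsU v n x) (hy : IsU v n y) :
    IsU v n (x / y) := by
  rw [div_eq_mul_inv]; exact hx.mul hn (hy.inv hn)

lemma IsU.pow {n : ℤ} {x : F} (hn : 1 ≤ n) (hx : IsU v n x) (k : ℕ) : IsU v n (x ^ k) := by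
  induction k with
  | zero => simpa using isU_one n
  | succ k ih => rw [pow_succ]; exact ih.mul hn hx

lemma IsU.div_iff {n : ℤ} {x y : F} (hy : v y = ((0 : ℤ) : WithTop ℤ)) :
    IsU v n (x / y) ↔ x - y ∈ ball v n := by
  have hy0 := ne_zero_of_val hy
  have : x / y - 1 = (x - y) / y := by field_simp
  unfold IsU; rw [this]
  constructor
  · intro h
    have := ball_mul h (mem_ball_of_val hy) (k := n) (by omega)
    rwa [div_mul_cancel₀ _ hy0] at this
  · intro h; exact ball_div h hy (by omega)

end ball

/-- Completeness of a valued field, phrased with sequences. -/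
def Cpl {F : Type*} [Field F] (v : AddValuation F (WithTop ℤ)) : Prop :=
  ∀ a : ℕ → F, (∀ n : ℕ, a (n + 1) - a n ∈ ball v n) → ∃ x, ∀ n : ℕ, x - a n ∈ ball v n

/-- Finiteness of the residue field of a valued field. -/
def FinRes {F : Type*} [Field F] (v : AddValuation F (WithTop ℤ)) : Prop :=
  ∃ S : Finset F, (∀ s ∈ S, s ∈ ball v 0) ∧ ∀ x ∈ ball v 0, ∃ s ∈ S, x - s ∈ ball v 1

/-- The valuation ring of `v`. -/
def Ov {F : Type*} [Field F] (v : AddValuation F (WithTop ℤ)) : ValuationSubring F where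
  carrier := {x | x ∈ ball v 0}
  one_mem' := one_mem_ball
  mul_mem' := fun ha hb => ball_mul_left ha hb
  zero_mem' := (ball v 0).zero_mem
  add_mem' := fun ha hb => (ball v 0).add_mem ha hb
  neg_mem' := fun {_} ha => (ball v 0).neg_mem ha
  mem_or_inv_mem' := fun x => by
    by_cases hx : x = 0
    · left; subst hx; exact zero_mem (ball v 0)
    obtain ⟨k, hk⟩ := exists_int_val (v := v) hx
    rcases le_total 0 k with h | h
    · left; exact (mem_ball_iff_of_val hk).2 h
    · right; exact (mem_ball_iff_of_val (val_inv hk)).2 (by omega)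

section
variable {F : Type*} [Field F] {v : AddValuation F (WithTop ℤ)}

lemma mem_Ov {x : F} : x ∈ Ov v ↔ x ∈ ball v 0 := Iff.rfl

lemma isUnit_Ov_iff {x : Ov v} : IsUnit x ↔ v (x : F) = ((0 : ℤ) : WithTop ℤ) := by
  constructor
  · rintro ⟨u, rfl⟩
    have h1 : ((u : Ov v) : F) * ((u⁻¹ : (Ov v)ˣ) : Ov v) = 1 := by
      have : (u : Ov v) * ((u⁻¹ : (Ov v)ˣ) : Ov v) = 1 := u.mul_inv
      exact_mod_cast congrArg (Subtype.val) this
    have hu : ((u : Ov v) : F) ≠ 0 := left_ne_zero_of_mul_eq_one h1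
    have hu' : (((u⁻¹ : (Ov v)ˣ) : Ov v) : F) ≠ 0 := right_ne_zero_of_mul_eq_one h1
    obtain ⟨a, ha⟩ := exists_int_val (v := v) hu
    obtain ⟨b, hb⟩ := exists_int_val (v := v) hu'
    have h2 := val_mul ha hb
    rw [h1] at h2
    have h3 := val_unique val_one h2
    have ha0 := (mem_ball_iff_of_val ha).1 (u : Ov v).2
    have hb0 := (mem_ball_iff_of_val hb).1 ((u⁻¹ : (Ov v)ˣ) : Ov v).2
    rw [ha]; congr 1; omega
  · intro h
    refine isUnit_iff_exists_inv.2 ⟨⟨(x : F)⁻¹, mem_ball_of_val (val_inv h)⟩, ?_⟩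
    ext
    simp [ne_zero_of_val h]

lemma mem_maxIdeal_iff {x : Ov v} : x ∈ IsLocalRing.maximalIdeal (Ov v) ↔ (x : F) ∈ ball v 1 := by
  rw [IsLocalRing.mem_maximalIdeal, mem_nonunits_iff, isUnit_Ov_iff, val_eq_iff]
  have := mem_Ov.1 x.2
  simp only [zero_add]
  tauto

lemma residue_eq_iff {x y : Ov v} :
    IsLocalRing.residue (Ov v) x = IsLocalRing.residue (Ov v) y ↔ (x : F) - y ∈ ball v 1 := by
  rw [← sub_eq_zero, ← map_sub, IsLocalRing.residue_eq_zero_iff, mem_maxIdeal_iff]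
  rfl

lemma finite_residue_iff : FinRes v ↔ Finite (IsLocalRing.ResidueField (Ov v)) := by
  constructor
  · rintro ⟨S, hS, h⟩
    let f : S → IsLocalRing.ResidueField (Ov v) :=
      fun s => IsLocalRing.residue (Ov v) ⟨s.1, hS _ s.2⟩
    refine Finite.of_surjective f fun z => ?_
    obtain ⟨x, rfl⟩ := IsLocalRing.residue_surjective z
    obtain ⟨s, hs, hxs⟩ := h x.1 x.2
    exact ⟨⟨s, hs⟩, (residue_eq_iff.2 hxs).symm⟩
  · intro hfin
    have := Fintype.ofFinite (IsLocalRing.ResidueField (Ov v))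
    choose r hr using IsLocalRing.residue_surjective (R := Ov v)
    refine ⟨Finset.univ.image (fun z => ((r z : Ov v) : F)), ?_, ?_⟩
    · intro s hs
      obtain ⟨z, -, rfl⟩ := Finset.mem_image.1 hs
      exact (r z).2
    · intro x hx
      refine ⟨_, Finset.mem_image.2 ⟨IsLocalRing.residue (Ov v) ⟨x, hx⟩, Finset.mem_univ _, rfl⟩, ?_⟩
      exact residue_eq_iff.1 (hr (IsLocalRing.residue (Ov v) ⟨x, hx⟩)).symm

lemma charP_residue {p : ℕ} [Fact p.Prime] (hp : (p : F) ∈ ball v 1) :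
    CharP (IsLocalRing.ResidueField (Ov v)) p := by
  refine (CharP.charP_iff_prime_eq_zero Fact.out).2 ?_
  have : ((p : Ov v) : F) ∈ ball v 1 := by simpa using hp
  have := mem_maxIdeal_iff.2 this
  rw [← IsLocalRing.residue_eq_zero_iff] at this
  simpa using this

lemma residue_perfect {p : ℕ} [Fact p.Prime] (hp : (p : F) ∈ ball v 1) (hfin : FinRes v)
    {x : F} (hx : x ∈ ball v 0) : ∃ y ∈ ball v 0, y ^ p - x ∈ ball v 1 := by
  have := finite_residue_iff.1 hfin
  have := charP_residue (p := p) hp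
  obtain ⟨z, hz⟩ := (Finite.surjective_of_injective
    (frobenius_inj (IsLocalRing.ResidueField (Ov v)) p)) (IsLocalRing.residue (Ov v) ⟨x, hx⟩)
  obtain ⟨y, rfl⟩ := IsLocalRing.residue_surjective z
  refine ⟨y, y.2, ?_⟩
  rw [frobenius_def, ← map_pow, residue_eq_iff] at hz
  simpa using hz

lemma finite_field_artinSchreier {k : Type*} [Field k] [Finite k] (p : ℕ) [Fact p.Prime] [CharP k p]
    (a : k) : ∃ g : k, ∀ c : k, ∃ (x : k) (j : ℕ), c = j • g + (x ^ p + a * x) := by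
  let h : k →+ k := (frobenius k p).toAddMonoidHom + AddMonoidHom.mulLeft a
  have hh : ∀ x, h x = x ^ p + a * x := fun x => rfl
  have hp := Fact.out (p := p.Prime)
  have hker : Nat.card h.ker ≤ p := by
    have hne : (Polynomial.X ^ p + Polynomial.C a * Polynomial.X : Polynomial k) ≠ 0 := by
      intro h0
      have := congrArg (fun q => Polynomial.coeff q p) h0
      rw [Polynomial.coeff_add, Polynomial.coeff_X_pow, Polynomial.coeff_C_mul, Polynomial.coeff_X,
        if_pos rfl, if_neg hp.one_lt.ne, mul_zero, add_zero, Polynomial.coeff_zero] at this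
      exact one_ne_zero this
    have hdeg : (Polynomial.X ^ p + Polynomial.C a * Polynomial.X : Polynomial k).natDegree ≤ p := by
      compute_degree
      exact max_le le_rfl hp.one_lt.le
    have hinj : Function.Injective (fun x : h.ker =>
        (⟨x.1, by
          have h2 := (AddMonoidHom.mem_ker).1 x.2
          rw [hh] at h2
          rw [Multiset.mem_toFinset, Polynomial.mem_roots hne]
          simpa using h2⟩ :
          (Polynomial.X ^ p + Polynomial.C a * Polynomial.X : Polynomial k).roots.toFinset)) := by
      intro x y hxy
      exact Subtype.ext (Subtype.mk.inj hxy)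
    calc Nat.card h.ker ≤ Nat.card _ := Nat.card_le_card_of_injective _ hinj
      _ ≤ _ := by
        rw [Nat.card_eq_fintype_card, Fintype.card_coe]
        exact (Multiset.toFinset_card_le _).trans ((Polynomial.card_roots' _).trans hdeg)
  let Q := k ⧸ h.range
  have hcard : Nat.card Q ≤ p := by
    have : h.range.index = Nat.card h.ker := AddSubgroup.index_range
    have h2 : Nat.card Q = h.range.index := rfl
    omega
  have hpQ : ∀ x : Q, p • x = 0 := by
    intro x
    induction x using QuotientAddGroup.induction_on with
    | H z => rw [← QuotientAddGroup.mk_nsmul]; simp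
  have hcyc : ∃ g : Q, ∀ c : Q, ∃ j : ℕ, c = j • g := by
    by_cases htriv : ∀ g : Q, g = 0
    · exact ⟨0, fun c => ⟨0, by simpa using htriv c⟩⟩
    · push Not at htriv
      obtain ⟨g, hg⟩ := htriv
      refine ⟨g, fun c => ?_⟩
      have hord : addOrderOf g = p := addOrderOf_eq_prime (hpQ g) hg
      have hc2 : Nat.card (AddSubgroup.zmultiples g) = p := by rw [Nat.card_zmultiples, hord]
      have : AddSubgroup.zmultiples g = ⊤ := by
        apply AddSubgroup.eq_top_of_le_card
        omega
      have hc : c ∈ AddSubgroup.zmultiples g := by rw [this]; trivial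
      rw [mem_zmultiples_iff_mem_range_addOrderOf] at hc
      obtain ⟨j, -, hj⟩ := Finset.mem_image.1 hc
      exact ⟨j, hj.symm⟩
  obtain ⟨g, hg⟩ := hcyc
  induction g using QuotientAddGroup.induction_on with
  | H g =>
    refine ⟨g, fun c => ?_⟩
    obtain ⟨j, hj⟩ := hg (c : Q)
    rw [← QuotientAddGroup.mk_nsmul, eq_comm, QuotientAddGroup.eq] at hj
    obtain ⟨x, hx⟩ := hj
    refine ⟨x, j, ?_⟩
    rw [← hh, hx]; abel

lemma residue_artinSchreier {p : ℕ} [Fact p.Prime] (hp : (p : F) ∈ ball v 1) (hfin : FinRes v)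
    {a : F} (ha : a ∈ ball v 0) : ∃ g ∈ ball v 0, ∀ c ∈ ball v 0,
      ∃ x ∈ ball v 0, ∃ j : ℕ, c - (j * g + (x ^ p + a * x)) ∈ ball v 1 := by
  have := finite_residue_iff.1 hfin
  have := charP_residue (p := p) hp
  obtain ⟨g, hg⟩ := finite_field_artinSchreier p (IsLocalRing.residue (Ov v) ⟨a, ha⟩)
  obtain ⟨g, rfl⟩ := IsLocalRing.residue_surjective g
  refine ⟨g, g.2, fun c hc => ?_⟩
  obtain ⟨x, j, hxj⟩ := hg (IsLocalRing.residue (Ov v) ⟨c, hc⟩)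
  obtain ⟨x, rfl⟩ := IsLocalRing.residue_surjective x
  refine ⟨x, x.2, j, ?_⟩
  rw [← map_pow, ← map_mul, ← map_add, ← map_nsmul, ← map_add, residue_eq_iff] at hxj
  simpa using hxj

end

section
variable {F : Type*} [Field F] {v : AddValuation F (WithTop ℤ)}

lemma one_add_pow_prime {p : ℕ} (hp : p.Prime) {z : F} (hz : z ∈ ball v 0) :
    ∃ r ∈ ball v 0, (1 + z) ^ p = 1 + p * z + z ^ p + p * z ^ 2 * r := by
  obtain ⟨q, rfl⟩ : ∃ q, p = q + 2 := ⟨p - 2, by have := hp.two_le; omega⟩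
  refine ⟨∑ k ∈ Finset.range q, z ^ k * (((q + 2).choose (k + 2) / (q + 2) : ℕ) : F), ?_, ?_⟩
  · exact sum_mem fun k _ => ball_mul_left (ball_pow_zero hz k) (natCast_mem_ball _)
  · rw [add_comm, add_pow, Finset.sum_range_succ, Finset.sum_range_succ', Finset.sum_range_succ',
      Finset.mul_sum]
    have : ∀ k ∈ Finset.range q, z ^ (k + 1 + 1) * 1 ^ (q + 2 - (k + 1 + 1)) *
        ((q + 2).choose (k + 1 + 1) : F) =
        ((q + 2 : ℕ) : F) * z ^ 2 * (z ^ k * (((q + 2).choose (k + 2) / (q + 2) : ℕ) : F)) := by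
      intro k hk
      have hk := Finset.mem_range.1 hk
      have hd : (q + 2) ∣ (q + 2).choose (k + 2) :=
        hp.dvd_choose_self (by omega) (by omega)
      obtain ⟨c, hc⟩ := hd
      rw [show k + 1 + 1 = k + 2 from rfl, hc, Nat.mul_div_cancel_left _ (by omega)]
      push_cast; ring
    rw [Finset.sum_congr rfl this]
    simp only [one_pow, Nat.choose_self, Nat.choose_zero_right, zero_add, Nat.choose_one_right]
    push_cast; ring

lemma IsU.pow_prime {p : ℕ} (hp : p.Prime) {ε k j : ℤ} (hpv : (p : F) ∈ ball v ε) {x : F}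
    (hk : 0 ≤ k) (hx : IsU v k x) (h1 : j ≤ p * k) (h2 : j ≤ k + ε) : IsU v j (x ^ p) := by
  obtain ⟨r, hr, h⟩ := one_add_pow_prime hp (ball_anti hk hx)
  have : x ^ p - 1 = p * (x - 1) + (x - 1) ^ p + p * (x - 1) * ((x - 1) * r) := by
    rw [show 1 + (x - 1) = x by ring] at h
    rw [h]; ring
  unfold IsU; rw [this]
  refine add_mem (add_mem (ball_mul hpv hx (by omega)) (ball_anti h1 (ball_pow hx p))) ?_
  exact ball_mul (ball_mul hpv hx le_rfl) (ball_mul_right hx hr) (by omega)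

/-- Level change of the `p`-power map on principal units: the exact leading terms. -/
lemma IsU.pow_prime_sub {p : ℕ} (hp : p.Prime) {ε k j : ℤ} (hpv : (p : F) ∈ ball v ε) {z : F}
    (hk : 0 ≤ k) (hz : z ∈ ball v k) (h2 : j ≤ 2 * k + ε) :
    (1 + z) ^ p - 1 - (p * z + z ^ p) ∈ ball v j := by
  obtain ⟨r, hr, h⟩ := one_add_pow_prime hp (ball_anti hk hz)
  rw [h, show 1 + p * z + z ^ p + p * z ^ 2 * r - 1 - (p * z + z ^ p) = p * z * (z * r) by ring]
  exact ball_mul (ball_mul hpv hz le_rfl) (ball_mul_right hz hr) (by omega)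

lemma exists_limit (hc : Cpl v) {N : ℤ} (a : ℕ → F) (ha : ∀ n : ℕ, a (n + 1) - a n ∈ ball v (n + N)) :
    ∃ x, ∀ n : ℕ, x - a n ∈ ball v (n + N) := by
  have htel : ∀ n k : ℕ, a (n + k) - a n ∈ ball v (n + N) := by
    intro n k
    induction k with
    | zero => simp
    | succ k ih =>
      rw [show a (n + (k + 1)) - a n = (a (n + k + 1) - a (n + k)) + (a (n + k) - a n) by
        rw [← add_assoc]; ring]
      exact add_mem (ball_anti (by push_cast; omega) (ha (n + k))) ih
  obtain ⟨M, hM⟩ : ∃ M : ℕ, 0 ≤ M + N := ⟨(-N).toNat, by omega⟩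
  obtain ⟨x, hx⟩ := hc (fun n => a (n + M)) (fun n => by
    have := ha (n + M)
    rw [show n + M + 1 = n + 1 + M by ring] at this
    exact ball_anti (by push_cast; omega) this)
  refine ⟨x, fun n => ?_⟩
  obtain ⟨k, hk⟩ : ∃ k : ℕ, (n : ℤ) + N ≤ n + k ∧ M ≤ n + k :=
    ⟨N.toNat + M, by push_cast; omega, by omega⟩
  have h1 := hx (n + k)
  have h2 := htel n (k + M)
  rw [← add_assoc] at h2
  have := add_mem (ball_anti (m := n + N) (by push_cast; omega) h1) h2
  simpa using this

lemma exists_pow_prime_eq (hc : Cpl v) {p : ℕ} (hp : p.Prime) {ε n : ℤ}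
    (hpv : v (p : F) = ε) (hε : 0 ≤ ε) (hn : n < p * (n - ε)) (hn0 : ε < n) {x : F} (hx : IsU v n x) :
    ∃ y, IsU v (n - ε) y ∧ y ^ p = x := by
  have hpb := mem_ball_of_val hpv
  have hp2 := hp.two_le
  have step : ∀ k : ℕ, ∀ y : F, IsU v (n + k) y → ∃ z, IsU v (n + k - ε) z ∧
      IsU v (n + k + 1) (y / z ^ p) := by
    intro k y hy
    have hz : (y - 1) / p ∈ ball v (n + k - ε) := ball_div hy hpv le_rfl
    have hu : IsU v (n + k - ε) (1 + (y - 1) / p) := by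
      unfold IsU; rwa [add_sub_cancel_left]
    refine ⟨1 + (y - 1) / p, hu, ?_⟩
    rw [IsU.div_iff (by simpa using val_pow (hu.val (by omega)) p)]
    have h1 := IsU.pow_prime_sub (j := n + k + 1) hp hpb (by omega) hz (by omega)
    rw [mul_div_cancel₀ _ (ne_zero_of_val hpv)] at h1
    have h2 := ball_anti (m := n + k + 1) (by nlinarith) (ball_pow hz p)
    have := neg_mem (add_mem h1 h2)
    convert this using 1
    ring
  choose! f hf1 hf2 using step
  let s : ℕ → {z : F × F // True} := fun k => Nat.rec ⟨(1, x), trivial⟩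
    (fun k s => ⟨(s.1.1 * f k s.1.2, s.1.2 / (f k s.1.2) ^ p), trivial⟩) k
  let a : ℕ → F := fun k => (s k).1.1
  let b : ℕ → F := fun k => (s k).1.2
  have ha : ∀ k, a (k + 1) = a k * f k (b k) := fun k => rfl
  have hb : ∀ k, b (k + 1) = b k / f k (b k) ^ p := fun k => rfl
  have hbU : ∀ k : ℕ, IsU v (n + k) (b k) := by
    intro k
    induction k with
    | zero => change IsU v (n + ((0 : ℕ) : ℤ)) x; simpa using hx
    | succ k ih => rw [hb]; push_cast; rw [← add_assoc]; exact hf2 k _ ih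
  have hfU : ∀ k : ℕ, IsU v (n + k - ε) (f k (b k)) := fun k => hf1 k _ (hbU k)
  have haU : ∀ k : ℕ, IsU v (n - ε) (a k) := by
    intro k
    induction k with
    | zero => exact isU_one _
    | succ k ih => rw [ha]; exact ih.mul (by omega) ((hfU k).anti (by omega))
  have hab : ∀ k, x = a k ^ p * b k := by
    intro k
    induction k with
    | zero => change x = 1 ^ p * x; simp
    | succ k ih =>
      rw [ha, hb, mul_pow, ih]
      have := pow_ne_zero p ((hfU k).ne_zero (by omega))
      field_simp
  obtain ⟨y, hy⟩ := exists_limit hc (N := n - ε) a (fun k => by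
    rw [ha, show a k * f k (b k) - a k = a k * (f k (b k) - 1) by ring]
    exact ball_mul (mem_ball_of_val ((haU k).val (by omega))) (hfU k) (by omega))
  have hyU : IsU v (n - ε) y := by
    have := hy 0
    change y - 1 ∈ ball v _ at this
    unfold IsU; simpa using this
  refine ⟨y, hyU, ?_⟩
  have hx0 : v x = ((0 : ℤ) : WithTop ℤ) := hx.val (by omega)
  have hpow : ∀ k : ℕ, y ^ p - x ∈ ball v (n + k) := by
    intro k
    have h1 : IsU v (k + (n - ε)) (y / a k) := (IsU.div_iff ((haU k).val (by omega))).2 (hy k)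
    have h2 : IsU v (n + k) ((y / a k) ^ p) := h1.pow_prime hp hpb (by omega) (by nlinarith) (by omega)
    have h3 : IsU v (n + k) (y ^ p / x) := by
      have := h2.div (by omega) (hbU k)
      rw [div_pow, div_div, ← hab k] at this
      exact this
    exact (IsU.div_iff hx0).1 h3
  exact sub_eq_zero.1 (eq_zero_of_forall_ball fun k => ball_anti (by omega) (hpow k))

lemma exists_prime_pow_root (hc : Cpl v) {p : ℕ} (hp : p.Prime) {ε : ℤ}
    (hpv : v (p : F) = ε) (hε : 0 ≤ ε) (m : ℕ) :
    ∃ n0 : ℤ, 1 ≤ n0 ∧ ∀ x, IsU v n0 x → ∃ y, IsU v 1 y ∧ y ^ (p ^ m) = x := by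
  have hp2 := hp.two_le
  have : ∀ m : ℕ, ∀ x, IsU v (2 * ε + 1 + m * ε) x → ∃ y, IsU v (2 * ε + 1) y ∧ y ^ (p ^ m) = x := by
    intro m
    induction m with
    | zero => intro x hx; exact ⟨x, by simpa using hx, by simp⟩
    | succ m ih =>
      intro x hx
      have h0 : (0 : ℤ) ≤ m * ε := by positivity
      obtain ⟨y, hy, hyx⟩ := exists_pow_prime_eq hc hp hpv hε
        (n := 2 * ε + 1 + (m + 1 : ℕ) * ε) (by push_cast; nlinarith) (by push_cast; nlinarith) hx
      obtain ⟨z, hz, hzy⟩ := ih y (hy.anti (by push_cast; nlinarith))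
      exact ⟨z, hz, by rw [pow_succ, pow_mul, hzy, hyx]⟩
  refine ⟨2 * ε + 1 + m * ε, by nlinarith [show (0:ℤ) ≤ m * ε by positivity], fun x hx => ?_⟩
  obtain ⟨y, hy, h⟩ := this m x hx
  exact ⟨y, hy.anti (by omega), h⟩

end

lemma IsPadicValuation.val_p {p : ℕ} [Fact p.Prime] {F : Type*} [Field F] [Algebra ℚ_[p] F]
    {v : AddValuation F (WithTop ℤ)} {e : ℕ} (h : IsPadicValuation p v e) :
    v (p : F) = ((e : ℤ) : WithTop ℤ) := by
  have hp : (p : ℚ_[p]) ≠ 0 := by exact_mod_cast (Fact.out (p := p.Prime)).ne_zero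
  have := h.2.2 (p : ℚ_[p]) hp
  rw [map_natCast, Padic.valuation_p] at this
  rw [this, mul_one]

section
variable (p : ℕ) [Fact p.Prime] (e : ℕ)

/-- The real number `p ^ (-1/e)`. -/
def rad : ℝ := (p : ℝ) ^ (-(1 : ℝ) / e)

lemma rad_pos : 0 < rad p e :=
  Real.rpow_pos_of_pos (by exact_mod_cast (Fact.out (p := p.Prime)).pos) _

lemma rad_lt_one (he : 0 < e) : rad p e < 1 := by
  apply Real.rpow_lt_one_of_one_lt_of_neg
  · exact_mod_cast (Fact.out (p := p.Prime)).one_lt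
  · apply div_neg_of_neg_of_pos <;> [norm_num; exact_mod_cast he]

lemma rad_zpow_mul (he : 0 < e) (n : ℤ) : rad p e ^ ((e : ℤ) * n) = (p : ℝ) ^ (-n) := by
  have hp : (0 : ℝ) ≤ p := by positivity
  have he' : (e : ℝ) ≠ 0 := by positivity
  rw [zpow_mul, zpow_natCast, rad, ← Real.rpow_mul_natCast hp, div_mul_cancel₀ _ he',
    Real.rpow_neg_one, inv_zpow, zpow_neg]

/-- The absolute value attached to an additive valuation. -/
def absOf {F : Type*} [Field F] (v : AddValuation F (WithTop ℤ)) (he : 0 < e) :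
    AbsoluteValue F ℝ where
  toFun x := if x = 0 then 0 else rad p e ^ ((v x).untopD 0)
  map_mul' x y := by
    by_cases hx : x = 0
    · simp [hx]
    by_cases hy : y = 0
    · simp [hy]
    obtain ⟨a, ha⟩ := exists_int_val (v := v) hx
    obtain ⟨b, hb⟩ := exists_int_val (v := v) hy
    simp only [mul_eq_zero, hx, hy, or_self, if_false, val_mul ha hb, ha, hb, WithTop.untopD_coe]
    exact zpow_add₀ (rad_pos p e).ne' _ _
  nonneg' x := by
    show 0 ≤ if x = 0 then 0 else _
    split_ifs
    · exact le_rfl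
    · exact (zpow_pos (rad_pos p e) _).le
  eq_zero' x := by
    show (if x = 0 then 0 else _) = (0 : ℝ) ↔ _
    by_cases h : x = 0
    · simp [h]
    · simp [h, (zpow_pos (rad_pos p e) _).ne']
  add_le' x y := by
    by_cases hx : x = 0
    · simp [hx]
    by_cases hy : y = 0
    · simp [hy]
    obtain ⟨a, ha⟩ := exists_int_val (v := v) hx
    obtain ⟨b, hb⟩ := exists_int_val (v := v) hy
    have hpa := zpow_pos (rad_pos p e) a
    have hpb := zpow_pos (rad_pos p e) b
    simp only [hx, hy, if_false, ha, hb, WithTop.untopD_coe]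
    split_ifs with hxy
    · positivity
    obtain ⟨c, hc⟩ := exists_int_val (v := v) hxy
    rw [hc, WithTop.untopD_coe]
    have : min a b ≤ c := by
      have := add_mem (ball_anti (min_le_left a b) (mem_ball_of_val ha))
        (ball_anti (min_le_right a b) (mem_ball_of_val hb))
      exact (mem_ball_iff_of_val hc).1 this
    have hr := fun {i j : ℤ} (h : i ≤ j) =>
      zpow_le_zpow_right_of_le_one₀ (rad_pos p e) (rad_lt_one p e he).le h
    rcases min_le_iff.1 this with h | h
    · linarith [hr h]
    · linarith [hr h]

lemma absOf_of_val {F : Type*} [Field F] {v : AddValuation F (WithTop ℤ)} (he : 0 < e) {x : F}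
    {n : ℤ} (h : v x = n) : absOf p e v he x = rad p e ^ n := by
  show (if x = 0 then 0 else _) = _
  rw [if_neg (ne_zero_of_val h), h, WithTop.untopD_coe]

end

section
variable {p : ℕ} [Fact p.Prime] {F : Type*} [Field F] [Algebra ℚ_[p] F] [FiniteDimensional ℚ_[p] F]
  {v : AddValuation F (WithTop ℤ)} {e : ℕ}

lemma IsPadicValuation.spectralNorm_eq (h : IsPadicValuation p v e) {x : F} {n : ℤ}
    (hx : v x = n) : spectralNorm ℚ_[p] F x = rad p e ^ n := by
  rw [← absOf_of_val p e h.2.1 hx]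
  refine (spectralNorm_unique_field_norm_ext (K := ℚ_[p]) (L := F) ?_ x).symm
  intro x
  by_cases h0 : x = 0
  · simp [h0]
  rw [absOf_of_val p e h.2.1 (h.2.2 x h0), rad_zpow_mul p e h.2.1,
    Padic.norm_eq_zpow_neg_valuation h0]

lemma IsPadicValuation.mem_ball_iff (h : IsPadicValuation p v e) {x : F} {n : ℤ} :
    x ∈ ball v n ↔ spectralNorm ℚ_[p] F x ≤ rad p e ^ n := by
  by_cases hx : x = 0
  · subst hx
    simp only [zero_mem, true_iff]
    rw [show spectralNorm ℚ_[p] F 0 = 0 from spectralNorm_zero]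
    exact (zpow_pos (rad_pos p e) _).le
  obtain ⟨k, hk⟩ := exists_int_val (v := v) hx
  rw [h.spectralNorm_eq hk, mem_ball_iff_of_val hk,
    zpow_le_zpow_iff_right_of_lt_one₀ (rad_pos p e) (rad_lt_one p e h.2.1)]

lemma IsPadicValuation.cpl (h : IsPadicValuation p v e) : Cpl v := by
  intro a ha
  let := spectralNorm.normedField ℚ_[p] F
  let := spectralNorm.normedAlgebra ℚ_[p] F
  have hnorm : ∀ x : F, ‖x‖ = spectralNorm ℚ_[p] F x := fun x => rfl
  have hcs : CompleteSpace F := FiniteDimensional.complete ℚ_[p] F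
  have hcau : CauchySeq a := by
    refine cauchySeq_of_le_geometric (rad p e) 1 (rad_lt_one p e h.2.1) fun n => ?_
    rw [dist_comm, dist_eq_norm, hnorm, one_mul]
    have := h.mem_ball_iff.1 (ha n)
    rwa [zpow_natCast] at this
  obtain ⟨x, hx⟩ := cauchySeq_tendsto_of_complete hcau
  refine ⟨x, fun n => h.mem_ball_iff.2 ?_⟩
  rw [← hnorm]
  have h2 : Filter.Tendsto (fun k => ‖a k - a n‖) Filter.atTop (nhds ‖x - a n‖) :=
    (hx.sub_const _).norm
  refine le_of_tendsto h2 (Filter.eventually_atTop.2 ⟨n, fun k hk => ?_⟩)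
  rw [hnorm, ← h.mem_ball_iff]
  induction k, hk using Nat.le_induction with
  | base => simp
  | succ k hk ih =>
    rw [show a (k + 1) - a n = (a (k + 1) - a k) + (a k - a n) by ring]
    exact add_mem (ball_anti (by exact_mod_cast hk) (ha k)) ih

lemma IsPadicValuation.finRes (h : IsPadicValuation p v e) : FinRes v := by
  let := spectralNorm.normedField ℚ_[p] F
  let := spectralNorm.normedAlgebra ℚ_[p] F
  have hnorm : ∀ x : F, ‖x‖ = spectralNorm ℚ_[p] F x := fun x => rfl
  have hps : ProperSpace F := FiniteDimensional.proper ℚ_[p] F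
  have hcomp : IsCompact (Metric.closedBall (0 : F) 1) := isCompact_closedBall 0 1
  obtain ⟨t, ht, htfin, hcov⟩ := hcomp.finite_cover_balls (e := 1) one_pos
  have hmem : ∀ x : F, x ∈ Metric.closedBall (0 : F) 1 ↔ x ∈ ball v 0 := by
    intro x
    rw [mem_closedBall_zero_iff, hnorm, h.mem_ball_iff, zpow_zero]
  refine ⟨htfin.toFinset, fun s hs => (hmem s).1 (ht (htfin.mem_toFinset.1 hs)), fun x hx => ?_⟩
  obtain ⟨s, hs, hxs⟩ := Set.mem_iUnion₂.1 (hcov ((hmem x).2 hx))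
  refine ⟨s, htfin.mem_toFinset.2 hs, ?_⟩
  rw [mem_ball_iff_norm, hnorm] at hxs
  by_contra hcon
  have h0 : x - s ≠ 0 := fun h0 => hcon (h0 ▸ zero_mem _)
  obtain ⟨k, hk⟩ := exists_int_val (v := v) h0
  rw [mem_ball_iff_of_val hk] at hcon
  rw [h.spectralNorm_eq hk] at hxs
  have := one_le_zpow_of_nonpos₀ (rad_pos p e) (rad_lt_one p e h.2.1).le (show k ≤ 0 by omega)
  linarith

end

/-- The additive valuation given by an integer-valued function on nonzero elements. -/
def mkVal {F : Type*} [Field F] (w : F → ℤ)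
    (hmul : ∀ x y, x ≠ 0 → y ≠ 0 → w (x * y) = w x + w y)
    (hadd : ∀ x y, x ≠ 0 → y ≠ 0 → x + y ≠ 0 → min (w x) (w y) ≤ w (x + y)) :
    AddValuation F (WithTop ℤ) :=
  AddValuation.of (fun x => if x = 0 then ⊤ else (w x : WithTop ℤ)) (by simp)
    (by
      have := hmul 1 1 one_ne_zero one_ne_zero
      rw [mul_one] at this
      have : w 1 = 0 := by omega
      simp [this])
    (by
      intro x y
      by_cases hx : x = 0
      · simp [hx]
      by_cases hy : y = 0
      · simp [hy]
      by_cases hxy : x + y = 0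
      · simp [hxy]
      simp only [hx, hy, hxy, if_false]
      rw [← WithTop.coe_min, WithTop.coe_le_coe]
      exact hadd x y hx hy hxy)
    (by
      intro x y
      by_cases hx : x = 0
      · simp [hx]
      by_cases hy : y = 0
      · simp [hy]
      simp only [hx, hy, mul_eq_zero, or_self, if_false, hmul x y hx hy]
      exact WithTop.coe_add _ _)

lemma mkVal_apply {F : Type*} [Field F] {w : F → ℤ}
    {hmul : ∀ x y, x ≠ 0 → y ≠ 0 → w (x * y) = w x + w y}
    {hadd : ∀ x y, x ≠ 0 → y ≠ 0 → x + y ≠ 0 → min (w x) (w y) ≤ w (x + y)} {x : F} (hx : x ≠ 0) :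
    mkVal w hmul hadd x = w x := by
  show (if x = 0 then ⊤ else _) = _
  rw [if_neg hx]

lemma exists_normalized {F : Type*} [Field F] (w : AddValuation F (WithTop ℤ)) {x0 : F} {n0 : ℤ}
    (h0 : n0 ≠ 0) (hx0 : w x0 = n0) : ∃ (v : AddValuation F (WithTop ℤ)) (g : ℤ), 0 < g ∧
      IsNormalized v ∧ (∀ (x : F) (n : ℤ), v x = n ↔ w x = ((g * n : ℤ) : WithTop ℤ)) := by
  let H : AddSubgroup ℤ :=
    { carrier := {n | ∃ x, w x = n}
      zero_mem' := ⟨1, val_one⟩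
      add_mem' := by
        rintro a b ⟨x, hx⟩ ⟨y, hy⟩
        exact ⟨x * y, val_mul hx hy⟩
      neg_mem' := by
        rintro a ⟨x, hx⟩
        exact ⟨x⁻¹, val_inv hx⟩ }
  have hH : ∀ n, n ∈ H ↔ ∃ x, w x = n := fun n => Iff.rfl
  obtain ⟨g, hg⟩ : ∃ g : ℤ, 0 < g ∧ ∀ n, n ∈ H ↔ g ∣ n := by
    obtain ⟨a, ha⟩ := Int.subgroup_cyclic H
    have hmem : ∀ n, n ∈ H ↔ a ∣ n := by
      intro n
      rw [ha, AddSubgroup.mem_closure_singleton]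
      constructor
      · rintro ⟨k, rfl⟩; exact ⟨k, by simp [mul_comm]⟩
      · rintro ⟨k, rfl⟩; exact ⟨k, by simp [mul_comm]⟩
    have ha0 : a ≠ 0 := by
      rintro rfl
      exact h0 (zero_dvd_iff.1 ((hmem n0).1 ⟨x0, hx0⟩))
    exact ⟨|a|, abs_pos.2 ha0, fun n => by rw [hmem, abs_dvd]⟩
  have hdef : ∀ x : F, x ≠ 0 → w x = ((g * ((w x).untopD 0 / g) : ℤ) : WithTop ℤ) := by
    intro x hx
    obtain ⟨n, hn⟩ := exists_int_val (v := w) hx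
    obtain ⟨c, rfl⟩ := (hg.2 n).1 ⟨x, hn⟩
    rw [hn, WithTop.untopD_coe, Int.mul_ediv_cancel_left _ hg.1.ne']
  let v := mkVal (fun x => (w x).untopD 0 / g)
    (fun x y hx hy => by
      have h1 := val_mul (hdef x hx) (hdef y hy)
      have h2 := val_unique h1 (hdef (x * y) (mul_ne_zero hx hy))
      rw [← mul_add] at h2
      exact (mul_left_cancel₀ hg.1.ne' h2).symm)
    (fun x y hx hy hxy => by
      have h1 := hdef x hx
      have h2 := hdef y hy
      have h3 := hdef _ hxy
      set a := (w x).untopD 0 / g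
      set b := (w y).untopD 0 / g
      have h4 := add_mem (ball_anti (mul_le_mul_of_nonneg_left (min_le_left a b) hg.1.le)
        (mem_ball_of_val h1)) (ball_anti (mul_le_mul_of_nonneg_left (min_le_right a b) hg.1.le)
        (mem_ball_of_val h2))
      exact le_of_mul_le_mul_left ((mem_ball_iff_of_val h3).1 h4) hg.1)
  have hv : ∀ (x : F) (n : ℤ), v x = n ↔ w x = ((g * n : ℤ) : WithTop ℤ) := by
    intro x n
    by_cases hx : x = 0
    · subst hx
      rw [v.map_zero, w.map_zero]
      exact iff_of_false (WithTop.top_ne_coe) (WithTop.top_ne_coe)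
    rw [show v x = _ from mkVal_apply hx]
    have h1 := hdef x hx
    constructor
    · intro h
      have : (w x).untopD 0 / g = n := by exact_mod_cast h
      rwa [this] at h1
    · intro h
      have := mul_left_cancel₀ hg.1.ne' (val_unique h1 h)
      rw [this]
  refine ⟨v, g, hg.1, fun n => ?_, hv⟩
  obtain ⟨x, hx⟩ := (hg.2 (g * n)).2 (dvd_mul_right _ _)
  exact ⟨x, (hv x n).2 hx⟩

section
variable {p : ℕ} [Fact p.Prime] {F : Type*} [Field F] [Algebra ℚ_[p] F] [FiniteDimensional ℚ_[p] F]

lemma spectralNorm_pow_factorial (x : F) (hx : x ≠ 0) : ∃ n : ℤ,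
    spectralNorm ℚ_[p] F x ^ (Module.finrank ℚ_[p] F).factorial = (p : ℝ) ^ (-n) := by
  have hx_int : IsIntegral ℚ_[p] x := Algebra.IsIntegral.isIntegral x
  have hc : (minpoly ℚ_[p] x).coeff 0 ≠ 0 := minpoly.coeff_zero_ne_zero hx_int hx
  have hdeg : 0 < (minpoly ℚ_[p] x).natDegree := minpoly.natDegree_pos hx_int
  obtain ⟨k, hk⟩ : (minpoly ℚ_[p] x).natDegree ∣ (Module.finrank ℚ_[p] F).factorial :=
    Nat.dvd_factorial hdeg (minpoly.natDegree_le x)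
  refine ⟨((minpoly ℚ_[p] x).coeff 0).valuation * k, ?_⟩
  rw [spectralNorm.spectralNorm_eq_norm_coeff_zero_rpow, hk, pow_mul, ← Real.rpow_natCast (_ ^ (_ : ℝ)),
    ← Real.rpow_mul (norm_nonneg _), one_div_mul_cancel (by exact_mod_cast hdeg.ne'), Real.rpow_one,
    Padic.norm_eq_zpow_neg_valuation hc, ← zpow_natCast, ← zpow_mul]
  congr 1; ring

variable (p F) in
lemma exists_padicValuation : ∃ (v : AddValuation F (WithTop ℤ)) (e : ℕ), IsPadicValuation p v e := by
  have hp1 : (1 : ℝ) < p := by exact_mod_cast (Fact.out (p := p.Prime)).one_lt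
  have hp0 : (0 : ℝ) < p := by linarith
  set D := (Module.finrank ℚ_[p] F).factorial with hD
  have hDpos : 0 < D := Nat.factorial_pos _
  choose! w hw using (spectralNorm_pow_factorial (p := p) (F := F))
  have hinj : ∀ {a b : ℤ}, (p : ℝ) ^ (-a) = (p : ℝ) ^ (-b) → a = b := by
    intro a b h
    have := zpow_right_injective₀ hp0 hp1.ne' h
    omega
  have hle : ∀ {a b : ℤ}, (p : ℝ) ^ (-a) ≤ (p : ℝ) ^ (-b) → b ≤ a := by
    intro a b h
    have := (zpow_le_zpow_iff_right₀ hp1).1 h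
    omega
  let v0 : AddValuation F (WithTop ℤ) := mkVal w
    (fun x y hx hy => by
      apply hinj
      rw [← hw _ (mul_ne_zero hx hy), show spectralNorm ℚ_[p] F (x * y) =
        spectralNorm ℚ_[p] F x * spectralNorm ℚ_[p] F y from spectralAlgNorm_mul x y, mul_pow, hw x hx, hw y hy, ← zpow_add₀ hp0.ne']
      congr 1; ring)
    (fun x y hx hy hxy => by
      have h := isNonarchimedean_spectralNorm (K := ℚ_[p]) (L := F) x y
      have h0 := fun z : F => spectralNorm_nonneg (K := ℚ_[p]) (L := F) z
      rcases le_max_iff.1 h with h | h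
      · refine min_le_of_left_le (hle ?_)
        rw [← hw _ hxy, ← hw _ hx]
        exact pow_le_pow_left₀ (h0 _) h _
      · refine min_le_of_right_le (hle ?_)
        rw [← hw _ hxy, ← hw _ hy]
        exact pow_le_pow_left₀ (h0 _) h _)
  have hv0 : ∀ x : ℚ_[p], x ≠ 0 → v0 (algebraMap ℚ_[p] F x) = ((D * x.valuation : ℤ) : WithTop ℤ) := by
    intro x hx
    have hx' : algebraMap ℚ_[p] F x ≠ 0 := by simpa using hx
    rw [show v0 _ = _ from mkVal_apply hx']
    congr 1
    apply hinj
    rw [← hw _ hx', spectralNorm_extends, Padic.norm_eq_zpow_neg_valuation hx, ← zpow_natCast,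
      ← zpow_mul]
    congr 1; ring
  have hpne : (p : ℚ_[p]) ≠ 0 := by exact_mod_cast (Fact.out (p := p.Prime)).ne_zero
  obtain ⟨v, g, hg, hn, hv⟩ := exists_normalized v0 (n0 := D) (by exact_mod_cast hDpos.ne')
    (x0 := algebraMap ℚ_[p] F p) (by rw [hv0 _ hpne, Padic.valuation_p, mul_one])
  obtain ⟨e, he⟩ : ∃ e : ℤ, (D : ℤ) = g * e := by
    obtain ⟨k, hk⟩ := exists_int_val (v := v) (x := algebraMap ℚ_[p] F p)
      ((map_ne_zero _).2 hpne)
    refine ⟨k, ?_⟩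
    have h1 := (hv _ _).1 hk
    have := val_unique (hv0 _ hpne) h1
    rwa [Padic.valuation_p, mul_one] at this
  have hepos : 0 < e := by
    have : (0 : ℤ) < g * e := by rw [← he]; exact_mod_cast hDpos
    exact pos_of_mul_pos_right this hg.le
  refine ⟨v, e.toNat, hn, by omega, fun x hx => ?_⟩
  rw [hv, hv0 x hx, he, Int.toNat_of_nonneg hepos.le]
  congr 1; ring

lemma IsPadicValuation.galInvariant {v : AddValuation F (WithTop ℤ)} {e : ℕ}
    (h : IsPadicValuation p v e) (σ : F ≃ₐ[ℚ_[p]] F) (x : F) : v (σ x) = v x := by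
  by_cases hx : x = 0
  · simp [hx]
  obtain ⟨n, hn⟩ := exists_int_val (v := v) hx
  rw [hn, val_eq_iff, h.mem_ball_iff, h.mem_ball_iff, ← spectralNorm_eq_of_equiv σ x,
    ← h.mem_ball_iff, ← h.mem_ball_iff, ← val_eq_iff, hn]

lemma IsPadicValuation.galInvariant' {K : Type*} [Field K] [Algebra ℚ_[p] K] [Algebra K F]
    [IsScalarTower ℚ_[p] K F] {v : AddValuation F (WithTop ℤ)} {e : ℕ}
    (h : IsPadicValuation p v e) : GalInvariant K v :=
  fun σ x => h.galInvariant (σ.restrictScalars ℚ_[p]) x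

lemma IsPadicValuation.extends {K : Type*} [Field K] [Algebra ℚ_[p] K]
    [FiniteDimensional ℚ_[p] K] [Algebra K F]
    [IsScalarTower ℚ_[p] K F] {vK : AddValuation K (WithTop ℤ)} {eK : ℕ}
    (hK : IsPadicValuation p vK eK) {v : AddValuation F (WithTop ℤ)} {e : ℕ}
    (h : IsPadicValuation p v e) : ∃ n : ℕ, e = eK * n ∧ Extends vK v n := by
  have key : ∀ (x : K) (a b : ℤ), vK x = a → v (algebraMap K F x) = b → (e : ℤ) * a = eK * b := by
    intro x a b ha hb
    have h1 := hK.spectralNorm_eq ha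
    have h2 := h.spectralNorm_eq hb
    rw [← spectralNorm.eq_of_tower, h1] at h2
    have h3 : rad p eK ^ a = rad p e ^ b := h2
    have h4 : rad p eK ^ ((eK : ℤ) * (e * a)) = rad p e ^ ((e : ℤ) * (eK * b)) := by
      rw [show (eK : ℤ) * (e * a) = a * (eK * e) by ring, show (e : ℤ) * (eK * b) = b * (eK * e) by ring,
        zpow_mul, h3, ← zpow_mul]
    rw [rad_zpow_mul p eK hK.2.1, rad_zpow_mul p e h.2.1] at h4
    have hp1 : (1 : ℝ) < p := by exact_mod_cast (Fact.out (p := p.Prime)).one_lt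
    have := zpow_right_injective₀ (by linarith) hp1.ne' h4
    omega
  have heK := hK.2.1
  have he := h.2.1
  obtain ⟨π, hπ⟩ := exists_unif hK.1
  obtain ⟨n, hn⟩ := exists_int_val (v := v) (x := algebraMap K F π)
    (by simpa using ne_zero_of_val hπ)
  have h1 := key π 1 n hπ hn
  have hnpos : 0 < n := by
    have : (0 : ℤ) < eK * n := by rw [← h1]; omega
    exact pos_of_mul_pos_right this (by omega)
  obtain ⟨n, rfl⟩ := Int.eq_ofNat_of_zero_le hnpos.le
  have h2 : e = eK * n := by exact_mod_cast (by simpa using h1 : (e : ℤ) = eK * n)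
  refine ⟨n, h2, by exact_mod_cast hnpos, fun x => ?_⟩
  by_cases hx : x = 0
  · subst hx
    have : n ≠ 0 := by rintro rfl; simp at hnpos
    obtain ⟨k, rfl⟩ := Nat.exists_eq_succ_of_ne_zero this
    simp [succ_nsmul]
  obtain ⟨a, ha⟩ := exists_int_val (v := vK) hx
  obtain ⟨b, hb⟩ := exists_int_val (v := v) (x := algebraMap K F x) (by simpa using hx)
  have h3 := key x a b ha hb
  rw [h2] at h3
  push_cast at h3
  rw [mul_assoc] at h3
  have h4 := mul_left_cancel₀ (show (eK : ℤ) ≠ 0 by omega) h3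
  rw [ha, hb, ← h4, ← WithTop.coe_nsmul, nsmul_eq_mul]
end

lemma Extends.val {K F : Type*} [Field K] [Field F] [Algebra K F] {vK : AddValuation K (WithTop ℤ)}
    {vF : AddValuation F (WithTop ℤ)} {e : ℕ} (h : Extends vK vF e) {x : K} {n : ℤ} (hx : vK x = n) :
    vF (algebraMap K F x) = ((e * n : ℤ) : WithTop ℤ) := by
  rw [h.2, hx, ← WithTop.coe_nsmul, nsmul_eq_mul]

lemma Extends.val_iff {K F : Type*} [Field K] [Field F] [Algebra K F]
    {vK : AddValuation K (WithTop ℤ)}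
    {vF : AddValuation F (WithTop ℤ)} {e : ℕ} (h : Extends vK vF e) {x : K} {n : ℤ} :
    vF (algebraMap K F x) = ((e * n : ℤ) : WithTop ℤ) ↔ vK x = n := by
  refine ⟨fun h1 => ?_, h.val⟩
  obtain ⟨k, hk⟩ := exists_int_val (v := vK) (x := x) (by
    rintro rfl; rw [map_zero, vF.map_zero] at h1; exact WithTop.top_ne_coe h1)
  have := val_unique h1 (h.val hk)
  have := mul_left_cancel₀ (by have := h.1; omega) this
  rw [hk, this]

lemma Extends.mem_ball {K F : Type*} [Field K] [Field F] [Algebra K F]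
    {vK : AddValuation K (WithTop ℤ)}
    {vF : AddValuation F (WithTop ℤ)} {e : ℕ} (h : Extends vK vF e) {x : K} {n : ℤ} :
    algebraMap K F x ∈ ball vF (e * n) ↔ x ∈ ball vK n := by
  by_cases hx : x = 0
  · subst hx; simp [zero_mem]
  obtain ⟨k, hk⟩ := exists_int_val (v := vK) hx
  rw [mem_ball_iff_of_val hk, mem_ball_iff_of_val (h.val hk)]
  have := h.1
  exact mul_le_mul_iff_right₀ (by omega)

lemma IsPadicValuation.of_extends {p : ℕ} [Fact p.Prime] {K F : Type*} [Field K] [Field F]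
    [Algebra ℚ_[p] K] [Algebra ℚ_[p] F] [Algebra K F] [IsScalarTower ℚ_[p] K F]
    {vK : AddValuation K (WithTop ℤ)} {vF : AddValuation F (WithTop ℤ)} {eK e : ℕ}
    (hK : IsPadicValuation p vK eK) (h : Extends vK vF e) (hn : IsNormalized vF) :
    IsPadicValuation p vF (eK * e) := by
  refine ⟨hn, Nat.mul_pos hK.2.1 h.1, fun x hx => ?_⟩
  rw [IsScalarTower.algebraMap_apply ℚ_[p] K F, h.val (hK.2.2 x hx)]
  congr 1; push_cast; ring

lemma ball_of_sum_distinct {F : Type*} [Field F] {v : AddValuation F (WithTop ℤ)} {ι : Type*}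
    (s : Finset ι) (f : ι → F)
    (hd : ∀ i ∈ s, ∀ j ∈ s, i ≠ j → f i ≠ 0 → v (f i) ≠ v (f j)) {k : ℤ}
    (hs : ∑ i ∈ s, f i ∈ ball v k) : ∀ i ∈ s, f i ∈ ball v k := by
  by_contra! hcon
  let B := s.filter (fun i => f i ∉ ball v k)
  have hB : B.Nonempty := by
    obtain ⟨i, hi, h⟩ := hcon
    exact ⟨i, Finset.mem_filter.2 ⟨hi, h⟩⟩
  obtain ⟨i, hiB, hmin⟩ := B.exists_min_image (fun i => v (f i)) hB
  obtain ⟨hi, hik⟩ := Finset.mem_filter.1 hiB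
  have hi0 : f i ≠ 0 := fun h => hik (h ▸ zero_mem _)
  obtain ⟨n, hn⟩ := exists_int_val (v := v) hi0
  rw [mem_ball_iff_of_val hn] at hik
  have hrest : ∑ j ∈ s.erase i, f j ∈ ball v (n + 1) := by
    refine sum_mem fun j hj => ?_
    obtain ⟨hji, hj⟩ := Finset.mem_erase.1 hj
    by_cases hjB : f j ∈ ball v k
    · exact ball_anti (by omega) hjB
    · have h1 := hmin j (Finset.mem_filter.2 ⟨hj, hjB⟩)
      have h2 := hd i hi j hj hji.symm hi0
      have hj0 : f j ≠ 0 := fun h => hjB (h ▸ zero_mem _)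
      obtain ⟨l, hl⟩ := exists_int_val (v := v) hj0
      rw [mem_ball_iff_of_val hl]
      rw [hn, hl] at h1 h2
      have h3 := WithTop.coe_le_coe.1 h1
      have h4 : n ≠ l := fun h => h2 (by rw [h])
      omega
  have h := val_add_of_ball hn hrest
  rw [Finset.add_sum_erase s f hi] at h
  rw [mem_ball_iff_of_val h] at hs
  omega

/-- `F / K` is totally ramified of degree `n` with normalized valuations `vK`, `vF`. -/
structure TR {K F : Type*} [Field K] [Field F] [Algebra K F] (vK : AddValuation K (WithTop ℤ))
    (vF : AddValuation F (WithTop ℤ)) (n : ℕ) : Prop where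
  normK : IsNormalized vK
  normF : IsNormalized vF
  ext : Extends vK vF n
  rank : Module.finrank K F = n

section
variable {K F : Type*} [Field K] [Field F] [Algebra K F] {vK : AddValuation K (WithTop ℤ)}
  {vF : AddValuation F (WithTop ℤ)} {n : ℕ}

lemma Extends.ball_of_sum (h : Extends vK vF n) {π : F} (hπ : vF π = ((1 : ℤ) : WithTop ℤ))
    (c : Fin n → K) {k : ℤ} (hs : ∑ j, algebraMap K F (c j) * π ^ (j : ℕ) ∈ ball vF k) (j : Fin n) :
    algebraMap K F (c j) * π ^ (j : ℕ) ∈ ball vF k := by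
  refine ball_of_sum_distinct Finset.univ _ ?_ hs j (Finset.mem_univ _)
  intro i _ j _ hij h0 heq
  have hci : c i ≠ 0 := by rintro h; simp [h] at h0
  have hj0 : algebraMap K F (c j) * π ^ (j : ℕ) ≠ 0 := by
    rw [← (vF.ne_top_iff), ← heq, vF.ne_top_iff]; exact h0
  have hcj : c j ≠ 0 := by rintro h; simp [h] at hj0
  obtain ⟨a, ha⟩ := exists_int_val (v := vK) hci
  obtain ⟨b, hb⟩ := exists_int_val (v := vK) hcj
  rw [val_mul (h.val ha) (val_pow hπ i), val_mul (h.val hb) (val_pow hπ j)] at heq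
  have heq := WithTop.coe_injective heq
  have hi := i.2
  have hj := j.2
  apply hij
  ext
  have h1 : (n : ℤ) * (a - b) = (j : ℕ) - (i : ℕ) := by linarith
  have h2 : (n : ℤ) ∣ ((j : ℕ) : ℤ) - (i : ℕ) := ⟨_, h1.symm⟩
  have h3 : (((j : ℕ) : ℤ) - (i : ℕ)).natAbs < n := by omega
  have := Int.eq_zero_of_dvd_of_natAbs_lt_natAbs h2 (by simpa using h3)
  omega

lemma Extends.linearIndependent (h : Extends vK vF n) {π : F} (hπ : vF π = ((1 : ℤ) : WithTop ℤ)) :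
    LinearIndependent K (fun j : Fin n => π ^ (j : ℕ)) := by
  rw [Fintype.linearIndependent_iff]
  intro c hc j
  by_contra hcj
  obtain ⟨a, ha⟩ := exists_int_val (v := vK) hcj
  have hv := val_mul (h.val ha) (val_pow hπ j)
  have := h.ball_of_sum hπ c (k := n * a + (j : ℕ) * 1 + 1) (by
    simp only [Algebra.smul_def] at hc; rw [hc]; exact zero_mem _) j
  rw [mem_ball_iff_of_val hv] at this
  omega

lemma Extends.le_finrank [FiniteDimensional K F] (h : Extends vK vF n) (hF : IsNormalized vF) :
    n ≤ Module.finrank K F := by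
  obtain ⟨π, hπ⟩ := exists_unif hF
  simpa using (h.linearIndependent hπ).fintype_card_le_finrank

lemma TR.pos (h : TR vK vF n) : 0 < n := h.ext.1

lemma TR.finiteDimensional (h : TR vK vF n) : FiniteDimensional K F :=
  FiniteDimensional.of_finrank_pos (by rw [h.rank]; exact h.pos)

lemma TR.exists_sum (h : TR vK vF n) {π : F} (hπ : vF π = ((1 : ℤ) : WithTop ℤ)) (x : F) :
    ∃ c : Fin n → K, x = ∑ j, algebraMap K F (c j) * π ^ (j : ℕ) := by
  have := h.finiteDimensional
  have hne : Nonempty (Fin n) := ⟨⟨0, h.pos⟩⟩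
  have hli := h.ext.linearIndependent hπ
  have hsp := hli.span_eq_top_of_card_eq_finrank (by simp [h.rank])
  have hx : x ∈ Submodule.span K (Set.range fun j : Fin n => π ^ (j : ℕ)) := by rw [hsp]; trivial
  obtain ⟨c, hc⟩ := (Submodule.mem_span_range_iff_exists_fun K).1 hx
  exact ⟨c, by rw [← hc]; simp [Algebra.smul_def]⟩

lemma TR.coeff_mem (h : TR vK vF n) {π : F} (hπ : vF π = ((1 : ℤ) : WithTop ℤ)) (c : Fin n → K)
    (hx : ∑ j, algebraMap K F (c j) * π ^ (j : ℕ) ∈ ball vF 0) (j : Fin n) : c j ∈ ball vK 0 := by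
  have h1 := h.ext.ball_of_sum hπ c hx j
  by_cases hc : c j = 0
  · rw [hc]; exact zero_mem _
  obtain ⟨a, ha⟩ := exists_int_val (v := vK) hc
  rw [mem_ball_iff_of_val (val_mul (h.ext.val ha) (val_pow hπ j))] at h1
  rw [mem_ball_iff_of_val ha]
  have := j.2
  by_contra hneg
  have h2 : a ≤ -1 := by omega
  nlinarith

lemma TR.exists_residue (h : TR vK vF n) {x : F} (hx : x ∈ ball vF 0) :
    ∃ c ∈ ball vK 0, x - algebraMap K F c ∈ ball vF 1 := by
  obtain ⟨π, hπ⟩ := exists_unif h.normF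
  obtain ⟨c, rfl⟩ := h.exists_sum hπ x
  have hc := h.coeff_mem hπ c hx
  obtain ⟨k, rfl⟩ : ∃ k, n = k + 1 := ⟨n - 1, by have := h.pos; omega⟩
  refine ⟨c 0, hc 0, ?_⟩
  rw [Fin.sum_univ_succ]
  simp only [Fin.val_zero, pow_zero, mul_one, add_sub_cancel_left]
  refine sum_mem fun j _ => ?_
  refine ball_mul (n := 1) (m := 0) ?_ ?_ (by norm_num)
  · have := (h.ext.mem_ball (n := 0)).2 (hc j.succ)
    simpa using this
  · rw [Fin.val_succ, pow_succ]
    exact ball_mul (ball_pow_zero (ball_anti zero_le_one (mem_ball_of_val hπ)) _)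
      (mem_ball_of_val hπ) (by norm_num)

lemma pow_sub_pow_mem {v : AddValuation F (WithTop ℤ)} {x y : F} {a i : ℤ} (hx : x ∈ ball v a)
    (hy : y ∈ ball v a) (hxy : x - y ∈ ball v i) (j : ℕ) :
    x ^ j - y ^ j ∈ ball v (i + (j - 1) * a) := by
  cases j with
  | zero => simp [zero_mem]
  | succ j =>
    rw [← Commute.geom_sum₂_mul (Commute.all x y)]
    refine ball_mul (m := j * a) (sum_mem fun k hk => ?_) hxy (by push_cast; linarith)
    have := Finset.mem_range.1 hk
    refine ball_mul (ball_pow hx k) (ball_pow hy _) ?_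
    rw [← add_mul, show ((k : ℤ) + ((j + 1 - 1 - k : ℕ) : ℤ)) = j by omega]

lemma TR.diff_mem (h : TR vK vF n) {π : F} (hπ : vF π = ((1 : ℤ) : WithTop ℤ)) (τ : F →ₐ[K] F)
    (hinv : ∀ x, vF (τ x) = vF x)
    {s : ℤ} (hs : τ π - π ∈ ball vF (s + 1)) {x : F} {k : ℤ} (hx : x ∈ ball vF k) :
    τ x - x ∈ ball vF (k + s) := by
  obtain ⟨c, rfl⟩ := h.exists_sum hπ x
  have hc := h.ext.ball_of_sum hπ c hx
  rw [map_sum, ← Finset.sum_sub_distrib]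
  refine sum_mem fun j _ => ?_
  rw [map_mul, map_pow, AlgHom.commutes, ← mul_sub]
  have h1 := pow_sub_pow_mem (v := vF) (mem_ball_of_val (by rw [hinv]; exact hπ)) (mem_ball_of_val hπ) hs j
  by_cases hcj : c j = 0
  · simp [hcj, zero_mem]
  obtain ⟨a, ha⟩ := exists_int_val (v := vK) hcj
  have h2 := (mem_ball_iff_of_val (val_mul (h.ext.val ha) (val_pow hπ j))).1 (hc j)
  exact ball_mul (mem_ball_of_val (h.ext.val ha)) h1 (by linarith)

/-- If `x` is an integral element, `τ x - x` is divisible by `τ π - π`. -/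
lemma TR.diff_mem' (h : TR vK vF n) {M : Type*} [Field M] [Algebra K M] {v : AddValuation M (WithTop ℤ)}
    (ι τ : F →ₐ[K] M) (hι : ∀ x ∈ ball vF 0, ι x ∈ ball v 0) (hτ : ∀ x ∈ ball vF 0, τ x ∈ ball v 0)
    {π : F} (hπ : vF π = ((1 : ℤ) : WithTop ℤ)) {i : ℤ}
    (hi : τ π - ι π ∈ ball v i) {x : F} (hx : x ∈ ball vF 0) : τ x - ι x ∈ ball v i := by
  obtain ⟨c, rfl⟩ := h.exists_sum hπ x
  have hc := h.coeff_mem hπ c hx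
  rw [map_sum, map_sum, ← Finset.sum_sub_distrib]
  refine sum_mem fun j _ => ?_
  rw [map_mul, map_pow, map_mul, map_pow, AlgHom.commutes, AlgHom.commutes, ← mul_sub]
  have hπ0 := ball_anti zero_le_one (mem_ball_of_val hπ)
  have h1 := pow_sub_pow_mem (hτ π hπ0) (hι π hπ0) hi j
  refine ball_mul_left ?_ (by simpa using h1)
  have := hι (algebraMap K F (c j)) (by simpa using (h.ext.mem_ball (n := 0)).2 (hc j))
  rwa [AlgHom.commutes] at this

/-- The intermediate fields of a totally ramified extension. -/
lemma TR.tower (h : TR vK vF n) (E : Type*) [Field E] [Algebra K E] [Algebra E F]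
    [IsScalarTower K E F] : ∃ vE : AddValuation E (WithTop ℤ),
      TR vK vE (Module.finrank K E) ∧ TR vE vF (Module.finrank E F) := by
  have := h.finiteDimensional
  have : FiniteDimensional K E := FiniteDimensional.left K E F
  have : FiniteDimensional E F := FiniteDimensional.right K E F
  let w : AddValuation E (WithTop ℤ) := vF.comap (algebraMap E F)
  have hw : ∀ x, w x = vF (algebraMap E F x) := fun x => rfl
  obtain ⟨ϖ, hϖ⟩ := exists_unif h.normK
  have hn0 : ((n : ℤ) * 1) ≠ 0 := by have := h.pos; omega
  have h1 : w (algebraMap K E ϖ) = (((n : ℤ) * 1 : ℤ) : WithTop ℤ) := by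
    rw [hw, ← IsScalarTower.algebraMap_apply]; exact h.ext.val hϖ
  obtain ⟨vE, g, hg, hnE, hv⟩ := exists_normalized w hn0 h1
  obtain ⟨g, rfl⟩ := Int.eq_ofNat_of_zero_le hg.le
  have hg' : 0 < g := by exact_mod_cast hg
  have hEF : Extends vE vF g := by
    refine ⟨hg', fun x => ?_⟩
    by_cases hx : x = 0
    · subst hx
      obtain ⟨k, rfl⟩ := Nat.exists_eq_succ_of_ne_zero hg'.ne'
      simp [succ_nsmul]
    obtain ⟨a, ha⟩ := exists_int_val (v := vE) hx
    rw [← hw, (hv x a).1 ha, ha, ← WithTop.coe_nsmul, nsmul_eq_mul]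
  obtain ⟨e, he⟩ := exists_int_val (v := vE) (x := algebraMap K E ϖ) (by
    simpa using ne_zero_of_val hϖ)
  have hge : (n : ℤ) = g * e := by
    have := val_unique h1 ((hv _ _).1 he); simpa using this
  have hepos : 0 < e := by
    have : (0 : ℤ) < g * e := by rw [← hge]; exact_mod_cast h.pos
    exact pos_of_mul_pos_right this hg.le
  obtain ⟨e, rfl⟩ := Int.eq_ofNat_of_zero_le hepos.le
  have he' : 0 < e := by exact_mod_cast hepos
  have hge' : n = g * e := by exact_mod_cast hge
  have hKE : Extends vK vE e := by
    refine ⟨he', fun x => ?_⟩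
    by_cases hx : x = 0
    · subst hx
      obtain ⟨k, rfl⟩ := Nat.exists_eq_succ_of_ne_zero he'.ne'
      simp [succ_nsmul]
    obtain ⟨a, ha⟩ := exists_int_val (v := vK) hx
    rw [ha, ← WithTop.coe_nsmul, nsmul_eq_mul, hv, hw, ← IsScalarTower.algebraMap_apply, h.ext.val ha,
      hge]
    congr 1
    ring
  have h2 := hEF.le_finrank h.normF
  have h3 := hKE.le_finrank hnE
  have h4 := Module.finrank_mul_finrank K E F
  rw [h.rank, hge'] at h4
  have h5 : g = Module.finrank E F := by
    apply le_antisymm h2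
    by_contra hlt
    have : g * e < Module.finrank K E * Module.finrank E F := by nlinarith
    omega
  have h6 : e = Module.finrank K E := by
    rw [← h5, mul_comm] at h4
    exact (Nat.eq_of_mul_eq_mul_left hg' h4).symm
  refine ⟨vE, ⟨h.normK, hnE, h6 ▸ hKE, rfl⟩, ⟨hnE, h.normF, h5 ▸ hEF, rfl⟩⟩

end

section
open Polynomial
variable {K E M : Type*} [Field K] [Field E] [Field M] [Algebra K E] [Algebra K M] [Algebra E M]
  [IsScalarTower K E M]
  {vK : AddValuation K (WithTop ℤ)} {vE : AddValuation E (WithTop ℤ)}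
  {vM : AddValuation M (WithTop ℤ)} {n b N : ℕ}

lemma TR.algHom_ext (h : TR vK vM n) {M' : Type*} [Field M'] [Algebra K M'] {f g : M →ₐ[K] M'}
    {π : M} (hπ : vM π = ((1 : ℤ) : WithTop ℤ)) (hfg : f π = g π) : f = g := by
  ext x
  obtain ⟨c, rfl⟩ := h.exists_sum hπ x
  simp [hfg]

lemma eval_mem_ball {P : M[X]} {x : M} (hx : x ∈ ball vM 0) {i : ℤ}
    (hP : ∀ j, P.coeff j ∈ ball vM i) : P.eval x ∈ ball vM i := by
  rw [eval_eq_sum_range]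
  exact sum_mem fun j _ => ball_mul_right (hP j) (ball_pow_zero hx j)

lemma prod_dvd_of_eval_zero {R ι : Type*} [CommRing R] [IsDomain R] [Fintype ι] {r : ι → R}
    (hr : Function.Injective r) {G : R[X]} (hG : ∀ i, G.eval (r i) = 0) :
    ∏ i, (X - C (r i)) ∣ G := by
  by_cases h0 : G = 0
  · exact h0 ▸ dvd_zero _
  have := (Multiset.prod_X_sub_C_dvd_iff_le_roots h0 (Finset.univ.val.map r)).2 (by
    rw [Multiset.le_iff_subset (Finset.univ.nodup.map hr)]
    intro x hx
    obtain ⟨i, -, rfl⟩ := Multiset.mem_map.1 hx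
    exact (mem_roots h0).2 (hG i))
  simpa [Multiset.map_map] using this

lemma val_prod {ι : Type*} (s : Finset ι) {f : ι → M} {a : ι → ℤ}
    (h : ∀ i ∈ s, vM (f i) = (a i : WithTop ℤ)) :
    vM (∏ i ∈ s, f i) = ((∑ i ∈ s, a i : ℤ) : WithTop ℤ) := by
  induction s using Finset.induction_on with
  | empty => simp
  | insert i s his ih =>
    rw [Finset.prod_insert his, Finset.sum_insert his]
    exact val_mul (h i (Finset.mem_insert_self i s)) (ih fun j hj => h j (Finset.mem_insert_of_mem hj))

/-- Herbrand's formula for the valuation of `τ ϖ - ϖ` at the bottom of a totally ramified tower. -/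
lemma TR.herbrand [FiniteDimensional E M] [IsGalois E M] (hKE : TR vK vE n) (hEM : TR vE vM b)
    (hKM : TR vK vM N) (hinv : GalInvariant K vM) (τ : M ≃ₐ[K] M) {π : M}
    (hπ : vM π = ((1 : ℤ) : WithTop ℤ)) {ϖ : E} (hϖ : vE ϖ = ((1 : ℤ) : WithTop ℤ))
    {a : (M ≃ₐ[E] M) → ℤ} (ha : ∀ h, vM (τ (h π) - π) = (a h : WithTop ℤ)) :
    vM (τ (algebraMap E M ϖ) - algebraMap E M ϖ) = ((∑ h, a h : ℤ) : WithTop ℤ) := by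
  have hπ0 := ball_anti zero_le_one (mem_ball_of_val hπ)
  have hhinv : ∀ (h : M ≃ₐ[E] M) x, vM (h x) = vM x := fun h x => hinv (h.restrictScalars K) x
  have hE0 : ∀ x ∈ ball vE 0, algebraMap E M x ∈ ball vM 0 := fun x hx => by
    simpa using (hEM.ext.mem_ball (n := 0)).2 hx
  have hprod := val_prod Finset.univ (f := fun h : M ≃ₐ[E] M => π - τ (h π)) (a := a)
    fun h _ => by rw [vM.map_sub_swap]; exact ha h
  have hone : ∀ i : ℤ, τ (algebraMap E M ϖ) - algebraMap E M ϖ ∈ ball vM i ↔ i ≤ ∑ h, a h := by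
    intro i
    constructor
    · intro hi
      let P : M[X] := ∏ h : M ≃ₐ[E] M, (X - C (h π))
      have hPτ : (P.map (τ : M →+* M)).eval π = ∏ h : M ≃ₐ[E] M, (π - τ (h π)) := by
        simp [P, Polynomial.map_prod, eval_prod]
      have hP0 : P.eval π = 0 := by
        rw [eval_prod]
        exact Finset.prod_eq_zero (Finset.mem_univ 1) (by simp)
      have hPO : P ∈ lifts (Ov vM).subtype := by
        refine prod_mem fun h _ => ?_
        refine (mem_lifts _).2 ⟨X - C ⟨h π, mem_Ov.2 ?_⟩, by simp⟩
        rw [mem_ball, hhinv]; exact hπ0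
      have hPE : P ∈ lifts (algebraMap E M) := by
        rw [lifts_iff_coeff_lifts]
        intro j
        rw [IsGalois.mem_range_algebraMap_iff_fixed]
        intro g
        have : P.map (g : M →+* M) = P := by
          simp only [P, Polynomial.map_prod, Polynomial.map_sub, map_X, map_C]
          exact Fintype.prod_equiv (Equiv.mulLeft g) _ _ fun h => by simp
        conv_rhs => rw [← this, coeff_map]
        rfl
      rw [← mem_ball_iff_of_val hprod, ← hPτ, ← sub_zero (eval π (P.map (τ : M →+* M))), ← hP0,
        ← eval_sub]
      refine eval_mem_ball hπ0 fun j => ?_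
      rw [coeff_sub, coeff_map]
      obtain ⟨x, hx⟩ := (lifts_iff_coeff_lifts P).1 hPE j
      obtain ⟨y, hy⟩ := (lifts_iff_coeff_lifts P).1 hPO j
      have hxO : x ∈ ball vE 0 := by
        rw [← (hEM.ext.mem_ball (n := 0))]
        simp only [mul_zero]
        rw [hx, ← hy]; exact mem_Ov.1 y.2
      have := hKE.diff_mem' (v := vM) (IsScalarTower.toAlgHom K E M)
        ((τ : M →ₐ[K] M).comp (IsScalarTower.toAlgHom K E M)) (by simpa using hE0)
        (by intro x hx; have := hE0 x hx; rw [mem_ball, ← hinv τ] at this; simpa [mem_ball] using this)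
        hϖ (i := i) (by simpa using hi) hxO
      rw [← hx]
      simpa using this
    · intro hi
      refine ball_anti hi ?_
      obtain ⟨c, hc⟩ := hKM.exists_sum hπ (algebraMap E M ϖ)
      have hϖ0 := hE0 ϖ (ball_anti zero_le_one (mem_ball_of_val hϖ))
      have hcO := hKM.coeff_mem hπ c (by rw [← hc]; exact hϖ0)
      have hcM : ∀ j, algebraMap K M (c j) ∈ ball vM 0 := fun j => by
        simpa using (hKM.ext.mem_ball (n := 0)).2 (hcO j)
      have hτO : ∀ x ∈ ball vM 0, τ x ∈ ball vM 0 := fun x hx => by rwa [mem_ball, hinv]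
      let G : (Ov vM)[X] := ∑ j : Fin N, C ⟨algebraMap K M (c j), mem_Ov.2 (hcM j)⟩ * X ^ (j : ℕ) -
        C ⟨τ (algebraMap E M ϖ), mem_Ov.2 (hτO _ hϖ0)⟩
      have hr0 : ∀ h : M ≃ₐ[E] M, τ (h π) ∈ ball vM 0 := fun h => hτO _ (by
        rw [mem_ball, hhinv]; exact hπ0)
      let r : (M ≃ₐ[E] M) → Ov vM := fun h => ⟨τ (h π), mem_Ov.2 (hr0 h)⟩
      have hrinj : Function.Injective r := by
        intro h h' hh
        have h1 : h π = h' π := τ.injective (congrArg Subtype.val hh)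
        have h2 := hEM.algHom_ext (f := (h : M →ₐ[E] M)) (g := (h' : M →ₐ[E] M)) hπ h1
        ext x
        exact DFunLike.congr_fun h2 x
      have hGeval : ∀ x : Ov vM, ((G.eval x : Ov vM) : M) =
          ∑ j, algebraMap K M (c j) * (x : M) ^ (j : ℕ) - τ (algebraMap E M ϖ) := by
        intro x
        simp [G, eval_finsetSum]
      have hGz : ∀ h, G.eval (r h) = 0 := by
        intro h
        apply Subtype.ext
        rw [hGeval]
        have h1 : h (algebraMap E M ϖ) = algebraMap E M ϖ := h.commutes ϖ
        have h2 : ∀ x, h (algebraMap K M x) = algebraMap K M x := (h.restrictScalars K).commutes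
        conv_lhs => enter [2]; rw [← h1, hc]
        simp [r, h2]
      obtain ⟨Q, hQ⟩ := prod_dvd_of_eval_zero hrinj hGz
      have h3 := congrArg (fun P : (Ov vM)[X] => ((P.eval ⟨π, mem_Ov.2 hπ0⟩ : Ov vM) : M)) hQ
      simp only [hGeval, eval_mul, eval_prod, eval_sub, eval_X, eval_C] at h3
      rw [← hc] at h3
      rw [← neg_mem_iff, neg_sub, h3]
      push_cast
      refine ball_mul_right ?_ (mem_Ov.1 (Subtype.prop _))
      exact mem_ball_of_val hprod
  rw [val_eq_iff, hone, hone]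
  constructor
  · exact le_rfl
  · omega

end

/-- A totally ramified Galois extension of prime degree `p`, with generator `τ` and
lower ramification jump `s`. -/
structure Step {E F : Type*} [Field E] [Field F] [Algebra E F] (p : ℕ)
    (vE : AddValuation E (WithTop ℤ)) (vF : AddValuation F (WithTop ℤ)) (τ : F ≃ₐ[E] F)
    (ε s : ℤ) : Prop where
  prime : p.Prime
  tr : TR vE vF p
  gal : IsGalois E F
  inv : GalInvariant E vF
  gen : ∀ g : F ≃ₐ[E] F, g ∈ Subgroup.zpowers τ
  valp : vE (p : E) = ε
  one_le_ε : 1 ≤ ε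
  one_le_s : 1 ≤ s
  jump : ∃ π, vF π = ((1 : ℤ) : WithTop ℤ) ∧ vF (τ π - π) = ((s + 1 : ℤ) : WithTop ℤ)

section
variable {E F : Type*} [Field E] [Field F] [Algebra E F] {p : ℕ}
    {vE : AddValuation E (WithTop ℤ)} {vF : AddValuation F (WithTop ℤ)} {τ : F ≃ₐ[E] F}
    {ε s : ℤ}

lemma Step.valpF (h : Step p vE vF τ ε s) : vF (p : F) = ((p * ε : ℤ) : WithTop ℤ) := by
  simpa using h.tr.ext.val h.valp

lemma val_natCast {F : Type*} [Field F] {v : AddValuation F (WithTop ℤ)} (hp : p.Prime)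
    (hpv : (p : F) ∈ ball v 1) {j : ℕ} (hj : ¬p ∣ j) :
    v (j : F) = ((0 : ℤ) : WithTop ℤ) := by
  rw [val_eq_iff]
  refine ⟨natCast_mem_ball j, fun hj1 => ?_⟩
  have hco : IsCoprime (p : ℤ) j := Nat.isCoprime_iff_coprime.2 ((hp.coprime_iff_not_dvd).2 hj)
  obtain ⟨a, b, hab⟩ := hco
  have h1 : (1 : F) = a * p + b * j := by
    have := congrArg (Int.cast : ℤ → F) hab.symm
    push_cast at this; exact this
  have h2 : (1 : F) ∈ ball v 1 := by
    rw [h1]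
    exact add_mem (ball_mul_left (intCast_mem_ball a) hpv)
      (ball_mul_left (intCast_mem_ball b) (by simpa using hj1))
  rw [mem_ball_iff_of_val val_one] at h2
  omega

lemma Step.p_mem (h : Step p vE vF τ ε s) : (p : F) ∈ ball vF 1 := by
  rw [mem_ball_iff_of_val h.valpF]
  have := h.prime.pos
  have := h.one_le_ε
  nlinarith

lemma Step.diff_mem (h : Step p vE vF τ ε s) {x : F} {k : ℤ} (hx : x ∈ ball vF k) :
    τ x - x ∈ ball vF (k + s) := by
  obtain ⟨π, hπ, hs⟩ := h.jump
  exact h.tr.diff_mem hπ (τ : F →ₐ[E] F) (h.inv τ) (mem_ball_of_val hs) hx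

lemma Step.val_diff (h : Step p vE vF τ ε s) {x : F} {k : ℤ} (hk : ¬(p : ℤ) ∣ k)
    (hx : vF x = (k : WithTop ℤ)) : vF (τ x - x) = ((k + s : ℤ) : WithTop ℤ) := by
  obtain ⟨π, hπ, hs⟩ := h.jump
  have hp0 : (0 : ℤ) < p := by exact_mod_cast h.prime.pos
  obtain ⟨j, hj⟩ := Int.eq_ofNat_of_zero_le (Int.emod_nonneg k hp0.ne')
  have hjp : ¬p ∣ j := by
    intro hd
    apply hk
    rw [Int.dvd_iff_emod_eq_zero, hj]
    have : (j : ℤ) < p := hj ▸ Int.emod_lt_of_pos k hp0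
    have : j = 0 := Nat.eq_zero_of_dvd_of_lt hd (by omega)
    simp [this]
  obtain ⟨e, he⟩ := h.tr.normK (k / p)
  have heF := h.tr.ext.val he
  have hkj : k = p * (k / p) + j := by rw [← hj]; exact (Int.mul_ediv_add_emod k p).symm
  have hmon : vF (algebraMap E F e * π ^ j) = ((k : ℤ) : WithTop ℤ) := by
    rw [val_mul heF (val_pow hπ j)]; congr 1; linarith
  obtain ⟨c, hc0, hc⟩ := h.tr.exists_residue (x := x / (algebraMap E F e * π ^ j)) (by
    rw [mem_ball_iff_of_val (val_div hx hmon)]; omega)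
  have hcv : vF (algebraMap E F c) = ((0 : ℤ) : WithTop ℤ) :=
    val_of_sub_mem_ball (by rw [val_div hx hmon]; simp) (by
      rw [← neg_mem_iff, neg_sub]; simpa using hc)
  have hmul := val_mul heF hcv
  set y := algebraMap E F e * π ^ j with hy
  have hy0 : y ≠ 0 := ne_zero_of_val hmon
  have hz : (x / y - algebraMap E F c) * y ∈ ball vF (k + 1) :=
    ball_mul hc (mem_ball_of_val hmon) (by omega)
  have hsplit : τ x - x = algebraMap E F e * algebraMap E F c * ((τ π) ^ j - π ^ j) +
      (τ ((x / y - algebraMap E F c) * y) - (x / y - algebraMap E F c) * y) := by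
    have : x = algebraMap E F e * algebraMap E F c * π ^ j + (x / y - algebraMap E F c) * y := by
      rw [sub_mul, div_mul_cancel₀ _ hy0, hy]; ring
    conv_lhs => rw [this]
    simp only [map_add, map_mul, map_pow, AlgEquiv.commutes]
    ring
  rw [hsplit]
  refine val_add_of_ball ?_ (ball_anti (by omega) (h.diff_mem hz))
  obtain ⟨i, rfl⟩ : ∃ i, j = i + 1 := ⟨j - 1, by
    have : j ≠ 0 := fun h0 => hjp (by simp [h0])
    omega⟩
  have hpow : vF (τ π ^ (i + 1) - π ^ (i + 1)) = ((i + (s + 1) : ℤ) : WithTop ℤ) := by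
    rw [← Commute.geom_sum₂_mul (Commute.all (τ π) π)]
    refine val_mul ?_ hs
    have hτπ : τ π ∈ ball vF 1 := mem_ball_of_val (by rw [h.inv τ]; exact hπ)
    have h1 : vF (((i + 1 : ℕ) : F) * π ^ i) = (i : ℤ) := by
      rw [val_mul (val_natCast h.prime h.p_mem hjp) (val_pow hπ i)]; simp
    refine val_of_sub_mem_ball h1 ?_
    have : ∑ l ∈ Finset.range (i + 1), τ π ^ l * π ^ (i + 1 - 1 - l) - ((i + 1 : ℕ) : F) * π ^ i =
        ∑ l ∈ Finset.range (i + 1), (τ π ^ l - π ^ l) * π ^ (i - l) := by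
      simp only [sub_mul, Finset.sum_sub_distrib]
      congr 1
      rw [Finset.sum_congr rfl (g := fun _ => π ^ i)]
      · simp
      · intro l hl
        rw [← pow_add]; congr 1; have := Finset.mem_range.1 hl; omega
    rw [this]
    refine sum_mem fun l hl => ?_
    have hl := Finset.mem_range.1 hl
    refine ball_mul (pow_sub_pow_mem hτπ (mem_ball_of_val hπ) (mem_ball_of_val hs) l)
      (ball_pow (mem_ball_of_val hπ) (i - l)) ?_
    have := h.one_le_s
    have : ((i - l : ℕ) : ℤ) = i - l := by omega
    rw [this]; linarith
  rw [val_mul hmul hpow]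
  congr 1
  push_cast at hkj
  linarith

lemma Step.iterate_mem (h : Step p vE vF τ ε s) {x : F} {k : ℤ} (hx : x ∈ ball vF k) (j : ℕ) :
    (fun y => τ y - y)^[j] x ∈ ball vF (k + j * s) := by
  induction j with
  | zero => simpa using hx
  | succ j ih =>
    rw [Function.iterate_succ_apply']
    exact ball_anti (by push_cast; linarith) (h.diff_mem ih)

lemma Step.iterate_val (h : Step p vE vF τ ε s) {x : F} {k : ℤ} (hx : vF x = (k : WithTop ℤ))
    (j : ℕ) (hk : ∀ i < j, ¬(p : ℤ) ∣ k + i * s) :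
    vF ((fun y => τ y - y)^[j] x) = ((k + j * s : ℤ) : WithTop ℤ) := by
  induction j with
  | zero => simpa using hx
  | succ j ih =>
    rw [Function.iterate_succ_apply',
      h.val_diff (hk j (by omega)) (ih fun i hi => hk i (by omega))]
    congr 1; push_cast; ring

lemma Step.card (h : Step p vE vF τ ε s) : Nat.card (F ≃ₐ[E] F) = p := by
  have := h.gal; have := h.tr.finiteDimensional
  rw [IsGalois.card_aut_eq_finrank, h.tr.rank]

lemma Step.order (h : Step p vE vF τ ε s) : orderOf τ = p := by
  rw [← h.card]; exact orderOf_eq_card_of_forall_mem_zpowers h.gen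

lemma Step.trace_eq_range (h : Step p vE vF τ ε s) (x : F) :
    algebraMap E F (Algebra.trace E F x) = ∑ k ∈ Finset.range p, (τ ^ k) x := by
  have := h.gal; have := h.tr.finiteDimensional
  rw [trace_eq_sum_automorphisms, ← IsCyclic.image_range_orderOf h.gen, h.order,
    Finset.sum_image]
  intro a ha b hb hab
  rw [← h.order] at ha hb
  exact pow_injOn_Iio_orderOf (by simpa using ha) (by simpa using hb) hab

lemma Step.trace_eq (h : Step p vE vF τ ε s) (x : F) :
    algebraMap E F (Algebra.trace E F x) =
      ∑ k ∈ Finset.range p, (p.choose (k + 1) : F) * (fun y => τ y - y)^[k] x := by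
  rw [h.trace_eq_range]
  let T : Module.End E F := (τ : F →ₐ[E] F).toLinearMap - 1
  have hT : ∀ k y, (T ^ k) y = (fun y => τ y - y)^[k] y := by
    intro k y
    rw [Module.End.pow_apply]; rfl
  have hτ : ∀ k y, (τ ^ k) y = ((T + 1) ^ k) y := by
    intro k y
    rw [sub_add_cancel, Module.End.pow_apply]
    induction k with
    | zero => rfl
    | succ k ih => rw [pow_succ', AlgEquiv.mul_apply, ih, Function.iterate_succ_apply']; rfl
  have hpoly := congrArg (fun P => Polynomial.aeval T P)
    (Polynomial.geom_sum_X_comp_X_add_one_eq_sum (R := E) p)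
  simp only [Polynomial.sum_comp, Polynomial.pow_comp, Polynomial.X_comp, map_sum, map_pow,
    map_add, Polynomial.aeval_X, map_one, map_mul, map_natCast] at hpoly
  have := congrArg (fun A : Module.End E F => A x) hpoly
  simp only [LinearMap.sum_apply, Module.End.mul_apply, hT, ← hτ] at this
  rw [this]
  refine Finset.sum_congr rfl fun k _ => ?_
  rw [Module.End.natCast_apply, nsmul_eq_mul]

/-- The trace of `x` is `D ^ (p - 1) x` up to the terms divisible by `p`. -/
lemma Step.trace_sub_mem (h : Step p vE vF τ ε s) {x : F} {k : ℤ} (hx : x ∈ ball vF k) :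
    algebraMap E F (Algebra.trace E F x) - (p * x + (fun y => τ y - y)^[p - 1] x) ∈
      ball vF (k + p * ε + s) := by
  rw [h.trace_eq]
  obtain ⟨q, hq⟩ : ∃ q, p = q + 2 := ⟨p - 2, by have := h.prime.two_le; omega⟩
  have h1 : ∀ k ∈ Finset.range p, True := fun _ _ => trivial
  have : ∑ k ∈ Finset.range p, (p.choose (k + 1) : F) * (fun y => τ y - y)^[k] x -
      (p * x + (fun y => τ y - y)^[p - 1] x) =
      ∑ k ∈ Finset.range q, (p.choose (k + 2) : F) * (fun y => τ y - y)^[k + 1] x := by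
    conv_lhs => rw [show Finset.range p = Finset.range (q + 1 + 1) by rw [hq]]
    rw [Finset.sum_range_succ, Finset.sum_range_succ']
    have e1 : p - 1 = q + 1 := by omega
    have e2 : p.choose (q + 1 + 1) = 1 := by rw [hq]; exact Nat.choose_self _
    simp only [e1, e2, Nat.choose_one_right, Function.iterate_zero, id, zero_add, Nat.cast_one,
      one_mul]
    ring
  rw [this]
  refine sum_mem fun j hj => ?_
  have hj := Finset.mem_range.1 hj
  obtain ⟨c, hc⟩ := h.prime.dvd_choose_self (k := j + 2) (by omega) (by omega)
  rw [hc, Nat.cast_mul]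
  refine ball_mul (ball_mul_right (mem_ball_of_val h.valpF) (natCast_mem_ball c))
    (h.iterate_mem hx (j + 1)) ?_
  have := h.one_le_s
  have : (0 : ℤ) ≤ j * s := by positivity
  push_cast
  linarith

end

section
variable {E F : Type*} [Field E] [Field F] [Algebra E F] {p : ℕ}
    {vE : AddValuation E (WithTop ℤ)} {vF : AddValuation F (WithTop ℤ)} {τ : F ≃ₐ[E] F}
    {ε s : ℤ}

lemma TR.dvd_val {n : ℕ} (h : TR vE vF n) {x : E} {k : ℤ}
    (hx : vF (algebraMap E F x) = (k : WithTop ℤ)) : (n : ℤ) ∣ k := by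
  have hx0 : x ≠ 0 := by rintro rfl; exact ne_zero_of_val hx (map_zero _)
  obtain ⟨a, ha⟩ := exists_int_val (v := vE) hx0
  exact ⟨a, val_unique hx (h.ext.val ha)⟩

lemma Step.not_dvd_of_lt (h : Step p vE vF τ ε s) (hs : ¬(p : ℤ) ∣ s) {j : ℤ} (h0 : 0 < j)
    (hj : j < p) : ¬(p : ℤ) ∣ j * s := by
  intro hd
  rcases (Nat.prime_iff_prime_int.1 h.prime).dvd_or_dvd hd with hd | hd
  · exact absurd (Int.le_of_dvd h0 hd) (by omega)
  · exact hs hd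

lemma Step.jump_le (h : Step p vE vF τ ε s) : (p - 1) * s ≤ p * ε := by
  by_contra! hlt
  obtain ⟨π, hπ, -⟩ := h.jump
  have h1 := h.trace_sub_mem (mem_ball_of_val hπ)
  have hs := h.one_le_s
  have hp := h.prime.two_le
  have h2 : vF (algebraMap E F (Algebra.trace E F π)) = ((p * ε + 1 : ℤ) : WithTop ℤ) := by
    refine val_of_sub_mem_ball (val_mul h.valpF hπ) ?_
    have h3 := h.iterate_mem (mem_ball_of_val hπ) (p - 1)
    rw [Nat.cast_sub (by omega)] at h3
    have := add_mem (ball_anti (m := p * ε + 1 + 1) (by linarith) h1)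
      (ball_anti (by push_cast; linarith) h3)
    ring_nf at this ⊢
    exact this
  have h3 := h.tr.dvd_val h2
  rw [dvd_add_right (Dvd.intro ε rfl)] at h3
  have := Int.le_of_dvd one_pos h3
  omega

lemma Step.jump_eq (h : Step p vE vF τ ε s) (hps : (p : ℤ) ∣ s) : (p - 1) * s = p * ε := by
  refine le_antisymm h.jump_le ?_
  by_contra! hlt
  obtain ⟨π, hπ, -⟩ := h.jump
  have h1 := h.trace_sub_mem (mem_ball_of_val hπ)
  have hs := h.one_le_s
  have hp := h.prime.two_le
  have hnd : ∀ i : ℤ, ¬(p : ℤ) ∣ 1 + i * s := by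
    intro i hd
    rw [dvd_add_left (hps.mul_left i)] at hd
    have := Int.le_of_dvd one_pos hd
    omega
  have h3 := h.iterate_val hπ (p - 1) fun i _ => hnd i
  have h2 : vF (algebraMap E F (Algebra.trace E F π)) = ((1 + (p - 1 : ℤ) * s : ℤ) : WithTop ℤ) := by
    refine val_of_sub_mem_ball (by rw [h3, Nat.cast_sub (by omega)]; simp) ?_
    have h4 := ball_mul (k := 1 + (p - 1) * s + 1) (mem_ball_of_val h.valpF)
      (mem_ball_of_val hπ) (by linarith)
    have := add_mem (ball_anti (m := 1 + (p - 1) * s + 1) (by linarith) h1) h4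
    ring_nf at this ⊢
    exact this
  exact hnd _ (h.tr.dvd_val h2)

lemma Step.trace_mem (h : Step p vE vF τ ε s) {x : F} {k : ℤ} (hx : x ∈ ball vF k) :
    algebraMap E F (Algebra.trace E F x) ∈ ball vF (k + (p - 1) * s) := by
  have h1 := h.trace_sub_mem hx
  have hs := h.one_le_s
  have hp := h.prime.two_le
  have hj := h.jump_le
  have h3 := h.iterate_mem hx (p - 1)
  rw [Nat.cast_sub (by omega)] at h3
  have h4 := ball_mul (k := k + (p - 1) * s) (mem_ball_of_val h.valpF) hx (by linarith)
  have := add_mem (ball_anti (m := k + (p - 1) * s) (by linarith) h1) (add_mem h4 (by simpa using h3))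
  simpa using this

lemma Step.exists_trace (h : Step p vE vF τ ε s) : ∃ y, vF y = (s : WithTop ℤ) ∧
    vE (Algebra.trace E F y) = (s : WithTop ℤ) := by
  have hs := h.one_le_s
  have hp := h.prime.two_le
  suffices ∃ y, vF y = (s : WithTop ℤ) ∧
      vF (algebraMap E F (Algebra.trace E F y)) = ((p * s : ℤ) : WithTop ℤ) by
    obtain ⟨y, h1, h2⟩ := this
    exact ⟨y, h1, (h.tr.ext.val_iff).1 h2⟩
  by_cases hps : (p : ℤ) ∣ s
  · have hj := h.jump_eq hps
    obtain ⟨k, hk⟩ := hps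
    obtain ⟨e, he⟩ := h.tr.normK k
    have heF := h.tr.ext.val he
    rw [← hk] at heF
    refine ⟨_, heF, ?_⟩
    rw [Algebra.trace_algebraMap, h.tr.rank, nsmul_eq_mul, map_mul, map_natCast,
      val_mul h.valpF heF]
    congr 1; linarith
  · obtain ⟨π, hπ, -⟩ := h.jump
    have hle := h.jump_le
    have hlt : (p - 1) * s < p * ε := lt_of_le_of_ne hle fun heq => hps ⟨s - ε, by linarith⟩
    have hy : vF (π ^ s) = (s : WithTop ℤ) := by simpa using val_zpow hπ s
    refine ⟨π ^ s, hy, ?_⟩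
    have h3 := h.iterate_val hy (p - 1) fun i hi => by
      have := h.not_dvd_of_lt hps (j := i + 1) (by omega) (by omega)
      rwa [add_mul, one_mul, add_comm] at this
    refine val_of_sub_mem_ball (by rw [h3, Nat.cast_sub (by omega)]; congr 1; push_cast; ring) ?_
    have h1 := h.trace_sub_mem (mem_ball_of_val hy)
    have h4 := ball_mul (k := p * s + 1) (mem_ball_of_val h.valpF) (mem_ball_of_val hy) (by linarith)
    have := add_mem (ball_anti (m := p * s + 1) (by linarith) h1) h4
    ring_nf at this ⊢
    exact this

variable [FiniteDimensional E F]

lemma Step.algebraMap_norm (h : Step p vE vF τ ε s) (x : F) :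
    algebraMap E F (Algebra.norm E x) = ∏ g : F ≃ₐ[E] F, g x := by
  have := h.gal
  exact Algebra.norm_eq_prod_automorphisms E x

lemma Step.norm_val (h : Step p vE vF τ ε s) {x : F} {k : ℤ} (hx : vF x = (k : WithTop ℤ)) :
    vE (Algebra.norm E x) = (k : WithTop ℤ) := by
  rw [← h.tr.ext.val_iff, h.algebraMap_norm,
    val_prod Finset.univ (a := fun _ => k) fun g _ => by rw [h.inv g]; exact hx]
  rw [Finset.sum_const, Finset.card_univ, ← Nat.card_eq_fintype_card, h.card, nsmul_eq_mul]

lemma Step.norm_mem (h : Step p vE vF τ ε s) {x : F} {k : ℤ} (hx : x ∈ ball vF k) :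
    Algebra.norm E x ∈ ball vE k := by
  by_cases h0 : x = 0
  · rw [h0, Algebra.norm_zero]; exact zero_mem _
  obtain ⟨a, ha⟩ := exists_int_val (v := vF) h0
  rw [mem_ball_iff_of_val ha] at hx
  rwa [mem_ball_iff_of_val (h.norm_val ha)]

/-- An elementary symmetric function of intermediate degree in the conjugates is a trace. -/
lemma Step.esymm_eq_trace (h : Step p vE vF τ ε s) [CharZero F] (x : F) {a : ℤ} (hx : x ∈ ball vF a)
    {k : ℕ} (h0 : 0 < k) (hk : k < p) : ∃ y ∈ ball vF (k * a),
      ∑ A ∈ Finset.powersetCard k (Finset.univ : Finset (F ≃ₐ[E] F)), ∏ g ∈ A, g x =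
        algebraMap E F (Algebra.trace E F y) := by
  have := h.gal
  let S := (Finset.powersetCard k (Finset.univ : Finset (F ≃ₐ[E] F))).filter (1 ∈ ·)
  have hk0 : (k : F) ≠ 0 := by exact_mod_cast h0.ne'
  have hkv := val_natCast (v := vF) h.prime h.p_mem (Nat.not_dvd_of_pos_of_lt h0 hk)
  refine ⟨(∑ A ∈ S, ∏ g ∈ A, g x) / k, ?_, ?_⟩
  · refine ball_div (sum_mem (S := ball vF (k * a)) fun A hA => ?_) hkv (by simp)
    have hc := (Finset.mem_powersetCard.1 (Finset.mem_filter.1 hA).1).2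
    have : ∀ B : Finset (F ≃ₐ[E] F), ∏ g ∈ B, g x ∈ ball vF (B.card * a) := by
      intro B
      induction B using Finset.induction_on with
      | empty => simpa using one_mem_ball
      | insert g B hg ih =>
        rw [Finset.prod_insert hg, Finset.card_insert_of_notMem hg]
        refine ball_mul (m := a) ?_ ih (by push_cast; linarith)
        rw [mem_ball, h.inv g]; exact hx
    have := this A
    rwa [hc] at this
  · rw [trace_eq_sum_automorphisms]
    simp only [map_div₀, map_natCast, ← Finset.sum_div]
    rw [eq_div_iff hk0]
    have h1 : ∀ g : F ≃ₐ[E] F, g (∑ A ∈ S, ∏ g ∈ A, g x) =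
        ∑ A ∈ (Finset.powersetCard k (Finset.univ : Finset (F ≃ₐ[E] F))).filter (g ∈ ·),
          ∏ g ∈ A, g x := by
      intro g
      rw [map_sum]
      refine Finset.sum_bij (fun A _ => A.map (Equiv.mulLeft g).toEmbedding) ?_ ?_ ?_ ?_
      · intro A hA
        simp only [S, Finset.mem_filter, Finset.mem_powersetCard_univ] at hA ⊢
        refine ⟨by simpa using hA.1, ?_⟩
        exact Finset.mem_map.2 ⟨1, hA.2, by simp⟩
      · intro A _ B _ hAB
        exact Finset.map_injective _ hAB
      · intro B hB
        simp only [Finset.mem_filter, Finset.mem_powersetCard_univ] at hB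
        refine ⟨B.map (Equiv.mulLeft g⁻¹).toEmbedding, ?_, ?_⟩
        · simp only [S, Finset.mem_filter, Finset.mem_powersetCard_univ]
          exact ⟨by simpa using hB.1, Finset.mem_map.2 ⟨g, hB.2, by simp⟩⟩
        · ext l
          simp
      · intro A _
        rw [map_prod, Finset.prod_map]
        rfl
    simp only [h1]
    simp only [Finset.sum_filter]
    rw [Finset.sum_comm, Finset.sum_mul]
    refine Finset.sum_congr rfl fun A hA => ?_
    rw [← Finset.sum_filter, Finset.sum_const, Finset.filter_univ_mem,
      (Finset.mem_powersetCard.1 hA).2, nsmul_eq_mul, mul_comm]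

lemma Step.norm_one_add (h : Step p vE vF τ ε s) [CharZero F] {x : F} {a : ℤ} (ha : 0 ≤ a)
    (hx : x ∈ ball vF a) : ∃ y ∈ ball vF (2 * a),
      Algebra.norm E (1 + x) = 1 + Algebra.norm E x + Algebra.trace E F x + Algebra.trace E F y := by
  have := h.gal
  have hp := h.prime.two_le
  choose! y hy hye using fun k (hk : 0 < k ∧ k < p) => h.esymm_eq_trace x hx hk.1 hk.2
  refine ⟨∑ k ∈ Finset.Ico 2 p, y k, sum_mem fun k hk => ?_, ?_⟩
  · have hk := Finset.mem_Ico.1 hk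
    refine ball_anti ?_ (hy k ⟨by omega, hk.2⟩)
    have : (2 : ℤ) ≤ k := by exact_mod_cast hk.1
    nlinarith
  · apply (algebraMap E F).injective
    have hcard : (Finset.univ : Finset (F ≃ₐ[E] F)).card = p := by
      rw [Finset.card_univ, ← Nat.card_eq_fintype_card, h.card]
    rw [h.algebraMap_norm]
    simp only [map_add, map_one]
    rw [Finset.prod_one_add, Finset.sum_powerset, hcard, Finset.sum_range_succ,
      ← Finset.sum_range_add_sum_Ico _ hp, Finset.sum_range_succ, Finset.sum_range_one, map_sum,
      map_sum, h.algebraMap_norm]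
    have e1 : Finset.powersetCard p (Finset.univ : Finset (F ≃ₐ[E] F)) = {Finset.univ} := by
      rw [← hcard]; exact Finset.powersetCard_self _
    rw [Finset.sum_congr (s₁ := Finset.Ico 2 p) rfl fun k hk => hye k (by
      have hk := Finset.mem_Ico.1 hk; omega), e1]
    simp only [Finset.powersetCard_zero, Finset.sum_singleton, Finset.prod_empty,
      Finset.powersetCard_one, Finset.sum_map, Function.Embedding.coeFn_mk, Finset.prod_singleton]
    rw [trace_eq_sum_automorphisms (K := E) x]
    ring

end

/-- The inverse Herbrand function of an extension of degree `p` with jump `s`. -/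
def psi1 (p : ℕ) (s u : ℤ) : ℤ := if u ≤ s then u else s + p * (u - s)

/-- The behaviour of a norm map on the filtration by units, with respect to a function `ψ` and
a set `T` of jumps. -/
structure NormFil {K M : Type*} [Field K] [Field M] (vK : AddValuation K (WithTop ℤ))
    (vM : AddValuation M (WithTop ℤ)) (N : M →* K) (ψ : ℤ → ℤ) (T : ℤ → Prop) : Prop where
  one_le : ∀ u, 1 ≤ u → 1 ≤ ψ u
  map : ∀ u, 1 ≤ u → ∀ x, IsU vM (ψ u) x → IsU vK u (N x)
  map_succ : ∀ u, 1 ≤ u → ∀ x, IsU vM (ψ u + 1) x → IsU vK (u + 1) (N x)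
  surj : ∀ u, 1 ≤ u → ¬T u → ∀ y, IsU vK u y →
    ∃ x, IsU vM (ψ u) x ∧ IsU vK (u + 1) (y / N x)
  cyclic : ∀ u, 1 ≤ u → ∃ g, IsU vK u g ∧ ∀ y, IsU vK u y →
    ∃ (j : ℕ) (x : M), IsU vM (ψ u) x ∧ IsU vK (u + 1) (y / (g ^ j * N x))

lemma monoidHom_map_div {A B : Type*} [Field A] [Field B] (f : A →* B) (x : A) {y : A}
    (hy : y ≠ 0) : f (x / y) = f x / f y := by
  have h1 : f y * f y⁻¹ = 1 := by rw [← map_mul, mul_inv_cancel₀ hy, map_one]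
  rw [eq_div_iff (left_ne_zero_of_mul_eq_one h1), ← map_mul, div_mul_cancel₀ _ hy]

lemma NormFil.comp {K E M : Type*} [Field K] [Field E] [Field M] {vK : AddValuation K (WithTop ℤ)}
    {vE : AddValuation E (WithTop ℤ)} {vM : AddValuation M (WithTop ℤ)} {N₁ : E →* K} {N₂ : M →* E}
    {ψ₁ ψ₂ : ℤ → ℤ} {T₁ T₂ : ℤ → Prop} (h₁ : NormFil vK vE N₁ ψ₁ T₁) (h₂ : NormFil vE vM N₂ ψ₂ T₂)
    (hdis : ∀ u, 1 ≤ u → T₁ u → ¬T₂ (ψ₁ u)) :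
    NormFil vK vM (N₁.comp N₂) (ψ₂ ∘ ψ₁) (fun u => T₁ u ∨ T₂ (ψ₁ u)) := by
  refine ⟨fun u hu => h₂.one_le _ (h₁.one_le u hu),
    fun u hu x hx => h₁.map u hu _ (h₂.map _ (h₁.one_le u hu) x hx),
    fun u hu x hx => h₁.map_succ u hu _ (h₂.map_succ _ (h₁.one_le u hu) x hx), ?_, ?_⟩
  · intro u hu hT y hy
    rw [not_or] at hT
    obtain ⟨x₁, hx₁, hy₁⟩ := h₁.surj u hu hT.1 y hy
    obtain ⟨x₂, hx₂, hy₂⟩ := h₂.surj _ (h₁.one_le u hu) hT.2 x₁ hx₁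
    refine ⟨x₂, hx₂, ?_⟩
    have h3 := hy₁.mul (by omega) (h₁.map_succ u hu _ hy₂)
    have h4 := (h₁.map u hu x₁ hx₁).ne_zero hu
    have h5 := (h₁.map u hu _ (h₂.map _ (h₁.one_le u hu) x₂ hx₂)).ne_zero hu
    rw [monoidHom_map_div _ _ ((h₂.map _ (h₁.one_le u hu) x₂ hx₂).ne_zero (h₁.one_le u hu))] at h3
    rwa [MonoidHom.comp_apply, ← div_mul_div_cancel₀ h4]
  · intro u hu
    by_cases hT : T₁ u
    · obtain ⟨g, hg, hcyc⟩ := h₁.cyclic u hu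
      refine ⟨g, hg, fun y hy => ?_⟩
      obtain ⟨j, x₁, hx₁, hy₁⟩ := hcyc y hy
      obtain ⟨x₂, hx₂, hy₂⟩ := h₂.surj _ (h₁.one_le u hu) (hdis u hu hT) x₁ hx₁
      refine ⟨j, x₂, hx₂, ?_⟩
      have h3 := hy₁.mul (by omega) (h₁.map_succ u hu _ hy₂)
      have h4 := (h₁.map u hu x₁ hx₁).ne_zero hu
      have h5 := (h₁.map u hu _ (h₂.map _ (h₁.one_le u hu) x₂ hx₂)).ne_zero hu
      have h6 := hg.ne_zero hu
      rw [monoidHom_map_div _ _ ((h₂.map _ (h₁.one_le u hu) x₂ hx₂).ne_zero (h₁.one_le u hu))] at h3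
      convert h3 using 1
      rw [MonoidHom.comp_apply]
      field_simp
    · obtain ⟨g, hg, hcyc⟩ := h₂.cyclic (ψ₁ u) (h₁.one_le u hu)
      refine ⟨N₁ g, h₁.map u hu g hg, fun y hy => ?_⟩
      obtain ⟨x₁, hx₁, hy₁⟩ := h₁.surj u hu hT y hy
      obtain ⟨j, x₂, hx₂, hy₂⟩ := hcyc x₁ hx₁
      refine ⟨j, x₂, hx₂, ?_⟩
      have h3 := hy₁.mul (by omega) (h₁.map_succ u hu _ hy₂)
      have h4 := (h₁.map u hu x₁ hx₁).ne_zero hu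
      have h5 := (h₁.map u hu _ (h₂.map _ (h₁.one_le u hu) x₂ hx₂)).ne_zero hu
      rw [monoidHom_map_div _ _ (mul_ne_zero (pow_ne_zero j (hg.ne_zero (h₁.one_le u hu)))
        ((h₂.map _ (h₁.one_le u hu) x₂ hx₂).ne_zero (h₁.one_le u hu))), map_mul, map_pow] at h3
      convert h3 using 1
      rw [MonoidHom.comp_apply]
      have h6 := (h₁.map u hu g hg).ne_zero hu
      field_simp

section
variable {E F : Type*} [Field E] [Field F] [Algebra E F] {p : ℕ}
    {vE : AddValuation E (WithTop ℤ)} {vF : AddValuation F (WithTop ℤ)} {τ : F ≃ₐ[E] F}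
    {ε s : ℤ}

lemma TR.mem_of_lt {n : ℕ} (h : TR vE vF n) {x : E} {k : ℤ}
    (hx : algebraMap E F x ∈ ball vF (n * (k - 1) + 1)) : x ∈ ball vE k := by
  by_cases h0 : x = 0
  · rw [h0]; exact zero_mem _
  obtain ⟨a, ha⟩ := exists_int_val (v := vE) h0
  rw [mem_ball_iff_of_val ha]
  rw [mem_ball_iff_of_val (h.ext.val ha)] at hx
  have hn : (0 : ℤ) < n := by exact_mod_cast h.pos
  by_contra! hlt
  nlinarith

lemma Step.trace_mem' (h : Step p vE vF τ ε s) {x : F} {k u : ℤ} (hx : x ∈ ball vF k)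
    (hu : p * (u - 1) + 1 ≤ k + (p - 1) * s) : Algebra.trace E F x ∈ ball vE u :=
  h.tr.mem_of_lt (ball_anti hu (h.trace_mem hx))

lemma Step.normFil [Fact p.Prime] (h : Step p vE vF τ ε s) [CharZero F] (hfin : FinRes vE) :
    NormFil vE vF (Algebra.norm E : F →* E) (psi1 p s) (fun u => u = s) := by
  have := h.tr.finiteDimensional
  have hs := h.one_le_s
  have hp : (2 : ℤ) ≤ p := by exact_mod_cast h.prime.two_le
  have hpE : (p : E) ∈ ball vE 1 := by rw [mem_ball_iff_of_val h.valp]; exact h.one_le_ε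
  have hψ1 : ∀ u, u ≤ psi1 p s u := fun u => by
    unfold psi1; split_ifs with hus
    · exact le_rfl
    · nlinarith
  have hψ2 : ∀ u, p * u ≤ psi1 p s u + (p - 1) * s := fun u => by
    unfold psi1; split_ifs with hus
    · nlinarith
    · linarith
  have hdec : ∀ x : F, x = 1 + (x - 1) := fun x => by ring
  have hmap : ∀ u, 1 ≤ u → ∀ z, z ∈ ball vF (psi1 p s u) →
      IsU vE u (Algebra.norm E (1 + z)) := by
    intro u hu z hz
    have h1 := hψ1 u
    have h2 := hψ2 u
    obtain ⟨y, hy, hye⟩ := h.norm_one_add (by omega) hz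
    have e1 := ball_anti h1 (h.norm_mem hz)
    have e2 := h.trace_mem' hz (u := u) (by linarith)
    have e3 := h.trace_mem' hy (u := u) (by linarith)
    rw [IsU, hye]
    convert add_mem (add_mem e1 e2) e3 using 1
    ring
  have happrox : ∀ u, 1 ≤ u → ∀ z ∈ ball vF (psi1 p s u), ∀ w ∈ ball vE u,
      w - (Algebra.norm E z + Algebra.trace E F z) ∈ ball vE (u + 1) →
      IsU vE (u + 1) ((1 + w) / Algebra.norm E (1 + z)) := by
    intro u hu z hz w hw hwz
    have h1 := hψ1 u
    have h2 := hψ2 u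
    rw [IsU.div_iff ((hmap u hu z hz).val hu)]
    obtain ⟨y, hy, hye⟩ := h.norm_one_add (by omega) hz
    have e3 := h.trace_mem' hy (u := u + 1) (by linarith)
    rw [hye]
    convert sub_mem hwz e3 using 1
    ring
  obtain ⟨y₀, hy₀, hty₀⟩ := h.exists_trace
  have hny₀ := h.norm_val hy₀
  have hsurj : ∀ u, 1 ≤ u → ¬u = s → ∀ y, IsU vE u y →
      ∃ x, IsU vF (psi1 p s u) x ∧ IsU vE (u + 1) (y / Algebra.norm E x) := by
    intro u hu hus y hy
    suffices ∃ z ∈ ball vF (psi1 p s u),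
        (y - 1) - (Algebra.norm E z + Algebra.trace E F z) ∈ ball vE (u + 1) by
      obtain ⟨z, hz, hzz⟩ := this
      refine ⟨1 + z, by simpa [IsU] using hz, ?_⟩
      simpa using happrox u hu z hz (y - 1) hy hzz
    rcases lt_or_gt_of_ne hus with hlt | hgt
    · obtain ⟨π, hπ, -⟩ := h.jump
      obtain ⟨n, rfl⟩ := Int.eq_ofNat_of_zero_le (by omega : 0 ≤ u)
      have hπn : vF (π ^ n) = (n : ℤ) := by simpa using val_pow hπ n
      obtain ⟨d, hd, hdc⟩ := residue_perfect hpE hfin (x := (y - 1) / Algebra.norm E (π ^ n))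
        (ball_div hy (h.norm_val hπn) (by omega))
      have hdF : algebraMap E F d ∈ ball vF 0 := by
        simpa using (h.tr.ext.mem_ball (n := 0)).2 hd
      have hz : π ^ n * algebraMap E F d ∈ ball vF (psi1 p s n) := by
        rw [psi1, if_pos (by omega)]
        exact ball_mul_right (mem_ball_of_val hπn) hdF
      refine ⟨_, hz, ?_⟩
      have e1 := h.trace_mem' hz (u := (n : ℤ) + 1) (by
        rw [psi1, if_pos (by omega)]; nlinarith)
      have e2 := ball_mul (k := (n : ℤ) + 1) hdc (mem_ball_of_val (h.norm_val hπn)) (by omega)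
      have hn0 := ne_zero_of_val (h.norm_val hπn)
      rw [map_mul, Algebra.norm_algebraMap, h.tr.rank]
      rw [← neg_mem_iff] at e2
      convert sub_mem e2 e1 using 1
      field_simp
      ring
    · have hψ : psi1 p s u = s + p * (u - s) := if_neg (by omega)
      have hc : (y - 1) / Algebra.trace E F y₀ ∈ ball vE (u - s) := ball_div hy hty₀ le_rfl
      have hz : algebraMap E F ((y - 1) / Algebra.trace E F y₀) * y₀ ∈ ball vF (psi1 p s u) :=
        ball_mul (h.tr.ext.mem_ball.2 hc) (mem_ball_of_val hy₀) (by rw [hψ]; linarith)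
      refine ⟨_, hz, ?_⟩
      have e1 := ball_anti (m := u + 1) (by rw [hψ]; nlinarith) (h.norm_mem hz)
      have htr : Algebra.trace E F (algebraMap E F ((y - 1) / Algebra.trace E F y₀) * y₀) = y - 1 := by
        rw [← Algebra.smul_def, map_smul, smul_eq_mul, div_mul_cancel₀ _ (ne_zero_of_val hty₀)]
      rw [htr, ← neg_mem_iff]
      simpa using e1
  refine ⟨fun u hu => hu.trans (hψ1 u), fun u hu x hx => ?_, fun u hu x hx => ?_, hsurj, ?_⟩
  · rw [hdec x]; exact hmap u hu _ hx
  · have h1 := hψ1 u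
    have h2 := hψ2 u
    obtain ⟨y, hy, hye⟩ := h.norm_one_add (x := x - 1) (by omega) hx
    have e1 := ball_anti (m := u + 1) (by linarith) (h.norm_mem hx)
    have e2 := h.trace_mem' hx (u := u + 1) (by linarith)
    have e3 := h.trace_mem' hy (u := u + 1) (by linarith)
    rw [hdec x, IsU, hye]
    convert add_mem (add_mem e1 e2) e3 using 1
    ring
  · intro u hu
    by_cases hus : u = s
    · subst hus
      have hψ : psi1 p u u = u := if_pos le_rfl
      obtain ⟨g, hg, hcyc⟩ := residue_artinSchreier hpE hfin
        (a := Algebra.trace E F y₀ / Algebra.norm E y₀)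
        (ball_div (mem_ball_of_val hty₀) hny₀ (by omega))
      have hgU : IsU vE u (1 + Algebra.norm E y₀ * g) := by
        simpa [IsU] using ball_mul_right (mem_ball_of_val hny₀) hg
      refine ⟨_, hgU, fun y hy => ?_⟩
      obtain ⟨x, hx, j, hj⟩ := hcyc ((y - 1) / Algebra.norm E y₀) (ball_div hy hny₀ (by omega))
      have hn0 := ne_zero_of_val hny₀
      have hxF : algebraMap E F x ∈ ball vF 0 := by
        simpa using (h.tr.ext.mem_ball (n := 0)).2 hx
      have hz : algebraMap E F x * y₀ ∈ ball vF (psi1 p u u) := by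
        rw [hψ]; exact ball_mul_left hxF (mem_ball_of_val hy₀)
      refine ⟨j, 1 + algebraMap E F x * y₀, by simpa [IsU] using hz, ?_⟩
      have hgj := hgU.pow hu j
      have hgj1 : (1 + Algebra.norm E y₀ * g) ^ j - (1 + j * (Algebra.norm E y₀ * g)) ∈
          ball vE (u + 1) := by
        have hb := ball_mul_right (mem_ball_of_val hny₀) hg
        generalize Algebra.norm E y₀ * g = b at hb
        clear * - hb hs
        induction j with
        | zero => simp [zero_mem]
        | succ j ih =>
          have e1 := ball_mul_right ih (add_mem one_mem_ball (ball_anti (by omega : 0 ≤ u) hb))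
          have e2 := ball_mul (k := u + 1) hb hb (by omega)
          have e3 := ball_mul_left (natCast_mem_ball j) e2
          convert add_mem e1 e3 using 1
          push_cast
          ring
      have hyg : IsU vE u (y / (1 + Algebra.norm E y₀ * g) ^ j) := hy.div hu hgj
      have := happrox u hu _ hz (y / (1 + Algebra.norm E y₀ * g) ^ j - 1) hyg (by
        have hG0 := hgj.ne_zero hu
        have htr : Algebra.trace E F (algebraMap E F x * y₀) = x * Algebra.trace E F y₀ := by
          rw [← Algebra.smul_def, map_smul, smul_eq_mul]
        have e1 := ball_mul (k := u + 1) hj (mem_ball_of_val hny₀) (by omega)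
        have e2 : y / (1 + Algebra.norm E y₀ * g) ^ j - 1 -
            (y - (1 + Algebra.norm E y₀ * g) ^ j) ∈ ball vE (u + 1) := by
          have e3 : (y / (1 + Algebra.norm E y₀ * g) ^ j - 1) *
              (1 - (1 + Algebra.norm E y₀ * g) ^ j) ∈ ball vE (u + 1) := by
            refine ball_mul hyg (n := u) ?_ (by omega)
            rw [← neg_mem_iff, neg_sub]; exact hgj
          convert e3 using 1
          field_simp
        rw [htr, map_mul, Algebra.norm_algebraMap, h.tr.rank]
        convert sub_mem (add_mem e1 e2) hgj1 using 1
        field_simp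
        ring)
      rw [add_sub_cancel, div_div] at this
      exact this
    · refine ⟨1, isU_one _, fun y hy => ?_⟩
      obtain ⟨x, hx, hxy⟩ := hsurj u hu hus y hy
      exact ⟨0, x, hx, by simpa using hxy⟩

end

/-- A totally ramified cyclic extension of degree `p ^ m` with generator `σ` and lower
ramification jumps `s 0, …, s (m - 1)`. -/
structure CycTR {K M : Type*} [Field K] [Field M] [Algebra K M] (p m : ℕ)
    (vK : AddValuation K (WithTop ℤ)) (vM : AddValuation M (WithTop ℤ)) (σ : M ≃ₐ[K] M)
    (ε : ℤ) (s : ℕ → ℤ) : Prop where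
  prime : p.Prime
  tr : TR vK vM (p ^ m)
  gal : IsGalois K M
  inv : GalInvariant K vM
  gen : ∀ g : M ≃ₐ[K] M, g ∈ Subgroup.zpowers σ
  valp : vK (p : K) = ε
  one_le_ε : 1 ≤ ε
  jump : ∀ π, vM π = ((1 : ℤ) : WithTop ℤ) → ∀ a < m, ∀ b : ℤ, ¬(p : ℤ) ∣ b →
    vM ((σ ^ (b * p ^ a)) π - π) = ((s a + 1 : ℤ) : WithTop ℤ)
  one_le : ∀ a < m, 1 ≤ s a
  strict : ∀ a, a + 1 < m → s a < s (a + 1)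

section
variable {K M : Type*} [Field K] [Field M] [Algebra K M] {p m n : ℕ}
    {vK : AddValuation K (WithTop ℤ)} {vM : AddValuation M (WithTop ℤ)} {σ : M ≃ₐ[K] M}
    {ε : ℤ} {s : ℕ → ℤ}

lemma TR.diff_mem_one (h : TR vK vM n) (hinv : GalInvariant K vM) (g : M ≃ₐ[K] M) {x : M}
    (hx : x ∈ ball vM 0) : g x - x ∈ ball vM 1 := by
  obtain ⟨c, -, hc⟩ := h.exists_residue hx
  have h1 : g (x - algebraMap K M c) ∈ ball vM 1 := by rwa [mem_ball, hinv g]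
  convert sub_mem h1 hc using 1
  simp

lemma TR.diff_val_unif (h : TR vK vM n) (hinv : GalInvariant K vM) (g : M ≃ₐ[K] M) {π ϖ : M}
    (hπ : vM π = ((1 : ℤ) : WithTop ℤ)) (hϖ : vM ϖ = ((1 : ℤ) : WithTop ℤ)) {i : ℤ}
    (hi : vM (g π - π) = (i : WithTop ℤ)) : vM (g ϖ - ϖ) = (i : WithTop ℤ) := by
  rw [val_eq_iff] at hi ⊢
  refine ⟨?_, fun hcon => hi.2 ?_⟩
  · have := h.diff_mem hπ (g : M →ₐ[K] M) (hinv g) (s := i - 1) (by simpa using hi.1)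
      (mem_ball_of_val hϖ)
    simpa using this
  · have := h.diff_mem hϖ (g : M →ₐ[K] M) (hinv g) (s := i) (by simpa using hcon)
      (mem_ball_of_val hπ)
    rw [add_comm]; simpa using this

lemma diff_zpow_mem (hinv : GalInvariant K vM) (g : M ≃ₐ[K] M) {π : M} {i : ℤ}
    (hi : g π - π ∈ ball vM i) (k : ℤ) :
    (g ^ k : M ≃ₐ[K] M) π - π ∈ ball vM i := by
  have hmul : ∀ g₁ g₂ : M ≃ₐ[K] M, g₁ π - π ∈ ball vM i → g₂ π - π ∈ ball vM i →
      (g₁ * g₂) π - π ∈ ball vM i := by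
    intro g₁ g₂ h₁ h₂
    have h3 : g₁ (g₂ π - π) ∈ ball vM i := by rwa [mem_ball, hinv g₁]
    convert add_mem h3 h₁ using 1
    simp
  have hinv' : g⁻¹ π - π ∈ ball vM i := by
    have h3 : g⁻¹ (g π - π) ∈ ball vM i := by rwa [mem_ball, hinv g⁻¹]
    rw [← neg_mem_iff]
    convert h3 using 1
    rw [map_sub, ← AlgEquiv.mul_apply]
    simp
  induction k using Int.induction_on with
  | zero => simp [zero_mem]
  | succ k ih => rw [zpow_add_one]; exact hmul _ _ ih hi
  | pred k ih => rw [zpow_sub_one]; exact hmul _ _ ih hinv'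

lemma pow_eq_one_of_residue [Fact p.Prime] (hp : (p : M) ∈ ball vM 1) {u : M} (hu : u ∈ ball vM 0)
    (h : u ^ p ^ m - 1 ∈ ball vM 1) : u - 1 ∈ ball vM 1 := by
  have := charP_residue (p := p) hp
  have h1 := (residue_eq_iff (x := (⟨u, mem_Ov.2 hu⟩ : Ov vM) ^ p ^ m) (y := 1)).2 (by simpa using h)
  rw [map_pow, map_one, ← one_pow (p ^ m)] at h1
  have h2 := (iterateFrobenius_inj (IsLocalRing.ResidueField (Ov vM)) p m) (by
    simpa only [iterateFrobenius_def] using h1)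
  rw [← map_one (IsLocalRing.residue (Ov vM)), residue_eq_iff] at h2
  simpa using h2

lemma prod_range_div_of_ne_zero (f : ℕ → M) (hf : ∀ k, f k ≠ 0) (N : ℕ) :
    ∏ k ∈ Finset.range N, f (k + 1) / f k = f N / f 0 := by
  induction N with
  | zero => simp [hf 0]
  | succ N ih => rw [Finset.prod_range_succ, ih]; field_simp [hf N, hf 0]

lemma TR.diff_mem_two [Fact p.Prime] (h : TR vK vM n) (hinv : GalInvariant K vM)
    (hp : (p : M) ∈ ball vM 1) {g : M ≃ₐ[K] M} (hg : g ^ p ^ m = 1) {π : M}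
    (hπ : vM π = ((1 : ℤ) : WithTop ℤ)) : g π - π ∈ ball vM 2 := by
  have hπ0 := ne_zero_of_val hπ
  have hgπ0 : ∀ k : ℕ, (g ^ k) π ≠ 0 := fun k => by
    rw [Ne, map_eq_zero_iff _ (g ^ k).injective]; exact hπ0
  let u := g π / π
  have hu : u ∈ ball vM 0 := by
    rw [mem_ball_iff_of_val (val_div (by rw [hinv g]; exact hπ) hπ)]; omega
  have hprod : ∏ k ∈ Finset.range (p ^ m), (g ^ k) u = 1 := by
    have h1 : ∀ k, (g ^ k) u = (g ^ (k + 1)) π / (g ^ k) π := fun k => by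
      rw [map_div₀, pow_succ, AlgEquiv.mul_apply]
    simp only [h1]
    rw [prod_range_div_of_ne_zero (fun k => (g ^ k) π) hgπ0, hg, pow_zero, div_self]
    exact hπ0
  have hpr : ∀ N : ℕ, u ^ N - ∏ k ∈ Finset.range N, (g ^ k) u ∈ ball vM 1 := by
    intro N
    induction N with
    | zero => simp [zero_mem]
    | succ N ih =>
      rw [Finset.prod_range_succ, pow_succ]
      have h1 := h.diff_mem_one hinv (g ^ N) hu
      have h2 : (g ^ N) u ∈ ball vM 0 := by rwa [mem_ball, hinv]
      rw [← neg_mem_iff] at h1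
      convert add_mem (ball_mul_right ih h2) (ball_mul_left (ball_pow_zero hu N) h1) using 1
      ring
  have h3 := pow_eq_one_of_residue (p := p) (m := m) hp hu (by have := hpr (p ^ m); rwa [hprod] at this)
  have h4 := ball_mul (k := 2) h3 (mem_ball_of_val hπ) (by norm_num)
  convert h4 using 1
  simp only [u]
  field_simp

lemma TR.diff_pow_prime_mem (h : TR vK vM n) (hinv : GalInvariant K vM) (hpr : p.Prime)
    (hp : (p : M) ∈ ball vM 1) {g : M ≃ₐ[K] M} {π : M} (hπ : vM π = ((1 : ℤ) : WithTop ℤ)) {i : ℤ}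
    (hi : 1 ≤ i) (hg : g π - π ∈ ball vM (i + 1)) : (g ^ p) π - π ∈ ball vM (i + 2) := by
  let T : Module.End K M := (g : M →ₐ[K] M).toLinearMap - 1
  have hT : ∀ k : ℕ, (T ^ k) π ∈ ball vM (1 + k * i) := by
    intro k
    induction k with
    | zero => simpa using mem_ball_of_val hπ
    | succ k ih =>
      rw [pow_succ', Module.End.mul_apply]
      exact ball_anti (by push_cast; linarith)
        (h.diff_mem hπ (g : M →ₐ[K] M) (hinv g) hg ih)
  have hτ : ∀ k : ℕ, (g ^ k) π = ((T + 1) ^ k) π := by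
    intro k
    rw [sub_add_cancel, Module.End.pow_apply]
    induction k with
    | zero => rfl
    | succ k ih => rw [pow_succ', AlgEquiv.mul_apply, ih, Function.iterate_succ_apply']; rfl
  rw [hτ, (Commute.one_right T).add_pow]
  obtain ⟨q, rfl⟩ : ∃ q, p = q + 1 := ⟨p - 1, by have := hpr.pos; omega⟩
  rw [Finset.sum_range_succ', LinearMap.add_apply]
  simp only [pow_zero, one_pow, mul_one, Nat.choose_zero_right, Nat.cast_one, LinearMap.sum_apply,
    Module.End.one_apply, add_sub_cancel_right, Module.End.mul_apply]
  refine sum_mem fun k hk => ?_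
  have hk := Finset.mem_range.1 hk
  have h1 : (T ^ (k + 1)) (((q + 1).choose (k + 1) : Module.End K M) π) =
      ((q + 1).choose (k + 1) : M) * (T ^ (k + 1)) π := by
    rw [Module.End.natCast_apply, map_nsmul, nsmul_eq_mul]
  rw [h1]
  rcases lt_or_ge (k + 1) (q + 1) with hlt | hge
  · obtain ⟨c, hc⟩ := hpr.dvd_choose_self (k := k + 1) (by omega) hlt
    rw [hc, Nat.cast_mul]
    refine ball_mul (ball_mul_right hp (natCast_mem_ball c)) (hT (k + 1)) ?_
    push_cast
    nlinarith [Int.natCast_nonneg k]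
  · refine ball_mul_left (natCast_mem_ball _) (ball_anti ?_ (hT (k + 1)))
    have : 1 ≤ k := by have := hpr.two_le; omega
    have : (1 : ℤ) ≤ k := by exact_mod_cast this
    push_cast
    nlinarith

/-- A totally ramified cyclic extension of degree `p ^ m` has lower ramification jumps. -/
lemma TR.exists_cycTR [Fact p.Prime] (h : TR vK vM (p ^ m)) (hgal : IsGalois K M)
    (hinv : GalInvariant K vM) (hgen : ∀ g : M ≃ₐ[K] M, g ∈ Subgroup.zpowers σ)
    (hv : vK (p : K) = (ε : WithTop ℤ)) (hε : 1 ≤ ε) : ∃ s, CycTR p m vK vM σ ε s := by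
  have hfd := h.finiteDimensional
  have hpr : p.Prime := Fact.out
  have hp : (p : M) ∈ ball vM 1 := by
    have := h.ext.val hv
    rw [map_natCast] at this
    rw [mem_ball_iff_of_val this]
    have : (1 : ℤ) ≤ (p ^ m : ℕ) := by exact_mod_cast h.pos
    nlinarith
  have hord : orderOf σ = p ^ m := by
    rw [orderOf_eq_card_of_forall_mem_zpowers hgen, IsGalois.card_aut_eq_finrank, h.rank]
  obtain ⟨π, hπ⟩ := exists_unif h.normF
  have hdvd : ∀ a < m, ∀ b : ℤ, ¬(p : ℤ) ∣ b → (σ ^ (b * p ^ a)) π - π ≠ 0 := by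
    intro a ha b hb h0
    have h1 : σ ^ (b * p ^ a) = 1 := by
      have := h.algHom_ext (f := ((σ ^ (b * p ^ a) : M ≃ₐ[K] M) : M →ₐ[K] M))
        (g := AlgHom.id K M) hπ (sub_eq_zero.1 h0)
      ext x
      exact DFunLike.congr_fun this x
    rw [← orderOf_dvd_iff_zpow_eq_one, hord] at h1
    obtain ⟨c, hc⟩ := h1
    apply hb
    have hpa : (p : ℤ) ^ a ≠ 0 := pow_ne_zero _ (by exact_mod_cast hpr.ne_zero)
    obtain ⟨d, rfl⟩ : ∃ d, m = a + d + 1 := ⟨m - a - 1, by omega⟩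
    refine ⟨p ^ d * c, mul_right_cancel₀ hpa ?_⟩
    rw [hc]; push_cast; ring
  have hmem : ∀ a, ∀ b c : ℤ, ∀ i, ¬(p : ℤ) ∣ b → (σ ^ (b * p ^ a)) π - π ∈ ball vM i →
      (σ ^ (c * p ^ a)) π - π ∈ ball vM i := by
    intro a b c i hb hi
    have hco : IsCoprime b ((p : ℤ) ^ m) :=
      ((Nat.prime_iff_prime_int.1 hpr).coprime_iff_not_dvd.2 hb).symm.pow_right
    obtain ⟨x, y, hxy⟩ := hco
    have h1 := diff_zpow_mem hinv _ hi (c * x)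
    have h2 : (σ ^ (b * (p : ℤ) ^ a)) ^ (c * x) = σ ^ (c * (p : ℤ) ^ a) := by
      rw [← zpow_mul]
      have : b * (p : ℤ) ^ a * (c * x) = c * p ^ a + ((p ^ m : ℕ) : ℤ) * (- c * p ^ a * y) := by
        push_cast
        linear_combination (c * (p : ℤ) ^ a) * hxy
      rw [this, zpow_add, zpow_mul σ ((p ^ m : ℕ) : ℤ), zpow_natCast, ← hord, pow_orderOf_eq_one, one_zpow, mul_one]
    rwa [h2] at h1
  have hp1 : ¬(p : ℤ) ∣ 1 := fun hd => by
    have := Int.le_of_dvd one_pos hd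
    have := hpr.two_le
    omega
  choose! i hi using fun a (ha : a < m) => exists_int_val (v := vM) (hdvd a ha 1 hp1)
  refine ⟨fun a => i a - 1, ⟨hpr, h, hgal, hinv, hgen, hv, hε, ?_, ?_, ?_⟩⟩
  · intro ϖ hϖ a ha b hb
    refine h.diff_val_unif hinv _ hπ hϖ ?_
    rw [sub_add_cancel]
    have hia := hi a ha
    rw [val_eq_iff] at hia ⊢
    exact ⟨hmem a 1 b _ hp1 hia.1, fun hcon => hia.2 (hmem a b 1 _ hb hcon)⟩
  · intro a ha
    have := h.diff_mem_two (m := m) hinv hp (g := σ ^ (1 * (p : ℤ) ^ a)) (by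
      rw [← zpow_natCast, zpow_comm, zpow_natCast, ← hord, pow_orderOf_eq_one, one_zpow]) hπ
    rw [mem_ball_iff_of_val (hi a ha)] at this
    show 1 ≤ i a - 1
    omega
  · intro a ha
    have h2 := h.diff_mem_two (m := m) hinv hp (g := σ ^ (1 * (p : ℤ) ^ a)) (by
      rw [← zpow_natCast, zpow_comm, zpow_natCast, ← hord, pow_orderOf_eq_one, one_zpow]) hπ
    rw [mem_ball_iff_of_val (hi a (by omega))] at h2
    have := h.diff_pow_prime_mem hinv hpr hp (g := σ ^ (1 * (p : ℤ) ^ a)) hπ (i := i a - 1) (by omega)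
      (by rw [sub_add_cancel]; exact mem_ball_of_val (hi a (by omega)))
    rw [← zpow_natCast, ← zpow_mul, mul_assoc, ← pow_succ, mem_ball_iff_of_val (hi _ ha)] at this
    show i a - 1 < i (a + 1) - 1
    omega

end

section

section
variable {K E M : Type*} [Field K] [Field E] [Field M] [Algebra K E] [Algebra K M] [Algebra E M]
    {vE : AddValuation E (WithTop ℤ)} {vM : AddValuation M (WithTop ℤ)} {n : ℕ}

lemma Extends.inj {n : ℕ} (h : Extends vE vM n) {x y : E}
    (hxy : vM (algebraMap E M x) = vM (algebraMap E M y)) : vE x = vE y := by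
  by_cases hx : x = 0
  · subst hx
    rw [map_zero, vM.map_zero, eq_comm, vM.top_iff, map_eq_zero_iff _ (algebraMap E M).injective]
      at hxy
    rw [hxy]
  · obtain ⟨k, hk⟩ := exists_int_val (v := vE) hx
    rw [hk, eq_comm, ← h.val_iff, ← hxy, h.val hk]

lemma GalInvariant.of_extends [IsScalarTower K E M] [Normal K E] [Normal K M]
    (hinv : GalInvariant K vM) (h : Extends vE vM n) : GalInvariant K vE := by
  intro g x
  refine h.inj ?_
  rw [← AlgEquiv.liftNormal_commutes g M, hinv]

end

section
variable {K M : Type*} [Field K] [Field M] [Algebra K M] {p m n : ℕ}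
    {vK : AddValuation K (WithTop ℤ)} {vM : AddValuation M (WithTop ℤ)} {σ : M ≃ₐ[K] M}
    {ε : ℤ} {s : ℕ → ℤ}

lemma TR.finRes (h : TR vK vM n) (hfin : FinRes vK) : FinRes vM := by
  obtain ⟨S, hS, hS'⟩ := hfin
  refine ⟨S.image (algebraMap K M), ?_, ?_⟩
  · intro s hs
    obtain ⟨c, hc, rfl⟩ := Finset.mem_image.1 hs
    simpa using (h.ext.mem_ball (n := 0)).2 (hS c hc)
  · intro x hx
    obtain ⟨c, hc, hxc⟩ := h.exists_residue hx
    obtain ⟨s, hs, hcs⟩ := hS' c hc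
    refine ⟨algebraMap K M s, Finset.mem_image_of_mem _ hs, ?_⟩
    have h1 : algebraMap K M (c - s) ∈ ball vM 1 :=
      ball_anti (by have := h.pos; omega) ((h.ext.mem_ball (n := 1)).2 hcs)
    convert add_mem hxc h1 using 1
    rw [map_sub]; ring

/-- The subextension of degree `p` of a totally ramified cyclic extension. -/
lemma CycTR.succ (h : CycTR p (m + 1) vK vM σ ε s) :
    ∃ (E : IntermediateField K M) (vE : AddValuation E (WithTop ℤ)) (τ : E ≃ₐ[K] E)
      (σ' : M ≃ₐ[E] M), Step p vK vE τ ε (s 0) ∧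
        CycTR p m vE vM σ' (p * ε) (fun a => s (a + 1)) := by
  have hfd := h.tr.finiteDimensional
  have hgal := h.gal
  have hp := h.prime
  have hp1 : ¬(p : ℤ) ∣ 1 := fun hd => by
    have := Int.le_of_dvd one_pos hd
    have := hp.two_le
    omega
  have hord : orderOf σ = p ^ (m + 1) := by
    rw [orderOf_eq_card_of_forall_mem_zpowers h.gen, IsGalois.card_aut_eq_finrank, h.tr.rank]
  let H : Subgroup (M ≃ₐ[K] M) := Subgroup.zpowers (σ ^ p)
  have hHn : H.Normal := by
    refine ⟨fun x hx g => ?_⟩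
    obtain ⟨i, rfl⟩ := h.gen g
    obtain ⟨j, rfl⟩ := h.gen x
    have : σ ^ i * σ ^ j * (σ ^ i)⁻¹ = σ ^ j := by
      rw [← zpow_add, add_comm, zpow_add, mul_inv_cancel_right]
    simp only at hx ⊢
    rwa [this]
  let E : IntermediateField K M := IntermediateField.fixedField H
  have hEM : Module.finrank E M = p ^ m := by
    rw [IntermediateField.finrank_fixedField_eq_card, Nat.card_zpowers, orderOf_pow, hord,
      Nat.gcd_eq_right (dvd_pow_self p (by omega)), pow_succ, Nat.mul_div_cancel _ hp.pos]
  have hKE : Module.finrank K E = p := by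
    have h1 := Module.finrank_mul_finrank K E M
    rw [hEM, h.tr.rank, pow_succ, mul_comm] at h1
    exact Nat.eq_of_mul_eq_mul_left (pow_pos hp.pos m) h1
  have hnorm : IsGalois K E := IsGalois.of_fixedField_normal_subgroup H
  obtain ⟨vE, trKE, trEM⟩ := h.tr.tower E
  rw [hEM] at trEM
  rw [hKE] at trKE
  have hfix : E.fixingSubgroup = H := IntermediateField.fixingSubgroup_fixedField H
  let σ' : M ≃ₐ[E] M := E.fixingSubgroupEquiv ⟨σ ^ p, by
    rw [hfix]; exact Subgroup.mem_zpowers _⟩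
  have hσ' : AlgEquiv.restrictScalarsHom K σ' = σ ^ p := by ext x; rfl
  have hz : ∀ (k : ℤ) x, (σ' ^ k) x = (σ ^ (p * k)) x := by
    intro k x
    have : AlgEquiv.restrictScalarsHom K (σ' ^ k) = σ ^ (p * k) := by
      rw [map_zpow, hσ', zpow_mul, zpow_natCast]
    exact DFunLike.congr_fun this x
  have hgen' : ∀ g : M ≃ₐ[E] M, g ∈ Subgroup.zpowers σ' := by
    intro g
    have h1 : g.restrictScalars K ∈ H := by
      rw [← hfix, IntermediateField.mem_fixingSubgroup_iff]
      intro x hx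
      exact g.commutes ⟨x, hx⟩
    obtain ⟨k, hk⟩ := h1
    refine ⟨k, ?_⟩
    apply AlgEquiv.restrictScalarsHom_injective K
    simp only at hk ⊢
    rw [map_zpow, hσ', hk]; rfl
  have hvp := trKE.ext.val h.valp
  rw [map_natCast] at hvp
  refine ⟨E, vE, AlgEquiv.restrictNormal σ E, σ', ?_, ?_⟩
  · refine ⟨hp, trKE, hnorm, h.inv.of_extends trEM.ext, ?_, h.valp, h.one_le_ε,
      h.one_le 0 (by omega), ?_⟩
    · intro g
      obtain ⟨g', rfl⟩ := AlgEquiv.restrictNormalHom_surjective (F := K) (K₁ := E) M g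
      obtain ⟨k, rfl⟩ := h.gen g'
      exact ⟨k, (map_zpow (AlgEquiv.restrictNormalHom E) σ k).symm⟩
    · obtain ⟨ϖ, hϖ⟩ := exists_unif trKE.normF
      obtain ⟨π, hπ⟩ := exists_unif h.tr.normF
      refine ⟨ϖ, hϖ, ?_⟩
      have h1 := TR.herbrand trKE trEM h.tr h.inv σ hπ hϖ (a := fun _ => s 0 + 1) (by
        intro g
        obtain ⟨k, rfl⟩ := hgen' g
        have h2 := h.jump π hπ 0 (by omega) (1 + p * k) (by
          rwa [Int.dvd_add_left (dvd_mul_right _ _)])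
        simp only at h2 ⊢
        rw [hz, ← AlgEquiv.mul_apply]
        simpa [zpow_add] using h2)
      rw [Finset.sum_const, Finset.card_univ, ← Nat.card_eq_fintype_card,
        IsGalois.card_aut_eq_finrank, hEM, nsmul_eq_mul] at h1
      rw [← trEM.ext.val_iff, map_sub, AlgEquiv.restrictNormal_commutes]
      exact h1
  · refine ⟨hp, trEM, inferInstance, fun g x => h.inv (g.restrictScalars K) x, hgen', hvp, ?_, ?_,
      fun a ha => h.one_le _ (by omega), fun a ha => h.strict _ (by omega)⟩
    · have := hp.pos
      have := h.one_le_ε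
      nlinarith
    · intro π hπ a ha b hb
      rw [hz]
      have := h.jump π hπ (a + 1) (by omega) b hb
      rwa [show (p : ℤ) * (b * p ^ a) = b * p ^ (a + 1) by ring]

/-- The inverse Herbrand function for the lower jumps `s 0, …, s (m - 1)`. -/
def psi (p : ℕ) : ℕ → (ℕ → ℤ) → ℤ → ℤ
  | 0, _, u => u
  | m + 1, s, u => psi p m (fun a => s (a + 1)) (psi1 p (s 0) u)

/-- The upper jumps for the lower jumps `s 0, …, s (m - 1)`. -/
def upSet (p : ℕ) (m : ℕ) (s : ℕ → ℤ) (u : ℤ) : Prop := ∃ a < m, psi p m s u = s a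

lemma lt_of_strict {s : ℕ → ℤ} (hs : ∀ a, a + 1 < m → s a < s (a + 1)) {a b : ℕ} (hab : a < b)
    (hb : b < m) : s a < s b := by
  induction b, hab using Nat.le_induction with
  | base => exact hs a hb
  | succ b hab ih => exact (ih (by omega)).trans (hs b hb)

lemma le_psi1 (hp : 0 < p) (s u : ℤ) : u ≤ psi1 p s u := by
  unfold psi1
  have : (1 : ℤ) ≤ p := by exact_mod_cast hp
  split_ifs with h
  · exact le_rfl
  · nlinarith

lemma psi1_lt (hp : 0 < p) (s : ℤ) {u w : ℤ} (huw : u < w) : psi1 p s u < psi1 p s w := by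
  unfold psi1
  have : (1 : ℤ) ≤ p := by exact_mod_cast hp
  split_ifs <;> nlinarith

lemma le_psi (hp : 0 < p) (m : ℕ) (s : ℕ → ℤ) (u : ℤ) : u ≤ psi p m s u := by
  induction m generalizing s u with
  | zero => exact le_rfl
  | succ m ih => exact (le_psi1 hp _ _).trans (ih _ _)

lemma psi_lt (hp : 0 < p) (m : ℕ) (s : ℕ → ℤ) {u w : ℤ} (huw : u < w) :
    psi p m s u < psi p m s w := by
  induction m generalizing s u w with
  | zero => exact huw
  | succ m ih => exact ih _ (psi1_lt hp _ huw)

lemma psi_of_le (m : ℕ) (s : ℕ → ℤ) {u : ℤ} (hu : ∀ a < m, u ≤ s a) : psi p m s u = u := by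
  induction m generalizing s u with
  | zero => rfl
  | succ m ih =>
    have h0 := hu 0 (by omega)
    rw [psi, psi1, if_pos h0]
    exact ih _ fun a ha => hu (a + 1) (by omega)

lemma psi_eq_of_le (hp : 0 < p) {s : ℕ → ℤ} {u w : ℤ}
    (hw : ∀ a < m, w ≤ s a) (hu : psi p m s u = w) : u = w := by
  rcases lt_trichotomy u w with h | h | h
  · rw [psi_of_le m s fun a ha => h.le.trans (hw a ha)] at hu
    omega
  · exact h
  · have := psi_lt hp m s h
    rw [psi_of_le m s hw] at this
    omega

lemma upSet_succ (hp : 0 < p) {s : ℕ → ℤ} (hs : ∀ a, a + 1 < m + 1 → s a < s (a + 1)) {u : ℤ} :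
    upSet p (m + 1) s u ↔ u = s 0 ∨ upSet p m (fun a => s (a + 1)) (psi1 p (s 0) u) := by
  have h0 : ∀ a < m + 1, s 0 ≤ s a := fun a ha => by
    rcases Nat.eq_zero_or_pos a with rfl | h
    · exact le_rfl
    · exact (lt_of_strict hs h ha).le
  constructor
  · rintro ⟨a, ha, h⟩
    rcases a with _ | a
    · exact Or.inl (psi_eq_of_le hp h0 h)
    · exact Or.inr ⟨a, by omega, h⟩
  · rintro (rfl | ⟨a, ha, h⟩)
    · exact ⟨0, by omega, psi_of_le _ _ h0⟩
    · exact ⟨a + 1, by omega, h⟩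

lemma not_upSet_of_le (hp : 0 < p) {s : ℕ → ℤ} (hs : ∀ a, a + 1 < m + 1 → s a < s (a + 1)) :
    ¬upSet p m (fun a => s (a + 1)) (psi1 p (s 0) (s 0)) := by
  rintro ⟨a, ha, h⟩
  have h1 : ∀ a < m + 1, s 0 ≤ s a := fun a ha => by
    rcases Nat.eq_zero_or_pos a with rfl | h
    · exact le_rfl
    · exact (lt_of_strict hs h ha).le
  have h2 : psi p (m + 1) s (s 0) = s 0 := psi_of_le _ _ h1
  replace h2 : s (a + 1) = s 0 := by rw [psi, h] at h2; exact h2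
  have := lt_of_strict hs (a := 0) (b := a + 1) (by omega) (by omega)
  omega

lemma CycTR.normFil_zero (h : CycTR p 0 vK vM σ ε s) :
    NormFil vK vM (Algebra.norm K : M →* K) (psi p 0 s) (upSet p 0 s) := by
  have hr : Module.finrank K M = 1 := by simpa using h.tr.rank
  have hU : ∀ (x : K) n, IsU vM n (algebraMap K M x) ↔ IsU vK n x := by
    intro x n
    have := h.tr.ext.mem_ball (x := x - 1) (n := n)
    simpa [IsU] using this
  have hN : ∀ x : K, Algebra.norm K (algebraMap K M x) = x := by
    intro x; rw [Algebra.norm_algebraMap, hr, pow_one]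
  have hs : Function.Surjective (algebraMap K M) :=
    Algebra.surjective_algebraMap_iff.2 (Subalgebra.bot_eq_top_of_finrank_eq_one hr).symm
  refine ⟨fun u hu => hu, fun u hu x hx => ?_, fun u hu x hx => ?_, fun u hu _ y hy => ?_,
    fun u hu => ?_⟩
  · obtain ⟨x, rfl⟩ := hs x
    rwa [hN, ← hU]
  · obtain ⟨x, rfl⟩ := hs x
    rwa [hN, ← hU]
  · refine ⟨algebraMap K M y, (hU y _).2 hy, ?_⟩
    rw [hN, div_self (hy.ne_zero hu)]
    exact isU_one _
  · refine ⟨1, isU_one _, fun y hy => ⟨0, algebraMap K M y, (hU y _).2 hy, ?_⟩⟩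
    rw [hN, pow_zero, one_mul, div_self (hy.ne_zero hu)]
    exact isU_one _

lemma CycTR.normFil_succ [Fact p.Prime] [CharZero K] (h : CycTR p (m + 1) vK vM σ ε s)
    (hfin : FinRes vK)
    (ih : ∀ (E : IntermediateField K M) (vE : AddValuation E (WithTop ℤ)) (σ' : M ≃ₐ[E] M)
      (ε : ℤ) (s : ℕ → ℤ), CharZero E → CycTR p m vE vM σ' ε s → FinRes vE →
        NormFil vE vM (Algebra.norm E : M →* E) (psi p m s) (upSet p m s)) :
    NormFil vK vM (Algebra.norm K : M →* K) (psi p (m + 1) s) (upSet p (m + 1) s) := by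
  obtain ⟨E, vE, τ, σ', hst, hcyc⟩ := h.succ
  have hfd := h.tr.finiteDimensional
  have hgal := h.gal
  have hE : CharZero E := charZero_of_injective_algebraMap (algebraMap K E).injective
  have h1 := (hst.normFil hfin).comp (ih E vE σ' _ _ hE hcyc (hst.tr.finRes hfin)) (by
    rintro u - rfl
    exact not_upSet_of_le h.prime.pos h.strict)
  have e1 : ((Algebra.norm K : E →* K).comp (Algebra.norm E : M →* E)) = Algebra.norm K := by
    ext x; exact Algebra.norm_norm
  have e2 : (fun u => u = s 0 ∨ upSet p m (fun a => s (a + 1)) (psi1 p (s 0) u)) =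
      upSet p (m + 1) s := by
    ext u; exact (upSet_succ h.prime.pos h.strict).symm
  rw [e1, e2] at h1
  exact h1

end

universe u

lemma CycTR.normFil_of_univ {p m : ℕ} [Fact p.Prime] {K M : Type u} [Field K]
    [Field M] [CharZero K] [Algebra K M]
    {vK : AddValuation K (WithTop ℤ)} {vM : AddValuation M (WithTop ℤ)} {σ : M ≃ₐ[K] M}
    {ε : ℤ} {s : ℕ → ℤ} (h : CycTR p m vK vM σ ε s) (hfin : FinRes vK) :
    NormFil vK vM (Algebra.norm K : M →* K) (psi p m s) (upSet p m s) := by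
  induction m generalizing K ε s with
  | zero => exact h.normFil_zero
  | succ m ih => exact h.normFil_succ hfin fun E vE σ' ε s _ hc hf => ih hc hf

lemma CycTR.normFil {p m : ℕ} [Fact p.Prime] {K M : Type*} [Field K] [Field M] [CharZero K]
    [Algebra K M]
    {vK : AddValuation K (WithTop ℤ)} {vM : AddValuation M (WithTop ℤ)} {σ : M ≃ₐ[K] M}
    {ε : ℤ} {s : ℕ → ℤ} (h : CycTR p m vK vM σ ε s) (hfin : FinRes vK) :
    NormFil vK vM (Algebra.norm K : M →* K) (psi p m s) (upSet p m s) := by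
  cases m with
  | zero => exact h.normFil_zero
  | succ m => exact h.normFil_succ hfin fun E vE σ' ε s _ hc hf => hc.normFil_of_univ hf

end

/-- `v` is a normalized complete valuation with finite residue field of characteristic `p`, on a
field of characteristic zero with ramification index `ε`. -/
structure LocField (p : ℕ) {F : Type*} [Field F] (v : AddValuation F (WithTop ℤ)) (ε : ℤ) :
    Prop where
  norm : IsNormalized v
  valp : v (p : F) = ε
  one_le : 1 ≤ ε
  cpl : Cpl v
  fin : FinRes v

section
variable {F : Type*} [Field F] {v : AddValuation F (WithTop ℤ)} {p : ℕ} {ε : ℤ}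

lemma residue_surj_of_inj [Fact p.Prime] (hp : (p : F) ∈ ball v 1) (hfin : FinRes v) {a : F}
    (ha : a ∈ ball v 0) (hinj : ∀ c ∈ ball v 0, c ^ p + a * c ∈ ball v 1 → c ∈ ball v 1) {d : F}
    (hd : d ∈ ball v 0) : ∃ c ∈ ball v 0, c ^ p + a * c - d ∈ ball v 1 := by
  have := finite_residue_iff.1 hfin
  have := charP_residue (p := p) hp
  let k := IsLocalRing.ResidueField (Ov v)
  let a' : Ov v := ⟨a, ha⟩
  let h : k →+ k := (frobenius k p).toAddMonoidHom +
    AddMonoidHom.mulLeft (IsLocalRing.residue (Ov v) a')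
  have hh : ∀ x : Ov v, h (IsLocalRing.residue _ x) = IsLocalRing.residue _ (x ^ p + a' * x) :=
    fun x => by rw [map_add, map_pow, map_mul]; rfl
  have hi : Function.Injective h := by
    rw [injective_iff_map_eq_zero]
    intro x hx
    obtain ⟨x, rfl⟩ := IsLocalRing.residue_surjective x
    rw [hh, ← map_zero (IsLocalRing.residue (Ov v)), residue_eq_iff] at hx
    rw [← map_zero (IsLocalRing.residue (Ov v)), residue_eq_iff]
    simpa using hinj x x.2 (by simpa [a'] using hx)
  obtain ⟨x, hx⟩ := (Finite.surjective_of_injective hi) (IsLocalRing.residue _ ⟨d, hd⟩)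
  obtain ⟨x, rfl⟩ := IsLocalRing.residue_surjective x
  rw [hh, residue_eq_iff] at hx
  exact ⟨x, x.2, by simpa [a'] using hx⟩

lemma LocField.p_mem (h : LocField p v ε) : (p : F) ∈ ball v 1 :=
  ball_anti h.one_le (mem_ball_of_val h.valp)

/-- The `p`-th power map is injective on graded pieces when there are no `p`-th roots of unity. -/
lemma LocField.mem_of_pow [Fact p.Prime] (h : LocField p v ε) (hζ : ¬∃ ζ : F, IsPrimitiveRoot ζ p)
    {u : ℤ} (hu : 1 ≤ u) {x : F} (hx : IsU v u x) (hxp : IsU v (min (p * u) (u + ε) + 1) (x ^ p)) :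
    IsU v (u + 1) x := by
  have hp : p.Prime := Fact.out
  have hp2 : (2 : ℤ) ≤ p := by exact_mod_cast hp.two_le
  have hε := h.one_le
  rcases lt_or_ge ((p - 1) * u) ε with hlt | hge
  · rw [min_eq_left (by linarith)] at hxp
    have h1 := IsU.pow_prime_sub (j := p * u + 1) hp (mem_ball_of_val h.valp) (by omega) hx
      (by linarith)
    have h2 : (p : F) * (x - 1) ∈ ball v (p * u + 1) :=
      ball_mul (mem_ball_of_val h.valp) hx (by linarith)
    rw [add_sub_cancel] at h1
    have h3 : (x - 1) ^ p ∈ ball v (p * u + 1) := by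
      rw [IsU] at hxp
      convert sub_mem (sub_mem hxp h1) h2 using 1
      ring
    by_contra hc
    have hv := val_eq_iff.2 ⟨hx, hc⟩
    rw [mem_ball_iff_of_val (val_pow hv p)] at h3
    linarith
  · rw [min_eq_right (by linarith)] at hxp
    obtain ⟨y, hy, hyx⟩ := exists_pow_prime_eq h.cpl hp h.valp (by omega) (by
      nlinarith) (by omega) hxp
    have hy' : IsU v (u + 1) y := by convert hy using 1; ring
    have hy0 := hy'.ne_zero (by omega)
    have h1 : (x / y) ^ p = 1 := by rw [div_pow, hyx, div_self (pow_ne_zero _ (hx.ne_zero hu))]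
    have h2 : x / y = 1 := by
      by_contra hne
      exact hζ ⟨_, (IsPrimitiveRoot.iff_orderOf.2 (orderOf_eq_prime h1 hne))⟩
    rwa [(div_eq_one_iff_eq hy0).1 h2]

lemma LocField.pow_mem [Fact p.Prime] (h : LocField p v ε) {u : ℤ} (hu : 0 ≤ u) {x : F}
    (hx : IsU v u x) : IsU v (min (p * u) (u + ε)) (x ^ p) :=
  IsU.pow_prime Fact.out (mem_ball_of_val h.valp) hu hx (min_le_left _ _) (min_le_right _ _)

lemma LocField.exists_pow_of_lt [Fact p.Prime] (h : LocField p v ε) {u : ℤ} (hu : 1 ≤ u)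
    (hue : (p - 1) * u < ε) {y : F} (hy : IsU v (p * u) y) :
    ∃ x, IsU v u x ∧ IsU v (p * u + 1) (y / x ^ p) := by
  have hp : p.Prime := Fact.out
  have hp2 : (2 : ℤ) ≤ p := by exact_mod_cast hp.two_le
  obtain ⟨π, hπ⟩ := exists_unif h.norm
  obtain ⟨n, rfl⟩ := Int.eq_ofNat_of_zero_le (by omega : 0 ≤ u)
  have hn : v (π ^ n) = ((n : ℤ) : WithTop ℤ) := by simpa using val_pow hπ n
  have hnp := val_pow hn p
  obtain ⟨d, hd, hdy⟩ := residue_perfect h.p_mem h.fin (x := (y - 1) / (π ^ n) ^ p)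
    (ball_div hy hnp (by simp))
  have hz : π ^ n * d ∈ ball v n := ball_mul_right (mem_ball_of_val hn) hd
  have hx : IsU v n (1 + π ^ n * d) := by simpa [IsU] using hz
  refine ⟨_, hx, (IsU.div_iff ((hx.pow hu p).val hu)).2 ?_⟩
  have h1 := IsU.pow_prime_sub (j := p * n + 1) hp (mem_ball_of_val h.valp) (by omega) hz
    (by linarith)
  have h2 : (p : F) * (π ^ n * d) ∈ ball v (p * n + 1) :=
    ball_mul (mem_ball_of_val h.valp) hz (by linarith)
  have h3 := ball_mul (k := p * n + 1) (mem_ball_of_val hnp) hdy le_rfl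
  rw [← neg_mem_iff]
  convert add_mem (add_mem h1 h2) h3 using 1
  have := ne_zero_of_val hnp
  field_simp
  ring

lemma LocField.exists_pow_of_ge [Fact p.Prime] (h : LocField p v ε)
    (hζ : ¬∃ ζ : F, IsPrimitiveRoot ζ p) {u : ℤ} (hu : 1 ≤ u)
    (hue : ε ≤ (p - 1) * u) {y : F} (hy : IsU v (u + ε) y) :
    ∃ x, IsU v u x ∧ IsU v (u + ε + 1) (y / x ^ p) := by
  have hp : p.Prime := Fact.out
  have hp2 : (2 : ℤ) ≤ p := by exact_mod_cast hp.two_le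
  have hε := h.one_le
  rcases hue.lt_or_eq with hlt | heq
  · obtain ⟨x, hx, hxy⟩ := exists_pow_prime_eq h.cpl hp h.valp (by omega)
      (by rw [add_sub_cancel_right]; linarith) (by omega) hy
    rw [add_sub_cancel_right] at hx
    refine ⟨x, hx, ?_⟩
    rw [hxy, div_self (hy.ne_zero (by omega))]
    exact isU_one _
  obtain ⟨π, hπ⟩ := exists_unif h.norm
  obtain ⟨n, rfl⟩ := Int.eq_ofNat_of_zero_le (by omega : 0 ≤ u)
  have hn : v (π ^ n) = ((n : ℤ) : WithTop ℤ) := by simpa using val_pow hπ n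
  have hnp := val_pow hn p
  have hnp0 := ne_zero_of_val hnp
  have hpn : (n : ℤ) + ε = p * n := by linarith
  have ha : (p : F) * π ^ n / (π ^ n) ^ p ∈ ball v 0 :=
    mem_ball_of_val (by
      rw [val_div (val_mul h.valp hn) hnp, show ε + n - p * n = 0 by linarith])
  have key : ∀ c ∈ ball v 0, (1 + π ^ n * c) ^ p - 1 -
      (π ^ n) ^ p * (c ^ p + (p : F) * π ^ n / (π ^ n) ^ p * c) ∈ ball v ((n : ℤ) + ε + 1) := by
    intro c hc
    have h1 := IsU.pow_prime_sub (j := (n : ℤ) + ε + 1) hp (mem_ball_of_val h.valp) (by omega)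
      (ball_mul_right (mem_ball_of_val hn) hc) (by linarith)
    convert h1 using 1
    field_simp
    ring
  obtain ⟨c, hc, hcy⟩ := residue_surj_of_inj h.p_mem h.fin ha (fun c hc hc1 => by
    have h1 := key c hc
    have h2 := ball_mul (k := (n : ℤ) + ε + 1) (mem_ball_of_val hnp) hc1 (by linarith)
    have h3 : IsU v (min (p * ((n : ℕ) : ℤ)) (((n : ℕ) : ℤ) + ε) + 1) ((1 + π ^ n * c) ^ p) := by
      rw [← hpn, min_self]
      have := add_mem h1 h2
      rwa [sub_add_cancel] at this
    have h4 := h.mem_of_pow hζ hu (x := 1 + π ^ n * c)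
      (by simpa [IsU] using ball_mul_right (mem_ball_of_val hn) hc) h3
    have h5 : π ^ n * c ∈ ball v (n + 1) := by simpa [IsU] using h4
    have := ball_div (k := 1) h5 hn (by omega)
    rwa [mul_div_cancel_left₀ _ (ne_zero_of_val hn)] at this)
    (ball_div (k := 0) hy hnp (by linarith))
  have hx : IsU v n (1 + π ^ n * c) := by
    simpa [IsU] using ball_mul_right (mem_ball_of_val hn) hc
  refine ⟨_, hx, (IsU.div_iff ((hx.pow hu p).val hu)).2 ?_⟩
  have h2 := ball_mul (k := (n : ℤ) + ε + 1) (mem_ball_of_val hnp) hcy (by linarith)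
  rw [← neg_mem_iff]
  convert add_mem (key c hc) h2 using 1
  field_simp
  ring

end

section
variable {F : Type*} [Field F] {v : AddValuation F (WithTop ℤ)}

lemma mem_maxIdeal_pow_iff (hn : IsNormalized v) {x : Ov v} (k : ℕ) :
    x ∈ IsLocalRing.maximalIdeal (Ov v) ^ k ↔ (x : F) ∈ ball v k := by
  obtain ⟨π, hπ⟩ := exists_unif hn
  let π' : Ov v := ⟨π, mem_ball_of_val hπ |> ball_anti (by norm_num)⟩
  have hspan : IsLocalRing.maximalIdeal (Ov v) = Ideal.span {π'} := by
    ext y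
    rw [mem_maxIdeal_iff, Ideal.mem_span_singleton]
    constructor
    · intro hy
      refine ⟨⟨y / π, ball_div hy hπ (by norm_num)⟩, ?_⟩
      ext
      simp [π', mul_div_cancel₀ _ (ne_zero_of_val hπ)]
    · rintro ⟨z, rfl⟩
      exact ball_mul_right (mem_ball_of_val hπ) z.2
  rw [hspan, Ideal.span_singleton_pow, Ideal.mem_span_singleton]
  have hk := val_pow hπ k
  constructor
  · rintro ⟨z, rfl⟩
    have := ball_mul_right (mem_ball_of_val hk) z.2
    simpa [π'] using this
  · intro hx
    refine ⟨⟨x / π ^ k, ball_div hx hk (by simp)⟩, ?_⟩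
    ext
    simp [π', mul_div_cancel₀ _ (ne_zero_of_val hk)]

lemma isAdicComplete_Ov (hn : IsNormalized v) (hc : Cpl v) :
    IsAdicComplete (IsLocalRing.maximalIdeal (Ov v)) (Ov v) where
  haus' := by
    intro x hx
    have : ∀ n : ℕ, (x : F) ∈ ball v n := by
      intro n
      have := hx n
      rwa [SModEq.zero, smul_eq_mul, Ideal.mul_top, mem_maxIdeal_pow_iff hn] at this
    exact Subtype.ext (eq_zero_of_forall_ball this)
  prec' := by
    intro f hf
    have hf' : ∀ {m n : ℕ}, m ≤ n → (f n : F) - f m ∈ ball v m := by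
      intro m n hmn
      have := (hf hmn).symm
      rw [SModEq.sub_mem, smul_eq_mul, Ideal.mul_top, mem_maxIdeal_pow_iff hn] at this
      exact this
    obtain ⟨x, hx⟩ := hc (fun n => (f n : F)) (fun n => hf' (Nat.le_succ n))
    have hx0 : x ∈ ball v 0 := by
      have := (ball v 0).add_mem (hx 0) (f 0).2
      simpa using this
    refine ⟨⟨x, hx0⟩, fun n => ?_⟩
    rw [SModEq.comm, SModEq.sub_mem, smul_eq_mul, Ideal.mul_top, mem_maxIdeal_pow_iff hn]
    exact hx n

/-- Hensel's lemma in the valuation ring. -/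
lemma exists_root_Ov (hn : IsNormalized v) (hc : Cpl v) (f : Polynomial (Ov v)) (hf : f.Monic)
    (a : Ov v) (h0 : f.eval a ∈ IsLocalRing.maximalIdeal (Ov v))
    (h1 : f.derivative.eval a ∉ IsLocalRing.maximalIdeal (Ov v)) :
    ∃ b, f.IsRoot b ∧ b - a ∈ IsLocalRing.maximalIdeal (Ov v) := by
  have := isAdicComplete_Ov hn hc
  refine HenselianRing.is_henselian f hf a h0 ?_
  exact IsUnit.map _ (by simpa using h1)

end

section
variable {L : Type*} [Field L]

lemma prod_range_shift {g : L ≃+* L} (x : L) (i : ℕ) :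
    x * g (∏ j ∈ Finset.range i, (g ^ j) x) = ∏ j ∈ Finset.range (i + 1), (g ^ j) x := by
  rw [Finset.prod_range_succ', map_prod, mul_comm]
  simp [pow_succ', RingAut.mul_apply]

/-- Hilbert's Theorem 90 for a field automorphism of exact order `n`. -/
lemma exists_apply_eq_mul_of_prod_eq_one (g : L ≃+* L) {n : ℕ} (hg : g ^ n = 1)
    (hex : ∀ i, 0 < i → i < n → g ^ i ≠ 1) (hn : 0 < n) {x : L}
    (hx : ∏ i ∈ Finset.range n, (g ^ i) x = 1) : ∃ y, y ≠ 0 ∧ g y = x * y := by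
  have hx0 : x ≠ 0 := by
    rintro rfl
    rw [Finset.prod_eq_zero (i := 0) (by simpa using hn) (by simp)] at hx
    exact zero_ne_one hx
  let d : ℕ → L := fun i => (∏ j ∈ Finset.range i, (g ^ j) x)⁻¹
  have hd : ∀ i, g (d i) = x * d (i + 1) := by
    intro i
    simp only [d]
    rw [← prod_range_shift, map_inv₀, mul_inv, mul_inv_cancel_left₀ hx0]
  let f : Fin n → (L →* L) := fun i => ((g ^ (i : ℕ) : L ≃+* L) : L →* L)
  have hfi : Function.Injective f := by
    intro i j hij
    have key : ∀ i j : Fin n, i < j → f i ≠ f j := by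
      intro i j hlt hij
      refine hex (j - i) (by omega) (by omega) ?_
      ext a
      have := DFunLike.congr_fun hij (((g ^ (i : ℕ))⁻¹ : L ≃+* L) a)
      simp only [f] at this
      change (g ^ (i : ℕ) * (g ^ (i : ℕ))⁻¹) a = (g ^ (j : ℕ) * (g ^ (i : ℕ))⁻¹) a at this
      rw [mul_inv_cancel, ← pow_sub g hlt.le] at this
      exact this.symm
    rcases lt_trichotomy i j with h | h | h
    · exact absurd hij (key i j h)
    · exact h
    · exact absurd hij.symm (key j i h)
  have hli := (linearIndependent_monoidHom L L).comp f hfi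
  have hne : ∃ a, ∑ i : Fin n, d i * (g ^ (i : ℕ)) a ≠ 0 := by
    by_contra! hcon
    have := Fintype.linearIndependent_iff.1 hli (fun i => d i) (by
      ext a
      simpa [f] using hcon a) ⟨0, hn⟩
    simp [d] at this
  obtain ⟨a, ha⟩ := hne
  rw [Fin.sum_univ_eq_sum_range (fun i => d i * (g ^ i) a)] at ha
  refine ⟨_, ha, ?_⟩
  have h1 : ∀ i, g (d i * (g ^ i) a) = x * (d (i + 1) * (g ^ (i + 1)) a) := by
    intro i
    rw [map_mul, hd, pow_succ', RingAut.mul_apply, mul_assoc]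
  rw [map_sum, Finset.sum_congr rfl (fun i _ => h1 i), ← Finset.mul_sum]
  congr 1
  have h2 := Finset.sum_range_succ (fun i => d i * (g ^ i) a) n
  rw [Finset.sum_range_succ'] at h2
  have h3 : d n * (g ^ n) a = d 0 * (g ^ 0) a := by
    simp only [d, hx, hg]; simp
  rw [h3] at h2
  exact add_right_cancel h2

/-- The cyclic symbol computed by two commuting automorphisms. -/
lemma exists_symbol (f s : L ≃+* L) (hfs : Commute f s) {N n : ℕ} (hN : 0 < N) (hn : 0 < n)
    (hf : f ^ N = 1) (hfex : ∀ i, 0 < i → i < N → f ^ i ≠ 1)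
    (hs : s ^ n = 1) (hsex : ∀ i, 0 < i → i < n → s ^ i ≠ 1) {z : L} (hz0 : z ≠ 0)
    (hz : s (∏ i ∈ Finset.range N, (f ^ i) z) = ∏ i ∈ Finset.range N, (f ^ i) z) :
    ∃ y, y ≠ 0 ∧ f y = s z / z * y ∧ ∀ y', y' ≠ 0 → f y' = s z / z * y' →
      f (∏ i ∈ Finset.range n, (s ^ i) y') = ∏ i ∈ Finset.range n, (s ^ i) y' ∧
      s (∏ i ∈ Finset.range n, (s ^ i) y') = ∏ i ∈ Finset.range n, (s ^ i) y' ∧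
      ∀ (j : ℕ) (y0 : L), y0 ≠ 0 → f y0 = y0 →
        (∏ i ∈ Finset.range n, (s ^ i) y') ^ j = ∏ i ∈ Finset.range n, (s ^ i) y0 →
        ∃ w, w ≠ 0 ∧ s (z ^ j / (f w / w)) = z ^ j / (f w / w) := by
  have hsz : s z ≠ 0 := (map_ne_zero s).2 hz0
  have hcomm : ∀ i a, (f ^ i) (s a) = s ((f ^ i) a) := fun i a => by
    have := DFunLike.congr_fun (hfs.pow_left i).eq a
    exact this
  have hcomm' : ∀ i a, f ((s ^ i) a) = (s ^ i) (f a) := fun i a => by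
    have := DFunLike.congr_fun (hfs.pow_right i).eq a
    exact this
  have hprod0 : ∀ (g : L ≃+* L) k a, a ≠ 0 → ∏ i ∈ Finset.range k, (g ^ i) a ≠ 0 :=
    fun g k a ha => Finset.prod_ne_zero_iff.2 fun i _ => (map_ne_zero _).2 ha
  obtain ⟨y, hy0, hy⟩ := exists_apply_eq_mul_of_prod_eq_one f hf hfex hN (x := s z / z) (by
    rw [Finset.prod_congr rfl fun i _ => map_div₀ (f ^ i) (s z) z, Finset.prod_div_distrib,
      Finset.prod_congr rfl fun i _ => hcomm i z, ← map_prod, hz, div_self (hprod0 f N z hz0)])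
  refine ⟨y, hy0, hy, ?_⟩
  clear hy hy0 y
  intro y hy0 hy
  have hrot : ∀ a, s (∏ i ∈ Finset.range n, (s ^ i) a) = ∏ i ∈ Finset.range n, (s ^ i) a := by
    intro a
    by_cases ha : a = 0
    · subst ha; simp
    have h := prod_range_shift (g := s) a n
    rw [Finset.prod_range_succ, hs, RingAut.one_apply, mul_comm] at h
    exact mul_right_cancel₀ ha h
  refine ⟨?_, hrot y, ?_⟩
  · rw [map_prod, Finset.prod_congr rfl fun i _ => hcomm' i y, hy,
      Finset.prod_congr rfl fun i _ => map_mul (s ^ i) _ y, Finset.prod_mul_distrib,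
      Finset.prod_congr rfl fun i _ => map_div₀ (s ^ i) (s z) z, Finset.prod_div_distrib]
    have : ∏ i ∈ Finset.range n, (s ^ i) (s z) = ∏ i ∈ Finset.range n, (s ^ i) z := by
      rw [← hrot z, map_prod]
      refine Finset.prod_congr rfl fun i _ => ?_
      rw [← RingAut.mul_apply, ← RingAut.mul_apply, ← pow_succ, ← pow_succ']
    rw [this, div_self (hprod0 s n z hz0), one_mul]
  · intro j y0 hy00 hfy0 hj
    obtain ⟨w, hw0, hw⟩ := exists_apply_eq_mul_of_prod_eq_one s hs hsex hn (x := y ^ j / y0) (by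
      rw [Finset.prod_congr rfl fun i _ => map_div₀ (s ^ i) (y ^ j) y0, Finset.prod_div_distrib,
        Finset.prod_congr rfl fun i _ => map_pow (s ^ i) y j, Finset.prod_pow, hj,
        div_self (hprod0 s n y0 hy00)])
    refine ⟨w, hw0, ?_⟩
    have hfw : f w ≠ 0 := (map_ne_zero f).2 hw0
    have h1 : s (f w) = f (s w) := by simpa using (hcomm 1 w).symm
    rw [map_div₀, map_div₀, h1, hw, map_mul, map_div₀, map_pow, map_pow, hfy0, hy]
    field_simp
    rw [← mul_pow, ← mul_pow]
    congr 1
    field_simp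

end

section
open Polynomial
variable {k : Type*} [Field k]

lemma exists_monic_irreducible_natDegree [Finite k] {N : ℕ} (hN : 0 < N) :
    ∃ Q : k[X], Q.Monic ∧ Irreducible Q ∧ Q.natDegree = N := by
  obtain ⟨p, _⟩ := CharP.exists k
  have : Fact p.Prime := ⟨CharP.char_is_prime k p⟩
  have : NeZero N := ⟨hN.ne'⟩
  obtain ⟨α, hα⟩ := Field.exists_primitive_element k (FiniteField.Extension k p N)
  have hi : IsIntegral k α := IsIntegral.of_finite k α
  refine ⟨minpoly k α, minpoly.monic hi, minpoly.irreducible hi, ?_⟩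
  rw [← IntermediateField.adjoin.finrank hi, hα, IntermediateField.finrank_top',
    FiniteField.finrank_extension]

variable {l : Type*} [Field l] [Finite l] [Algebra k l]

lemma pow_card_pow_natDegree (a : l) : a ^ (Nat.card k ^ (minpoly k a).natDegree) = a := by
  have hi : IsIntegral k a := IsIntegral.of_finite k a
  let E := IntermediateField.adjoin k {a}
  have hc : Nat.card E = Nat.card k ^ (minpoly k a).natDegree := by
    rw [Module.natCard_eq_pow_finrank (K := k), IntermediateField.adjoin.finrank hi]
  have := Fintype.ofFinite E
  have h := FiniteField.pow_card (IntermediateField.AdjoinSimple.gen k a)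
  rw [← Nat.card_eq_fintype_card, hc] at h
  simpa using congrArg (algebraMap E l) h

lemma pow_card_pow_injOn [Finite k] (a : l) {i j : ℕ} (hij : i < j) (hj : j < (minpoly k a).natDegree) :
    a ^ (Nat.card k ^ i) ≠ a ^ (Nat.card k ^ j) := by
  intro h
  have := Fintype.ofFinite k
  have hi : IsIntegral k a := IsIntegral.of_finite k a
  have hf : ∀ (n : ℕ) (x : l), (FiniteField.frobeniusAlgHom k l ^ n) x = x ^ (Nat.card k ^ n) := by
    intro n x
    rw [Nat.card_eq_fintype_card]
    rw [AlgHom.coe_pow, FiniteField.coe_frobeniusAlgHom, pow_iterate]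
  have h1 : a ^ (Nat.card k ^ (j - i)) = a := by
    have hinj := ((FiniteField.frobeniusAlgHom k l ^ i : l →ₐ[k] l) : l →+* l).injective
    refine (hinj ?_).symm
    change (FiniteField.frobeniusAlgHom k l ^ i) a = (FiniteField.frobeniusAlgHom k l ^ i) _
    rw [hf, hf, ← pow_mul, ← pow_add, Nat.sub_add_cancel hij.le, h]
  let E := IntermediateField.adjoin k {a}
  have h2 : (FiniteField.frobeniusAlgHom k E) ^ (j - i) = 1 := by
    refine (IntermediateField.adjoin.powerBasis hi).algHom_ext ?_
    apply (algebraMap E l).injective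
    rw [AlgHom.coe_pow, FiniteField.coe_frobeniusAlgHom, pow_iterate,
      IntermediateField.adjoin.powerBasis_gen]
    simpa [Nat.card_eq_fintype_card] using h1
  have h3 := orderOf_dvd_of_pow_eq_one h2
  rw [FiniteField.orderOf_frobeniusAlgHom, IntermediateField.adjoin.finrank hi] at h3
  have := Nat.le_of_dvd (by omega) h3
  omega

end

section
open Polynomial IsLocalRing
variable {M L : Type*} [Field M] [Field L] [Algebra M L] {vM : AddValuation M (WithTop ℤ)}
  {vL : AddValuation L (WithTop ℤ)} {e : ℕ}

/-- The map of valuation rings induced by an extension of valued fields. -/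
def ovMap (h : Extends vM vL e) : Ov vM →+* Ov vL where
  toFun x := ⟨algebraMap M L x, by
    have := (h.mem_ball (x := (x : M)) (n := 0)).2 x.2
    simpa [mem_Ov] using this⟩
  map_one' := by ext; simp
  map_mul' x y := by ext; simp
  map_zero' := by ext; simp
  map_add' x y := by ext; simp

@[simp] lemma coe_ovMap (h : Extends vM vL e) (x : Ov vM) :
    ((ovMap h x : Ov vL) : L) = algebraMap M L x := rfl

lemma isLocalHom_ovMap (h : Extends vM vL e) : IsLocalHom (ovMap h) where
  map_nonunit x hx := by
    rw [isUnit_Ov_iff, coe_ovMap] at hx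
    have h0 : ((0 : ℤ) : WithTop ℤ) = (((e : ℤ) * 0 : ℤ) : WithTop ℤ) := by simp
    rw [h0, h.val_iff] at hx
    exact isUnit_Ov_iff.2 hx

/-- The residue field extension attached to an extension of valued fields. -/
abbrev resAlg (h : Extends vM vL e) : Algebra (ResidueField (Ov vM)) (ResidueField (Ov vL)) :=
  haveI := isLocalHom_ovMap h
  (ResidueField.map (ovMap h)).toAlgebra

lemma resAlg_algebraMap (h : Extends vM vL e) (x : Ov vM) :
    letI := resAlg h
    algebraMap (ResidueField (Ov vM)) (ResidueField (Ov vL)) (residue _ x) =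
      residue _ (ovMap h x) := rfl

lemma resAlg_aeval (h : Extends vM vL e) (Q : (Ov vM)[X]) (α : Ov vL) :
    letI := resAlg h
    aeval (residue _ α) (Q.map (residue (Ov vM))) = residue _ ((Q.map (ovMap h)).eval α) := by
  let := resAlg h
  rw [aeval_def, eval₂_map, eval_map, hom_eval₂]
  rfl

lemma resAlg_minpoly (h : Extends vM vL e) {Q : (Ov vM)[X]} (hQ : Q.Monic)
    (hirr : Irreducible (Q.map (residue (Ov vM)))) {α : Ov vL} (hα : (Q.map (ovMap h)).IsRoot α) :
    letI := resAlg h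
    Q.map (residue (Ov vM)) = minpoly (ResidueField (Ov vM)) (residue _ α) := by
  let := resAlg h
  refine minpoly.eq_of_irreducible_of_monic hirr ?_ (hQ.map _)
  rw [resAlg_aeval, hα.eq_zero, map_zero]

lemma resAlg_natDegree (h : Extends vM vL e) {Q : (Ov vM)[X]} (hQ : Q.Monic)
    (hirr : Irreducible (Q.map (residue (Ov vM)))) {α : Ov vL} (hα : (Q.map (ovMap h)).IsRoot α) :
    letI := resAlg h
    (minpoly (ResidueField (Ov vM)) (residue _ α)).natDegree = Q.natDegree := by
  let := resAlg h
  rw [← resAlg_minpoly h hQ hirr hα, hQ.natDegree_map]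

lemma coeff_mem_of_sum_mem (h : Extends vM vL e) {Q : (Ov vM)[X]} (hQ : Q.Monic)
    (hirr : Irreducible (Q.map (residue (Ov vM)))) {α : Ov vL} (hα : (Q.map (ovMap h)).IsRoot α)
    (d : Fin Q.natDegree → Ov vM) (hd : ∑ i, ovMap h (d i) * α ^ (i : ℕ) ∈ maximalIdeal (Ov vL))
    (i : Fin Q.natDegree) : d i ∈ maximalIdeal (Ov vM) := by
  let := resAlg h
  have hli := linearIndependent_pow (K := ResidueField (Ov vM)) (residue (Ov vL) α)
  rw [resAlg_natDegree h hQ hirr hα] at hli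
  rw [← residue_eq_zero_iff]
  refine Fintype.linearIndependent_iff.1 hli (fun i => residue _ (d i)) ?_ i
  rw [← residue_eq_zero_iff, map_sum] at hd
  simpa [Algebra.smul_def, resAlg_algebraMap] using hd

lemma frob_diff_notMem (h : Extends vM vL e) (hfM : FinRes vM) (hfL : FinRes vL) {Q : (Ov vM)[X]}
    (hQ : Q.Monic) (hirr : Irreducible (Q.map (residue (Ov vM)))) {α : Ov vL}
    (hα : (Q.map (ovMap h)).IsRoot α) {i j : ℕ} (hij : i < j) (hj : j < Q.natDegree) :
    α ^ (Nat.card (ResidueField (Ov vM)) ^ i) - α ^ (Nat.card (ResidueField (Ov vM)) ^ j) ∉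
      maximalIdeal (Ov vL) := by
  let := resAlg h
  have := finite_residue_iff.1 hfM
  have := finite_residue_iff.1 hfL
  rw [← residue_eq_zero_iff, map_sub, sub_eq_zero, map_pow, map_pow]
  exact pow_card_pow_injOn _ hij (by rwa [resAlg_natDegree h hQ hirr hα])

lemma frob_pow_natDegree (h : Extends vM vL e) (hfL : FinRes vL) {Q : (Ov vM)[X]}
    (hQ : Q.Monic) (hirr : Irreducible (Q.map (residue (Ov vM)))) {α : Ov vL}
    (hα : (Q.map (ovMap h)).IsRoot α) :
    α ^ (Nat.card (ResidueField (Ov vM)) ^ Q.natDegree) - α ∈ maximalIdeal (Ov vL) := by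
  let := resAlg h
  have := finite_residue_iff.1 hfL
  rw [← residue_eq_zero_iff, map_sub, sub_eq_zero, map_pow]
  have := pow_card_pow_natDegree (k := ResidueField (Ov vM)) (residue (Ov vL) α)
  rwa [resAlg_natDegree h hQ hirr hα] at this

lemma derivative_notMem (h : Extends vM vL e) (hfM : FinRes vM) {Q : (Ov vM)[X]}
    (hirr : Irreducible (Q.map (residue (Ov vM)))) {α : Ov vL}
    (hα : (Q.map (ovMap h)).eval α ∈ maximalIdeal (Ov vL)) :
    (Q.map (ovMap h)).derivative.eval α ∉ maximalIdeal (Ov vL) := by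
  let := resAlg h
  have := finite_residue_iff.1 hfM
  rw [← residue_eq_zero_iff, ← resAlg_aeval] at hα
  rw [← residue_eq_zero_iff, derivative_map, ← resAlg_aeval, ← derivative_map]
  exact (PerfectField.separable_of_irreducible hirr).aeval_derivative_ne_zero hα

lemma root_unique (h : Extends vM vL e) (hfM : FinRes vM) {Q : (Ov vM)[X]}
    (hirr : Irreducible (Q.map (residue (Ov vM)))) {α β : Ov vL}
    (hα : (Q.map (ovMap h)).IsRoot α) (hβ : (Q.map (ovMap h)).IsRoot β)
    (hαβ : α - β ∈ maximalIdeal (Ov vL)) : α = β := by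
  refine IsLocalRing.eq_of_eval_eq_zero_of_not_isUnit_sub hα hβ hαβ ?_
  have := derivative_notMem h hfM hirr (α := α) (by rw [hα.eq_zero]; exact zero_mem _)
  simpa using this

lemma exists_frob_root (h : Extends vM vL e) (hn : IsNormalized vL) (hc : Cpl vL)
    (hfM : FinRes vM) {Q : (Ov vM)[X]}
    (hQ : Q.Monic) (hirr : Irreducible (Q.map (residue (Ov vM)))) {α : Ov vL}
    (hα : (Q.map (ovMap h)).IsRoot α) :
    ∃ β, (Q.map (ovMap h)).IsRoot β ∧
      β - α ^ Nat.card (ResidueField (Ov vM)) ∈ maximalIdeal (Ov vL) := by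
  let := resAlg h
  have := finite_residue_iff.1 hfM
  have := Fintype.ofFinite (ResidueField (Ov vM))
  have h0 : (Q.map (ovMap h)).eval (α ^ Nat.card (ResidueField (Ov vM))) ∈
      maximalIdeal (Ov vL) := by
    rw [← residue_eq_zero_iff, ← resAlg_aeval, map_pow]
    have := Polynomial.aeval_algHom_apply (FiniteField.frobeniusAlgHom (ResidueField (Ov vM))
      (ResidueField (Ov vL))) (residue _ α) (Q.map (residue (Ov vM)))
    rw [resAlg_aeval, hα.eq_zero, map_zero, map_zero, FiniteField.coe_frobeniusAlgHom,
      ← Nat.card_eq_fintype_card] at this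
    exact this
  exact exists_root_Ov hn hc _ (hQ.map _) _ h0 (derivative_notMem h hfM hirr h0)

end

section

universe w

/-- `L / M` is unramified of degree `N` generated by the integral element `α`, with Frobenius
generator `f`. -/
structure Unr {M L : Type*} [Field M] [Field L] [Algebra M L] (vM : AddValuation M (WithTop ℤ))
    (vL : AddValuation L (WithTop ℤ)) (N : ℕ) (α : L) (f : L ≃ₐ[M] L) : Prop where
  normL : IsNormalized vL
  ext : Extends vM vL 1
  mem : α ∈ ball vL 0
  span : ∀ x : L, ∃ c : Fin N → M, x = ∑ i, algebraMap M L (c i) * α ^ (i : ℕ)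
  coeff : ∀ (c : Fin N → M) (k : ℤ), ∑ i, algebraMap M L (c i) * α ^ (i : ℕ) ∈ ball vL k →
    ∀ i, c i ∈ ball vM k
  pow : f ^ N = 1
  diff : ∀ i j, i < j → j < N → (f ^ i) α - (f ^ j) α ∉ ball vL 1
  inv : ∀ x, vL (f x) = vL x

section
open Polynomial IsLocalRing

lemma coeff_scaled {M L : Type*} [Field M] [Field L] [Algebra M L]
    {vM : AddValuation M (WithTop ℤ)} {vL : AddValuation L (WithTop ℤ)} {e : ℕ}
    (h : Extends vM vL e) {N : ℕ} {α : L}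
    (h0 : ∀ d : Fin N → Ov vM, ∑ i, algebraMap M L (d i) * α ^ (i : ℕ) ∈ ball vL 1 →
      ∀ i, (d i : M) ∈ ball vM 1)
    (c : Fin N → M) (k : ℤ) (hc : ∑ i, algebraMap M L (c i) * α ^ (i : ℕ) ∈ ball vL k) (i : Fin N) :
    algebraMap M L (c i) ∈ ball vL k := by
  by_contra hcon
  obtain ⟨i0, -, hmin⟩ := Finset.exists_min_image Finset.univ (fun i => vM (c i)) ⟨i, Finset.mem_univ _⟩
  by_cases hz : c i0 = 0
  · have : c i = 0 := by
      have := hmin i (Finset.mem_univ _)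
      rw [hz, AddValuation.map_zero] at this
      exact (AddValuation.top_iff vM).1 (top_le_iff.1 this)
    rw [this, map_zero] at hcon
    exact hcon (zero_mem _)
  obtain ⟨n, hn⟩ := exists_int_val (v := vM) hz
  have hmem : ∀ j, c j / c i0 ∈ ball vM 0 := fun j => by
    have h1 := hmin j (Finset.mem_univ _)
    simp only [hn] at h1
    exact ball_div (mem_ball.2 h1) hn (by omega)
  have hn' := (h.val_iff (x := c i0) (n := n)).2 hn
  have hlt : (e : ℤ) * n < k := by
    by_contra hle
    refine hcon (ball_anti (not_lt.1 hle) ((h.mem_ball).2 ?_))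
    have h1 := hmin i (Finset.mem_univ _)
    simp only [hn] at h1
    exact mem_ball.2 h1
  have := h0 (fun j => ⟨c j / c i0, hmem j⟩) (by
    have h1 := ball_div (k := 1) hc hn' (by omega)
    rw [Finset.sum_div] at h1
    convert h1 using 2 with j
    rw [map_div₀]; ring) i0
  simp only [div_self hz] at this
  rw [mem_ball_iff_of_val val_one] at this
  omega

theorem exists_unr {p : ℕ} [Fact p.Prime] {K : Type*} {M : Type w} [Field K] [Field M]
    [Algebra K M] [Algebra ℚ_[p] M] [FiniteDimensional ℚ_[p] M] {vM : AddValuation M (WithTop ℤ)}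
    {e : ℕ} (hM : IsPadicValuation p vM e)
    (hres : ∀ x ∈ ball vM 0, ∃ c : K, algebraMap K M c ∈ ball vM 0 ∧ x - algebraMap K M c ∈ ball vM 1)
    {N : ℕ} (hN : 0 < N) (s : M ≃ₐ[ℚ_[p]] M) (hs : ∀ c : K, s (algebraMap K M c) = algebraMap K M c) :
    ∃ (L : Type w) (_ : Field L) (_ : Algebra M L) (vL : AddValuation L (WithTop ℤ)) (α : L)
      (f : L ≃ₐ[M] L) (S : L ≃+* L), Unr vM vL N α f ∧ S α = α ∧
      (∀ x, S (algebraMap M L x) = algebraMap M L (s x)) ∧ (∀ x, f (S x) = S (f x)) ∧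
      ∀ x, vL (S x) = vL x := by
  have hfM : FinRes vM := hM.finRes
  have := finite_residue_iff.1 hfM
  let R0 : Subring M := (algebraMap K M).range ⊓ (Ov vM).toSubring
  let ι : R0 →+* Ov vM := Subring.inclusion inf_le_right
  have hsurj : Function.Surjective ((residue (Ov vM)).comp ι) := by
    intro x
    obtain ⟨x, rfl⟩ := residue_surjective x
    obtain ⟨c, hc0, hc⟩ := hres x x.2
    refine ⟨⟨algebraMap K M c, ⟨c, rfl⟩, hc0⟩, ?_⟩
    rw [RingHom.comp_apply, eq_comm, residue_eq_iff]
    exact hc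
  obtain ⟨Qb, hQbm, hQbi, hQbd⟩ := exists_monic_irreducible_natDegree (k := ResidueField (Ov vM)) hN
  obtain ⟨Q0, hQ0, hQ0d, hQ0m⟩ := lifts_and_natDegree_eq_and_monic
    (f := (residue (Ov vM)).comp ι) (p := Qb) (Polynomial.mem_lifts _ |>.2
      (Polynomial.map_surjective _ hsurj Qb)) hQbm
  let Q : (Ov vM)[X] := Q0.map ι
  have hQ : Q.Monic := hQ0m.map _
  have hQd : Q.natDegree = N := by rw [hQ0m.natDegree_map, hQ0d, hQbd]
  have hirr : Irreducible (Q.map (residue (Ov vM))) := by rwa [Polynomial.map_map, hQ0]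
  let QM : M[X] := Q.map (algebraMap (Ov vM) M)
  have hQMm : QM.Monic := hQ.map _
  have hQMi : Irreducible QM :=
    (hQ.irreducible_iff_irreducible_map_fraction_map).1
      (hQ.irreducible_of_irreducible_map (residue (Ov vM)) Q hirr)
  have hQMd : QM.natDegree = N := by rw [hQ.natDegree_map, hQd]
  have : Fact (Irreducible QM) := ⟨hQMi⟩
  let L := AdjoinRoot QM
  have : FiniteDimensional M L := (AdjoinRoot.powerBasis' hQMm).finite
  have : FiniteDimensional ℚ_[p] L := FiniteDimensional.trans ℚ_[p] M L
  obtain ⟨vL, eL, hL⟩ := exists_padicValuation p L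
  obtain ⟨e', -, hext⟩ := hM.extends hL
  have hcL : Cpl vL := hL.cpl
  have hfL : FinRes vL := hL.finRes
  have hcomp : (algebraMap (Ov vL) L).comp (ovMap hext) =
      (algebraMap M L).comp (algebraMap (Ov vM) M) := rfl
  have hroot0 : QM.eval₂ (algebraMap M L) (AdjoinRoot.root QM) = 0 := AdjoinRoot.eval₂_root QM
  have hmapQ : ∀ a : L, (Q.map (ovMap hext)).eval₂ (algebraMap (Ov vL) L) a =
      QM.eval₂ (algebraMap M L) a := by
    intro a
    exact (eval₂_map (ovMap hext) _ a).trans (by rw [hcomp]; exact (eval₂_map _ _ a).symm)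
  obtain ⟨α, hα⟩ : ∃ α : Ov vL, (α : L) = AdjoinRoot.root QM := by
    have : IsIntegral (Ov vL) (AdjoinRoot.root QM) :=
      ⟨Q.map (ovMap hext), hQ.map _, by rw [hmapQ, hroot0]⟩
    exact IsIntegrallyClosed.isIntegral_iff.1 this
  have hisRoot : ∀ a : Ov vL, (Q.map (ovMap hext)).IsRoot a ↔
      QM.eval₂ (algebraMap M L) (a : L) = 0 := by
    intro a
    have := Polynomial.hom_eval₂ (Q.map (ovMap hext)) (RingHom.id _) (algebraMap (Ov vL) L) a
    rw [RingHom.comp_id, eval₂_id] at this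
    change _ = (Q.map (ovMap hext)).eval₂ (algebraMap (Ov vL) L) (a : L) at this
    rw [← hmapQ, ← this, IsRoot.def]
    exact ⟨fun h => by rw [h, map_zero], fun h => Subtype.ext h⟩
  have hαr : (Q.map (ovMap hext)).IsRoot α := by rw [hisRoot, hα, hroot0]
  obtain ⟨β, hβr, hβ⟩ := exists_frob_root hext hL.1 hcL hfM hQ hirr hαr
  let f0 : L →ₐ[M] L := AdjoinRoot.liftAlgHom QM (Algebra.ofId M L) (β : L)
    ((hisRoot β).1 hβr)
  let f : L ≃ₐ[M] L := AlgEquiv.ofBijective f0 (Algebra.IsAlgebraic.algHom_bijective f0)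
  have hfα : f (α : L) = β := by
    rw [hα]
    exact AdjoinRoot.liftAlgHom_root QM (Algebra.ofId M L) (β : L) ((hisRoot β).1 hβr)
  have hfinv : ∀ x, vL (f x) = vL x := fun x => hL.galInvariant (f.restrictScalars ℚ_[p]) x
  have hsQ : QM.map ((s : M →+* M)) = QM := by
    simp only [QM, Q, Polynomial.map_map]
    congr 1
    ext ⟨_, ⟨c, rfl⟩, _⟩
    exact hs c
  have hsQ' : ∀ a, QM.eval₂ ((algebraMap M L).comp (s : M →+* M)) a =
      QM.eval₂ (algebraMap M L) a := fun a => by rw [← eval₂_map, hsQ]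
  let S0 : L →ₐ[ℚ_[p]] L := AdjoinRoot.liftAlgHom QM
    ((IsScalarTower.toAlgHom ℚ_[p] M L).comp s.toAlgHom) (AdjoinRoot.root QM) ((hsQ' _).trans hroot0)
  let S : L ≃ₐ[ℚ_[p]] L := AlgEquiv.ofBijective S0 (Algebra.IsAlgebraic.algHom_bijective S0)
  have hSα : S (α : L) = α := by
    rw [hα]
    exact AdjoinRoot.liftAlgHom_root QM ((IsScalarTower.toAlgHom ℚ_[p] M L).comp s.toAlgHom)
      (AdjoinRoot.root QM) ((hsQ' _).trans hroot0)
  have hSM : ∀ x, S (algebraMap M L x) = algebraMap M L (s x) := fun x =>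
    AdjoinRoot.liftAlgHom_of QM ((IsScalarTower.toAlgHom ℚ_[p] M L).comp s.toAlgHom)
      (AdjoinRoot.root QM) ((hsQ' _).trans hroot0) x
  have hSinv : ∀ x, vL (S x) = vL x := fun x => hL.galInvariant S x
  refine ⟨L, inferInstance, inferInstance, vL, α, f, S, ?_, hSα, hSM, ?_, hSinv⟩
  · have hfroot : ∀ g : L ≃ₐ[M] L, QM.eval₂ (algebraMap M L) (g α) = 0 := fun g => by
      have := Polynomial.hom_eval₂ QM (algebraMap M L) (g : L →+* L) α
      rw [hα, hroot0, map_zero] at this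
      rw [hα]
      refine Eq.trans ?_ this.symm
      congr 1
      ext x
      exact (g.commutes x).symm
    have hfpow : ∀ i, (f ^ i) (α : L) - (α : L) ^ (Nat.card (ResidueField (Ov vM)) ^ i) ∈
        ball vL 1 := by
      intro i
      induction i with
      | zero => simp
      | succ i ih =>
        have h1 : f ((f ^ i) (α : L) - (α : L) ^ (Nat.card (ResidueField (Ov vM)) ^ i)) ∈
            ball vL 1 := by
          rw [mem_ball, hfinv]; exact ih
        have h2 := mem_maxIdeal_iff.1 (Ideal.mem_of_dvd _
          (sub_dvd_pow_sub_pow β (α ^ Nat.card (ResidueField (Ov vM)))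
            (Nat.card (ResidueField (Ov vM)) ^ i)) hβ)
        convert (ball vL 1).add_mem h1 h2 using 1
        rw [pow_succ', AlgEquiv.mul_apply, map_sub, map_pow, hfα]
        push_cast
        rw [← pow_mul, ← pow_succ']
        ring
    have hfmem : ∀ g : L ≃ₐ[M] L, g (α : L) ∈ ball vL 0 := fun g => by
      have : vL (g α) = vL α := hL.galInvariant (g.restrictScalars ℚ_[p]) α
      rw [mem_ball, this]; exact α.2
    have key : ∀ N', Q.natDegree = N' → ∀ d : Fin N' → Ov vM,
        ∑ i, algebraMap M L (d i) * (α : L) ^ (i : ℕ) ∈ ball vL 1 → ∀ i, (d i : M) ∈ ball vM 1 := by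
      rintro _ rfl d hd i
      refine mem_maxIdeal_iff.1 (coeff_mem_of_sum_mem hext hQ hirr hαr d ?_ i)
      rw [mem_maxIdeal_iff]
      push_cast
      exact hd
    have hco := coeff_scaled hext (key N hQd)
    have hspan : ∀ x : L, ∃ c : Fin N → M, x = ∑ i, algebraMap M L (c i) * (α : L) ^ (i : ℕ) := by
      intro x
      obtain ⟨g, rfl⟩ := AdjoinRoot.mk_surjective x
      have h1 : AdjoinRoot.mk QM g = AdjoinRoot.mk QM (g %ₘ QM) := by
        rw [AdjoinRoot.mk_eq_mk]
        exact ⟨g /ₘ QM, by rw [sub_eq_iff_eq_add', Polynomial.modByMonic_add_div]⟩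
      refine ⟨fun i => (g %ₘ QM).coeff i, ?_⟩
      have h2 : (g %ₘ QM).natDegree < N := by
        have := natDegree_modByMonic_lt g hQMm (fun h => hQMi.1 (h ▸ isUnit_one))
        rwa [hQMd] at this
      rw [h1, ← AdjoinRoot.aeval_eq, aeval_eq_sum_range' h2, ← hα,
        ← Fin.sum_univ_eq_sum_range (fun i => (g %ₘ QM).coeff i • (α : L) ^ i)]
      exact Finset.sum_congr rfl fun i _ => Algebra.smul_def _ _
    have he' : e' = 1 := by
      obtain ⟨x, hx⟩ := hL.1 1
      obtain ⟨c, rfl⟩ := hspan x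
      have h1 := hco c 1 (mem_ball_of_val hx)
      have h2 : ∀ i, algebraMap M L (c i) ∈ ball vL e' := fun i => by
        by_cases hz : c i = 0
        · rw [hz, map_zero]; exact zero_mem _
        obtain ⟨n, hn⟩ := exists_int_val (v := vM) hz
        have h3 := (hext.val_iff).2 hn
        have h4 := (mem_ball_iff_of_val h3).1 (h1 i)
        rw [mem_ball_iff_of_val h3]
        have : 0 < n := by
          by_contra hneg
          have := mul_nonpos_of_nonneg_of_nonpos (Int.natCast_nonneg e') (not_lt.1 hneg)
          omega
        nlinarith
      have h3 : ∑ i, algebraMap M L (c i) * (α : L) ^ (i : ℕ) ∈ ball vL e' :=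
        sum_mem fun i _ => ball_mul_right (h2 i) (ball_pow_zero α.2 _)
      rw [mem_ball_iff_of_val hx] at h3
      have := hext.1
      omega
    subst he'
    refine ⟨hL.1, hext, α.2, hspan, ?_, ?_, ?_, hfinv⟩
    · intro c k hc i
      have := hco c k hc i
      rwa [← hext.mem_ball, Nat.cast_one, one_mul]
    · have h1 : (f ^ N) (α : L) - α ∈ ball vL 1 := by
        have h2 := mem_maxIdeal_iff.1 (frob_pow_natDegree hext hfL hQ hirr hαr)
        rw [hQd] at h2
        convert (ball vL 1).add_mem (hfpow N) h2 using 1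
        push_cast
        ring
      have h2 : (⟨(f ^ N) (α : L), hfmem _⟩ : Ov vL) = α :=
        root_unique hext hfM hirr ((hisRoot _).2 (hfroot (f ^ N))) hαr (mem_maxIdeal_iff.2 h1)
      have h3 : (f ^ N) (α : L) = α := congrArg Subtype.val h2
      have h4 : ((f ^ N : L ≃ₐ[M] L) : L →ₐ[M] L) = AlgHom.id M L :=
        AdjoinRoot.algHom_ext (by rw [hα] at h3; exact h3)
      ext x
      exact DFunLike.congr_fun h4 x
    · intro i j hij hj h
      refine frob_diff_notMem hext hfM hfL hQ hirr hαr hij (by rwa [hQd]) ?_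
      rw [mem_maxIdeal_iff]
      convert (ball vL 1).add_mem ((ball vL 1).sub_mem h (hfpow i)) (hfpow j) using 1
      push_cast
      ring
  · have hSβ : S (β : L) = β := by
      have hmem : S (β : L) ∈ ball vL 0 := by rw [mem_ball, hSinv]; exact β.2
      have h1 : S ((β : L) - (α : L) ^ Nat.card (ResidueField (Ov vM))) ∈ ball vL 1 := by
        rw [mem_ball, hSinv]; exact mem_maxIdeal_iff.1 hβ
      rw [map_sub, map_pow, hSα] at h1
      have h2 : (⟨S (β : L), hmem⟩ : Ov vL) = β := by
        refine root_unique hext hfM hirr ((hisRoot _).2 ?_) hβr (mem_maxIdeal_iff.2 ?_)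
        · have := Polynomial.hom_eval₂ QM (algebraMap M L) (S : L →+* L) β
          rw [(hisRoot β).1 hβr, map_zero] at this
          rw [← hsQ']
          refine Eq.trans ?_ this.symm
          congr 1
          ext x
          exact (hSM x).symm
        · convert (ball vL 1).sub_mem h1 (mem_maxIdeal_iff.1 hβ) using 1
          push_cast
          ring
      exact congrArg Subtype.val h2
    intro x
    obtain ⟨g, rfl⟩ := AdjoinRoot.mk_surjective x
    rw [← AdjoinRoot.aeval_eq, ← hα, aeval_eq_sum_range]
    change f (S _) = S (f _)
    have hc : ∀ y : M, f (S (algebraMap M L y)) = S (f (algebraMap M L y)) := fun y => by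
      rw [hSM, f.commutes, f.commutes, hSM]
    simp only [map_sum, Algebra.smul_def, map_mul, map_pow, hSα, hfα, hSβ]
    exact Finset.sum_congr rfl fun i _ => congrArg (· * _) (hc _)

end

end

section
variable {F : Type*} [Field F] {v : AddValuation F (WithTop ℤ)}

lemma prod_one_add_sub_mem {ι : Type*} (S : Finset ι) (z : ι → F) {u : ℤ} (hu : 0 ≤ u)
    (hz : ∀ i ∈ S, z i ∈ ball v u) :
    ∏ i ∈ S, (1 + z i) - 1 - ∑ i ∈ S, z i ∈ ball v (2 * u) := by
  induction S using Finset.induction_on with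
  | empty => simp
  | insert i S hi ih =>
    rw [Finset.prod_insert hi, Finset.sum_insert hi]
    have h1 := ih fun j hj => hz j (Finset.mem_insert_of_mem hj)
    have h2 : ∑ j ∈ S, z j ∈ ball v u := sum_mem fun j hj => hz j (Finset.mem_insert_of_mem hj)
    have h3 := hz i (Finset.mem_insert_self _ _)
    have h4 : ∏ i ∈ S, (1 + z i) - 1 ∈ ball v u := by
      have := (ball v u).add_mem (ball_anti (by omega) h1) h2
      simpa using this
    convert (ball v (2 * u)).add_mem h1 (ball_mul h3 h4 (by omega : 2 * u ≤ u + u)) using 1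
    ring

end

section
open Polynomial IsLocalRing
variable {M L : Type*} [Field M] [Field L] [Algebra M L]
    {vM : AddValuation M (WithTop ℤ)} {vL : AddValuation L (WithTop ℤ)} {N : ℕ} {α : L}
    {f : L ≃ₐ[M] L}

lemma Unr.inv_pow (h : Unr vM vL N α f) (i : ℕ) (x : L) : vL ((f ^ i) x) = vL x := by
  induction i with
  | zero => rfl
  | succ i ih => rw [pow_succ', AlgEquiv.mul_apply, h.inv, ih]

lemma Unr.injective (h : Unr vM vL N α f) : Function.Injective fun i : Fin N => (f ^ (i : ℕ)) α := by
  intro i j hij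
  by_contra hne
  rcases lt_or_gt_of_ne (Fin.val_ne_iff.2 hne) with hlt | hlt
  · exact h.diff _ _ hlt j.2 (by simp only at hij; rw [hij, sub_self]; exact zero_mem _)
  · exact h.diff _ _ hlt i.2 (by simp only at hij; rw [hij, sub_self]; exact zero_mem _)

lemma Unr.exists_of_fixed (h : Unr vM vL N α f) (hN : 0 < N) {x : L} (hx : f x = x) :
    ∃ c, x = algebraMap M L c := by
  obtain ⟨c, hc⟩ := h.span x
  refine ⟨c ⟨0, hN⟩, ?_⟩
  have hfx : ∀ i : ℕ, (f ^ i) x = x := fun i => by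
    induction i with
    | zero => rfl
    | succ i ih => rw [pow_succ', AlgEquiv.mul_apply, ih, hx]
  let P : L[X] := ∑ i : Fin N, C (algebraMap M L (c i)) * X ^ (i : ℕ)
  have hP : P - C x = 0 := by
    refine eq_zero_of_natDegree_lt_card_of_eval_eq_zero _ h.injective ?_ ?_
    · intro j
      rw [eval_sub, eval_C, sub_eq_zero]
      conv_rhs => rw [← hfx j, hc]
      simp only [P, eval_finsetSum, map_sum, map_mul, map_pow, AlgEquiv.commutes, eval_mul, eval_C,
        eval_pow, eval_X]
    · rw [Fintype.card_fin]
      refine lt_of_le_of_lt (natDegree_sub_le _ _) (max_lt ?_ (by simpa using hN))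
      refine lt_of_le_of_lt (b := N - 1) (natDegree_sum_le_of_forall_le _ _ fun i _ => ?_) (by omega)
      exact (natDegree_C_mul_X_pow_le _ _).trans (by omega)
  have h0 : (P - C x).coeff 0 = 0 := by rw [hP, coeff_zero]
  rw [coeff_sub, coeff_C_zero, sub_eq_zero, finsetSum_coeff] at h0
  rw [← h0, Finset.sum_eq_single ⟨0, hN⟩]
  · simp
  · intro b _ hb
    rw [coeff_C_mul_X_pow, if_neg]
    exact fun h => hb (Fin.ext h.symm)
  · simp

lemma Unr.pow_ne_one (h : Unr vM vL N α f) {i : ℕ} (h0 : 0 < i) (hi : i < N) : f ^ i ≠ 1 := by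
  intro h1
  exact h.diff 0 i h0 hi (by rw [h1, pow_zero, sub_self]; exact zero_mem _)

lemma Unr.exists_trace_eq_one (h : Unr vM vL N α f) (hN : 0 < N) :
    ∃ β ∈ ball vL 0, ∑ i ∈ Finset.range N, (f ^ i) β = 1 := by
  have hmem : ∀ i : ℕ, (f ^ i) α ∈ ball vL 0 := fun i => by
    rw [mem_ball, h.inv_pow]; exact h.mem
  have htr0 : ∀ x ∈ ball vL 0, ∑ i ∈ Finset.range N, (f ^ i) x ∈ ball vL 0 := fun x hx =>
    sum_mem fun i _ => by rw [mem_ball, h.inv_pow]; exact hx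
  obtain ⟨j, hj⟩ : ∃ j : ℕ, ∑ i ∈ Finset.range N, (f ^ i) (α ^ j) ∉ ball vL 1 := by
    by_contra! hcon
    let r : Fin N → ResidueField (Ov vL) := fun i => residue (Ov vL) ⟨(f ^ (i : ℕ)) α, hmem i⟩
    have hr : Function.Injective r := by
      intro i j hij
      have hij' := residue_eq_iff.1 hij
      by_contra hne
      rcases lt_or_gt_of_ne (Fin.val_ne_iff.2 hne) with hlt | hlt
      · exact h.diff _ _ hlt j.2 hij'
      · exact h.diff _ _ hlt i.2 (by simpa using (ball vL 1).neg_mem hij')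
    have := Matrix.eq_zero_of_forall_pow_sum_mul_pow_eq_zero (v := fun _ => 1) hr (by
      intro i
      have : ∑ j : Fin N, 1 * r j ^ (i : ℕ) =
          residue (Ov vL) (∑ j : Fin N, ⟨(f ^ (j : ℕ)) α, hmem j⟩ ^ (i : ℕ)) := by
        simp only [r, one_mul, map_sum, map_pow]
      rw [this, residue_eq_zero_iff, mem_maxIdeal_iff]
      push_cast
      have h1 := hcon i
      rw [← Fin.sum_univ_eq_sum_range (fun k => (f ^ k) (α ^ (i : ℕ)))] at h1
      simpa using h1)
    exact one_ne_zero (congrFun this ⟨0, hN⟩)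
  set t := ∑ i ∈ Finset.range N, (f ^ i) (α ^ j) with ht
  have ht0 : vL t = ((0 : ℤ) : WithTop ℤ) := val_eq_iff.2 ⟨htr0 _ (ball_pow_zero h.mem j), hj⟩
  have hft : f t = t := by
    obtain ⟨n, rfl⟩ : ∃ n, N = n + 1 := ⟨N - 1, by omega⟩
    rw [ht, map_sum, Finset.sum_range_succ, Finset.sum_range_succ', ← AlgEquiv.mul_apply,
      ← pow_succ', h.pow, pow_zero]
    congr 1
    exact Finset.sum_congr rfl fun i _ => by rw [← AlgEquiv.mul_apply, ← pow_succ']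
  have hft' : ∀ i : ℕ, (f ^ i) t = t := fun i => by
    induction i with
    | zero => rfl
    | succ i ih => rw [pow_succ', AlgEquiv.mul_apply, ih, hft]
  refine ⟨α ^ j / t, ball_div (ball_pow_zero h.mem j) ht0 (by omega), ?_⟩
  simp only [map_div₀, hft']
  rw [← Finset.sum_div, ← ht, div_self (ne_zero_of_val ht0)]

lemma Unr.exists_prod_eq {p m : ℕ} (h : Unr vM vL (p ^ m) α f) (hp : p.Prime) (hc : Cpl vM) {ε : ℤ}
    (hpv : vM (p : M) = ε) (hε : 0 ≤ ε) {y : M} (hy : IsU vM 1 y) :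
    ∃ x, vL x = ((0 : ℤ) : WithTop ℤ) ∧
      ∏ i ∈ Finset.range (p ^ m), (f ^ i) x = algebraMap M L y := by
  have hN : 0 < p ^ m := pow_pos hp.pos m
  have hfp : ∀ x, f (∏ i ∈ Finset.range (p ^ m), (f ^ i) x) =
      ∏ i ∈ Finset.range (p ^ m), (f ^ i) x := by
    intro x
    obtain ⟨n, hn⟩ : ∃ n, p ^ m = n + 1 := ⟨p ^ m - 1, by omega⟩
    have hpow := h.pow
    rw [hn] at hpow ⊢
    rw [map_prod, Finset.prod_range_succ, Finset.prod_range_succ', ← AlgEquiv.mul_apply,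
      ← pow_succ', hpow, pow_zero]
    congr 1
    exact Finset.prod_congr rfl fun i _ => by rw [← AlgEquiv.mul_apply, ← pow_succ']
  obtain ⟨β, hβ, hβ1⟩ := h.exists_trace_eq_one hN
  have hIs : ∀ {u : ℤ} {y : M}, IsU vL u (algebraMap M L y) ↔ IsU vM u y := fun {u y} => by
    unfold IsU
    rw [← map_one (algebraMap M L), ← map_sub, ← h.ext.mem_ball (n := u), Nat.cast_one, one_mul]
  have step : ∀ n : ℕ, ∃ x y', vL x = ((0 : ℤ) : WithTop ℤ) ∧
      ∏ i ∈ Finset.range (p ^ m), (f ^ i) x = algebraMap M L y' ∧ IsU vM (n + 1) (y / y') := by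
    intro n
    induction n with
    | zero => exact ⟨1, 1, val_one, by simp, by simpa using hy⟩
    | succ n ih =>
      obtain ⟨x, y', hx, hxy, hyy⟩ := ih
      set a := y / y' - 1 with ha
      have hab : algebraMap M L a ∈ ball vL (n + 1) := by
        have := (h.ext.mem_ball (x := a) (n := n + 1)).2 hyy
        rwa [Nat.cast_one, one_mul] at this
      have hz : ∀ i ∈ Finset.range (p ^ m), algebraMap M L a * (f ^ i) β ∈ ball vL (n + 1) :=
        fun i _ => ball_mul_right hab (by rw [mem_ball, h.inv_pow]; exact hβ)
      have h1 := prod_one_add_sub_mem (Finset.range (p ^ m)) _ (by omega) hz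
      rw [← Finset.mul_sum, hβ1, mul_one] at h1
      have hpr : ∏ i ∈ Finset.range (p ^ m), (f ^ i) (1 + algebraMap M L a * β) =
          ∏ i ∈ Finset.range (p ^ m), (1 + algebraMap M L a * (f ^ i) β) := by
        simp only [map_add, map_mul, map_one, AlgEquiv.commutes]
      have hfix := hfp (1 + algebraMap M L a * β)
      rw [hpr] at hfix
      obtain ⟨c, hcc⟩ := h.exists_of_fixed hN hfix
      rw [hcc] at h1
      have h2 : y / y' - c ∈ ball vM (n + 1 + 1) := by
        rw [← h.ext.mem_ball, Nat.cast_one, one_mul]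
        convert (ball vL (n + 1 + 1)).neg_mem (ball_anti (by omega) h1) using 1
        rw [ha]; simp only [map_sub, map_one]; ring
      have hcU : IsU vM 1 c := by
        have := (ball vM 1).sub_mem (ball_anti (by omega) hyy) (ball_anti (by omega) h2)
        unfold IsU
        convert this using 1
        ring
      refine ⟨x * (1 + algebraMap M L a * β), y' * c, ?_, ?_, ?_⟩
      · have := val_mul hx (val_one_add (v := vL)
          (ball_anti (by omega) (ball_mul_right hab hβ) : algebraMap M L a * β ∈ ball vL 1))
        simpa using this
      · simp only [map_mul, Finset.prod_mul_distrib, hxy]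
        rw [hpr, hcc]
      · rw [← div_div, IsU.div_iff (hcU.val le_rfl)]
        push_cast
        exact h2
  obtain ⟨n0, hn0, hroot⟩ := exists_prime_pow_root hc hp hpv hε m
  obtain ⟨x, y', hx, hxy, hyy⟩ := step n0.toNat
  obtain ⟨r, hr, hry⟩ := hroot _ (hyy.anti (by omega))
  have hx0 := ne_zero_of_val hx
  have hy'0 : y' ≠ 0 := by
    rintro rfl
    rw [map_zero, Finset.prod_eq_zero_iff] at hxy
    obtain ⟨i, -, hi⟩ := hxy
    exact hx0 ((map_eq_zero _).1 hi)
  refine ⟨x * algebraMap M L r, ?_, ?_⟩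
  · have hr' := h.ext.val (hr.val le_rfl)
    have := val_mul hx hr'
    simpa using this
  · simp only [map_mul, Finset.prod_mul_distrib, hxy, AlgEquiv.commutes]
    rw [Finset.prod_const, Finset.card_range, ← map_pow, hry, ← map_mul, mul_div_cancel₀ _ hy'0]

/-- Elements fixed by an automorphism of `L` that fixes `α` and acts on `M` as `s` have
coordinates fixed by `s`. -/
lemma Unr.coord_fixed (h : Unr vM vL N α f) {S : L ≃+* L} {s : M ≃+* M} (hSα : S α = α)
    (hS : ∀ x, S (algebraMap M L x) = algebraMap M L (s x)) {x : L} (hx : S x = x)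
    {c : Fin N → M} (hc : x = ∑ i, algebraMap M L (c i) * α ^ (i : ℕ)) (i : Fin N) :
    s (c i) = c i := by
  have h1 : ∑ i, algebraMap M L (s (c i) - c i) * α ^ (i : ℕ) = 0 := by
    have h2 : S x = ∑ i, algebraMap M L (s (c i)) * α ^ (i : ℕ) := by
      rw [hc, map_sum]
      exact Finset.sum_congr rfl fun i _ => by rw [map_mul, map_pow, hSα, hS]
    simp only [map_sub, sub_mul, Finset.sum_sub_distrib]
    rw [← h2, ← hc, hx, sub_self]
  have h3 := eq_zero_of_forall_ball (v := vM) (x := s (c i) - c i) fun n =>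
    h.coeff _ n (by rw [h1]; exact zero_mem _) i
  exact sub_eq_zero.1 h3

/-- The valuation of an element is the valuation of one of its coordinates. -/
lemma Unr.val_eq_coord (h : Unr vM vL N α f) {x : L} {n : ℤ} (hx : vL x = n)
    {c : Fin N → M} (hc : x = ∑ i, algebraMap M L (c i) * α ^ (i : ℕ)) :
    ∃ i, vM (c i) = n := by
  by_contra! hcon
  have h1 : ∀ i, c i ∈ ball vM n := h.coeff c n (by rw [← hc]; exact mem_ball_of_val hx)
  have h2 : ∀ i, c i ∈ ball vM (n + 1) := fun i => by
    by_contra hi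
    exact hcon i (val_eq_iff.2 ⟨h1 i, hi⟩)
  have h3 : x ∈ ball vL (n + 1) := by
    rw [hc]
    refine sum_mem fun i _ => ball_mul_right ?_ (ball_pow_zero h.mem _)
    have := (h.ext.mem_ball (x := c i) (n := n + 1)).2 (h2 i)
    rwa [Nat.cast_one, one_mul] at this
  rw [mem_ball_iff_of_val hx] at h3
  omega

end

lemma coe_ringEquiv_pow {M L : Type*} [Field M] [Field L] [Algebra M L] (f : L ≃ₐ[M] L) (i : ℕ)
    (x : L) : ((f : L ≃+* L) ^ i) x = (f ^ i) x := by
  induction i with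
  | zero => rfl
  | succ i ih => rw [pow_succ', pow_succ', RingAut.mul_apply, AlgEquiv.mul_apply, ih]; rfl

lemma prod_univ_eq_prod_range {G A : Type*} [Group G] [Fintype G] [CommMonoid A] {σ : G}
    (hgen : ∀ g : G, g ∈ Subgroup.zpowers σ) (F : G → A) :
    ∏ g, F g = ∏ i ∈ Finset.range (orderOf σ), F (σ ^ i) := by
  rw [← IsCyclic.image_range_orderOf hgen, Finset.prod_image]
  exact fun i hi j hj h => pow_injOn_Iio_orderOf (by simpa using hi) (by simpa using hj) h

section
variable {K M : Type*} [Field K] [Field M] [Algebra K M] {p m : ℕ} [Fact p.Prime]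
  [Algebra ℚ_[p] K] [Algebra ℚ_[p] M] [IsScalarTower ℚ_[p] K M] [FiniteDimensional ℚ_[p] M]
  {vK : AddValuation K (WithTop ℤ)} {vM : AddValuation M (WithTop ℤ)}

/-- A totally ramified cyclic extension of degree `p ^ m` of `p`-adic fields admits a unit whose
class modulo norms has order divisible by `p ^ m`. -/
theorem exists_unit_of_norm_order {eM : ℕ} (hM : IsPadicValuation p vM eM)
    (h : TR vK vM (p ^ m)) (hgal : IsGalois K M) {σ : M ≃ₐ[K] M}
    (hgen : ∀ g : M ≃ₐ[K] M, g ∈ Subgroup.zpowers σ) :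
    ∃ x : K, vK x = ((0 : ℤ) : WithTop ℤ) ∧
      ∀ j : ℕ, (∃ y0 : M, y0 ≠ 0 ∧ Algebra.norm K y0 = x ^ j) → p ^ m ∣ j := by
  have hN : 0 < p ^ m := h.ext.1
  have hpp : p.Prime := Fact.out
  have hfd : FiniteDimensional K M := Module.finite_of_finrank_pos (h.rank ▸ hN)
  have hord : orderOf σ = p ^ m := by
    rw [orderOf_eq_card_of_forall_mem_zpowers hgen, IsGalois.card_aut_eq_finrank, h.rank]
  have hres : ∀ x ∈ ball vM 0, ∃ c : K, algebraMap K M c ∈ ball vM 0 ∧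
      x - algebraMap K M c ∈ ball vM 1 := by
    intro x hx
    obtain ⟨c, hc, hxc⟩ := h.exists_residue hx
    refine ⟨c, ?_, hxc⟩
    have := (ball vM 0).sub_mem hx (ball_anti (by omega) hxc)
    simpa using this
  obtain ⟨L, _, _, vL, α, f, S, hU, hSα, hSM, hfS, hSv⟩ := exists_unr hM hres hN
    (σ.restrictScalars ℚ_[p]) (fun c => σ.commutes c)
  replace hSM : ∀ x, S (algebraMap M L x) = algebraMap M L (σ x) := hSM
  have hfixK : ∀ c : M, σ c = c → ∃ b, algebraMap K M b = c := by
    intro c hc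
    refine (IsGalois.mem_range_algebraMap_iff_fixed c).2 fun g => ?_
    obtain ⟨n, rfl⟩ := Subgroup.mem_zpowers_iff.1 (hgen g)
    have : σ ∈ MulAction.stabilizer (M ≃ₐ[K] M) c := hc
    exact Subgroup.zpow_mem _ this n
  have hSpow : ∀ i x, (S ^ i) (algebraMap M L x) = algebraMap M L ((σ ^ i) x) := by
    intro i x
    induction i with
    | zero => rfl
    | succ i ih => rw [pow_succ', RingAut.mul_apply, ih, hSM, pow_succ', AlgEquiv.mul_apply]
  have hSpowα : ∀ i, (S ^ i) α = α := by
    intro i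
    induction i with
    | zero => rfl
    | succ i ih => rw [pow_succ', RingAut.mul_apply, ih, hSα]
  have hSpowv : ∀ (i : ℕ) x, vL ((S ^ i) x) = vL x := by
    intro i x
    induction i with
    | zero => rfl
    | succ i ih => rw [pow_succ', RingAut.mul_apply, hSv, ih]
  obtain ⟨π, hπ⟩ := exists_unif h.normF
  obtain ⟨ϖ0, hϖ0⟩ := exists_unif h.normK
  have hr : vM (algebraMap K M ϖ0 / π ^ (p ^ m)) = ((0 : ℤ) : WithTop ℤ) := by
    have := val_div (h.ext.val hϖ0) (val_pow hπ (p ^ m))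
    simpa using this
  obtain ⟨c, -, hc⟩ := h.exists_residue (mem_ball_of_val hr)
  have hcv : vM (algebraMap K M c) = ((0 : ℤ) : WithTop ℤ) :=
    val_of_sub_mem_ball hr (by simpa using (ball vM 1).neg_mem hc)
  have hc0 : c ≠ 0 := by
    rintro rfl
    rw [map_zero] at hcv
    exact ne_zero_of_val hcv rfl
  have hyU : IsU vM 1 (algebraMap K M (ϖ0 / c) / π ^ (p ^ m)) := by
    have := (IsU.div_iff (x := algebraMap K M ϖ0 / π ^ (p ^ m)) hcv).2 hc
    convert this using 1
    rw [map_div₀, div_right_comm]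
  have hπ0 := ne_zero_of_val hπ
  obtain ⟨x1, hx1, hx1p⟩ := hU.exists_prod_eq hpp hM.cpl hM.val_p (by omega) hyU
  let f' : L ≃+* L := f
  have hf' : ∀ i x, (f' ^ i) x = (f ^ i) x := coe_ringEquiv_pow f
  have hfM : ∀ i x, (f' ^ i) (algebraMap M L x) = algebraMap M L x := fun i x => by
    rw [hf']; exact AlgEquiv.commutes _ _
  have hπL : vL (algebraMap M L π) = ((1 : ℤ) : WithTop ℤ) := by simpa using hU.ext.val hπ
  set z := algebraMap M L π * x1 with hz
  have hzv : vL z = ((1 : ℤ) : WithTop ℤ) := by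
    simpa only [add_zero] using val_mul hπL hx1
  have hz0 := ne_zero_of_val hzv
  have hprod : ∏ i ∈ Finset.range (p ^ m), (f' ^ i) z =
      algebraMap M L (algebraMap K M (ϖ0 / c)) := by
    simp only [hz, map_mul, Finset.prod_mul_distrib, hfM]
    simp only [hf']
    rw [hx1p, Finset.prod_const, Finset.card_range, ← map_pow, ← map_mul,
      mul_div_cancel₀ _ (pow_ne_zero _ hπ0)]
  have hS1 : ∀ i, S ^ i = 1 ↔ σ ^ i = 1 := by
    intro i
    constructor
    · intro hi
      ext x
      refine (algebraMap M L).injective ?_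
      rw [← hSpow, hi]; rfl
    · intro hi
      ext x
      obtain ⟨c, rfl⟩ := hU.span x
      rw [map_sum]
      refine Finset.sum_congr rfl fun j _ => ?_
      rw [map_mul, map_pow, hSpowα, hSpow, hi]; rfl
  obtain ⟨y, hy0, hy, hsym⟩ := exists_symbol f' S
    (by ext x; exact hfS x) hN hN
    (by ext x; rw [hf', hU.pow]; rfl)
    (fun i h0 hi h1 => hU.pow_ne_one h0 hi (by ext x; rw [← hf', h1]; rfl))
    ((hS1 _).2 (by rw [← hord, pow_orderOf_eq_one]))
    (fun i h0 hi h1 => pow_ne_one_of_lt_orderOf h0.ne' (by rwa [hord]) ((hS1 _).1 h1))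
    hz0 (by rw [hprod, hSM, AlgEquiv.commutes])
  obtain ⟨k, hk⟩ := exists_int_val (v := vL) hy0
  have hπk := val_zpow hπL k
  have hπk0 := ne_zero_of_val hπk
  have hy'v : vL (y / algebraMap M L π ^ k) = ((0 : ℤ) : WithTop ℤ) := by
    simpa using val_div hk hπk
  obtain ⟨hX1, hX2, hX3⟩ := hsym (y / algebraMap M L π ^ k) (div_ne_zero hy0 hπk0) (by
    rw [map_div₀, hy, map_zpow₀]
    have : f' (algebraMap M L π) = algebraMap M L π := f.commutes π
    rw [this, mul_div_assoc])
  set X := ∏ i ∈ Finset.range (p ^ m), (S ^ i) (y / algebraMap M L π ^ k) with hX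
  have hXv : vL X = ((0 : ℤ) : WithTop ℤ) := by
    have := val_prod (vM := vL) (f := fun i => (S ^ i) (y / algebraMap M L π ^ k)) (a := fun _ => 0)
      (Finset.range (p ^ m)) (fun i _ => by rw [hSpowv, hy'v])
    rwa [Finset.sum_const_zero] at this
  obtain ⟨c1, hc1⟩ := hU.exists_of_fixed hN (x := X) hX1
  obtain ⟨x, rfl⟩ := hfixK c1 ((algebraMap M L).injective (by rw [← hSM, ← hc1, hX2]))
  refine ⟨x, ?_, ?_⟩
  · rw [← h.ext.val_iff, ← hU.ext.val_iff, ← hc1]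
    simpa using hXv
  · rintro j ⟨y0, hy0', hj⟩
    obtain ⟨w, hw0, hw⟩ := hX3 j (algebraMap M L y0) ((map_ne_zero _).2 hy0') (f.commutes y0) (by
      rw [hc1, ← map_pow, ← map_pow, ← hj, Algebra.norm_eq_prod_automorphisms,
        prod_univ_eq_prod_range hgen, hord, map_prod]
      exact Finset.prod_congr rfl fun i _ => (hSpow i y0).symm)
    obtain ⟨n, hn⟩ := exists_int_val (v := vL) hw0
    have hfw : vL (f' w) = n := (hU.inv w).trans hn
    have hZ := val_div (val_pow hzv j) (val_div hfw hn)
    obtain ⟨cc, hcc⟩ := hU.span (z ^ j / (f' w / w))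
    obtain ⟨i, hi⟩ := hU.val_eq_coord hZ hcc
    have hfix := hU.coord_fixed (s := (σ : M ≃+* M)) hSα hSM hw hcc i
    obtain ⟨b, hb⟩ := hfixK _ hfix
    rw [← hb] at hi
    have hb0 : b ≠ 0 := by
      rintro rfl
      rw [map_zero] at hi
      exact ne_zero_of_val hi rfl
    obtain ⟨l, hl⟩ := exists_int_val (v := vK) hb0
    have := val_unique hi (h.ext.val hl)
    have h2 : (j : ℤ) = (p ^ m : ℕ) * l := by rw [← this]; ring
    exact Int.natCast_dvd_natCast.1 ⟨l, h2⟩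

end

/-- The number of integers `1 ≤ w < u` satisfying `T`. -/
def cnt (T : ℤ → Prop) (u : ℤ) : ℕ := ((Finset.Ico 1 u).filter T).card

/-- The filtration shift of the `p`-th power map on principal units. -/
def lam (p : ℕ) (ε u : ℤ) : ℤ := min (p * u) (u + ε)

lemma cnt_one (T : ℤ → Prop) : cnt T 1 = 0 := by simp [cnt]

lemma cnt_succ (T : ℤ → Prop) {u : ℤ} (hu : 1 ≤ u) :
    cnt T (u + 1) = cnt T u + if T u then 1 else 0 := by
  have : Finset.Ico 1 (u + 1) = insert u (Finset.Ico 1 u) := by ext; simp; omega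
  rw [cnt, this, Finset.filter_insert]
  split_ifs with h
  · rw [Finset.card_insert_of_notMem (by simp)]; rfl
  · rfl

lemma cnt_mono (T : ℤ → Prop) {u w : ℤ} (h : u ≤ w) : cnt T u ≤ cnt T w :=
  Finset.card_le_card (Finset.filter_subset_filter _ (Finset.Ico_subset_Ico le_rfl h))

lemma lt_lam {p : ℕ} (hp : 2 ≤ p) {ε u : ℤ} (hε : 1 ≤ ε) (hu : 1 ≤ u) : u < lam p ε u := by
  have : (2 : ℤ) ≤ p := by exact_mod_cast hp
  exact lt_min (by nlinarith) (by omega)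

section
variable {Q : Type*} [CommGroup Q] {F : ℤ → Subgroup Q} {T : ℤ → Prop} {p m : ℕ} {ε : ℤ}

lemma pow_mem_filtration (hpow : ∀ u, 1 ≤ u → ∀ x ∈ F u, x ^ p ∈ F (u + 1))
    (hT : ∀ u, 1 ≤ u → ¬T u → F u ≤ F (u + 1)) {u : ℤ} (hu : 1 ≤ u) {y : Q} (hy : y ∈ F u) (k : ℕ) :
    y ^ p ^ (cnt T (u + k) - cnt T u) ∈ F (u + k) := by
  induction k with
  | zero => simpa using hy
  | succ k ih =>
    have h1 := cnt_mono T (show u ≤ u + k by omega)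
    push_cast
    rw [← add_assoc, cnt_succ T (by omega)]
    split_ifs with h
    · rw [show cnt T (u + k) + 1 - cnt T u = cnt T (u + k) - cnt T u + 1 by omega, pow_succ, pow_mul]
      exact hpow _ (by omega) _ ih
    · exact hT _ (by omega) h ih

/-- The filtration of a cyclic quotient of the principal units, compared with the shift `lam`. -/
theorem filtration_numerics [Fact p.Prime] (hanti : ∀ u w, u ≤ w → F w ≤ F u)
    (hT : ∀ u, 1 ≤ u → ¬T u → F u ≤ F (u + 1))
    (hcyc : ∀ u, 1 ≤ u → ∃ g ∈ F u, ∀ y ∈ F u, ∃ j : ℕ, y / g ^ j ∈ F (u + 1))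
    (hε : 1 ≤ ε) (hpow : ∀ u, 1 ≤ u → ∀ x ∈ F u, x ^ p ∈ F (lam p ε u))
    (hsur : ∀ u, 1 ≤ u → ∀ y ∈ F (lam p ε u), ∃ x ∈ F u, y / x ^ p ∈ F (lam p ε u + 1))
    {n0 : ℤ} (hn0 : 1 ≤ n0) (hbot : F n0 = ⊥) (hcnt : ∀ n, cnt T n ≤ m)
    {x : Q} (hx : x ∈ F 1) (hord : p ^ m ∣ orderOf x) :
    cnt T n0 = m ∧ (∀ u, 1 ≤ u → cnt T (lam p ε u) ≤ cnt T u + 1) ∧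
      ∀ u, 1 ≤ u → T (lam p ε u) → cnt T u + 1 ≤ cnt T (lam p ε u) := by
  have hp : p.Prime := Fact.out
  have hpow1 : ∀ u, 1 ≤ u → ∀ x ∈ F u, x ^ p ∈ F (u + 1) := fun u hu x hx =>
    hanti _ _ (lt_lam hp.two_le hε hu) (hpow u hu x hx)
  have hdvd : ∀ k : ℕ, x ^ p ^ k = 1 → m ≤ k := fun k hk =>
    (Nat.pow_dvd_pow_iff_le_right hp.one_lt).1 (hord.trans (orderOf_dvd_of_pow_eq_one hk))
  have hzdvd : ∀ k : ℤ, x ^ k = 1 → (p : ℤ) ^ m ∣ k := fun k hk => by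
    have := orderOf_dvd_iff_zpow_eq_one.2 hk
    exact (by exact_mod_cast hord : ((p : ℤ) ^ m) ∣ orderOf x).trans this
  have hfrom1 : ∀ u, 1 ≤ u → x ^ p ^ cnt T u ∈ F u := fun u hu => by
    have := pow_mem_filtration hpow1 hT le_rfl hx (u - 1).toNat
    rwa [cnt_one, Nat.sub_zero, show 1 + ((u - 1).toNat : ℤ) = u by omega] at this
  have hcn0 : cnt T n0 = m := by
    refine le_antisymm (hcnt _) (hdvd _ ?_)
    have := hfrom1 n0 hn0
    rwa [hbot, Subgroup.mem_bot] at this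
  have hTn0 : ∀ u, 1 ≤ u → T u → u < n0 := fun u hu hTu => by
    by_contra hle
    have h1 := cnt_mono T (not_lt.1 hle)
    have h2 := cnt_succ T hu
    rw [if_pos hTu] at h2
    have := hcnt (u + 1)
    omega
  have key : ∀ u, 1 ≤ u → ∀ k, k < m → x ^ p ^ k ∈ F u → cnt T u ≤ k := by
    intro u hu k hk hmem
    have hun : u < n0 := by
      by_contra hle
      have := hanti _ _ (not_lt.1 hle) hmem
      rw [hbot, Subgroup.mem_bot] at this
      have := hdvd k this
      omega
    have h1 := pow_mem_filtration hpow1 hT hu hmem (n0 - u).toNat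
    rw [show u + ((n0 - u).toNat : ℤ) = n0 by omega, hbot, Subgroup.mem_bot, ← pow_mul, ← pow_add,
      hcn0] at h1
    have := hdvd _ h1
    have := hcnt u
    omega
  have hgen : ∀ k : ℕ, 1 ≤ n0 - k → F (n0 - k) ≤ Subgroup.zpowers (x ^ p ^ cnt T (n0 - k)) := by
    intro k
    induction k with
    | zero => intro _; simp [hbot]
    | succ k ih =>
      intro hk
      obtain ⟨u, rfl⟩ : ∃ u, n0 = u + k + 1 := ⟨n0 - k - 1, by ring⟩
      rw [show u + k + 1 - (k + 1 : ℕ) = u by push_cast; ring] at hk ⊢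
      rw [show u + k + 1 - k = u + 1 by ring] at ih
      specialize ih (by omega)
      rw [cnt_succ T hk] at ih
      split_ifs at ih with hTu
      · intro y hy
        have hx' := hfrom1 u hk
        have hnot : x ^ p ^ cnt T u ∉ F (u + 1) := fun hmem => by
          have h2 := cnt_succ T hk
          rw [if_pos hTu] at h2
          have := hcnt (u + 1)
          have := key (u + 1) (by omega) _ (by omega) hmem
          omega
        obtain ⟨g, hg, hgg⟩ := hcyc u hk
        obtain ⟨j, hj⟩ := hgg _ hx'
        obtain ⟨i, hi⟩ := hgg y hy
        have hgp := hpow1 u hk g hg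
        have hpj : ¬p ∣ j := by
          rintro ⟨l, rfl⟩
          refine hnot ?_
          have := (F (u + 1)).mul_mem hj ((F (u + 1)).pow_mem hgp l)
          rwa [← pow_mul, div_mul_cancel] at this
        obtain ⟨a, b, hab⟩ : ∃ a b : ℤ, j * a + p * b = 1 := by
          have hco : IsCoprime (j : ℤ) p :=
            Nat.isCoprime_iff_coprime.2 ((hp.coprime_iff_not_dvd.2 hpj).symm)
          obtain ⟨a, b, h⟩ := hco
          exact ⟨a, b, by linarith⟩
        set x' := x ^ p ^ cnt T u with hx'def
        have hmem : y / x' ^ (a * i) ∈ F (u + 1) := by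
          have h1 := (F (u + 1)).mul_mem (Subgroup.mul_mem _ hi (Subgroup.zpow_mem _ (Subgroup.inv_mem _ hj) (a * i)))
            (Subgroup.zpow_mem _ hgp (b * i))
          convert h1 using 1
          have h2 : g ^ i = (g ^ j) ^ (a * i) * (g ^ p) ^ (b * i) := by
            rw [← zpow_natCast g i, ← zpow_natCast g j, ← zpow_natCast g p, ← zpow_mul, ← zpow_mul,
              ← zpow_add]
            congr 1
            linear_combination -(i : ℤ) * hab
          rw [h2, inv_div, div_zpow]
          generalize (g ^ j) ^ (a * (i : ℤ)) = A
          generalize (g ^ p) ^ (b * (i : ℤ)) = B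
          generalize x' ^ (a * (i : ℤ)) = C
          rw [show y / (A * B) * (A / C) * B = y / (A * B) * (A * B) / C by
            simp only [div_eq_mul_inv]; ac_rfl, div_mul_cancel]
        have h3 := ih hmem
        rw [pow_succ, pow_mul, ← hx'def] at h3
        have h4 : Subgroup.zpowers (x' ^ p) ≤ Subgroup.zpowers x' :=
          Subgroup.zpowers_le.2 (Subgroup.pow_mem _ (Subgroup.mem_zpowers _) _)
        have := Subgroup.mul_mem _ (h4 h3) (Subgroup.zpow_mem _ (Subgroup.mem_zpowers x') (a * i))
        rwa [div_mul_cancel] at this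
      · exact (hT u hk hTu).trans ih
  have hgen' : ∀ u, 1 ≤ u → u ≤ n0 → F u ≤ Subgroup.zpowers (x ^ p ^ cnt T u) := fun u hu hun => by
    have := hgen (n0 - u).toNat
    rw [show n0 - ((n0 - u).toNat : ℤ) = u by omega] at this
    exact this hu
  refine ⟨hcn0, fun u hu => ?_, fun u hu hTl => ?_⟩
  · by_contra! hlt
    have h1 := hpow u hu _ (hfrom1 u hu)
    rw [← pow_mul, ← pow_succ] at h1
    have := hcnt (lam p ε u)
    have := key _ (hu.trans (lt_lam hp.two_le hε hu).le) _ (by omega) h1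
    omega
  · by_contra! hlt
    have hul := lt_lam hp.two_le hε hu
    have hln := hTn0 _ (by omega) hTl
    obtain ⟨x1, hx1, hx2⟩ := hsur u hu _ (hfrom1 (lam p ε u) (by omega))
    obtain ⟨a, ha⟩ := Subgroup.mem_zpowers_iff.1 (hgen' u hu (by omega) hx1)
    obtain ⟨b, hb⟩ := Subgroup.mem_zpowers_iff.1 (hgen' _ (by omega) (by omega) hx2)
    have h2 := cnt_succ T (show 1 ≤ lam p ε u by omega)
    rw [if_pos hTl] at h2
    have h3 := hcnt (lam p ε u + 1)
    rw [h2] at hb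
    set c := cnt T (lam p ε u)
    set d := cnt T u
    have h4 : x ^ ((a * p ^ (d + 1) + b * p ^ (c + 1) - p ^ c : ℤ)) = 1 := by
      rw [eq_div_iff_mul_eq', ← ha] at hb
      rw [zpow_sub, zpow_add, mul_comm a, mul_comm b, zpow_mul, zpow_mul]
      have e1 : ∀ k : ℕ, x ^ ((p : ℤ) ^ k) = x ^ p ^ k := fun k => by
        rw [← zpow_natCast]; push_cast; rfl
      rw [e1, e1, e1, mul_inv_eq_one, ← hb, mul_comm, pow_succ p d, pow_mul x, ← zpow_natCast _ p,
        ← zpow_natCast _ p, ← zpow_mul, ← zpow_mul]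
      rw [mul_comm a]
    have h5 := (pow_dvd_pow (p : ℤ) (show c + 1 ≤ m by omega)).trans (hzdvd _ h4)
    have h6 : (p : ℤ) ^ (c + 1) ∣ a * p ^ (d + 1) + b * p ^ (c + 1) :=
      dvd_add (Dvd.dvd.mul_left (pow_dvd_pow _ (by omega)) _) (Dvd.dvd.mul_left dvd_rfl _)
    have h7 := (dvd_sub_right h6).1 h5
    have : p ^ (c + 1) ∣ p ^ c := by exact_mod_cast h7
    have := (Nat.pow_dvd_pow_iff_le_right hp.one_lt).1 this
    omega

end

section
variable {p m : ℕ} {t : Fin m → ℤ}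

lemma cnt_apply (ht : StrictMono t) (h1 : ∀ i, 1 ≤ t i) (i : Fin m) :
    cnt (fun u => ∃ i, t i = u) (t i) = i := by
  have : (Finset.Ico 1 (t i)).filter (fun u => ∃ i, t i = u) = (Finset.Iio i).image t := by
    ext u
    simp only [Finset.mem_filter, Finset.mem_Ico, Finset.mem_image, Finset.mem_Iio]
    constructor
    · rintro ⟨⟨-, hu⟩, j, rfl⟩
      exact ⟨j, ht.lt_iff_lt.1 hu, rfl⟩
    · rintro ⟨j, hj, rfl⟩
      exact ⟨⟨h1 j, ht hj⟩, j, rfl⟩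
  have h2 := congrArg Finset.card this
  rw [Finset.card_image_of_injective _ ht.injective, Fin.card_Iio] at h2
  rw [← h2, cnt]
  congr!

lemma cnt_le_iff (ht : StrictMono t) (h1 : ∀ i, 1 ≤ t i) {i : Fin m} {u : ℤ} :
    cnt (fun u => ∃ i, t i = u) u ≤ i ↔ u ≤ t i := by
  constructor
  · intro h
    by_contra! hlt
    have h2 := cnt_mono (fun u => ∃ i, t i = u) (show t i + 1 ≤ u by omega)
    rw [cnt_succ _ (h1 i), cnt_apply ht h1, if_pos ⟨i, rfl⟩] at h2
    omega
  · intro h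
    exact (cnt_mono _ h).trans (cnt_apply ht h1 i).le

lemma lam_strictMono (hp : 0 < p) (ε : ℤ) : StrictMono (lam p ε) := by
  intro u w huw
  have : (0 : ℤ) < p := by exact_mod_cast hp
  exact lt_min ((min_le_left _ _).trans_lt (by nlinarith))
    ((min_le_right _ _).trans_lt (by omega))

/-- Every integer that is divisible by `p` or at least `p * ε / (p - 1)` is in the image of
`lam`. -/
lemma exists_lam_eq (hp : p.Prime) {ε w : ℤ} (hw : 1 ≤ w)
    (h : ¬(((p : ℤ) - 1) * w < p * ε ∧ Int.gcd w p = 1)) : ∃ u, 1 ≤ u ∧ lam p ε u = w := by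
  have hp2 : (2 : ℤ) ≤ p := by exact_mod_cast hp.two_le
  by_cases hlt : ((p : ℤ) - 1) * w < p * ε
  · have hd : (p : ℤ) ∣ w := by
      by_contra hd
      refine h ⟨hlt, ?_⟩
      rw [Int.gcd_comm]
      exact (Nat.prime_iff_prime_int.1 hp).coprime_iff_not_dvd.2 hd |> Int.isCoprime_iff_gcd_eq_one.1
    obtain ⟨u, rfl⟩ := hd
    have hu : 1 ≤ u := by nlinarith
    refine ⟨u, hu, min_eq_left ?_⟩
    have : (p : ℤ) * (((p : ℤ) - 1) * u) < p * ε := by linarith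
    have := lt_of_mul_lt_mul_left this (by omega)
    linarith
  · have hge := not_lt.1 hlt
    have h2 : ε ≤ ((p : ℤ) - 1) * (w - ε) := by linarith
    refine ⟨w - ε, ?_, ?_⟩
    · by_contra hneg
      have : ((p : ℤ) - 1) * (w - ε) ≤ 0 :=
        mul_nonpos_of_nonneg_of_nonpos (by omega) (by omega)
      omega
    · rw [lam, min_eq_right (by linarith)]
      ring

/-- The numerical conditions on the jumps. -/
theorem conditions_of_cnt (hp : p.Prime) {e : ℕ} (he : 1 ≤ e) (hm : 0 < m) (ht : StrictMono t)
    (h1 : ∀ i, 1 ≤ t i)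
    (hA : ∀ u, 1 ≤ u → cnt (fun u => ∃ i, t i = u) (lam p e u) ≤ cnt (fun u => ∃ i, t i = u) u + 1)
    (hB : ∀ u, 1 ≤ u → (∃ i, t i = lam p e u) →
      cnt (fun u => ∃ i, t i = u) u + 1 ≤ cnt (fun u => ∃ i, t i = u) (lam p e u)) :
    ((1 ≤ t ⟨0, hm⟩ ∧ ((p : ℤ) - 1) * t ⟨0, hm⟩ < (p : ℤ) * e ∧
        Int.gcd (t ⟨0, hm⟩) p = 1) ∧
      (∀ i : Fin m, ∀ hi : (i : ℕ) + 1 < m,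
        ((p : ℤ) - 1) * t i < (e : ℤ) →
          (t ⟨(i : ℕ) + 1, hi⟩ = (p : ℤ) * t i ∨
            ((p : ℤ) * t i < t ⟨(i : ℕ) + 1, hi⟩ ∧
              ((p : ℤ) - 1) * t ⟨(i : ℕ) + 1, hi⟩ < (p : ℤ) * e ∧
              Int.gcd (t ⟨(i : ℕ) + 1, hi⟩) p = 1))) ∧
      (∀ i : Fin m, ∀ hi : (i : ℕ) + 1 < m,
        (e : ℤ) ≤ ((p : ℤ) - 1) * t i →
          t ⟨(i : ℕ) + 1, hi⟩ = t i + e)) := by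
  have hp2 : (2 : ℤ) ≤ p := by exact_mod_cast hp.two_le
  have he' : (1 : ℤ) ≤ e := by exact_mod_cast he
  have hle : ∀ i : Fin m, ∀ hi : (i : ℕ) + 1 < m, lam p e (t i) ≤ t ⟨(i : ℕ) + 1, hi⟩ := by
    intro i hi
    rw [← cnt_le_iff ht h1]
    have := hA _ (h1 i)
    rwa [cnt_apply ht h1] at this
  have heq : ∀ i : Fin m, ∀ hi : (i : ℕ) + 1 < m,
      ¬(((p : ℤ) - 1) * t ⟨(i : ℕ) + 1, hi⟩ < p * e ∧ Int.gcd (t ⟨(i : ℕ) + 1, hi⟩) p = 1) →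
      t ⟨(i : ℕ) + 1, hi⟩ = lam p e (t i) := by
    intro i hi hcon
    obtain ⟨u, hu, hlu⟩ := exists_lam_eq hp (h1 _) hcon
    have h2 := hB u hu ⟨_, hlu.symm⟩
    rw [hlu, cnt_apply ht h1] at h2
    have h3 : u ≤ t i := (cnt_le_iff ht h1).1 (by simp only at h2; omega)
    refine le_antisymm ?_ (hle i hi)
    rw [← hlu]
    exact (lam_strictMono hp.pos e).monotone h3
  refine ⟨⟨h1 _, ?_⟩, ?_, ?_⟩
  · by_contra hcon
    obtain ⟨u, hu, hlu⟩ := exists_lam_eq hp (h1 _) hcon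
    have h2 := hB u hu ⟨_, hlu.symm⟩
    rw [hlu, cnt_apply ht h1] at h2
    simp at h2
  · intro i hi hlt
    have hlam : lam p e (t i) = p * t i := min_eq_left (by linarith)
    by_cases hc : ((p : ℤ) - 1) * t ⟨(i : ℕ) + 1, hi⟩ < p * e ∧ Int.gcd (t ⟨(i : ℕ) + 1, hi⟩) p = 1
    · have := hle i hi
      rw [hlam] at this
      rcases this.eq_or_lt with h | h
      · exact Or.inl h.symm
      · exact Or.inr ⟨h, hc⟩
    · exact Or.inl (by rw [heq i hi hc, hlam])
  · intro i hi hge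
    have hlam : lam p e (t i) = t i + e := min_eq_right (by linarith)
    rw [← hlam]
    refine heq i hi fun hc => ?_
    have h3 := hle i hi
    rw [hlam] at h3
    nlinarith [hc.1]

end

section
variable {F : Type*} [Field F] {v : AddValuation F (WithTop ℤ)} {p m : ℕ}

/-- Some power prime to `p` sends all units into the principal units. -/
lemma exists_coprime_pow_isU [Fact p.Prime] (hp : (p : F) ∈ ball v 1) (hfin : FinRes v) :
    ∃ k : ℕ, 0 < k ∧ Nat.Coprime p k ∧
      ∀ x, v x = ((0 : ℤ) : WithTop ℤ) → IsU v 1 (x ^ k) := by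
  have := finite_residue_iff.1 hfin
  have := charP_residue (p := p) hp
  have := Fintype.ofFinite (IsLocalRing.ResidueField (Ov v))
  set k := IsLocalRing.ResidueField (Ov v)
  have hpp : p.Prime := Fact.out
  have h1 : 1 < Fintype.card k := Fintype.one_lt_card
  refine ⟨Fintype.card k - 1, by omega, ?_, ?_⟩
  · obtain ⟨n, -, hn⟩ := FiniteField.card k p
    rw [hpp.coprime_iff_not_dvd]
    intro hd
    have h2 : p ∣ Fintype.card k := hn ▸ dvd_pow_self p n.pos.ne'
    have h3 := (Nat.dvd_sub h2 hd)
    rw [Nat.sub_sub_self h1.le] at h3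
    exact hpp.one_lt.ne' (Nat.dvd_one.1 h3)
  · intro x hx
    have hx0 : x ∈ ball v 0 := mem_ball_of_val hx
    have h2 : IsUnit (⟨x, mem_Ov.2 hx0⟩ : Ov v) := isUnit_Ov_iff.2 hx
    have h3 := FiniteField.pow_card_sub_one_eq_one (IsLocalRing.residue (Ov v) ⟨x, mem_Ov.2 hx0⟩)
      (h2.map _).ne_zero
    rw [← map_pow, ← map_one (IsLocalRing.residue (Ov v)), residue_eq_iff] at h3
    simpa [IsU] using h3

/-- The group of principal units of level `max u 1`. -/
def Usub (v : AddValuation F (WithTop ℤ)) (u : ℤ) : Subgroup Fˣ where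
  carrier := {x | IsU v (max u 1) (x : F)}
  one_mem' := by simpa using isU_one (v := v) (max u 1)
  mul_mem' ha hb := by
    simpa using IsU.mul (le_max_right _ _) ha hb
  inv_mem' ha := by
    simpa using IsU.inv (le_max_right _ _) ha

lemma mem_Usub {u : ℤ} (hu : 1 ≤ u) {x : Fˣ} : x ∈ Usub v u ↔ IsU v u (x : F) := by
  have : x ∈ Usub v u ↔ IsU v (max u 1) (x : F) := Iff.rfl
  rw [this, max_eq_left hu]

lemma Usub_anti {u w : ℤ} (h : u ≤ w) : Usub v w ≤ Usub v u := fun _ hx =>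
  IsU.anti (max_le_max_right 1 h) hx

lemma exists_Usub {u : ℤ} (hu : 1 ≤ u) {x : F} (hx : IsU v u x) : ∃ y ∈ Usub v u, (y : F) = x :=
  ⟨Units.mk0 x (hx.ne_zero hu), (mem_Usub hu).2 hx, rfl⟩

lemma LocField.Usub_pow [Fact p.Prime] {ε : ℤ} (h : LocField p v ε) {u : ℤ} (hu : 1 ≤ u) {x : Fˣ}
    (hx : x ∈ Usub v u) : x ^ p ∈ Usub v (lam p ε u) := by
  have := lt_lam (p := p) (Nat.Prime.two_le Fact.out) h.one_le hu
  rw [mem_Usub (by omega)]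
  simpa [lam] using h.pow_mem (by omega) ((mem_Usub hu).1 hx)

lemma LocField.exists_Usub_pow [Fact p.Prime] {ε : ℤ} (h : LocField p v ε)
    (hζ : ¬∃ ζ : F, IsPrimitiveRoot ζ p) {u : ℤ} (hu : 1 ≤ u) {y : Fˣ}
    (hy : y ∈ Usub v (lam p ε u)) : ∃ x ∈ Usub v u, y / x ^ p ∈ Usub v (lam p ε u + 1) := by
  have hlam := lt_lam (p := p) (Nat.Prime.two_le Fact.out) h.one_le hu
  rw [mem_Usub (by omega)] at hy
  have key : ∃ x, IsU v u x ∧ IsU v (lam p ε u + 1) (y / x ^ p) := by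
    by_cases hlt : ((p : ℤ) - 1) * u < ε
    · have h1 : lam p ε u = p * u := min_eq_left (by linarith)
      rw [h1] at hy ⊢
      exact h.exists_pow_of_lt hu hlt hy
    · have h1 : lam p ε u = u + ε := min_eq_right (by linarith)
      rw [h1] at hy ⊢
      exact h.exists_pow_of_ge hζ hu (not_lt.1 hlt) hy
  obtain ⟨x, hx, hxy⟩ := key
  obtain ⟨x, hx', rfl⟩ := exists_Usub hu hx
  exact ⟨x, hx', (mem_Usub (by omega)).2 (by simpa using hxy)⟩

lemma cnt_le_of_injective {f : ℤ → ℤ} {s : ℕ → ℤ} {T : ℤ → Prop}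
    (hT : ∀ u, T u ↔ ∃ a < m, f u = s a) (hf : Function.Injective f) (n : ℤ) :
    cnt T n ≤ m ∧ (cnt T n = m → ∀ a < m, ∃ u, 1 ≤ u ∧ f u = s a) := by
  have h1 : ((Finset.Ico 1 n).filter T).image f ⊆ (Finset.range m).image s := by
    intro x hx
    simp only [Finset.mem_image, Finset.mem_filter, Finset.mem_range] at hx ⊢
    obtain ⟨u, ⟨-, hu⟩, rfl⟩ := hx
    obtain ⟨a, ha, hu⟩ := (hT u).1 hu
    exact ⟨a, ha, hu.symm⟩
  have h2 := Finset.card_image_of_injective ((Finset.Ico 1 n).filter T) hf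
  have h3 := (Finset.card_image_le (s := Finset.range m) (f := s)).trans_eq (Finset.card_range m)
  have h4 := Finset.card_le_card h1
  refine ⟨by rw [cnt]; omega, fun h a ha => ?_⟩
  rw [cnt] at h
  have h5 := Finset.eq_of_subset_of_card_le h1 (by omega)
  have h6 : s a ∈ (Finset.range m).image s := Finset.mem_image_of_mem _ (Finset.mem_range.2 ha)
  rw [← h5] at h6
  simp only [Finset.mem_image, Finset.mem_filter, Finset.mem_Ico] at h6
  obtain ⟨u, ⟨⟨hu, -⟩, -⟩, hua⟩ := h6
  exact ⟨u, hu, hua⟩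

end

section
variable {K M : Type*} [Field K] [Field M] [Algebra K M] {p m : ℕ} [Fact p.Prime]
  [Algebra ℚ_[p] K] [Algebra ℚ_[p] M] [IsScalarTower ℚ_[p] K M] [FiniteDimensional ℚ_[p] M]
  {vK : AddValuation K (WithTop ℤ)} {vM : AddValuation M (WithTop ℤ)} {σ : M ≃ₐ[K] M}
  {ε : ℤ} {s : ℕ → ℤ}

/-- The positions of the jumps of a cyclic totally ramified extension relative to `lam`. -/
theorem CycTR.upSet_numerics {eM : ℕ} (hM : IsPadicValuation p vM eM)
    (h : CycTR p m vK vM σ ε s) (hK : LocField p vK ε) (hζ : ¬∃ ζ : K, IsPrimitiveRoot ζ p) :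
    (∀ a < m, ∃ u, 1 ≤ u ∧ psi p m s u = s a) ∧
      (∀ u, 1 ≤ u → cnt (upSet p m s) (lam p ε u) ≤ cnt (upSet p m s) u + 1) ∧
      ∀ u, 1 ≤ u → upSet p m s (lam p ε u) →
        cnt (upSet p m s) u + 1 ≤ cnt (upSet p m s) (lam p ε u) := by
  have hpp : p.Prime := Fact.out
  have hfd := h.tr.finiteDimensional
  have : CharZero K := charZero_of_injective_algebraMap (algebraMap ℚ_[p] K).injective
  have hnf := h.normFil hK.fin
  obtain ⟨n0, hn0, hroot⟩ := exists_prime_pow_root hK.cpl hpp hK.valp (by linarith [hK.one_le]) m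
  obtain ⟨x0, hx0, hx0N⟩ := exists_unit_of_norm_order hM h.tr h.gal h.gen
  obtain ⟨k, hk0, hkp, hk⟩ := exists_coprime_pow_isU hK.p_mem hK.fin
  obtain ⟨x, hx, hxk⟩ := exists_Usub le_rfl (hk x0 hx0)
  have hnorm : ∀ y : M, y ≠ 0 → ∀ a b : Kˣ, (b : K) = a / Algebra.norm K y →
      (QuotientGroup.mk' (normGroup K M)) a = QuotientGroup.mk' (normGroup K M) b := by
    intro y hy a b hab
    refine (QuotientGroup.eq (s := normGroup K M)).2
      ⟨(Units.mk0 y hy)⁻¹, Units.ext ?_⟩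
    have : Algebra.norm K y ≠ 0 := by simpa using hy
    simp [hab]
    field_simp
  have hmap : ∀ u (x : Kˣ), x ∈ Usub vK u → QuotientGroup.mk' (normGroup K M) x ∈
      (Usub vK u).map (QuotientGroup.mk' (normGroup K M)) := fun u x hx => ⟨x, hx, rfl⟩
  have hcnt := fun n => cnt_le_of_injective (m := m) (s := s) (T := upSet p m s) (fun _ => Iff.rfl)
    (StrictMono.injective fun u w huw => psi_lt hpp.pos m s huw) n
  have key := filtration_numerics (Q := Kˣ ⧸ normGroup K M) (p := p) (m := m) (T := upSet p m s)
    (F := fun u => (Usub vK u).map (QuotientGroup.mk' (normGroup K M))) (ε := ε) (n0 := n0)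
    (x := QuotientGroup.mk' (normGroup K M) x)
    (fun u w huw => Subgroup.map_mono (Usub_anti huw)) ?_ ?_ hK.one_le ?_ ?_ hn0 ?_
    (fun n => (hcnt n).1) (hmap _ _ hx) ?_
  · exact ⟨(hcnt n0).2 key.1, key.2⟩
  · rintro u hu hT _ ⟨y, hy, rfl⟩
    obtain ⟨z, hz, hyz⟩ := hnf.surj u hu hT y ((mem_Usub hu).1 hy)
    obtain ⟨w, hw, hwy⟩ := exists_Usub (by omega) hyz
    rw [hnorm z (hz.ne_zero (hnf.one_le u hu)) y w hwy]
    exact hmap _ _ hw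
  · intro u hu
    obtain ⟨g, hg, hgy⟩ := hnf.cyclic u hu
    obtain ⟨g, hg', rfl⟩ := exists_Usub hu hg
    refine ⟨_, hmap _ _ hg', ?_⟩
    rintro _ ⟨y, hy, rfl⟩
    obtain ⟨j, z, hz, hyz⟩ := hgy y ((mem_Usub hu).1 hy)
    obtain ⟨w, hw, hwy⟩ := exists_Usub (by omega) hyz
    refine ⟨j, ?_⟩
    change QuotientGroup.mk' (normGroup K M) (y / g ^ j) ∈ _
    rw [hnorm z (hz.ne_zero (hnf.one_le u hu)) (y / g ^ j) w
      (by rw [hwy]; push_cast; rw [div_div])]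
    exact hmap _ _ hw
  · rintro u hu _ ⟨y, hy, rfl⟩
    exact ⟨y ^ p, hK.Usub_pow hu hy, map_pow _ _ _⟩
  · rintro u hu _ ⟨y, hy, rfl⟩
    obtain ⟨z, hz, hyz⟩ := hK.exists_Usub_pow hζ hu hy
    exact ⟨_, hmap _ _ hz, ⟨_, hyz, rfl⟩⟩
  · rw [eq_bot_iff]
    rintro _ ⟨y, hy, rfl⟩
    obtain ⟨z, hz, hzy⟩ := hroot y ((mem_Usub hn0).1 hy)
    have hz0 : algebraMap K M z ≠ 0 := by simpa using hz.ne_zero le_rfl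
    rw [Subgroup.mem_bot, hnorm _ hz0 y 1 (by
      rw [Algebra.norm_algebraMap, h.tr.rank, hzy, Units.val_one, div_self y.ne_zero]), map_one]
  · have h1 : orderOf (QuotientGroup.mk' (normGroup K M) x) ∣ _ := dvd_rfl
    rw [orderOf_dvd_iff_pow_eq_one, ← map_pow] at h1
    obtain ⟨y, hy⟩ := (QuotientGroup.eq_one_iff (N := normGroup K M) _).1 h1
    refine (Nat.Coprime.dvd_mul_left (hkp.pow_left m)).1 (hx0N _ ⟨y, y.ne_zero, ?_⟩)
    have h2 := congrArg Units.val hy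
    simpa [hxk, ← pow_mul] using h2

end

section
variable {p m : ℕ} {s : ℕ → ℤ}

/-- The number of indices below `m` at which `s` is less than `i`. -/
def numLT (m : ℕ) (s : ℕ → ℤ) (i : ℤ) : ℕ := ∑ a ∈ Finset.range m, if s a < i then 1 else 0

lemma numLT_eq_zero {i : ℤ} (h : ∀ a < m, i ≤ s a) : numLT m s i = 0 :=
  Finset.sum_eq_zero fun a ha => if_neg (h a (Finset.mem_range.1 ha)).not_gt

lemma numLT_le (m : ℕ) (s : ℕ → ℤ) (i : ℤ) : numLT m s i ≤ m := by
  refine (Finset.sum_le_sum (g := fun _ => 1) fun a _ => ?_).trans (by simp)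
  split_ifs <;> omega

lemma numLT_succ (m : ℕ) (s : ℕ → ℤ) (i : ℤ) :
    numLT (m + 1) s i = numLT m (fun a => s (a + 1)) i + if s 0 < i then 1 else 0 :=
  Finset.sum_range_succ' _ _

lemma numLT_le_iff (hs : ∀ a, a + 1 < m → s a < s (a + 1)) {a : ℕ} (ha : a < m) {i : ℤ} :
    numLT m s i ≤ a ↔ i ≤ s a := by
  induction m generalizing s a with
  | zero => omega
  | succ m ih =>
    rw [numLT_succ]
    rcases a with _ | a
    · constructor
      · intro h
        by_contra hlt
        rw [if_pos (not_le.1 hlt)] at h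
        omega
      · intro h
        rw [if_neg h.not_gt, numLT_eq_zero fun b hb =>
          h.trans (lt_of_strict hs (Nat.succ_pos b) (by omega)).le]
    · have h1 := ih (s := fun a => s (a + 1)) (fun a ha => hs _ (by omega)) (a := a) (by omega)
      have h2 : s 0 < s (a + 1) := lt_of_strict hs (Nat.succ_pos a) (by omega)
      split_ifs with h
      · rw [← h1]; omega
      · have : i ≤ s (a + 1) := by omega
        have := h1.2 this
        constructor <;> intro <;> omega

/-- The Herbrand function for the lower jumps `s 0, …, s (m - 1)`. -/
def phi (p m : ℕ) (s : ℕ → ℤ) (n : ℤ) : ℚ :=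
  if n ≤ 0 then n else ∑ i ∈ Finset.Icc (1 : ℤ) n, ((p : ℚ) ^ numLT m s i)⁻¹

lemma phi_add_one (p m : ℕ) (s : ℕ → ℤ) {n : ℤ} (hn : 0 ≤ n) :
    phi p m s (n + 1) = phi p m s n + ((p : ℚ) ^ numLT m s (n + 1))⁻¹ := by
  have h1 : Finset.Icc (1 : ℤ) (n + 1) = insert (n + 1) (Finset.Icc 1 n) := by
    ext; simp; omega
  rw [phi, if_neg (by omega), h1, Finset.sum_insert (by simp), add_comm, phi]
  split_ifs with h
  · obtain rfl : n = 0 := by omega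
    simp
  · rfl

lemma phi_of_le (p : ℕ) {n : ℤ} (h : ∀ a < m, n ≤ s a) : phi p m s n = n := by
  rcases le_or_gt n 0 with h0 | h0
  · rw [phi, if_pos h0]
  · induction n, h0 using Int.leInduction with
    | base =>
      have := phi_add_one p m s (le_refl 0)
      rw [numLT_eq_zero (by simpa using h)] at this
      simpa [phi] using this
    | succ n hn ih =>
      rw [phi_add_one p m s (by omega), numLT_eq_zero h, ih fun a ha => by linarith [h a ha]]
      simp

lemma phi_lt (hp : 0 < p) {n k : ℤ} (h : n < k) : phi p m s n < phi p m s k := by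
  have hp' : (0 : ℚ) < p := by exact_mod_cast hp
  have key : ∀ n, phi p m s n < phi p m s (n + 1) := by
    intro n
    rcases lt_or_ge n 0 with h0 | h0
    · rw [phi, phi, if_pos (by omega), if_pos (by omega)]
      exact_mod_cast lt_add_one n
    · rw [phi_add_one p m s h0]
      have : 0 < ((p : ℚ) ^ numLT m s (n + 1))⁻¹ := by positivity
      linarith
  exact strictMono_int_of_lt_succ key h

lemma phi_succ (hp : 0 < p) (h0 : 1 ≤ s 0) (hs : ∀ a, a + 1 < m + 1 → s a < s (a + 1)) {n : ℤ}
    (hn : s 0 ≤ n) :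
    phi p (m + 1) s n = s 0 + (phi p m (fun a => s (a + 1)) n - s 0) / p := by
  have hle : ∀ a < m + 1, s 0 ≤ s a := fun a ha => by
    rcases Nat.eq_zero_or_pos a with rfl | h
    · exact le_rfl
    · exact (lt_of_strict hs h ha).le
  have hp' : (0 : ℚ) < p := by exact_mod_cast hp
  induction n, hn using Int.leInduction with
  | base => rw [phi_of_le p hle, phi_of_le p fun a ha => hle (a + 1) (by omega)]; simp
  | succ n hn ih =>
    rw [phi_add_one _ _ _ (by omega), phi_add_one _ _ _ (by omega), ih, numLT_succ,
      if_pos (by omega), pow_succ]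
    field_simp
    ring

lemma phi_psi (hp : 0 < p) (h1 : ∀ a < m, 1 ≤ s a) (hs : ∀ a, a + 1 < m → s a < s (a + 1))
    (u : ℤ) : phi p m s (psi p m s u) = u := by
  have hp' : (0 : ℚ) < p := by exact_mod_cast hp
  induction m generalizing s u with
  | zero => exact phi_of_le p (by simp)
  | succ m ih =>
    have ih' := ih (s := fun a => s (a + 1)) (fun a ha => h1 _ (by omega))
      (fun a ha => hs _ (by omega))
    have hle : ∀ a < m + 1, s 0 ≤ s a := fun a ha => by
      rcases Nat.eq_zero_or_pos a with rfl | h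
      · exact le_rfl
      · exact (lt_of_strict hs h ha).le
    rcases le_or_gt u (s 0) with h | h
    · have := fun a (ha : a < m + 1) => h.trans (hle a ha)
      rw [psi_of_le _ _ this, phi_of_le p this]
    · rw [phi_succ hp (h1 0 (by omega)) hs (h.le.trans (le_psi hp _ _ _)), psi, ih', psi1,
        if_neg (by omega)]
      push_cast
      field_simp
      ring

end

lemma exists_eq_mul_prime_pow (p m : ℕ) (k : ℤ) :
    (p : ℤ) ^ m ∣ k ∨ ∃ a < m, ∃ b : ℤ, ¬(p : ℤ) ∣ b ∧ k = b * p ^ a := by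
  induction m with
  | zero => simp
  | succ m ih =>
    rcases ih with ⟨b, rfl⟩ | ⟨a, ha, h⟩
    · by_cases hb : (p : ℤ) ∣ b
      · obtain ⟨c, rfl⟩ := hb
        exact Or.inl ⟨c, by ring⟩
      · exact Or.inr ⟨m, by omega, b, hb, by ring⟩
    · exact Or.inr ⟨a, by omega, h⟩

section
variable {K M : Type*} [Field K] [Field M] [Algebra K M] {p m : ℕ}
  {vK : AddValuation K (WithTop ℤ)} {vM : AddValuation M (WithTop ℤ)} {σ : M ≃ₐ[K] M}
  {ε : ℤ} {s : ℕ → ℤ}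

lemma CycTR.orderOf_eq (h : CycTR p m vK vM σ ε s) : orderOf σ = p ^ m := by
  have := h.tr.finiteDimensional
  have := h.gal
  rw [orderOf_eq_card_of_forall_mem_zpowers h.gen, IsGalois.card_aut_eq_finrank, h.tr.rank]

lemma CycTR.mem_lowerRG (h : CycTR p m vK vM σ ε s) (hinv : GalInvariant K vM) {a : ℕ} (ha : a < m)
    {b : ℤ} (hb : ¬(p : ℤ) ∣ b) {i : ℤ} : σ ^ (b * p ^ a) ∈ lowerRG vM hinv i ↔ i ≤ s a := by
  obtain ⟨π, hπ⟩ := exists_unif h.tr.normF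
  have hj := h.jump π hπ a ha b hb
  constructor
  · intro hg
    have := hg π (by rw [hπ]; exact WithTop.coe_le_coe.2 zero_le_one)
    rw [hj] at this
    have := WithTop.coe_le_coe.1 this
    omega
  · intro hi x hx
    obtain ⟨c, -, hc⟩ := h.tr.exists_residue (x := x) (by simpa [mem_ball] using hx)
    have h1 := h.tr.diff_mem hπ ((σ ^ (b * (p : ℤ) ^ a) : M ≃ₐ[K] M) : M →ₐ[K] M) (hinv _)
      (s := s a) (mem_ball_of_val hj) hc
    have h2 : (σ ^ (b * (p : ℤ) ^ a)) x - x ∈ ball vM (1 + s a) := by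
      convert h1 using 1
      simp
    exact ball_anti (by omega) h2

lemma CycTR.lowerRG_eq (h : CycTR p m vK vM σ ε s) (hinv : GalInvariant K vM) (i : ℤ) :
    lowerRG vM hinv i = Subgroup.zpowers (σ ^ p ^ numLT m s i) := by
  have hpow : ∀ k : ℤ, (p : ℤ) ^ m ∣ k → σ ^ k = 1 := fun k hk => by
    rw [← orderOf_dvd_iff_zpow_eq_one, h.orderOf_eq]
    exact_mod_cast hk
  have hp := Nat.prime_iff_prime_int.1 h.prime
  ext g
  obtain ⟨k, rfl⟩ := Subgroup.mem_zpowers_iff.1 (h.gen g)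
  rcases exists_eq_mul_prime_pow p m k with hk | ⟨a, ha, b, hb, rfl⟩
  · rw [hpow k hk]
    exact ⟨fun _ => one_mem _, fun _ => one_mem _⟩
  · rw [h.mem_lowerRG hinv ha hb, ← numLT_le_iff h.strict ha]
    constructor
    · intro hle
      refine Subgroup.mem_zpowers_iff.2 ⟨b * p ^ (a - numLT m s i), ?_⟩
      rw [← zpow_natCast, ← zpow_mul]
      congr 1
      push_cast
      rw [mul_left_comm, ← pow_add, Nat.add_sub_cancel' hle]
    · rintro hg
      obtain ⟨c, hc⟩ := Subgroup.mem_zpowers_iff.1 hg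
      rw [← zpow_natCast, ← zpow_mul, zpow_eq_zpow_iff_modEq, h.orderOf_eq] at hc
      have hd := Int.modEq_iff_dvd.1 hc
      push_cast at hd
      by_contra hlt
      have h1 : (p : ℤ) ^ (a + 1) ∣ b * p ^ a := by
        have := dvd_add ((pow_dvd_pow (p : ℤ) (show a + 1 ≤ m by omega)).trans hd)
          (Dvd.dvd.mul_right (pow_dvd_pow (p : ℤ) (show a + 1 ≤ numLT m s i by omega)) c)
        simpa using this
      rw [pow_succ', mul_comm b] at h1
      refine hb ((mul_dvd_mul_iff_left (pow_ne_zero a hp.ne_zero)).1 ?_)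
      rwa [mul_comm ((p : ℤ) ^ a)]

lemma CycTR.herbrandPhi_eq (h : CycTR p m vK vM σ ε s) (hinv : GalInvariant K vM) (n : ℤ) :
    herbrandPhi vM hinv n = phi p m s n := by
  have hp : (0 : ℚ) < p := by exact_mod_cast h.prime.pos
  have hcard : ∀ i, (Nat.card (lowerRG vM hinv i) : ℚ) = p ^ m * ((p : ℚ) ^ numLT m s i)⁻¹ := by
    intro i
    rw [h.lowerRG_eq hinv, Nat.card_zpowers, orderOf_pow_of_dvd (pow_pos h.prime.pos _).ne'
      (h.orderOf_eq ▸ pow_dvd_pow p (numLT_le m s i)), h.orderOf_eq,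
      Nat.pow_div (numLT_le m s i) h.prime.pos, Nat.cast_pow, ← div_eq_mul_inv,
      pow_sub₀ _ hp.ne' (numLT_le m s i), div_eq_mul_inv]
  rw [herbrandPhi, phi]
  split_ifs with hn
  · rfl
  · simp_rw [hcard]
    rw [numLT_eq_zero fun a ha => zero_le_one.trans (h.one_le a ha), ← Finset.mul_sum]
    field_simp

lemma CycTR.upperRG_eq (h : CycTR p m vK vM σ ε s) (hinv : GalInvariant K vM) (u : ℤ) :
    upperRG vM hinv u = lowerRG vM hinv (psi p m s u) := by
  have h1 : {n : ℤ | (u : ℚ) ≤ herbrandPhi vM hinv n} = Set.Ici (psi p m s u) := by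
    ext n
    rw [Set.mem_ofPred_eq, h.herbrandPhi_eq, ← phi_psi h.prime.pos h.one_le h.strict u, Set.mem_Ici]
    exact (StrictMono.le_iff_le (f := phi p m s) fun a b hab => phi_lt h.prime.pos hab)
  rw [upperRG, h1, csInf_Ici]

/-- The upper ramification jumps, when all of them are integers. -/
theorem CycTR.isUpperJump_iff (h : CycTR p m vK vM σ ε s) (hinv : GalInvariant K vM)
    (hit : ∀ a < m, ∃ u, psi p m s u = s a) (u : ℤ) :
    IsUpperJump vM hinv u ↔ upSet p m s u := by
  have hp := Nat.prime_iff_prime_int.1 h.prime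
  constructor
  · intro hu
    by_contra hcon
    refine hu (u + 1) (by omega) ?_
    rw [h.upperRG_eq, h.upperRG_eq, h.lowerRG_eq, h.lowerRG_eq]
    have key : ∀ a < m, (s a < psi p m s (u + 1) ↔ s a < psi p m s u) := by
      intro a ha
      refine ⟨fun hlt => ?_, fun hlt => hlt.trans (psi_lt h.prime.pos m s (lt_add_one u))⟩
      by_contra hle
      obtain ⟨w, hw⟩ := hit a ha
      have hmono : StrictMono (psi p m s) := fun a b hab => psi_lt h.prime.pos m s hab
      rw [← hw] at hlt hle
      have h1 := hmono.lt_iff_lt.1 hlt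
      rw [hmono.lt_iff_lt] at hle
      obtain rfl : w = u := by omega
      exact hcon ⟨a, ha, hw⟩
    have : numLT m s (psi p m s (u + 1)) = numLT m s (psi p m s u) :=
      Finset.sum_congr rfl fun a ha => by rw [if_congr (key a (Finset.mem_range.1 ha)) rfl rfl]
    rw [this]
  · rintro ⟨a, ha, hau⟩ w huw heq
    have h1 : ¬(p : ℤ) ∣ 1 := hp.not_dvd_one
    have h2 := (h.mem_lowerRG hinv ha h1).2 hau.le
    rw [← h.upperRG_eq, ← heq, h.upperRG_eq, h.mem_lowerRG hinv ha h1, ← hau] at h2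
    exact absurd (psi_lt h.prime.pos m s huw) h2.not_gt

end

section
variable {p : ℕ} [Fact p.Prime] {K M : Type*} [Field K] [Algebra ℚ_[p] K] [FiniteDimensional ℚ_[p] K]
  [Field M] [Algebra K M] {vK : AddValuation K (WithTop ℤ)} {vM : AddValuation M (WithTop ℤ)}
  {eK m : ℕ}

lemma IsPadicValuation.locField (hvK : IsPadicValuation p vK eK) : LocField p vK eK :=
  ⟨hvK.1, hvK.val_p, by exact_mod_cast hvK.2.1, hvK.cpl, hvK.finRes⟩

/-- The lower jumps of a totally ramified cyclic extension satisfying the numerical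
constraints. -/
theorem TR.exists_cycTR_numerics (hvK : IsPadicValuation p vK eK)
    (hζ : ¬∃ ζ : K, IsPrimitiveRoot ζ p) (h : TR vK vM (p ^ m)) (hgal : IsGalois K M)
    (hcyc : IsCyclic (M ≃ₐ[K] M)) (hinv : GalInvariant K vM) : ∃ σ s, CycTR p m vK vM σ eK s ∧
    (∀ a < m, ∃ u, 1 ≤ u ∧ psi p m s u = s a) ∧
      (∀ u, 1 ≤ u → cnt (upSet p m s) (lam p eK u) ≤ cnt (upSet p m s) u + 1) ∧
      ∀ u, 1 ≤ u → upSet p m s (lam p eK u) →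
        cnt (upSet p m s) u + 1 ≤ cnt (upSet p m s) (lam p eK u) := by
  obtain ⟨σ, hσ⟩ := hcyc
  have hloc := hvK.locField
  obtain ⟨s, hs⟩ := h.exists_cycTR hgal hinv hσ hloc.valp hloc.one_le
  let alg : Algebra ℚ_[p] M := ((algebraMap K M).comp (algebraMap ℚ_[p] K)).toAlgebra
  have : IsScalarTower ℚ_[p] K M := IsScalarTower.of_algebraMap_eq fun _ => rfl
  have := h.finiteDimensional
  have : FiniteDimensional ℚ_[p] M := FiniteDimensional.trans ℚ_[p] K M
  have hM := hvK.of_extends h.ext h.normF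
  exact ⟨σ, s, hs, hs.upSet_numerics hM hloc hζ⟩

theorem conditions_of_exists (hvK : IsPadicValuation p vK eK)
    (hζ : ¬∃ ζ : K, IsPrimitiveRoot ζ p) (h : TR vK vM (p ^ m)) (hgal : IsGalois K M)
    (hcyc : IsCyclic (M ≃ₐ[K] M)) (hinv : GalInvariant K vM) (hm : 0 < m) {t : Fin m → ℤ}
    (ht : StrictMono t) (hJ : ∀ s : ℤ, IsUpperJump vM hinv s ↔ ∃ i, t i = s) :
    ((1 ≤ t ⟨0, hm⟩ ∧ ((p : ℤ) - 1) * t ⟨0, hm⟩ < (p : ℤ) * eK ∧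
        Int.gcd (t ⟨0, hm⟩) p = 1) ∧
      (∀ i : Fin m, ∀ hi : (i : ℕ) + 1 < m,
        ((p : ℤ) - 1) * t i < (eK : ℤ) →
          (t ⟨(i : ℕ) + 1, hi⟩ = (p : ℤ) * t i ∨
            ((p : ℤ) * t i < t ⟨(i : ℕ) + 1, hi⟩ ∧
              ((p : ℤ) - 1) * t ⟨(i : ℕ) + 1, hi⟩ < (p : ℤ) * eK ∧
              Int.gcd (t ⟨(i : ℕ) + 1, hi⟩) p = 1))) ∧
      (∀ i : Fin m, ∀ hi : (i : ℕ) + 1 < m,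
        (eK : ℤ) ≤ ((p : ℤ) - 1) * t i →
          t ⟨(i : ℕ) + 1, hi⟩ = t i + eK)) := by
  have hpp : p.Prime := Fact.out
  obtain ⟨σ, s, hs, hit, hA, hB⟩ := h.exists_cycTR_numerics hvK hζ hgal hcyc hinv
  have hT : upSet p m s = fun u => ∃ i, t i = u := by
    funext u
    rw [← hJ, hs.isUpperJump_iff hinv fun a ha => (hit a ha).imp fun _ => And.right]
  refine conditions_of_cnt hpp hvK.2.1 hm ht (fun i => ?_) (by rwa [hT] at hA) ?_
  · have h1 : upSet p m s (t i) := by rw [hT]; exact ⟨i, rfl⟩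
    obtain ⟨a, ha, hau⟩ := h1
    by_contra hlt
    have h2 := hs.one_le a ha
    rw [psi_of_le m s fun b hb => by linarith [hs.one_le b hb]] at hau
    omega
  · rw [hT] at hB
    exact hB

end

section
variable {R : Type*} [CommRing R]

/-- Substitution of a power series without constant term. -/
def cmp (S : PowerSeries R) (hS : PowerSeries.constantCoeff S = 0) :
    PowerSeries R →ₐ[R] PowerSeries R :=
  PowerSeries.substAlgHom (PowerSeries.HasSubst.of_constantCoeff_zero' hS)

lemma cmp_X {S : PowerSeries R} (hS) : cmp S hS PowerSeries.X = S :=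
  PowerSeries.substAlgHom_X _

lemma cmp_coe {S : PowerSeries R} (hS) (g : Polynomial R) :
    cmp S hS (g : PowerSeries R) = Polynomial.aeval S g :=
  PowerSeries.substAlgHom_coe _ g

lemma X_mul_exists {S : PowerSeries R} (hS : PowerSeries.constantCoeff S = 0) :
    ∃ T, S = PowerSeries.X * T :=
  PowerSeries.X_dvd_iff.2 hS

lemma constantCoeff_cmp {S : PowerSeries R} (hS) (D : PowerSeries R) :
    PowerSeries.constantCoeff (cmp S hS D) = PowerSeries.constantCoeff D := by
  obtain ⟨T, hT⟩ := X_mul_exists (S := D - PowerSeries.C (PowerSeries.constantCoeff D)) (by simp)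
  have h1 : D = PowerSeries.C (PowerSeries.constantCoeff D) + PowerSeries.X * T := by
    rw [← hT]; ring
  have h2 : cmp S hS D = algebraMap R _ (PowerSeries.constantCoeff D) + S * cmp S hS T := by
    conv_lhs => rw [h1]
    rw [map_add, map_mul, cmp_X]
    congr 1
    exact (cmp S hS).commutes _
  rw [h2]
  simp [hS]

lemma cmp_cmp {S T : PowerSeries R} (hS hT) (hST) (D : PowerSeries R) :
    cmp S hS (cmp T hT D) = cmp (cmp S hS T) hST D := by
  have := PowerSeries.subst_comp_subst_apply (PowerSeries.HasSubst.of_constantCoeff_zero' hT)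
    (PowerSeries.HasSubst.of_constantCoeff_zero' hS) D
  simp only [cmp, PowerSeries.coe_substAlgHom]
  exact this

lemma cmp_self_X (h) (D : PowerSeries R) : cmp (PowerSeries.X) h D = D := by
  simp only [cmp, PowerSeries.coe_substAlgHom]
  exact PowerSeries.X_subst D

lemma coeff_one_cmp {S : PowerSeries R} (hS) {D : PowerSeries R}
    (hD : PowerSeries.constantCoeff D = 0) :
    PowerSeries.coeff 1 (cmp S hS D) = PowerSeries.coeff 1 S * PowerSeries.coeff 1 D := by
  obtain ⟨A, rfl⟩ := X_mul_exists hD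
  have h := constantCoeff_cmp hS A
  simp only [map_mul, cmp_X, PowerSeries.coeff_one_mul]
  simp [hS, h]

/-- The polynomial `π X + X ^ q` iterated `n` times. -/
def ltF (π : R) (q : ℕ) : ℕ → Polynomial R
  | 0 => Polynomial.X
  | n + 1 => Polynomial.C π * ltF π q n + ltF π q n ^ q

/-- The factor `ltF (n + 1) / ltF n`. -/
def ltH (π : R) (q n : ℕ) : Polynomial R := ltF π q n ^ (q - 1) + Polynomial.C π

variable {π : R} {q : ℕ}

lemma ltF_succ_eq_mul (hq : 2 ≤ q) (n : ℕ) : ltF π q (n + 1) = ltF π q n * ltH π q n := by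
  obtain ⟨k, rfl⟩ : ∃ k, q = k + 1 := ⟨q - 1, by omega⟩
  simp only [ltF, ltH, Nat.add_sub_cancel]; ring

lemma ltF_comp (a b : ℕ) : (ltF π q a).comp (ltF π q b) = ltF π q (a + b) := by
  induction a with
  | zero => simp [ltF]
  | succ a ih => rw [Nat.succ_add]; simp [ltF, ih]

lemma ltH_comp (a b : ℕ) : (ltH π q a).comp (ltF π q b) = ltH π q (a + b) := by
  simp [ltH, ltF_comp]

lemma eval_zero_ltF (hq : 2 ≤ q) (n : ℕ) : (ltF π q n).eval 0 = 0 := by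
  induction n with
  | zero => simp [ltF]
  | succ n ih => simp [ltF, ih, show q ≠ 0 by omega]

lemma eval_zero_ltH (hq : 2 ≤ q) (n : ℕ) : (ltH π q n).eval 0 = π := by
  simp [ltH, eval_zero_ltF hq, show q - 1 ≠ 0 by omega]

lemma ltF_monic_natDegree [Nontrivial R] (hq : 2 ≤ q) (n : ℕ) :
    (ltF π q n).Monic ∧ (ltF π q n).natDegree = q ^ n := by
  induction n with
  | zero => simp [ltF]
  | succ n ih =>
    have h1 : (ltF π q n ^ q).natDegree = q ^ (n + 1) := by
      rw [ih.1.natDegree_pow, ih.2, pow_succ, mul_comm]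
    have h2 : (Polynomial.C π * ltF π q n).natDegree < (ltF π q n ^ q).natDegree := by
      refine (Polynomial.natDegree_C_mul_le _ _).trans_lt ?_
      rw [h1, ih.2]
      exact Nat.pow_lt_pow_right (by omega) (by omega)
    constructor
    · exact (ih.1.pow q).add_of_right (Polynomial.degree_lt_degree h2)
    · rw [ltF, Polynomial.natDegree_add_eq_right_of_natDegree_lt h2, h1]

lemma ltH_monic_natDegree [Nontrivial R] (hq : 2 ≤ q) (n : ℕ) :
    (ltH π q n).Monic ∧ (ltH π q n).natDegree = q ^ n * (q - 1) := by
  obtain ⟨h, h'⟩ := ltF_monic_natDegree (π := π) hq n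
  have h1 : (ltF π q n ^ (q - 1)).natDegree = q ^ n * (q - 1) := by
    rw [h.natDegree_pow, h', mul_comm]
  have h2 : (Polynomial.C π).natDegree < (ltF π q n ^ (q - 1)).natDegree := by
    rw [h1, Polynomial.natDegree_C]
    have : 0 < q - 1 := by omega
    positivity
  exact ⟨(h.pow _).add_of_left (Polynomial.degree_lt_degree h2),
    by rw [ltH, Polynomial.natDegree_add_eq_left_of_natDegree_lt h2, h1]⟩

lemma map_ltF {A : Type*} [CommRing A] (g : R →+* A) (hg : g π = 0) (n : ℕ) :
    (ltF π q n).map g = Polynomial.X ^ (q ^ n) := by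
  induction n with
  | zero => simp [ltF]
  | succ n ih => simp [ltF, ih, hg, ← pow_mul, pow_succ]

lemma map_ltH {A : Type*} [CommRing A] (g : R →+* A) (hg : g π = 0) (n : ℕ) :
    (ltH π q n).map g = Polynomial.X ^ (q ^ n * (q - 1)) := by
  simp [ltH, map_ltF g hg, hg, ← pow_mul]

lemma coeff_one_ltF (hq : 2 ≤ q) (n : ℕ) : (ltF π q n).coeff 1 = π ^ n := by
  induction n with
  | zero => simp [ltF]
  | succ n ih =>
    rw [ltF_succ_eq_mul hq, Polynomial.mul_coeff_one, ih, Polynomial.coeff_zero_eq_eval_zero,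
      Polynomial.coeff_zero_eq_eval_zero, eval_zero_ltF hq, eval_zero_ltH hq, pow_succ]
    ring

lemma ltF_ps_zero (hq : 2 ≤ q) (n : ℕ) :
    PowerSeries.constantCoeff (ltF π q n : PowerSeries R) = 0 := by
  rw [← PowerSeries.coeff_zero_eq_constantCoeff_apply, Polynomial.coeff_coe,
    Polynomial.coeff_zero_eq_eval_zero, eval_zero_ltF hq]

lemma cmp_coe_coe {f : Polynomial R} (hf) (g : Polynomial R) :
    cmp (f : PowerSeries R) hf (g : PowerSeries R) = (g.comp f : Polynomial R) := by
  rw [cmp_coe]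
  induction g using Polynomial.induction_on' with
  | add a b ha hb => simp [ha, hb]
  | monomial n a =>
    rw [Polynomial.aeval_monomial, Polynomial.monomial_comp]
    simp

lemma aeval_ltF_one {A : Type*} [CommRing A] [Algebra R A] (y : A) :
    Polynomial.aeval y (ltF π q 1) = algebraMap R A π * y + y ^ q := by
  simp [ltF]

/-- `S` is an endomorphism with linear coefficient `u`. -/
structure IsLT (π : R) (q : ℕ) (u : R) (S : PowerSeries R) : Prop where
  zero : PowerSeries.constantCoeff S = 0
  one : PowerSeries.coeff 1 S = u
  comm : ∀ h, cmp (ltF π q 1 : PowerSeries R) h S = Polynomial.aeval S (ltF π q 1)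

end

section
variable {R : Type*} [CommRing R] {π : R} {q : ℕ}

lemma ps_eq_of_dvd {S T : PowerSeries R} (h : ∀ n : ℕ, PowerSeries.X ^ n ∣ S - T) : S = T := by
  rw [← sub_eq_zero]
  ext n
  exact PowerSeries.X_pow_dvd_iff.1 (h (n + 1)) n (by omega)

lemma coe_ltF_one (hq : 2 ≤ q) : (ltF π q 1 : PowerSeries R) =
    PowerSeries.X * (PowerSeries.C π + PowerSeries.X ^ (q - 1)) := by
  obtain ⟨k, rfl⟩ : ∃ k, q = k + 1 := ⟨q - 1, by omega⟩
  simp [ltF]; ring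

lemma IsLT.unique [IsDomain R] [IsLocalRing R] (hq : 2 ≤ q) (hπ0 : π ≠ 0)
    (hπ : π ∈ IsLocalRing.maximalIdeal R) {u : R} {S T : PowerSeries R}
    (hS : IsLT π q u S) (hT : IsLT π q u T) : S = T := by
  have key (n : ℕ) : PowerSeries.X ^ (n + 2) ∣ S - T := by
    induction n with
    | zero =>
      rw [PowerSeries.X_pow_dvd_iff]
      intro d hd
      have h0 : d = 0 ∨ d = 1 := by omega
      rcases h0 with rfl | rfl
      · simp [hS.zero, hT.zero]
      · simp [hS.one, hT.one]
    | succ n ih =>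
      obtain ⟨E, hE⟩ := ih
      have hf := ltF_ps_zero (π := π) hq 1
      have h1 := congrArg₂ (· - ·) (hS.comm hf) (hT.comm hf)
      simp only [← map_sub, aeval_ltF_one] at h1
      rw [hE, map_mul, map_pow, cmp_X] at h1
      obtain ⟨A, hA⟩ := X_mul_exists hS.zero
      obtain ⟨B, hB⟩ := X_mul_exists hT.zero
      obtain ⟨W, hW⟩ := sub_dvd_pow_sub_pow A B q
      have h2 : S ^ q - T ^ q = PowerSeries.X ^ (q - 1) * ((S - T) * W) := by
        obtain ⟨k, rfl⟩ : ∃ k, q = k + 1 := ⟨q - 1, by omega⟩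
        rw [hA, hB, mul_pow, mul_pow, ← mul_sub, hW, Nat.add_sub_cancel]
        ring
      set g : PowerSeries R := PowerSeries.C π + PowerSeries.X ^ (q - 1) with hg
      set E' := cmp (ltF π q 1 : PowerSeries R) hf E with hE'
      have h3 : (PowerSeries.X : PowerSeries R) ^ (n + 2) * (g ^ (n + 2) * E') =
          PowerSeries.X ^ (n + 2) * (PowerSeries.C π * E + PowerSeries.X ^ (q - 1) * (E * W)) := by
        have h4 : PowerSeries.C π * S + S ^ q - (PowerSeries.C π * T + T ^ q) =
          PowerSeries.C π * (S - T) + (S ^ q - T ^ q) := by ring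
        have h5 : (algebraMap R (PowerSeries R)) π = PowerSeries.C π := rfl
        rw [h5, h4, h2, hE] at h1
        rw [coe_ltF_one hq, ← hg, mul_pow] at h1
        linear_combination h1
      have h4 := mul_left_cancel₀ (pow_ne_zero _ PowerSeries.X_ne_zero) h3
      have h5 := congrArg PowerSeries.constantCoeff h4
      simp only [map_mul, map_pow, hg, map_add, hE', constantCoeff_cmp,
        PowerSeries.constantCoeff_C, PowerSeries.constantCoeff_X,
        zero_pow (show q - 1 ≠ 0 by omega), add_zero, zero_mul] at h5
      have h6 : π * (PowerSeries.constantCoeff E * (1 - π ^ (n + 1))) = 0 := by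
        linear_combination -h5
      have h7 : IsUnit (1 - π ^ (n + 1)) :=
        (IsLocalRing.isUnit_one_sub_self_of_mem_nonunits _ ((IsLocalRing.mem_maximalIdeal _).1
          (Ideal.pow_mem_of_mem _ hπ _ (by omega))))
      have h8 : PowerSeries.constantCoeff E = 0 := by
        have := (mul_eq_zero.1 h6).resolve_left hπ0
        exact (mul_eq_zero.1 this).resolve_right h7.ne_zero
      obtain ⟨E1, rfl⟩ := X_mul_exists h8
      exact ⟨E1, by rw [hE]; ring⟩
  exact ps_eq_of_dvd fun n => (pow_dvd_pow _ (by omega)).trans (key n)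

lemma lt_step [IsDomain R] [IsLocalRing R] [Fintype (IsLocalRing.ResidueField R)]
    (hq : q = Fintype.card (IsLocalRing.ResidueField R))
    (hπ : IsLocalRing.maximalIdeal R = Ideal.span {π}) (n : ℕ) {P : Polynomial R}
    (h0 : P.eval 0 = 0)
    (hP : Polynomial.X ^ (n + 2) ∣ (ltF π q 1).comp P - P.comp (ltF π q 1)) :
    ∃ a : R, Polynomial.X ^ (n + 3) ∣
      (ltF π q 1).comp (P + Polynomial.C a * Polynomial.X ^ (n + 2)) -
        (P + Polynomial.C a * Polynomial.X ^ (n + 2)).comp (ltF π q 1) := by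
  have hq2 : 2 ≤ q := hq ▸ Fintype.one_lt_card
  have hπm : π ∈ IsLocalRing.maximalIdeal R := by rw [hπ]; exact Ideal.mem_span_singleton_self π
  obtain ⟨E, hE⟩ := hP
  have hres : IsLocalRing.residue R π = 0 := (IsLocalRing.residue_eq_zero_iff _).2 hπm
  have h1 : E.map (IsLocalRing.residue R) = 0 := by
    have h2 := congrArg (Polynomial.map (IsLocalRing.residue R)) hE
    rw [Polynomial.map_sub, Polynomial.map_comp, Polynomial.map_comp, map_ltF _ hres, pow_one,
      Polynomial.map_mul, Polynomial.map_pow, Polynomial.map_X, Polynomial.X_pow_comp] at h2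
    have h3 := FiniteField.expand_card (P.map (IsLocalRing.residue R))
    rw [← hq, Polynomial.expand_eq_comp_X_pow] at h3
    rw [h3, sub_self] at h2
    exact (mul_eq_zero.1 h2.symm).resolve_left (pow_ne_zero _ Polynomial.X_ne_zero)
  have h2 : IsLocalRing.residue R (E.eval 0) = 0 := by
    rw [← Polynomial.coeff_zero_eq_eval_zero, ← Polynomial.coeff_map, h1, Polynomial.coeff_zero]
  rw [IsLocalRing.residue_eq_zero_iff, hπ, Ideal.mem_span_singleton] at h2
  obtain ⟨e, he⟩ := h2
  have h7 : IsUnit (1 - π ^ (n + 1)) :=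
    (IsLocalRing.isUnit_one_sub_self_of_mem_nonunits _ ((IsLocalRing.mem_maximalIdeal _).1
      (Ideal.pow_mem_of_mem _ hπm _ (by omega))))
  obtain ⟨w, hw⟩ := h7.exists_right_inv
  refine ⟨-(e * w), ?_⟩
  set a := -(e * w) with ha
  obtain ⟨B, rfl⟩ : Polynomial.X ∣ P := by
    rw [Polynomial.X_dvd_iff, Polynomial.coeff_zero_eq_eval_zero, h0]
  obtain ⟨W, hW⟩ := sub_dvd_pow_sub_pow (B + Polynomial.C a * Polynomial.X ^ (n + 1)) B q
  obtain ⟨k, rfl⟩ : ∃ k, q = k + 2 := ⟨q - 2, by omega⟩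
  set g : Polynomial R := Polynomial.C π + Polynomial.X ^ (k + 1) with hg
  have hf : ltF π (k + 2) 1 = Polynomial.X * g := by simp [ltF, hg]; ring
  have hbr : Polynomial.X ∣ E + Polynomial.C (π * a) + Polynomial.X ^ (k + 1) * Polynomial.C a * W
      - Polynomial.C a * g ^ (n + 2) := by
    rw [Polynomial.X_dvd_iff, Polynomial.coeff_zero_eq_eval_zero]
    simp only [hg, Polynomial.eval_add, Polynomial.eval_sub, Polynomial.eval_mul,
      Polynomial.eval_pow, Polynomial.eval_C, Polynomial.eval_X, he]
    rw [ha]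
    linear_combination (-e * π) * hw
  obtain ⟨V, hV⟩ := hbr
  refine ⟨V, ?_⟩
  have e1 : (ltF π (k + 2) 1).comp
      (Polynomial.X * B + Polynomial.C a * Polynomial.X ^ (n + 2)) =
      (ltF π (k + 2) 1).comp (Polynomial.X * B) + Polynomial.C (π * a) * Polynomial.X ^ (n + 2) +
      Polynomial.X ^ (n + 2) * (Polynomial.X ^ (k + 1) * Polynomial.C a * W) := by
    have hx : Polynomial.X * B + Polynomial.C a * Polynomial.X ^ (n + 2) =
        Polynomial.X * (B + Polynomial.C a * Polynomial.X ^ (n + 1)) := by ring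
    simp only [ltF, Polynomial.add_comp, Polynomial.mul_comp, Polynomial.pow_comp,
      Polynomial.C_comp, Polynomial.X_comp, map_mul, hx]
    rw [mul_pow, mul_pow]
    linear_combination Polynomial.X ^ (k + 2) * hW
  have e2 : (Polynomial.X * B + Polynomial.C a * Polynomial.X ^ (n + 2)).comp (ltF π (k + 2) 1) =
      (Polynomial.X * B).comp (ltF π (k + 2) 1) +
        Polynomial.C a * (Polynomial.X * g) ^ (n + 2) := by
    rw [Polynomial.add_comp, Polynomial.C_mul_comp, Polynomial.X_pow_comp, hf]
  rw [e1, e2, mul_pow]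
  linear_combination hE + Polynomial.X ^ (n + 2) * hV

/-- Every element is the linear coefficient of an endomorphism. -/
theorem exists_isLT [IsDomain R] [IsLocalRing R] [Fintype (IsLocalRing.ResidueField R)]
    (hq : q = Fintype.card (IsLocalRing.ResidueField R))
    (hπ : IsLocalRing.maximalIdeal R = Ideal.span {π}) (u : R) : ∃ S, IsLT π q u S := by
  have hq2 : 2 ≤ q := hq ▸ Fintype.one_lt_card
  have hf := ltF_ps_zero (π := π) hq2 1
  let Q (n : ℕ) (P : Polynomial R) : Prop := P.eval 0 = 0 ∧ P.coeff 1 = u ∧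
    Polynomial.X ^ (n + 2) ∣ (ltF π q 1).comp P - P.comp (ltF π q 1)
  have hstep (n : ℕ) (P : {P // Q n P}) : ∃ P' : {P // Q (n + 1) P},
      Polynomial.X ^ (n + 2) ∣ P'.1 - P.1 := by
    obtain ⟨P, h0, h1, h2⟩ := P
    obtain ⟨a, ha⟩ := lt_step hq hπ n h0 h2
    refine ⟨⟨P + Polynomial.C a * Polynomial.X ^ (n + 2), by simp [h0], ?_, ha⟩, ?_⟩
    · rw [Polynomial.coeff_add, Polynomial.coeff_C_mul_X_pow, h1]
      simp
    · exact ⟨Polynomial.C a, by ring⟩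
  have hQ0 : Q 0 (Polynomial.C u * Polynomial.X) := by
    refine ⟨by simp, by simp, ?_⟩
    obtain ⟨k, rfl⟩ : ∃ k, q = k + 2 := ⟨q - 2, by omega⟩
    refine ⟨Polynomial.X ^ k * Polynomial.C (u ^ (k + 2)) -
      Polynomial.C u * Polynomial.X ^ k, ?_⟩
    simp [ltF]; ring
  choose next hnext using hstep
  let P : (n : ℕ) → {P // Q n P} := fun n => Nat.rec ⟨_, hQ0⟩ next n
  have hP (n : ℕ) : Polynomial.X ^ (n + 2) ∣ (P (n + 1)).1 - (P n).1 := hnext n (P n)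
  have hP' (j k : ℕ) (h : j ≤ k) : Polynomial.X ^ (j + 2) ∣ (P k).1 - (P j).1 := by
    induction k, h using Nat.le_induction with
    | base => simp
    | succ k hk ih =>
      have := dvd_add ((pow_dvd_pow _ (by omega)).trans (hP k)) ih
      simpa using this
  let S : PowerSeries R := PowerSeries.mk fun i => (P i).1.coeff i
  have hS (n : ℕ) : PowerSeries.X ^ (n + 2) ∣ S - ((P n).1 : PowerSeries R) := by
    rw [PowerSeries.X_pow_dvd_iff]
    intro d hd
    rw [map_sub, PowerSeries.coeff_mk, Polynomial.coeff_coe, sub_eq_zero]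
    rcases le_total d n with h | h
    · have := Polynomial.X_pow_dvd_iff.1 (hP' d n h) d (by omega)
      rw [Polynomial.coeff_sub, sub_eq_zero] at this
      exact this.symm
    · have := Polynomial.X_pow_dvd_iff.1 (hP' n d h) d (by omega)
      rw [Polynomial.coeff_sub, sub_eq_zero] at this
      exact this
  have hS0 : PowerSeries.constantCoeff S = 0 := by
    have : PowerSeries.constantCoeff S = (P 0).1.coeff 0 :=
      (PowerSeries.coeff_zero_eq_constantCoeff_apply _).symm.trans (PowerSeries.coeff_mk _ _)
    rw [this, Polynomial.coeff_zero_eq_eval_zero, (P 0).2.1]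
  refine ⟨S, hS0, ?_, fun _ => ?_⟩
  · rw [PowerSeries.coeff_mk, (P 1).2.2.1]
  · refine ps_eq_of_dvd fun n => (pow_dvd_pow _ (show n ≤ n + 2 by omega)).trans ?_
    obtain ⟨T, hT⟩ := hS n
    have h1 : PowerSeries.X ^ (n + 2) ∣ cmp _ hf S - cmp _ hf ((P n).1 : PowerSeries R) := by
      rw [← map_sub, hT, map_mul, map_pow, cmp_X]
      exact (pow_dvd_pow_of_dvd (PowerSeries.X_dvd_iff.2 hf) _).mul_right _
    have h2 : PowerSeries.X ^ (n + 2) ∣ Polynomial.aeval S (ltF π q 1) -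
        Polynomial.aeval ((P n).1 : PowerSeries R) (ltF π q 1) := by
      refine (hS n).trans ?_
      rw [aeval_ltF_one, aeval_ltF_one, add_sub_add_comm, ← mul_sub]
      exact dvd_add (dvd_mul_left _ _) (sub_dvd_pow_sub_pow _ _ _)
    have h3 : PowerSeries.X ^ (n + 2) ∣ cmp _ hf ((P n).1 : PowerSeries R) -
        Polynomial.aeval ((P n).1 : PowerSeries R) (ltF π q 1) := by
      have h4 : Polynomial.aeval ((P n).1 : PowerSeries R) (ltF π q 1) =
          (((ltF π q 1).comp (P n).1 : Polynomial R) : PowerSeries R) := by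
        have hz : PowerSeries.constantCoeff ((P n).1 : PowerSeries R) = 0 := by
          rw [← PowerSeries.coeff_zero_eq_constantCoeff_apply, Polynomial.coeff_coe,
            Polynomial.coeff_zero_eq_eval_zero, (P n).2.1]
        rw [← cmp_coe hz, cmp_coe_coe]
      obtain ⟨Z, hZ⟩ := (P n).2.2.2
      refine ⟨-(Z : PowerSeries R), ?_⟩
      have h5 := congrArg (fun z : Polynomial R => (z : PowerSeries R)) hZ
      simp only [Polynomial.coe_sub, Polynomial.coe_mul, Polynomial.coe_pow,
        Polynomial.coe_X] at h5
      rw [cmp_coe_coe, h4]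
      linear_combination -h5
    have := dvd_sub (dvd_add h1 h3) h2
    convert this using 1
    ring

lemma IsLT.of_X : IsLT π q 1 PowerSeries.X := by
  refine ⟨by simp, PowerSeries.coeff_one_X, fun h => ?_⟩
  rw [cmp_X, ← cmp_coe (by simp), cmp_self_X]

lemma cmp_congr {S T : PowerSeries R} (h : S = T) (hS hT) (D : PowerSeries R) :
    cmp S hS D = cmp T hT D := by
  subst h; rfl

lemma IsLT.mul {u w : R} {S T : PowerSeries R} (hS : IsLT π q u S)
    (hT : IsLT π q w T) : IsLT π q (u * w) (cmp S hS.zero T) := by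
  have h0 : PowerSeries.constantCoeff (cmp S hS.zero T) = 0 := by
    rw [constantCoeff_cmp, hT.zero]
  refine ⟨h0, by rw [coeff_one_cmp _ hT.zero, hS.one, hT.one], fun h => ?_⟩
  have h1 : PowerSeries.constantCoeff (cmp _ h S) = 0 := by
    rw [constantCoeff_cmp, hS.zero]
  have h2 : cmp _ h S = cmp S hS.zero (ltF π q 1 : PowerSeries R) := by
    rw [hS.comm h, cmp_coe]
  rw [cmp_cmp h hS.zero h1, cmp_congr h2 _ (by rw [← h2, h1]), ← cmp_cmp hS.zero h, hT.comm,
    Polynomial.aeval_algHom_apply]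

lemma IsLT.comm_iterate (hq : 2 ≤ q) {u : R} {S : PowerSeries R} (hS : IsLT π q u S) (n : ℕ) (h) :
    cmp (ltF π q n : PowerSeries R) h S = Polynomial.aeval S (ltF π q n) := by
  induction n with
  | zero =>
    simp only [ltF, Polynomial.aeval_X, Polynomial.coe_X]
    exact cmp_self_X _ _
  | succ n ih =>
    have hf := ltF_ps_zero (π := π) hq 1
    have hn := ltF_ps_zero (π := π) hq n
    have h1 : cmp _ hf (ltF π q n : PowerSeries R) = (ltF π q (n + 1) : PowerSeries R) := by
      rw [cmp_coe_coe, ltF_comp]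
    rw [cmp_congr h1.symm h (by rw [h1, h]), ← cmp_cmp hf hn, ih hn, ← Polynomial.aeval_algHom_apply,
      hS.comm hf, ← ltF_comp n 1, Polynomial.aeval_comp]

end

section

set_option linter.unusedSectionVars false

/-- `π` is a uniformizer of a local domain with residue field of cardinality `q`. -/
structure LTBase {R : Type*} [CommRing R] [IsLocalRing R] (π : R) (q : ℕ) : Prop where
  ne_zero : π ≠ 0
  max : IsLocalRing.maximalIdeal R = Ideal.span {π}
  fin : Finite (IsLocalRing.ResidueField R)
  card : Nat.card (IsLocalRing.ResidueField R) = q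

section
variable {R : Type*} [CommRing R] [IsDomain R] [IsLocalRing R] {π : R} {q : ℕ}

lemma LTBase.two_le (h : LTBase π q) : 2 ≤ q := by
  have := h.fin
  rw [← h.card]
  exact Finite.one_lt_card

lemma LTBase.mem (h : LTBase π q) : π ∈ IsLocalRing.maximalIdeal R := by
  rw [h.max]; exact Ideal.mem_span_singleton_self π

lemma LTBase.residue (h : LTBase π q) : IsLocalRing.residue R π = 0 :=
  (IsLocalRing.residue_eq_zero_iff _).2 h.mem

lemma LTBase.exists_isLT (h : LTBase π q) (u : R) : ∃ S, IsLT π q u S := by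
  have := h.fin
  have := Fintype.ofFinite (IsLocalRing.ResidueField R)
  exact PaperRam.exists_isLT (by rw [← h.card, Nat.card_eq_fintype_card]) h.max u

lemma LTBase.unique (h : LTBase π q) {u : R} {S T : PowerSeries R}
    (hS : IsLT π q u S) (hT : IsLT π q u T) : S = T :=
  IsLT.unique h.two_le h.ne_zero h.mem hS hT

lemma LTBase.natDegree_pos (h : LTBase π q) (n : ℕ) : 0 < q ^ n * (q - 1) := by
  have := h.two_le
  have : 0 < q - 1 := by omega
  positivity

lemma LTBase.isEisensteinAt (h : LTBase π q) (n : ℕ) :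
    (ltH π q n).IsEisensteinAt (IsLocalRing.maximalIdeal R) := by
  obtain ⟨h1, h2⟩ := ltH_monic_natDegree (π := π) h.two_le n
  refine ⟨?_, fun {i} hi => ?_, ?_⟩
  · rw [h1.leadingCoeff]
    exact fun h => (Ideal.ne_top_iff_one _).1 (IsLocalRing.maximalIdeal.isMaximal R).ne_top h
  · rw [← IsLocalRing.residue_eq_zero_iff, ← Polynomial.coeff_map, map_ltH _ h.residue,
      Polynomial.coeff_X_pow, if_neg (by omega)]
  · rw [Polynomial.coeff_zero_eq_eval_zero, eval_zero_ltH h.two_le, h.max,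
      Ideal.span_singleton_pow, Ideal.mem_span_singleton]
    rintro ⟨c, hc⟩
    have h3 : π * (1 - π * c) = 0 := by linear_combination hc
    have h4 := (mul_eq_zero.1 h3).resolve_left h.ne_zero
    have h5 : IsUnit (1 - π * c) := IsLocalRing.isUnit_one_sub_self_of_mem_nonunits _
      ((IsLocalRing.mem_maximalIdeal _).1 (Ideal.mul_mem_right _ _ h.mem))
    exact h5.ne_zero h4

lemma LTBase.irreducible (h : LTBase π q) (n : ℕ) : Irreducible (ltH π q n) := by
  obtain ⟨h1, h2⟩ := ltH_monic_natDegree (π := π) h.two_le n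
  exact (h.isEisensteinAt n).irreducible inferInstance h1.isPrimitive
    (h2 ▸ h.natDegree_pos n)

lemma LTBase.exists_division [IsAdicComplete (IsLocalRing.maximalIdeal R) R] (h : LTBase π q)
    (n : ℕ) (D : PowerSeries R) : ∃ (Q : PowerSeries R) (r : Polynomial R),
      D = (ltH π q n : PowerSeries R) * Q + (r : PowerSeries R) ∧
        r.degree < (ltH π q n).degree := by
  obtain ⟨h1, h2⟩ := ltH_monic_natDegree (π := π) h.two_le n
  have h3 : (ltH π q n : PowerSeries R).map (IsLocalRing.residue R) =
      PowerSeries.X ^ (q ^ n * (q - 1)) := by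
    rw [← Polynomial.polynomial_map_coe, map_ltH _ h.residue, Polynomial.coe_pow,
      Polynomial.coe_X]
  obtain ⟨Q, r, hQ⟩ := PowerSeries.exists_isWeierstrassDivision (f := D)
    (g := (ltH π q n : PowerSeries R)) (by rw [h3]; exact pow_ne_zero _ PowerSeries.X_ne_zero)
  refine ⟨Q, r, hQ.eq_mul_add, ?_⟩
  have h4 := hQ.degree_lt
  have h5 : ((ltH π q n : PowerSeries R).map
      (Ideal.Quotient.mk (IsLocalRing.maximalIdeal R))).order.toNat = q ^ n * (q - 1) := by
    have : (ltH π q n : PowerSeries R).map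
      (Ideal.Quotient.mk (IsLocalRing.maximalIdeal R)) =
      (PowerSeries.X ^ (q ^ n * (q - 1)) : PowerSeries (R ⧸ IsLocalRing.maximalIdeal R)) := h3
    rw [this, PowerSeries.order_X_pow, ENat.toNat_natCast]
  rw [h5] at h4
  rwa [Polynomial.degree_eq_natDegree h1.ne_zero, h2]

variable {E : Type*} [CommRing E] [Algebra R E]

lemma algHom_coe (φ : PowerSeries R →ₐ[R] E) (r : Polynomial R) :
    φ (r : PowerSeries R) = Polynomial.aeval (φ PowerSeries.X) r := by
  have : (φ.comp (Polynomial.coeToPowerSeries.algHom R)) =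
      Polynomial.aeval (φ PowerSeries.X) := by
    ext; simp
  have h2 := DFunLike.congr_fun this r
  simpa using h2

lemma LTBase.algHom_eq [IsAdicComplete (IsLocalRing.maximalIdeal R) R] (h : LTBase π q) {n : ℕ}
    {φ ψ : PowerSeries R →ₐ[R] E} (hφ : φ (ltH π q n : PowerSeries R) = 0)
    (hψ : ψ (ltH π q n : PowerSeries R) = 0) (hX : φ PowerSeries.X = ψ PowerSeries.X) :
    φ = ψ := by
  ext D
  obtain ⟨Q, r, rfl, -⟩ := h.exists_division n D
  simp only [map_add, map_mul, hφ, hψ, algHom_coe, hX, zero_mul]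

lemma LTBase.exists_algHom [IsAdicComplete (IsLocalRing.maximalIdeal R) R] (h : LTBase π q)
    {n : ℕ} {y : E} (hy : Polynomial.aeval y (ltH π q n) = 0) :
    ∃ φ : PowerSeries R →ₐ[R] E, φ PowerSeries.X = y ∧ φ (ltH π q n : PowerSeries R) = 0 := by
  have hd : (ltH π q n).IsDistinguishedAt (IsLocalRing.maximalIdeal R) :=
    ⟨⟨(h.isEisensteinAt n).mem⟩, (ltH_monic_natDegree h.two_le n).1⟩
  have hI : ∀ a ∈ Ideal.span {ltH π q n}, Polynomial.aeval y a = 0 := by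
    intro a ha
    obtain ⟨b, rfl⟩ := Ideal.mem_span_singleton.1 ha
    rw [map_mul, hy, zero_mul]
  let φ : PowerSeries R →ₐ[R] E :=
    ((Ideal.Quotient.liftₐ (Ideal.span {ltH π q n}) (Polynomial.aeval y) hI).comp hd.algEquivQuotient.symm.toAlgHom).comp
      (Ideal.Quotient.mkₐ R _)
  have key (r : Polynomial R) : φ (r : PowerSeries R) = Polynomial.aeval y r := by
    have h1 : hd.algEquivQuotient (Ideal.Quotient.mk _ r) =
        Ideal.Quotient.mk _ (r : PowerSeries R) := by
      rw [Polynomial.IsDistinguishedAt.algEquivQuotient_apply]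
      erw [Ideal.quotientMap_mk]
      simp
    have h2 : hd.algEquivQuotient.symm (Ideal.Quotient.mk _ (r : PowerSeries R)) =
        Ideal.Quotient.mk _ r := by
      rw [← h1, AlgEquiv.symm_apply_apply]
    change (Ideal.Quotient.liftₐ (Ideal.span {ltH π q n}) (Polynomial.aeval y) hI)
      (hd.algEquivQuotient.symm (Ideal.Quotient.mk _ (r : PowerSeries R))) = _
    rw [h2]
    rfl
  exact ⟨φ, by rw [← Polynomial.coe_X, key, Polynomial.aeval_X], by rw [key, hy]⟩

variable [IsIntegrallyClosed R] [IsDomain E] [Module.IsTorsionFree R E]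
  [IsAdicComplete (IsLocalRing.maximalIdeal R) R]

lemma LTBase.algHom_eq_zero_iff (h : LTBase π q) {n : ℕ}
    {φ : PowerSeries R →ₐ[R] E} (hφ : φ (ltH π q n : PowerSeries R) = 0) (D : PowerSeries R) :
    φ D = 0 ↔ (ltH π q n : PowerSeries R) ∣ D := by
  constructor
  · intro hD
    obtain ⟨Q, r, rfl, hr⟩ := h.exists_division n D
    obtain ⟨h1, h2⟩ := ltH_monic_natDegree (π := π) h.two_le n
    rw [map_add, map_mul, hφ, zero_mul, zero_add, algHom_coe] at hD
    rw [algHom_coe] at hφ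
    set y := φ PowerSeries.X
    have hx_int : IsIntegral R y := ⟨_, h1, hφ⟩
    have h3 := minpoly.isIntegrallyClosed_dvd hx_int hφ
    have h4 := minpoly.isIntegrallyClosed_dvd hx_int hD
    obtain ⟨c, hc⟩ := h3
    have h5 : IsUnit c := by
      refine ((h.irreducible n).isUnit_or_isUnit hc).resolve_left (minpoly.not_isUnit R y)
    have h6 : ltH π q n ∣ r := by
      rw [hc]; exact h5.mul_right_dvd.2 h4
    have h7 : r = 0 := by
      by_contra h0
      exact h1.not_dvd_of_degree_lt h0 hr h6
    rw [h7]; simp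
  · rintro ⟨Q, rfl⟩
    rw [map_mul, hφ, zero_mul]

lemma LTBase.algHom_ltF_ne_zero (h : LTBase π q) {n : ℕ}
    {φ : PowerSeries R →ₐ[R] E} (hφ : φ (ltH π q n : PowerSeries R) = 0) :
    φ (ltF π q n : PowerSeries R) ≠ 0 := by
  intro h0
  have h1 : φ (ltF π q n : PowerSeries R) ^ (q - 1) + algebraMap R E π = 0 := by
    rw [algHom_coe] at *
    rw [← hφ, ltH]
    simp
  have := h.two_le
  rw [h0, zero_pow (by omega), zero_add] at h1
  exact h.ne_zero (FaithfulSMul.algebraMap_injective R E (by rw [h1, map_zero]))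

/-- The endomorphism `u` moves a root of `ltH n` to a root of `ltH n`. -/
lemma LTBase.algHom_cmp (h : LTBase π q) {n : ℕ}
    {φ : PowerSeries R →ₐ[R] E} (hφ : φ (ltH π q n : PowerSeries R) = 0) {u : R} (hu : IsUnit u)
    {S : PowerSeries R} (hS : IsLT π q u S) :
    φ (cmp S hS.zero (ltH π q n : PowerSeries R)) = 0 := by
  have h0 (k : ℕ) : cmp S hS.zero (ltF π q k : PowerSeries R) =
      cmp (ltF π q k : PowerSeries R) (ltF_ps_zero h.two_le k) S := by
    rw [hS.comm_iterate h.two_le, cmp_coe]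
  obtain ⟨B, hB⟩ := X_mul_exists hS.zero
  have hB0 : IsUnit B := by
    rw [PowerSeries.isUnit_iff_constantCoeff]
    have h1 := hS.one
    rw [hB, PowerSeries.coeff_one_mul] at h1
    have h2 : PowerSeries.constantCoeff B = u := by simpa using h1
    rwa [h2]
  have h1 : φ (cmp S hS.zero (ltF π q n : PowerSeries R)) ≠ 0 := by
    rw [h0, hB, map_mul, cmp_X, map_mul]
    exact mul_ne_zero (h.algHom_ltF_ne_zero hφ) ((hB0.map _).map φ).ne_zero
  have h2 : φ (cmp S hS.zero (ltF π q (n + 1) : PowerSeries R)) = 0 := by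
    have h3 : φ (ltF π q (n + 1) : PowerSeries R) = 0 := by
      rw [ltF_succ_eq_mul h.two_le, Polynomial.coe_mul, map_mul, hφ, mul_zero]
    rw [h0, hB, map_mul, cmp_X, map_mul, h3, zero_mul]
  rw [ltF_succ_eq_mul h.two_le, Polynomial.coe_mul, map_mul, map_mul] at h2
  exact (mul_eq_zero.1 h2).resolve_left h1

/-- A root of `ltH n` fixed by the endomorphism `u`. -/
lemma LTBase.ltF_dvd_sub_X (h : LTBase π q) {n : ℕ}
    {φ : PowerSeries R →ₐ[R] E} (hφ : φ (ltH π q n : PowerSeries R) = 0) {u : R}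
    {S : PowerSeries R} (hS : IsLT π q u S) (hφS : φ S = φ PowerSeries.X) :
    (ltF π q (n + 1) : PowerSeries R) ∣ S - PowerSeries.X := by
  have hz := ltF_ps_zero (π := π) h.two_le
  have hD (i : ℕ) : S - PowerSeries.X ∣ cmp _ (hz i) (S - PowerSeries.X) := by
    rw [map_sub, cmp_X, hS.comm_iterate h.two_le]
    have h2 : Polynomial.aeval S (ltF π q i) - (ltF π q i : PowerSeries R) =
      ((ltF π q i).map (algebraMap R (PowerSeries R))).eval S -
      ((ltF π q i).map (algebraMap R (PowerSeries R))).eval PowerSeries.X := by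
      have h3 := algHom_coe (AlgHom.id R (PowerSeries R)) (ltF π q i)
      rw [Polynomial.eval_map_algebraMap, Polynomial.eval_map_algebraMap]
      exact congrArg _ h3
    rw [h2]
    exact Polynomial.sub_dvd_eval_sub _ _ _
  have hk (i : ℕ) (hi : i ≤ n) :
      ((φ.comp (cmp _ (hz (n - i)))) : PowerSeries R →ₐ[R] E) (ltH π q i : PowerSeries R) = 0 := by
    rw [AlgHom.comp_apply, cmp_coe_coe, ltH_comp, Nat.add_sub_cancel' hi, hφ]
  have key (j : ℕ) (hj : j ≤ n + 1) : (ltF π q j : PowerSeries R) ∣ S - PowerSeries.X := by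
    induction j with
    | zero =>
      rw [ltF, Polynomial.coe_X, PowerSeries.X_dvd_iff]
      simp [hS.zero]
    | succ j ih =>
      obtain ⟨Q, hQ⟩ := ih (by omega)
      have h1 := hk j (by omega)
      have h2 : (φ.comp (cmp _ (hz (n - j)))) (S - PowerSeries.X) = 0 := by
        obtain ⟨Z, hZ⟩ := hD (n - j)
        rw [AlgHom.comp_apply, hZ, map_mul, map_sub, hφS, sub_self, zero_mul]
      rw [hQ, map_mul] at h2
      have h3 := (mul_eq_zero.1 h2).resolve_left (h.algHom_ltF_ne_zero h1)
      obtain ⟨V, hV⟩ := (h.algHom_eq_zero_iff h1 Q).1 h3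
      refine ⟨V, ?_⟩
      rw [hQ, hV, ltF_succ_eq_mul h.two_le, Polynomial.coe_mul, mul_assoc]
  exact key _ le_rfl

lemma LTBase.pow_dvd_of_fixed (h : LTBase π q) {n : ℕ} {u : R}
    {S : PowerSeries R} (hS : IsLT π q u S)
    (hd : (ltF π q n : PowerSeries R) ∣ S - PowerSeries.X) :
    ∃ g, S - PowerSeries.X = (ltF π q n : PowerSeries R) * g ∧
      u - 1 = π ^ n * PowerSeries.constantCoeff g := by
  obtain ⟨g, hg⟩ := hd
  refine ⟨g, hg, ?_⟩
  have h1 := congrArg (PowerSeries.coeff 1) hg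
  rw [map_sub, hS.one, PowerSeries.coeff_one_X, PowerSeries.coeff_one_mul, ltF_ps_zero h.two_le,
    Polynomial.coeff_coe, coeff_one_ltF h.two_le] at h1
  linear_combination h1

end

end

section

set_option linter.unusedSectionVars false

section
/-- The units congruent to `1` modulo the `k`-th power of the maximal ideal. -/
def unitSub (R : Type*) [CommRing R] [IsLocalRing R] (k : ℕ) : Subgroup Rˣ :=
  (Units.map (Ideal.Quotient.mk (IsLocalRing.maximalIdeal R ^ k)).toMonoidHom).ker

lemma mem_unitSub {R : Type*} [CommRing R] [IsLocalRing R] {k : ℕ} {u : Rˣ} :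
    u ∈ unitSub R k ↔ (u : R) - 1 ∈ IsLocalRing.maximalIdeal R ^ k := by
  rw [unitSub, MonoidHom.mem_ker, Units.ext_iff]
  simp only [Units.coe_map, Units.val_one]
  rw [← Ideal.Quotient.eq]
  simp

variable {R : Type*} [CommRing R] [IsDomain R] [IsDiscreteValuationRing R]

lemma index_unitSub {q : ℕ} {π : R} (h : LTBase π q) (n : ℕ) :
    (unitSub R (n + 1)).index = q ^ n * (q - 1) := by
  set P := IsLocalRing.maximalIdeal R with hP
  have hP0 : P ≠ ⊥ := IsDiscreteValuationRing.not_a_field R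
  have hcP : Nat.card (R ⧸ P) = q := h.card
  have hA : Nat.card (R ⧸ P ^ (n + 1)) = q ^ (n + 1) := by
    have h1 := cardQuot_pow_of_prime (P := P) (i := n + 1) hP0
    rw [Submodule.cardQuot_apply, Submodule.cardQuot_apply] at h1
    rw [← hcP]; exact h1
  have hq := h.two_le
  have hfA : Finite (R ⧸ P ^ (n + 1)) := Nat.finite_of_card_ne_zero (by rw [hA]; positivity)
  have hsurj : Function.Surjective (Ideal.Quotient.mk (P ^ (n + 1))) := Ideal.Quotient.mk_surjective
  have hnt : Nontrivial (R ⧸ P ^ (n + 1)) := by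
    rw [← Finite.one_lt_card_iff_nontrivial, hA]
    exact Nat.one_lt_pow (by omega) (by omega)
  have hloc : IsLocalHom (Ideal.Quotient.mk (P ^ (n + 1))) := IsLocalHom.of_surjective _ hsurj
  have hus := IsLocalRing.surjective_units_map_of_local_ringHom _ hsurj hloc
  rw [unitSub, Subgroup.index_ker, MonoidHom.range_eq_top.2 hus]
  rw [Subgroup.card_top]
  have hle : P ^ (n + 1) ≤ P := Ideal.pow_le_self (by omega)
  let f : (R ⧸ P ^ (n + 1)) →+* (R ⧸ P) := Ideal.Quotient.factor hle
  have hf : Function.Surjective f := Ideal.Quotient.factor_surjective hle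
  have hker : Nat.card f.toAddMonoidHom.ker * q = q ^ (n + 1) := by
    have h1 := AddSubgroup.card_mul_index f.toAddMonoidHom.ker
    rw [AddSubgroup.index_ker, hA] at h1
    have h2 : f.toAddMonoidHom.range = ⊤ := AddMonoidHom.range_eq_top.2 hf
    rw [h2] at h1
    have h3 : Nat.card (⊤ : AddSubgroup (R ⧸ P)) = q :=
      (Nat.card_congr AddSubgroup.topEquiv.toEquiv).trans hcP
    rw [h3] at h1
    exact h1
  have hker' : Nat.card f.toAddMonoidHom.ker = q ^ n := by
    rw [pow_succ q n] at hker
    exact Nat.eq_of_mul_eq_mul_right (by omega) hker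
  have h3 : Set.range (Units.val : (R ⧸ P ^ (n + 1))ˣ → _) = (f.toAddMonoidHom.ker : Set _)ᶜ := by
    ext a
    obtain ⟨a, rfl⟩ := hsurj a
    have h4 : f (Ideal.Quotient.mk _ a) = Ideal.Quotient.mk P a := by simp [f]
    constructor
    · rintro ⟨u, hu⟩ h0
      have h5 : IsUnit (f (Ideal.Quotient.mk _ a)) := by rw [← hu]; exact u.isUnit.map f
      have h6 : f (Ideal.Quotient.mk _ a) = 0 := h0
      rw [h6] at h5
      have : Nontrivial (R ⧸ P) := Ideal.Quotient.nontrivial_iff.2 (IsLocalRing.maximalIdeal.isMaximal R).ne_top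
      exact not_isUnit_zero h5
    · intro h0
      have h5 : a ∉ P := by
        intro ha
        exact h0 (AddMonoidHom.mem_ker.2 (h4.trans (Ideal.Quotient.eq_zero_iff_mem.2 ha)))
      have h6 : IsUnit a := by simpa [hP, IsLocalRing.mem_maximalIdeal] using h5
      obtain ⟨w, hw⟩ := h6.map (Ideal.Quotient.mk (P ^ (n + 1)))
      exact ⟨w, hw⟩
  have h4 := Nat.card_range_of_injective (Units.val_injective (α := R ⧸ P ^ (n + 1)))
  rw [← h4, h3, Nat.card_coe_set_eq]
  have h5 := Set.ncard_add_ncard_compl (f.toAddMonoidHom.ker : Set (R ⧸ P ^ (n + 1)))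
  have h6 : (f.toAddMonoidHom.ker : Set (R ⧸ P ^ (n + 1))).ncard = q ^ n := by
    rw [← hker', ← Nat.card_coe_set_eq]; rfl
  have h7 := h5.trans hA
  rw [h6, pow_succ q n] at h7
  rw [Nat.mul_sub, mul_one]
  omega

end

section
variable {R : Type*} [CommRing R] [IsDomain R] [IsDiscreteValuationRing R] {π : R} {q : ℕ}
  {E : Type*} [CommRing E] [Algebra R E] [IsDomain E] [Module.IsTorsionFree R E]
  [IsAdicComplete (IsLocalRing.maximalIdeal R) R]

/-- The endomorphism with linear coefficient `u`. -/
def LTBase.ser (h : LTBase π q) (u : R) : PowerSeries R := (h.exists_isLT u).choose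

lemma LTBase.ser_spec (h : LTBase π q) (u : R) : IsLT π q u (h.ser u) :=
  (h.exists_isLT u).choose_spec

lemma LTBase.ser_one (h : LTBase π q) : h.ser 1 = PowerSeries.X :=
  h.unique (h.ser_spec 1) IsLT.of_X

lemma LTBase.ser_mul (h : LTBase π q) (u w : R) :
    h.ser (u * w) = cmp (h.ser u) (h.ser_spec u).zero (h.ser w) :=
  h.unique (h.ser_spec _) (IsLT.mul (h.ser_spec u) (h.ser_spec w))

/-- Precomposition of `φ` with the endomorphism `u`. -/
def LTBase.tw (h : LTBase π q) (φ : PowerSeries R →ₐ[R] E) (u : R) : PowerSeries R →ₐ[R] E :=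
  φ.comp (cmp (h.ser u) (h.ser_spec u).zero)

lemma LTBase.tw_X (h : LTBase π q) (φ : PowerSeries R →ₐ[R] E) (u : R) :
    h.tw φ u PowerSeries.X = φ (h.ser u) := by
  rw [tw, AlgHom.comp_apply, cmp_X]

lemma LTBase.tw_ser (h : LTBase π q) (φ : PowerSeries R →ₐ[R] E) (u w : R) :
    h.tw φ u (h.ser w) = φ (h.ser (u * w)) := by
  rw [tw, AlgHom.comp_apply, h.ser_mul]

lemma LTBase.tw_ltH (h : LTBase π q) {n : ℕ} {φ : PowerSeries R →ₐ[R] E}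
    (hφ : φ (ltH π q n : PowerSeries R) = 0) (u : Rˣ) :
    h.tw φ u (ltH π q n : PowerSeries R) = 0 :=
  h.algHom_cmp hφ u.isUnit (h.ser_spec u)

lemma LTBase.tw_eq (h : LTBase π q) {n : ℕ} {φ : PowerSeries R →ₐ[R] E}
    (hφ : φ (ltH π q n : PowerSeries R) = 0) {u w : Rˣ} (he : φ (h.ser u) = φ (h.ser w)) :
    h.tw φ u = h.tw φ w :=
  h.algHom_eq (h.tw_ltH hφ u) (h.tw_ltH hφ w) (by rw [tw_X, tw_X, he])

/-- The stabilizer of a root. -/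
def LTBase.stab (h : LTBase π q) {n : ℕ} {φ : PowerSeries R →ₐ[R] E}
    (hφ : φ (ltH π q n : PowerSeries R) = 0) : Subgroup Rˣ where
  carrier := {u | φ (h.ser u) = φ PowerSeries.X}
  one_mem' := by simp [h.ser_one]
  mul_mem' := by
    intro u w hu hw
    have h1 : h.tw φ u = h.tw φ (1 : Rˣ) := h.tw_eq hφ (by simpa [h.ser_one] using hu)
    have h2 := DFunLike.congr_fun h1 (h.ser w)
    rw [tw_ser, tw_ser] at h2
    simp only [Units.val_one, one_mul] at h2
    exact h2.trans hw
  inv_mem' := by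
    intro u hu
    have h1 : h.tw φ u = h.tw φ (1 : Rˣ) := h.tw_eq hφ (by simpa [h.ser_one] using hu)
    have h2 := DFunLike.congr_fun h1 (h.ser (u⁻¹ : Rˣ))
    rw [tw_ser, tw_ser] at h2
    simp only [Units.val_one, one_mul, Units.mul_inv, h.ser_one] at h2
    exact h2.symm

lemma LTBase.stab_le (h : LTBase π q) {n : ℕ} {φ : PowerSeries R →ₐ[R] E}
    (hφ : φ (ltH π q n : PowerSeries R) = 0) : h.stab hφ ≤ unitSub R (n + 1) := by
  intro u hu
  obtain ⟨g, -, hg⟩ := h.pow_dvd_of_fixed (h.ser_spec u) (h.ltF_dvd_sub_X hφ (h.ser_spec u) hu)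
  rw [mem_unitSub, h.max, Ideal.span_singleton_pow, Ideal.mem_span_singleton]
  exact ⟨_, hg⟩

lemma LTBase.div_mem_stab (h : LTBase π q) {n : ℕ} {φ : PowerSeries R →ₐ[R] E}
    (hφ : φ (ltH π q n : PowerSeries R) = 0) {u w : Rˣ} (he : φ (h.ser u) = φ (h.ser w)) :
    w⁻¹ * u ∈ h.stab hφ := by
  have h2 := DFunLike.congr_fun (h.tw_eq hφ he) (h.ser (w⁻¹ : Rˣ))
  rw [tw_ser, tw_ser] at h2
  simp only [Units.mul_inv, h.ser_one] at h2
  rw [mul_comm]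
  exact h2

lemma LTBase.mem_aroots (h : LTBase π q) {n : ℕ} {φ : PowerSeries R →ₐ[R] E}
    (hφ : φ (ltH π q n : PowerSeries R) = 0) (u : Rˣ) :
    φ (h.ser u) ∈ (ltH π q n).aroots E := by
  have h1 := h.tw_ltH hφ u
  rw [algHom_coe, tw_X] at h1
  rw [Polynomial.mem_aroots]
  exact ⟨(ltH_monic_natDegree h.two_le n).1.ne_zero, h1⟩

lemma LTBase.card_aroots_le (h : LTBase π q) (n : ℕ) :
    ((ltH π q n).aroots E).toFinset.card ≤ q ^ n * (q - 1) := by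
  obtain ⟨h1, h2⟩ := ltH_monic_natDegree (π := π) h.two_le n
  refine (Multiset.toFinset_card_le _).trans ?_
  have := Polynomial.card_roots' ((ltH π q n).map (algebraMap R E))
  rwa [h1.natDegree_map, h2] at this

/-- The map from units modulo the stabilizer to roots. -/
def LTBase.rootMap (h : LTBase π q) {n : ℕ} {φ : PowerSeries R →ₐ[R] E}
    (hφ : φ (ltH π q n : PowerSeries R) = 0) (x : Rˣ ⧸ h.stab hφ) :
    ((ltH π q n).aroots E).toFinset :=
  ⟨φ (h.ser x.out), Multiset.mem_toFinset.2 (h.mem_aroots hφ _)⟩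

lemma LTBase.rootMap_injective (h : LTBase π q) {n : ℕ} {φ : PowerSeries R →ₐ[R] E}
    (hφ : φ (ltH π q n : PowerSeries R) = 0) : Function.Injective (h.rootMap hφ) := by
  intro x y hxy
  have h1 := h.div_mem_stab hφ (Subtype.ext_iff.1 hxy).symm
  rw [← QuotientGroup.out_eq' x, ← QuotientGroup.out_eq' y]
  exact QuotientGroup.eq.2 h1

lemma LTBase.stab_eq (h : LTBase π q) {n : ℕ} {φ : PowerSeries R →ₐ[R] E}
    (hφ : φ (ltH π q n : PowerSeries R) = 0) : h.stab hφ = unitSub R (n + 1) := by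
  have hfin : Finite (Rˣ ⧸ h.stab hφ) := Finite.of_injective _ (h.rootMap_injective hφ)
  have h1 : (h.stab hφ).index ≤ q ^ n * (q - 1) := by
    refine le_trans ?_ (h.card_aroots_le (E := E) n)
    have := Nat.card_le_card_of_injective _ (h.rootMap_injective hφ)
    rwa [Nat.card_eq_fintype_card (α := ((ltH π q n).aroots E).toFinset), Fintype.card_coe] at this
  have h0 : (h.stab hφ).FiniteIndex := ⟨Nat.card_pos.ne'⟩
  rw [← index_unitSub h] at h1
  refine le_antisymm (h.stab_le hφ) ?_
  have h2 := Subgroup.relIndex_mul_index (h.stab_le hφ)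
  have h3 : (unitSub R (n + 1)).index ≠ 0 := by
    rw [index_unitSub h]; exact (h.natDegree_pos n).ne'
  have h4 : (h.stab hφ).relIndex (unitSub R (n + 1)) = 1 := by
    have h5 : (h.stab hφ).relIndex (unitSub R (n + 1)) ≤ 1 := by
      by_contra! hc
      have : (unitSub R (n + 1)).index < (h.stab hφ).relIndex (unitSub R (n + 1)) * (unitSub R (n + 1)).index :=
        lt_mul_of_one_lt_left (Nat.pos_of_ne_zero h3) hc
      omega
    have h6 : (h.stab hφ).relIndex (unitSub R (n + 1)) ≠ 0 := fun h6 => h0.index_ne_zero (by rw [← h2, h6, zero_mul])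
    omega
  exact Subgroup.relIndex_eq_one.1 h4

lemma LTBase.rootMap_surjective (h : LTBase π q) {n : ℕ} {φ : PowerSeries R →ₐ[R] E}
    (hφ : φ (ltH π q n : PowerSeries R) = 0) : Function.Surjective (h.rootMap hφ) ∧
    Nat.card ((ltH π q n).aroots E).toFinset = q ^ n * (q - 1) := by
  have hfin : Finite (Rˣ ⧸ h.stab hφ) := Finite.of_injective _ (h.rootMap_injective hφ)
  have h1 : Nat.card (Rˣ ⧸ h.stab hφ) = q ^ n * (q - 1) := by
    rw [← index_unitSub h, ← h.stab_eq hφ, Subgroup.index]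
  have h2 := Nat.card_le_card_of_injective _ (h.rootMap_injective hφ)
  have h3 := h.card_aroots_le (E := E) n
  have h4 : Nat.card ((ltH π q n).aroots E).toFinset = q ^ n * (q - 1) := by
    refine le_antisymm (by rwa [Nat.card_eq_fintype_card, Fintype.card_coe]) (h1 ▸ h2)
  exact ⟨((Nat.bijective_iff_injective_and_card _).2
    ⟨h.rootMap_injective hφ, h1.trans h4.symm⟩).2, h4⟩

/-- Units congruent to `1` modulo `π ^ k` act as the identity on roots of `ltF k`. -/
lemma LTBase.ltF_dvd_of_mem (h : LTBase π q) {n k : ℕ} {φ : PowerSeries R →ₐ[R] E}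
    (hφ : φ (ltH π q n : PowerSeries R) = 0) {u : Rˣ} (hk : k ≤ n + 1) (hu : u ∈ unitSub R k) :
    (ltF π q k : PowerSeries R) ∣ h.ser u - PowerSeries.X := by
  cases k with
  | zero =>
    rw [ltF, Polynomial.coe_X, PowerSeries.X_dvd_iff]
    simp [(h.ser_spec u).zero]
  | succ k =>
    have h1 : ((φ.comp (cmp _ (ltF_ps_zero (π := π) h.two_le (n - k)))) : PowerSeries R →ₐ[R] E)
        (ltH π q k : PowerSeries R) = 0 := by
      rw [AlgHom.comp_apply, cmp_coe_coe, ltH_comp, Nat.add_sub_cancel' (by omega), hφ]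
    rw [← h.stab_eq h1] at hu
    exact h.ltF_dvd_sub_X h1 (h.ser_spec u) hu

lemma LTBase.exists_factor (h : LTBase π q) {n k : ℕ} {φ : PowerSeries R →ₐ[R] E}
    (hφ : φ (ltH π q n : PowerSeries R) = 0) {u : Rˣ} (hk : k ≤ n + 1) (hu : u ∈ unitSub R k)
    (hu' : u ∉ unitSub R (k + 1)) :
    ∃ g, IsUnit g ∧ h.ser u - PowerSeries.X = (ltF π q k : PowerSeries R) * g := by
  obtain ⟨g, hg, hc⟩ := h.pow_dvd_of_fixed (h.ser_spec u) (h.ltF_dvd_of_mem hφ hk hu)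
  refine ⟨g, ?_, hg⟩
  rw [PowerSeries.isUnit_iff_constantCoeff]
  by_contra h0
  apply hu'
  have h1 : PowerSeries.constantCoeff g ∈ IsLocalRing.maximalIdeal R := h0
  rw [h.max, Ideal.mem_span_singleton] at h1
  obtain ⟨c, hc'⟩ := h1
  rw [mem_unitSub, h.max, Ideal.span_singleton_pow, Ideal.mem_span_singleton, hc, hc', pow_succ]
  exact ⟨c, by ring⟩

end

end

section

set_option linter.unusedSectionVars false

section
variable {F : Type*} [Field F] {v : AddValuation F (WithTop ℤ)}

lemma isDiscreteValuationRing_Ov (hn : IsNormalized v) : IsDiscreteValuationRing (Ov v) := by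
  obtain ⟨π, hπ⟩ := exists_unif hn
  let π' : Ov v := ⟨π, mem_ball_of_val hπ |> ball_anti (by norm_num)⟩
  refine IsDiscreteValuationRing.ofHasUnitMulPowIrreducibleFactorization ⟨π', ?_, ?_⟩
  · constructor
    · rw [isUnit_Ov_iff]
      intro h
      have h2 := hπ.symm.trans h
      rw [WithTop.coe_inj] at h2
      omega
    · intro a b hab
      have hab' : π = (a : F) * b := congrArg Subtype.val hab
      have ha0 : (a : F) ≠ 0 := by rintro h; rw [h, zero_mul] at hab'; exact ne_zero_of_val hπ hab'
      have hb0 : (b : F) ≠ 0 := by rintro h; rw [h, mul_zero] at hab'; exact ne_zero_of_val hπ hab'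
      obtain ⟨i, hi⟩ := exists_int_val (v := v) ha0
      obtain ⟨j, hj⟩ := exists_int_val (v := v) hb0
      have h1 := val_unique hπ (hab' ▸ val_mul hi hj)
      have h2 := (mem_ball_iff_of_val hi).1 a.2
      have h3 := (mem_ball_iff_of_val hj).1 b.2
      rw [isUnit_Ov_iff, isUnit_Ov_iff, hi, hj, WithTop.coe_inj, WithTop.coe_inj]
      omega
  · intro x hx
    have hx0 : (x : F) ≠ 0 := fun h => hx (Subtype.ext h)
    obtain ⟨i, hi⟩ := exists_int_val (v := v) hx0
    have h2 := (mem_ball_iff_of_val hi).1 x.2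
    obtain ⟨k, rfl⟩ := Int.eq_ofNat_of_zero_le h2
    have hk := val_pow hπ k
    rw [mul_one] at hk
    have hd := val_div hi hk
    rw [sub_self] at hd
    have hu : IsUnit (⟨(x : F) / π ^ k, mem_ball_of_val hd⟩ : Ov v) := isUnit_Ov_iff.2 hd
    refine ⟨k, hu.unit, ?_⟩
    ext
    simp [π', mul_div_cancel₀ _ (ne_zero_of_val hk)]

lemma exists_ltBase (hn : IsNormalized v) (hfin : FinRes v) :
    ∃ (π : Ov v) (q : ℕ), LTBase π q ∧ v (π : F) = ((1 : ℤ) : WithTop ℤ) := by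
  obtain ⟨π, hπ⟩ := exists_unif hn
  let π' : Ov v := ⟨π, mem_ball_of_val hπ |> ball_anti (by norm_num)⟩
  refine ⟨π', _, ⟨?_, ?_, finite_residue_iff.1 hfin, rfl⟩, hπ⟩
  · intro h
    exact ne_zero_of_val hπ (congrArg Subtype.val h)
  · ext y
    rw [mem_maxIdeal_iff, Ideal.mem_span_singleton]
    constructor
    · intro hy
      refine ⟨⟨y / π, ball_div hy hπ (by norm_num)⟩, ?_⟩
      ext
      simp [π', mul_div_cancel₀ _ (ne_zero_of_val hπ)]
    · rintro ⟨z, rfl⟩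
      exact ball_mul_right (mem_ball_of_val hπ) z.2

end

section
variable {K M : Type*} [Field K] [Field M] [Algebra K M] {vK : AddValuation K (WithTop ℤ)}
  {vM : AddValuation M (WithTop ℤ)} {π : Ov vK} {q n : ℕ}

lemma algebraMap_Ov (x : Ov vK) : algebraMap (Ov vK) M x = algebraMap K M (x : K) := rfl

/-- A totally ramified extension generated by a root of `ltH n`. -/
structure LTExt (vK : AddValuation K (WithTop ℤ)) (vM : AddValuation M (WithTop ℤ)) (π : Ov vK)
    (q n : ℕ) (φ : PowerSeries (Ov vK) →ₐ[Ov vK] M) : Prop where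
  base : LTBase π q
  tr : TR vK vM (q ^ n * (q - 1))
  val : vK (π : K) = ((1 : ℤ) : WithTop ℤ)
  zero : φ (ltH π q n : PowerSeries (Ov vK)) = 0
  unif : vM (φ PowerSeries.X) = ((1 : ℤ) : WithTop ℤ)

lemma Extends.algebraMap_mem_ball {e : ℕ} (h : Extends vK vM e) (x : Ov vK) :
    algebraMap (Ov vK) M x ∈ ball vM 0 := by
  have := (h.mem_ball (x := (x : K)) (n := 0)).2 x.2
  rwa [mul_zero] at this

lemma Extends.aeval_mem_ball {e : ℕ} (h : Extends vK vM e) {l : M} (hl : l ∈ ball vM 0)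
    (r : Polynomial (Ov vK)) : Polynomial.aeval l r ∈ ball vM 0 := by
  rw [Polynomial.aeval_eq_sum_range]
  refine AddSubgroup.sum_mem _ fun i _ => ?_
  rw [Algebra.smul_def]
  exact ball_mul_left (h.algebraMap_mem_ball _) (ball_pow_zero hl i)

variable [IsDiscreteValuationRing (Ov vK)]
  [IsAdicComplete (IsLocalRing.maximalIdeal (Ov vK)) (Ov vK)]
  {φ : PowerSeries (Ov vK) →ₐ[Ov vK] M}

lemma LTExt.mem_ball (h : LTExt vK vM π q n φ) (D : PowerSeries (Ov vK)) : φ D ∈ ball vM 0 := by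
  obtain ⟨Q, r, rfl, -⟩ := h.base.exists_division n D
  rw [map_add, map_mul, h.zero, zero_mul, zero_add, algHom_coe]
  exact h.tr.ext.aeval_mem_ball (mem_ball_of_val h.unif |> ball_anti (by norm_num)) r

lemma LTExt.val_unit (h : LTExt vK vM π q n φ) {g : PowerSeries (Ov vK)} (hg : IsUnit g) :
    vM (φ g) = ((0 : ℤ) : WithTop ℤ) := by
  obtain ⟨g, rfl⟩ := hg
  have h1 := h.mem_ball (g : PowerSeries (Ov vK))
  have h2 := h.mem_ball ((g⁻¹ : (PowerSeries (Ov vK))ˣ) : PowerSeries (Ov vK))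
  have h3 : φ (g : PowerSeries (Ov vK)) * φ ((g⁻¹ : (PowerSeries (Ov vK))ˣ) : PowerSeries (Ov vK)) = 1 := by
    rw [← map_mul, Units.mul_inv, map_one]
  exact isUnit_Ov_iff.1 (IsUnit.of_mul_eq_one (a := (⟨_, h1⟩ : Ov vM)) ⟨_, h2⟩ (Subtype.ext h3))

lemma LTExt.val_ltF (h : LTExt vK vM π q n φ) {k : ℕ} (hk : k ≤ n) :
    vM (φ (ltF π q k : PowerSeries (Ov vK))) = (((q : ℤ) ^ k : ℤ) : WithTop ℤ) := by
  have hq := h.base.two_le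
  induction k with
  | zero => simpa [ltF] using h.unif
  | succ k ih =>
    have h1 := ih (by omega)
    have h2 : φ (ltF π q (k + 1) : PowerSeries (Ov vK)) =
        φ (ltF π q k : PowerSeries (Ov vK)) ^ q +
          algebraMap K M (π : K) * φ (ltF π q k : PowerSeries (Ov vK)) := by
      rw [algHom_coe, algHom_coe, ltF]
      simp only [map_add, map_mul, map_pow, Polynomial.aeval_C]
      rw [algebraMap_Ov]; ring
    have h3 := h.tr.ext.val h.val
    have h4 := val_pow h1 q
    rw [h2, show (q : ℤ) ^ (k + 1) = q * q ^ k by ring]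
    refine val_add_of_ball h4 (ball_anti ?_ (mem_ball_of_val (val_mul h3 h1)))
    have h5 : (q : ℤ) ^ (k + 1) ≤ q ^ n := pow_le_pow_right₀ (by omega) hk
    have h6 : (1 : ℤ) ≤ q ^ k := one_le_pow₀ (by omega)
    have h7 : (1 : ℤ) ≤ ((q - 1 : ℕ) : ℤ) := by omega
    push_cast
    rw [pow_succ] at h5
    nlinarith [pow_pos (show (0 : ℤ) < q by omega) n]

lemma LTExt.val_diff (h : LTExt vK vM π q n φ) {u : (Ov vK)ˣ} {k : ℕ} (hk : k ≤ n)
    (hu : u ∈ unitSub (Ov vK) k) (hu' : u ∉ unitSub (Ov vK) (k + 1)) :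
    vM (φ (h.base.ser u) - φ PowerSeries.X) = (((q : ℤ) ^ k : ℤ) : WithTop ℤ) := by
  obtain ⟨g, hg, he⟩ := h.base.exists_factor h.zero (hk.trans (Nat.le_succ n)) hu hu'
  rw [← map_sub, he, map_mul]
  have := val_mul (h.val_ltF hk) (h.val_unit hg)
  rwa [add_zero] at this

lemma LTExt.minpoly (h : LTExt vK vM π q n φ) :
    minpoly K (φ PowerSeries.X) = (ltH π q n).map (algebraMap (Ov vK) K) := by
  obtain ⟨h1, h2⟩ := ltH_monic_natDegree (π := π) h.base.two_le n
  refine (minpoly.eq_of_irreducible_of_monic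
    ((h1.irreducible_iff_irreducible_map_fraction_map).1 (h.base.irreducible n)) ?_ (h1.map _)).symm
  rw [Polynomial.aeval_map_algebraMap, ← algHom_coe, h.zero]

lemma LTExt.adjoin_eq_top (h : LTExt vK vM π q n φ) :
    IntermediateField.adjoin K {φ PowerSeries.X} = ⊤ := by
  have := h.tr.finiteDimensional
  obtain ⟨h1, h2⟩ := ltH_monic_natDegree (π := π) h.base.two_le n
  rw [Field.primitive_element_iff_minpoly_natDegree_eq, h.minpoly, h1.natDegree_map, h2, h.tr.rank]

lemma LTExt.isSplittingField (h : LTExt vK vM π q n φ) :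
    Polynomial.IsSplittingField K M ((ltH π q n).map (algebraMap (Ov vK) K)) := by
  have := h.tr.finiteDimensional
  obtain ⟨h1, h2⟩ := ltH_monic_natDegree (π := π) h.base.two_le n
  have hm : ((ltH π q n).map (algebraMap (Ov vK) K)).map (algebraMap K M) =
      (ltH π q n).map (algebraMap (Ov vK) M) := by
    rw [Polynomial.map_map]; rfl
  have hr : (((ltH π q n).map (algebraMap (Ov vK) M)).roots.toFinset).card = q ^ n * (q - 1) := by
    have := (h.base.rootMap_surjective h.zero).2
    rw [Nat.card_eq_fintype_card, Fintype.card_coe] at this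
    rw [← this]
  refine ⟨?_, ?_⟩
  · rw [hm, Polynomial.splits_iff_card_roots, h1.natDegree_map, h2]
    refine le_antisymm ?_ ?_
    · have := Polynomial.card_roots' ((ltH π q n).map (algebraMap (Ov vK) M))
      rwa [h1.natDegree_map, h2] at this
    · rw [← hr]
      exact Multiset.toFinset_card_le _
  · rw [eq_top_iff]
    have h3 : Algebra.adjoin K {φ PowerSeries.X} = ⊤ := by
      have := congrArg IntermediateField.toSubalgebra h.adjoin_eq_top
      rwa [IntermediateField.adjoin_simple_toSubalgebra_of_isAlgebraic
        (Algebra.IsAlgebraic.isAlgebraic _), IntermediateField.top_toSubalgebra] at this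
    rw [← h3]
    refine Algebra.adjoin_mono ?_
    rw [Set.singleton_subset_iff, Polynomial.mem_rootSet]
    refine ⟨(h1.map _).ne_zero, ?_⟩
    rw [Polynomial.aeval_map_algebraMap, ← algHom_coe, h.zero]

lemma LTExt.exists_algEquiv (h : LTExt vK vM π q n φ) (u : (Ov vK)ˣ) :
    ∃ σ : M ≃ₐ[K] M, σ (φ PowerSeries.X) = φ (h.base.ser u) := by
  have := h.tr.finiteDimensional
  have := h.isSplittingField
  have hN : Normal K M := Normal.of_isSplittingField ((ltH π q n).map (algebraMap (Ov vK) K))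
  obtain ⟨h1, h2⟩ := ltH_monic_natDegree (π := π) h.base.two_le n
  have h3 : IsConjRoot K (φ PowerSeries.X) (φ (h.base.ser u)) := by
    rw [isConjRoot_def, h.minpoly]
    refine minpoly.eq_of_irreducible_of_monic
      ((h1.irreducible_iff_irreducible_map_fraction_map).1 (h.base.irreducible n)) ?_ (h1.map _)
    have h4 := h.base.tw_ltH h.zero u
    rw [algHom_coe, LTBase.tw_X] at h4
    rw [Polynomial.aeval_map_algebraMap, h4]
  obtain ⟨σ, hσ⟩ := isConjRoot_iff_exists_algEquiv.1 h3.symm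
  exact ⟨σ, hσ⟩

/-- The automorphism attached to a unit. -/
def LTExt.aut (h : LTExt vK vM π q n φ) (u : (Ov vK)ˣ) : M ≃ₐ[K] M := (h.exists_algEquiv u).choose

lemma LTExt.aut_X (h : LTExt vK vM π q n φ) (u : (Ov vK)ˣ) :
    h.aut u (φ PowerSeries.X) = φ (h.base.ser u) := (h.exists_algEquiv u).choose_spec

lemma LTExt.aut_apply (h : LTExt vK vM π q n φ) (u : (Ov vK)ˣ) (D : PowerSeries (Ov vK)) :
    h.aut u (φ D) = h.base.tw φ u D := by
  let ψ : PowerSeries (Ov vK) →ₐ[Ov vK] M :=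
    (((h.aut u).toAlgHom).restrictScalars (Ov vK)).comp φ
  have : ψ = h.base.tw φ u := by
    refine h.base.algHom_eq (n := n) ?_ (h.base.tw_ltH h.zero u) ?_
    · change h.aut u (φ _) = 0
      rw [h.zero, map_zero]
    · rw [LTBase.tw_X]; exact h.aut_X u
  exact DFunLike.congr_fun this D

lemma LTExt.algEquiv_ext (h : LTExt vK vM π q n φ) {σ τ : M ≃ₐ[K] M}
    (hX : σ (φ PowerSeries.X) = τ (φ PowerSeries.X)) : σ = τ := by
  have := h.tr.algHom_ext (f := σ.toAlgHom) (g := τ.toAlgHom) h.unif hX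
  ext x
  exact DFunLike.congr_fun this x

/-- The reciprocity isomorphism of the Lubin-Tate tower at finite level. -/
def LTExt.recip (h : LTExt vK vM π q n φ) : (Ov vK)ˣ →* (M ≃ₐ[K] M) where
  toFun := h.aut
  map_one' := h.algEquiv_ext (by rw [h.aut_X, Units.val_one, h.base.ser_one]; rfl)
  map_mul' := by
    intro u w
    refine h.algEquiv_ext ?_
    rw [AlgEquiv.mul_apply, h.aut_X, h.aut_X, h.aut_apply, LTBase.tw_ser, Units.val_mul]

lemma LTExt.recip_X (h : LTExt vK vM π q n φ) (u : (Ov vK)ˣ) :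
    h.recip u (φ PowerSeries.X) = φ (h.base.ser u) := h.aut_X u

lemma LTExt.ker_recip (h : LTExt vK vM π q n φ) : h.recip.ker = unitSub (Ov vK) (n + 1) := by
  rw [← h.base.stab_eq h.zero]
  ext u
  rw [MonoidHom.mem_ker]
  constructor
  · intro h1
    have h2 := h.recip_X u
    rw [h1] at h2
    exact h2.symm
  · intro h1
    refine h.algEquiv_ext ?_
    rw [h.recip_X]
    exact h1

lemma LTExt.recip_surjective (h : LTExt vK vM π q n φ) : Function.Surjective h.recip := by
  intro σ
  have h1 : σ (φ PowerSeries.X) ∈ ((ltH π q n).aroots M).toFinset := by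
    rw [Multiset.mem_toFinset, Polynomial.mem_aroots]
    refine ⟨(ltH_monic_natDegree h.base.two_le n).1.ne_zero, ?_⟩
    have h2 := h.zero
    rw [algHom_coe] at h2
    have h3 := Polynomial.aeval_algHom_apply (σ.toAlgHom.restrictScalars (Ov vK)) (φ PowerSeries.X) (ltH π q n)
    rw [h2, map_zero] at h3
    exact h3
  obtain ⟨x, hx⟩ := (h.base.rootMap_surjective h.zero).1 ⟨_, h1⟩
  refine ⟨x.out, h.algEquiv_ext ?_⟩
  rw [h.recip_X]
  exact congrArg Subtype.val hx

end

section
universe u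
variable {p : ℕ} [Fact p.Prime] {K : Type u} [Field K] [Algebra ℚ_[p] K] [FiniteDimensional ℚ_[p] K]
  {vK : AddValuation K (WithTop ℤ)} {eK : ℕ}

lemma exists_ltExt (hvK : IsPadicValuation p vK eK) [IsDiscreteValuationRing (Ov vK)]
    [IsAdicComplete (IsLocalRing.maximalIdeal (Ov vK)) (Ov vK)] {π : Ov vK} {q : ℕ}
    (hb : LTBase π q) (hπ : vK (π : K) = ((1 : ℤ) : WithTop ℤ)) (n : ℕ) :
    ∃ (M : Type u) (_ : Field M) (_ : Algebra K M) (vM : AddValuation M (WithTop ℤ))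
      (φ : PowerSeries (Ov vK) →ₐ[Ov vK] M), LTExt vK vM π q n φ ∧ GalInvariant K vM := by
  obtain ⟨h1, h2⟩ := ltH_monic_natDegree (π := π) hb.two_le n
  set P := (ltH π q n).map (algebraMap (Ov vK) K) with hP
  have hirr : Irreducible P := (h1.irreducible_iff_irreducible_map_fraction_map).1 (hb.irreducible n)
  have : Fact (Irreducible P) := ⟨hirr⟩
  have hPm : P.Monic := h1.map _
  let M := AdjoinRoot P
  have hrank : Module.finrank K M = q ^ n * (q - 1) := by
    rw [(AdjoinRoot.powerBasis hirr.ne_zero).finrank, AdjoinRoot.powerBasis_dim, hP, h1.natDegree_map, h2]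
  have : FiniteDimensional K M := (AdjoinRoot.powerBasis hirr.ne_zero).finite
  have : IsScalarTower ℚ_[p] K M := inferInstance
  have : FiniteDimensional ℚ_[p] M := FiniteDimensional.trans ℚ_[p] K M
  obtain ⟨vM, e, hvM⟩ := exists_padicValuation p M
  obtain ⟨d, -, hd⟩ := hvK.extends hvM
  have hdle := hd.le_finrank hvM.1
  rw [hrank] at hdle
  have hl0 : Polynomial.aeval (AdjoinRoot.root P) (ltH π q n) = 0 := by
    have := AdjoinRoot.aeval_eq (f := P) P
    rw [AdjoinRoot.mk_self] at this
    rw [← this]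
    exact (Polynomial.aeval_map_algebraMap K (AdjoinRoot.root P) (ltH π q n)).symm
  obtain ⟨φ, hφX, hφ⟩ := hb.exists_algHom hl0
  set D := q ^ n * (q - 1) with hD
  have hD0 : 0 < D := hb.natDegree_pos n
  set l : M := AdjoinRoot.root P with hl
  have hsum := hl0
  rw [Polynomial.aeval_eq_sum_range, h2, Finset.sum_range_succ] at hsum
  have hlead : (ltH π q n).coeff D = 1 := by rw [← h2]; exact h1
  rw [hlead, one_smul] at hsum
  obtain ⟨D', hD'⟩ : ∃ D', D = D' + 1 := ⟨D - 1, by omega⟩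
  have hc0 : (ltH π q n).coeff 0 = π := by
    rw [Polynomial.coeff_zero_eq_eval_zero, eval_zero_ltH hb.two_le]
  have hci (i : ℕ) (hi : i < D) : algebraMap (Ov vK) M ((ltH π q n).coeff i) ∈ ball vM d := by
    have h3 : (ltH π q n).coeff i ∈ IsLocalRing.maximalIdeal (Ov vK) := by
      rw [← IsLocalRing.residue_eq_zero_iff, ← Polynomial.coeff_map, map_ltH _ hb.residue,
        Polynomial.coeff_X_pow, if_neg (by omega)]
    rw [mem_maxIdeal_iff] at h3
    have := (hd.mem_ball (x := (((ltH π q n).coeff i : Ov vK) : K)) (n := 1)).2 h3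
    rwa [mul_one] at this
  have hπM : vM (algebraMap (Ov vK) M π) = ((d : ℤ) : WithTop ℤ) := by
    have := hd.val hπ
    rwa [mul_one] at this
  have hlne : l ≠ 0 := by
    intro h0
    rw [h0, zero_pow hD0.ne', add_zero, hD', Finset.sum_range_succ'] at hsum
    simp only [hc0, pow_succ, mul_zero, Finset.sum_const_zero, zero_add, pow_zero,
      Algebra.smul_def, mul_one] at hsum
    rw [hsum, AddValuation.map_zero] at hπM
    exact WithTop.top_ne_coe hπM
  obtain ⟨a, ha⟩ := exists_int_val (v := vM) hlne
  have hdpos := hd.1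
  have haD := val_pow ha D
  have ha1 : 1 ≤ a := by
    by_contra! ha0
    have h3 : ∑ i ∈ Finset.range D, (ltH π q n).coeff i • l ^ i ∈ ball vM (D * a + 1) := by
      refine AddSubgroup.sum_mem _ fun i hi => ?_
      have hi' := Finset.mem_range.1 hi
      rw [Algebra.smul_def]
      refine ball_mul (hci i hi') (mem_ball_of_val (val_pow ha i)) ?_
      have : (i : ℤ) ≤ D := by exact_mod_cast hi'.le
      nlinarith
    have h4 : l ^ D ∈ ball vM (D * a + 1) := by
      rw [show l ^ D = -∑ i ∈ Finset.range D, (ltH π q n).coeff i • l ^ i by linear_combination hsum]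
      exact neg_mem h3
    exact (val_eq_iff.1 haD).2 h4
  have hDa : (D : ℤ) * a = d := by
    refine val_unique haD ?_
    rw [hD', Finset.sum_range_succ', ← hD'] at hsum
    have h5 : l ^ D = -(algebraMap (Ov vK) M π +
        ∑ i ∈ Finset.range D', (ltH π q n).coeff (i + 1) • l ^ (i + 1)) := by
      rw [hc0, pow_zero, Algebra.smul_def, mul_one] at hsum
      linear_combination hsum
    rw [h5, AddValuation.map_neg]
    refine val_add_of_ball hπM (AddSubgroup.sum_mem _ fun i hi => ?_)
    have hi' := Finset.mem_range.1 hi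
    rw [Algebra.smul_def]
    refine ball_mul (hci (i + 1) (by omega)) (mem_ball_of_val (val_pow ha (i + 1))) ?_
    push_cast
    nlinarith
  have hdle' : (d : ℤ) ≤ D := by exact_mod_cast hdle
  have hD0' : (0 : ℤ) < D := by exact_mod_cast hD0
  have ha' : a = 1 := by nlinarith
  subst ha'
  have hdD : d = D := by
    have : (d : ℤ) = D := by rw [← hDa, mul_one]
    exact_mod_cast this
  subst hdD
  exact ⟨M, inferInstance, inferInstance, vM, φ, ⟨hb, ⟨hvK.1, hvM.1, hd, hrank⟩, hπ, hφ,
    hφX ▸ ha⟩, hvM.galInvariant'⟩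

end

end

section

set_option linter.unusedSectionVars false

section
variable {A : Type*} [AddCommGroup A]

lemma exists_extend_char {B : Type*} [AddCommGroup B] (f : A →+ B) (χ : A →+ AddCircle (1 : ℚ))
    (h : ∀ x, f x = 0 → χ x = 0) : ∃ θ : B →+ AddCircle (1 : ℚ), ∀ x, θ (f x) = χ x := by
  let g : A ⧸ f.ker →ₗ[ℤ] B := (QuotientAddGroup.kerLift f).toIntLinearMap
  have hg : Function.Injective g := QuotientAddGroup.kerLift_injective f
  let χ' : A ⧸ f.ker →+ AddCircle (1 : ℚ) := QuotientAddGroup.lift f.ker χ (fun x hx => h x hx)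
  obtain ⟨θ, hθ⟩ := CharacterModule.dual_surjective_of_injective g hg χ'
  refine ⟨θ, fun x => ?_⟩
  have := DFunLike.congr_fun hθ (QuotientAddGroup.mk x)
  exact this

lemma exists_char_ne_zero (H : AddSubgroup A) {y : A} (hy : y ∉ H) :
    ∃ η : A →+ AddCircle (1 : ℚ), (∀ x ∈ H, η x = 0) ∧ η y ≠ 0 := by
  obtain ⟨c, hc⟩ := CharacterModule.exists_character_apply_ne_zero_of_ne_zero
    (a := (QuotientAddGroup.mk y : A ⧸ H)) (by rwa [Ne, QuotientAddGroup.eq_zero_iff])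
  refine ⟨(c : (A ⧸ H) →+ AddCircle (1 : ℚ)).comp (QuotientAddGroup.mk' H), fun x hx => ?_, hc⟩
  have : QuotientAddGroup.mk' H x = 0 := (QuotientAddGroup.eq_zero_iff x).2 hx
  change c (QuotientAddGroup.mk' H x) = 0
  rw [this]
  exact map_zero (c : (A ⧸ H) →+ AddCircle (1 : ℚ))

lemma exists_char_root (p : ℕ) (V V' : AddSubgroup A)
    (χ : A →+ AddCircle (1 : ℚ)) (h1 : ∀ x, p • x ∈ V' → χ x = 0)
    (h2 : (∃ x, p • x ∈ V ∧ χ x ≠ 0) ∨ ∃ y ∈ V, ∀ x, y - p • x ∉ V') :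
    ∃ θ : A →+ AddCircle (1 : ℚ), p • θ = χ ∧ (∀ x ∈ V', θ x = 0) ∧ ∃ y ∈ V, θ y ≠ 0 := by
  let f : A →+ A ⧸ V' := (QuotientAddGroup.mk' V').comp (nsmulAddMonoidHom p)
  obtain ⟨θ', hθ'⟩ := exists_extend_char f χ (fun x hx => h1 x (by
    simpa [f, QuotientAddGroup.eq_zero_iff] using (QuotientAddGroup.eq_zero_iff (p • x)).1 hx))
  let θ : A →+ AddCircle (1 : ℚ) := θ'.comp (QuotientAddGroup.mk' V')
  have hθ (x : A) : θ (p • x) = χ x := hθ' x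
  have hθ0 : ∀ x ∈ V', θ x = 0 := by
    intro x hx
    have : QuotientAddGroup.mk' V' x = 0 := (QuotientAddGroup.eq_zero_iff x).2 hx
    change θ' (QuotientAddGroup.mk' V' x) = 0
    rw [this, map_zero]
  have hθp : p • θ = χ := by
    ext x
    rw [AddMonoidHom.nsmul_apply, ← map_nsmul, hθ]
  by_cases hne : ∃ y ∈ V, θ y ≠ 0
  · exact ⟨θ, hθp, hθ0, hne⟩
  push Not at hne
  rcases h2 with ⟨x, hx, hx'⟩ | ⟨y, hy, hy'⟩
  · exact absurd (hθ x ▸ hne _ hx) hx'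
  let H : AddSubgroup A := V' ⊔ (nsmulAddMonoidHom p).range
  obtain ⟨η, hη, hηy⟩ := exists_char_ne_zero H (y := y) (by
    intro hyH
    obtain ⟨a, ha, b, ⟨x, rfl⟩, hab⟩ := AddSubgroup.mem_sup.1 hyH
    apply hy' x
    rw [← hab]
    simpa using ha)
  refine ⟨θ + η, ?_, ?_, y, hy, ?_⟩
  · ext x
    have h3 : η (p • x) = 0 := hη _ (AddSubgroup.mem_sup_right ⟨x, rfl⟩)
    rw [AddMonoidHom.nsmul_apply, AddMonoidHom.add_apply, nsmul_add, ← map_nsmul, ← map_nsmul, h3, hθ,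
      add_zero]
  · intro x hx
    rw [AddMonoidHom.add_apply, hθ0 x hx, hη x (AddSubgroup.mem_sup_left hx), add_zero]
  · rw [AddMonoidHom.add_apply, hne y hy, zero_add]
    exact hηy

end

section
variable {p : ℕ} [Fact p.Prime] {K : Type*} [Field K] {v : AddValuation K (WithTop ℤ)} {ε : ℤ}

lemma mem_unitSub_iff (hn : IsNormalized v) {u : (Ov v)ˣ} {k : ℕ} :
    u ∈ unitSub (Ov v) k ↔ IsU v k ((u : Ov v) : K) := by
  rw [mem_unitSub, mem_maxIdeal_pow_iff hn]
  rfl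

lemma unitSub_anti {R : Type*} [CommRing R] [IsLocalRing R] {k l : ℕ} (h : k ≤ l) :
    unitSub R l ≤ unitSub R k := by
  intro u hu
  rw [mem_unitSub] at *
  exact Ideal.pow_le_pow_right h hu

lemma LocField.mem_unitSub_one (h : LocField p v ε) {x : (Ov v)ˣ}
    (hx : x ^ p ∈ unitSub (Ov v) 1) : x ∈ unitSub (Ov v) 1 := by
  rw [mem_unitSub, pow_one] at *
  have := charP_residue (v := v) (p := p) (ball_anti h.one_le (mem_ball_of_val h.valp))
  rw [← IsLocalRing.residue_eq_zero_iff, map_sub, map_one] at *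
  rw [Units.val_pow_eq_pow_val, map_pow] at hx
  have h1 : (IsLocalRing.residue (Ov v) x - 1) ^ p = 0 := by
    rw [sub_pow_char, one_pow, hx]
  exact eq_zero_of_pow_eq_zero h1

lemma LocField.mem_unitSub_of_pow (h : LocField p v ε) (hζ : ¬∃ ζ : K, IsPrimitiveRoot ζ p)
    {x : (Ov v)ˣ} {T T' : ℕ} (hT : lam p ε T ≤ T')
    (hx : x ^ p ∈ unitSub (Ov v) (T' + 1)) : x ∈ unitSub (Ov v) (T + 1) := by
  have hp : p.Prime := Fact.out
  have key (u : ℕ) (hu : u ≤ T) : x ∈ unitSub (Ov v) (u + 1) := by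
    induction u with
    | zero => exact h.mem_unitSub_one (unitSub_anti (by omega) hx)
    | succ u ih =>
      have h1 := ih (by omega)
      rw [mem_unitSub_iff h.norm] at *
      have h2 : lam p ε ((u + 1 : ℕ) : ℤ) ≤ T' :=
        ((lam_strictMono hp.pos ε).monotone (by exact_mod_cast hu)).trans hT
      refine h.mem_of_pow hζ (by push_cast; omega) h1 ?_
      have h3 : IsU v (T' + 1) (((x : Ov v) : K) ^ p) := by simpa using hx
      exact h3.anti (by simp only [lam] at h2; omega)
  exact key T le_rfl

lemma LocField.not_mem_pow (h : LocField p v ε) (hζ : ¬∃ ζ : K, IsPrimitiveRoot ζ p)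
    {T : ℕ} (hT1 : 1 ≤ T) (hT : ∀ u : ℤ, 1 ≤ u → lam p ε u ≠ T) :
    ∃ y ∈ unitSub (Ov v) T, ∀ x, y / x ^ p ∉ unitSub (Ov v) (T + 1) := by
  have hp : p.Prime := Fact.out
  obtain ⟨π, hπ⟩ := exists_unif h.norm
  have hπT := val_pow hπ T
  rw [mul_one] at hπT
  have hy : v (1 + π ^ T) = ((0 : ℤ) : WithTop ℤ) :=
    val_add_of_ball val_one (ball_anti (by omega) (mem_ball_of_val hπT))
  obtain ⟨y, hy'⟩ := isUnit_Ov_iff.2 (show v (((⟨_, mem_ball_of_val hy⟩ : Ov v)) : K) = _ from hy)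
  have hyT : y ∈ unitSub (Ov v) T := by
    rw [mem_unitSub_iff h.norm, hy']
    simpa [IsU] using mem_ball_of_val hπT
  have hyT' : y ∉ unitSub (Ov v) (T + 1) := by
    rw [mem_unitSub_iff h.norm, hy']
    have := (val_eq_iff.1 hπT).2
    simpa [IsU] using this
  refine ⟨y, hyT, fun x hx => ?_⟩
  have hxT : x ^ p ∈ unitSub (Ov v) T := by
    have := Subgroup.div_mem _ hyT (unitSub_anti (Nat.le_succ T) hx)
    simpa using this
  have hxT' : x ^ p ∉ unitSub (Ov v) (T + 1) := by
    intro h1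
    have := Subgroup.mul_mem _ hx h1
    exact hyT' (by simpa using this)
  have key (u : ℕ) (hu : lam p ε u ≤ T) : x ∈ unitSub (Ov v) (u + 1) := by
    induction u with
    | zero => exact h.mem_unitSub_one (unitSub_anti (by omega) hxT)
    | succ u ih =>
      have hlt := lam_strictMono hp.pos ε (show (u : ℤ) < ((u + 1 : ℕ) : ℤ) by push_cast; omega)
      have h1 := ih (by omega)
      have h2 := hT ((u + 1 : ℕ) : ℤ) (by push_cast; omega)
      refine h.mem_unitSub_of_pow hζ (T' := T - 1) (by omega) ?_
      rwa [Nat.sub_add_cancel hT1]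
  have hlam0 : lam p ε 0 ≤ T := by
    simp only [lam, mul_zero]
    exact (min_le_left _ _).trans (by omega)
  -- take the largest `u` with `lam u ≤ T`
  have hex : ∃ u : ℕ, ¬lam p ε u ≤ T := by
    refine ⟨T + 1, ?_⟩
    have h1 := h.one_le
    have h2 : (2 : ℤ) ≤ p := by exact_mod_cast hp.two_le
    push_cast
    rw [not_le, lam, lt_min_iff]
    constructor <;> nlinarith
  have hfind := Nat.find_spec hex
  set u := Nat.find hex with hu
  have hu0 : 0 < u := by
    by_contra! h0
    have : u = 0 := by omega
    rw [this] at hfind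
    exact hfind hlam0
  have hmin : lam p ε ((u - 1 : ℕ) : ℤ) ≤ T := by
    have := Nat.find_min hex (m := u - 1) (by omega)
    push Not at this
    exact this
  have hxu := key _ hmin
  rw [Nat.sub_add_cancel hu0, mem_unitSub_iff h.norm] at hxu
  have h4 := h.pow_mem (by omega) hxu
  apply hxT'
  rw [mem_unitSub_iff h.norm]
  have : IsU v ((T + 1 : ℕ) : ℤ) (((x : Ov v) : K) ^ p) := h4.anti (by
    rw [not_le, lam] at hfind; push_cast; omega)
  simpa using this

/-- A character of the unit group with prescribed conductors. -/
lemma LocField.exists_char (h : LocField p v ε) (hζ : ¬∃ ζ : K, IsPrimitiveRoot ζ p)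
    (T : ℕ → ℕ) (m : ℕ) (h0 : 0 < m → 1 ≤ T 0 ∧ ∀ u : ℤ, 1 ≤ u → lam p ε u ≠ T 0)
    (h1 : ∀ a, a + 1 < m → lam p ε (T a) = T (a + 1) ∨
      (lam p ε (T a) ≤ T (a + 1) ∧ ∀ u : ℤ, 1 ≤ u → lam p ε u ≠ T (a + 1))) :
    ∃ χ : Additive (Ov v)ˣ →+ AddCircle (1 : ℚ), p ^ m • χ = 0 ∧
      ∀ a < m, (∀ x ∈ unitSub (Ov v) (T a + 1), p ^ (m - 1 - a) • χ (Additive.ofMul x) = 0) ∧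
        ∃ x ∈ unitSub (Ov v) (T a), p ^ (m - 1 - a) • χ (Additive.ofMul x) ≠ 0 := by
  have hp : p.Prime := Fact.out
  induction m with
  | zero => exact ⟨0, by simp, by simp⟩
  | succ m ih =>
    obtain ⟨χ, hχ0, hχ⟩ := ih (fun _ => h0 (by omega)) (fun a ha => h1 a (by omega))
    have hT1 (a : ℕ) (ha : a < m + 1) : 1 ≤ T a := by
      induction a with
      | zero => exact (h0 (by omega)).1
      | succ a iha =>
        have h2 := iha (by omega)
        have h3 : lam p ε (T a) ≤ T (a + 1) := by
          rcases h1 a ha with h3 | h3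
          · exact h3.le
          · exact h3.1
        have h4 := lt_lam hp.two_le h.one_le (u := T a) (by omega)
        omega
    obtain ⟨θ, hθ, hθ0, y, hy, hθy⟩ := exists_char_root p
      (V := (unitSub (Ov v) (T m)).toAddSubgroup) (V' := (unitSub (Ov v) (T m + 1)).toAddSubgroup) χ
      (by
        intro x hx
        have hx' : (Additive.toMul x) ^ p ∈ unitSub (Ov v) (T m + 1) := hx
        rcases m with _ | m
        · rw [pow_zero, one_smul] at hχ0
          rw [hχ0]; rfl
        · have h3 : lam p ε (T m) ≤ T (m + 1) := by
            rcases h1 m (by omega) with h3 | h3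
            · exact h3.le
            · exact h3.1
          have h4 := (hχ m (by omega)).1 _ (h.mem_unitSub_of_pow hζ h3 hx')
          simpa using h4)
      (by
        by_cases hl : ∀ u : ℤ, 1 ≤ u → lam p ε u ≠ T m
        · obtain ⟨y, hy, hy'⟩ := h.not_mem_pow hζ (hT1 m (by omega)) hl
          exact Or.inr ⟨Additive.ofMul y, hy, fun x hx => hy' (Additive.toMul x) hx⟩
        · left
          rcases m with _ | m
          · exact absurd (h0 (by omega)).2 hl
          · have h3 : lam p ε (T m) = T (m + 1) := (h1 m (by omega)).resolve_right (fun h => hl h.2)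
            obtain ⟨x, hx, hx'⟩ := (hχ m (by omega)).2
            refine ⟨Additive.ofMul x, ?_, by simpa using hx'⟩
            change x ^ p ∈ unitSub (Ov v) (T (m + 1))
            rw [mem_unitSub_iff h.norm] at *
            have := h.pow_mem (by omega) hx
            rw [← h3]
            simpa [lam] using this)
    refine ⟨θ, ?_, fun a ha => ?_⟩
    · rw [pow_succ, mul_smul, hθ, hχ0]
    · rcases Nat.lt_succ_iff_lt_or_eq.1 ha with ha' | rfl
      · have h5 : m + 1 - 1 - a = (m - 1 - a) + 1 := by omega
        have h6 (x : (Ov v)ˣ) : p ^ (m + 1 - 1 - a) • θ (Additive.ofMul x) =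
            p ^ (m - 1 - a) • χ (Additive.ofMul x) := by
          rw [h5, pow_succ, mul_smul, ← AddMonoidHom.nsmul_apply, hθ]
        simp only [h6]
        exact hχ a ha'
      · simp only [add_tsub_cancel_right, tsub_self, pow_zero, one_smul]
        exact ⟨fun x hx => hθ0 _ hx, Additive.toMul y, hy, hθy⟩

end

end

section
variable {p m : ℕ} {T : ℕ → ℕ} {s : ℕ → ℤ}

lemma phi_add_const (p : ℕ) {b : ℤ} {c : ℕ} (hb : 0 ≤ b) (k : ℕ)
    (h : ∀ j : ℤ, b < j → j ≤ b + k → numLT m s j = c) :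
    phi p m s (b + k) = phi p m s b + k * ((p : ℚ) ^ c)⁻¹ := by
  induction k with
  | zero => simp
  | succ k ih =>
    rw [Nat.cast_succ, ← add_assoc, phi_add_one p m s (by omega),
      ih fun j h1 h2 => h j h1 (by push_cast; omega), h (b + k + 1) (by omega) (by push_cast; omega)]
    push_cast
    ring

/-- The lower jumps belonging to the upper jumps `T 0, …, T (m - 1)`. -/
lemma psi_eq_of_sum (hp : 0 < p) (hT : ∀ a, a + 1 < m → T a < T (a + 1)) (hT0 : 0 < m → 1 ≤ T 0)
    (h1 : ∀ a < m, 1 ≤ s a) (hs : ∀ a, a + 1 < m → s a < s (a + 1))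
    (h : ∀ a < m, s a = ∑ j ∈ Finset.Icc 1 (T a), (p : ℤ) ^ numLT m (fun a => (T a : ℤ)) j)
    {a : ℕ} (ha : a < m) : psi p m s (T a) = s a := by
  have hTz : ∀ a, a + 1 < m → (fun a => (T a : ℤ)) a < (fun a => (T a : ℤ)) (a + 1) := by
    intro a ha; simpa using hT a ha
  have hpq : (0 : ℚ) < p := by exact_mod_cast hp
  have key : phi p m s (s a) = T a := by
    induction a with
    | zero =>
      have h2 : ∀ b < m, s 0 ≤ s b := by
        intro b hb
        rcases Nat.eq_zero_or_pos b with rfl | h0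
        · exact le_rfl
        · exact (lt_of_strict hs h0 hb).le
      rw [phi_of_le p h2, h 0 ha, Finset.sum_congr rfl (g := fun _ => 1)]
      · simp
      · intro j hj
        rw [Finset.mem_Icc] at hj
        have := (numLT_le_iff hTz ha (i := j)).2 (by simpa using hj.2)
        rw [Nat.le_zero.1 this, pow_zero]
    | succ a ih =>
      have ih := ih (by omega)
      have hlt := hT a ha
      have hdiff : s (a + 1) = s a + ((T (a + 1) - T a) * p ^ (a + 1) : ℕ) := by
        rw [h _ ha, h a (by omega)]
        have hdisj : Finset.Icc 1 (T (a + 1)) = Finset.Icc 1 (T a) ∪ Finset.Ioc (T a) (T (a + 1)) := by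
          ext; simp; omega
        rw [hdisj, Finset.sum_union (by
          rw [Finset.disjoint_left]; intro x; simp; omega)]
        congr 1
        rw [Finset.sum_congr rfl (g := fun _ => (p : ℤ) ^ (a + 1))]
        · simp
        · intro j hj
          rw [Finset.mem_Ioc] at hj
          have h3 := (numLT_le_iff hTz ha (i := j)).2 (by simpa using hj.2)
          have h4 := mt (numLT_le_iff hTz (a := a) (by omega) (i := j)).1
            (by simpa using hj.1)
          rw [show numLT m (fun a => (T a : ℤ)) j = a + 1 by omega]
      have hnum : ∀ j : ℤ, s a < j → j ≤ s a + ((T (a + 1) - T a) * p ^ (a + 1) : ℕ) →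
          numLT m s j = a + 1 := by
        intro j hj1 hj2
        have h3 := (numLT_le_iff hs ha (i := j)).2 (by omega)
        have h4 := mt (numLT_le_iff hs (a := a) (by omega) (i := j)).1 (by omega)
        omega
      rw [hdiff, phi_add_const p (by linarith [h1 a (by omega)]) _ hnum, ih, Nat.cast_mul,
        Nat.cast_sub hlt.le, Nat.cast_pow]
      field_simp
      ring
  have hphi := phi_psi hp h1 hs (T a)
  rcases lt_trichotomy (psi p m s (T a)) (s a) with h0 | h0 | h0
  · have := phi_lt (m := m) (s := s) hp h0
    rw [hphi, key] at this
    simp at this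
  · exact h0
  · have := phi_lt (m := m) (s := s) hp h0
    rw [hphi, key] at this
    simp at this

lemma psi_injective (hp : 0 < p) (h1 : ∀ a < m, 1 ≤ s a)
    (hs : ∀ a, a + 1 < m → s a < s (a + 1)) {u w : ℤ} (h : psi p m s u = psi p m s w) : u = w := by
  have := phi_psi hp h1 hs u
  rw [h, phi_psi hp h1 hs w] at this
  exact_mod_cast this.symm
end

section
variable {G C : Type*} [Group G] [Finite G] [Group C] {D : G →* C} {p m : ℕ}

lemma isCyclic_of_ker_eq (hD : Function.Surjective D) (χ : G →* Multiplicative (AddCircle (1 : ℚ)))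
    (h : D.ker = χ.ker) : IsCyclic C := by
  have : Finite C := Finite.of_surjective D hD
  have : Fintype C := Fintype.ofFinite C
  let ψ : C →* Multiplicative (AddCircle (1 : ℚ)) := D.liftOfSurjective hD ⟨χ, h.le⟩
  have hψ : ∀ g, ψ (D g) = χ g := fun g => MonoidHom.liftOfRightInverse_comp_apply D _ _ ⟨χ, h.le⟩ g
  have hinj : Function.Injective ψ := by
    rw [injective_iff_map_eq_one]
    intro c hc
    obtain ⟨g, rfl⟩ := hD c
    rw [hψ] at hc
    have : g ∈ D.ker := h ▸ hc
    exact this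
  refine isCyclic_of_card_pow_eq_one_le fun n hn => ?_
  have h1 := AddCircle.card_torsion_le_of_isSMulRegular (1 : ℚ) n hn.ne'
    (fun a b hab => by simpa [hn.ne'] using hab)
  have h2 : (ψ '' {c : C | c ^ n = 1}).encard ≤ n := by
    refine le_trans (Set.encard_le_encard ?_) h1
    rintro _ ⟨c, hc, rfl⟩
    have hc' : c ^ n = 1 := hc
    have : ψ c ^ n = 1 := by rw [← map_pow, hc', map_one]
    exact this
  rw [hinj.encard_image, Set.encard_eq_coe_toFinset_card] at h2
  have h3 : ({c : C | c ^ n = 1} : Set C).toFinset.card ≤ n := by exact_mod_cast h2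
  convert h3 using 2
  ext; simp

lemma card_eq_of_exponent [Fact p.Prime] {C : Type*} [Group C] [Finite C] [IsCyclic C] {A : Subgroup C} {k : ℕ}
    (h1 : ∀ x ∈ A, x ^ p ^ k = 1) (h2 : 0 < k → ∃ x ∈ A, x ^ p ^ (k - 1) ≠ 1) :
    Nat.card A = p ^ k := by
  have hp : p.Prime := Fact.out
  have : Fintype C := Fintype.ofFinite C
  apply le_antisymm
  · have := IsCyclic.card_pow_eq_one_le (α := C) (pow_pos hp.pos k)
    refine le_trans ?_ this
    rw [Nat.card_eq_fintype_card, Fintype.card_subtype]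
    refine Finset.card_le_card fun x hx => ?_
    simp only [Finset.mem_filter, Finset.mem_univ, true_and] at hx ⊢
    exact h1 x hx
  · rcases Nat.eq_zero_or_pos k with rfl | hk
    · rw [pow_zero]; exact Nat.card_pos
    · obtain ⟨x, hx, hx'⟩ := h2 hk
      obtain ⟨k, rfl⟩ := Nat.exists_eq_succ_of_ne_zero hk.ne'
      have := orderOf_eq_prime_pow hx' (h1 x hx)
      rw [Nat.succ_eq_add_one, Nat.add_sub_cancel] at this
      rw [Nat.succ_eq_add_one, ← this, ← Nat.card_zpowers]
      exact Subgroup.card_le_of_le (Subgroup.zpowers_le.2 hx)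

end

section
variable {G C : Type*} [Group G] [Finite G] [Group C] {D : G →* C} {p m : ℕ}

/-- Counting the elements of a coset of the kernel of a surjection onto a cyclic group in a
subgroup. -/
lemma index_mul_card_coset [Fact p.Prime] (hD : Function.Surjective D) [IsCyclic C]
    (hC : Nat.card C = p ^ m) {σ : C} (hσ : ∀ c, c ∈ Subgroup.zpowers σ) {A : Subgroup G} {ν : ℕ}
    (hν : ν ≤ m) (h1 : ∀ x ∈ A, D x ^ p ^ (m - ν) = 1)
    (h2 : ν < m → ∃ x ∈ A, D x ^ p ^ (m - ν - 1) ≠ 1) {a : ℕ} (ha : a < m) {τ : G}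
    (hτ : D τ = σ ^ p ^ a) :
    A.index * Nat.card {h : D.ker // τ * h ∈ A} = if ν ≤ a then Nat.card D.ker * p ^ ν else 0 := by
  have hp : p.Prime := Fact.out
  have : Finite C := Finite.of_surjective D hD
  have hcard : Nat.card (A.map D) = p ^ (m - ν) := by
    refine card_eq_of_exponent ?_ ?_
    · rintro _ ⟨x, hx, rfl⟩
      exact h1 x hx
    · intro h
      obtain ⟨x, hx, hx'⟩ := h2 (by omega)
      exact ⟨D x, ⟨x, hx, rfl⟩, hx'⟩
  have hσo : orderOf σ = p ^ m := by rw [orderOf_eq_card_of_forall_mem_zpowers hσ, hC]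
  have hmem : ∀ c : C, c ∈ A.map D ↔ c ^ p ^ (m - ν) = 1 := by
    intro c
    constructor
    · rintro ⟨x, hx, rfl⟩
      exact h1 x hx
    · intro hc
      have := Fintype.ofFinite C
      have h3 : (A.map D : Set C) = {c : C | c ^ p ^ (m - ν) = 1} := by
        refine Set.eq_of_subset_of_ncard_le ?_ ?_ (Set.toFinite _)
        · rintro _ ⟨x, hx, rfl⟩
          exact h1 x hx
        · rw [show (A.map D : Set C).ncard = p ^ (m - ν) from hcard, Set.ncard_eq_toFinset_card']
          refine le_trans (le_of_eq ?_) (IsCyclic.card_pow_eq_one_le (α := C) (pow_pos hp.pos (m - ν)))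
          congr 1
          ext; simp
      exact h3.symm.subset hc
  have hiff : σ ^ p ^ a ∈ A.map D ↔ ν ≤ a := by
    rw [hmem, ← pow_mul, ← pow_add, ← orderOf_dvd_iff_pow_eq_one, hσo,
      Nat.pow_dvd_pow_iff_le_right hp.one_lt]
    omega
  split_ifs with hνa
  · obtain ⟨x, hx, hxτ⟩ := hiff.2 hνa
    have hcoset : Nat.card {h : D.ker // τ * h ∈ A} = Nat.card (D.ker ⊓ A : Subgroup G) := by
      have hk : τ⁻¹ * x ∈ D.ker := by
        rw [MonoidHom.mem_ker, map_mul, map_inv, hτ, hxτ]; simp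
      refine Nat.card_congr ⟨fun h => ⟨(τ⁻¹ * x)⁻¹ * h.1.1, ?_, ?_⟩,
        fun h => ⟨⟨(τ⁻¹ * x) * h.1, mul_mem hk h.2.1⟩, ?_⟩, ?_, ?_⟩
      · exact D.ker.mul_mem (D.ker.inv_mem hk) h.1.2
      · have := mul_mem (A.inv_mem hx) h.2
        convert this using 1
        simp [mul_assoc]
      · have := mul_mem hx h.2.2
        convert this using 1
        simp [mul_assoc]
      · intro h; ext; simp [mul_assoc]
      · intro h; ext; simp [mul_assoc]
    have e1 : Nat.card (D.ker ⊓ A : Subgroup G) * Nat.card (A.map D) = Nat.card A := by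
      rw [← Subgroup.relIndex_ker, ← Subgroup.inf_relIndex_right]
      rw [← Nat.card_congr (Subgroup.subgroupOfEquivOfLe
        (inf_le_right : D.ker ⊓ A ≤ A)).toEquiv]
      exact Subgroup.card_mul_index _
    have e2 : Nat.card D.ker * p ^ m = Nat.card G := by
      rw [← hC, ← Subgroup.card_mul_index D.ker, Subgroup.index_ker,
        MonoidHom.range_eq_top.2 hD, Subgroup.card_top]
    have e3 := Subgroup.card_mul_index A
    rw [hcoset]
    rw [hcard] at e1
    have hpos : 0 < p ^ (m - ν) := pow_pos hp.pos _
    apply Nat.eq_of_mul_eq_mul_right hpos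
    calc _ = Nat.card (D.ker ⊓ A : Subgroup G) * p ^ (m - ν) * A.index := by ring
      _ = Nat.card D.ker * p ^ m := by rw [e1, e3, e2]
      _ = _ := by rw [mul_assoc, ← pow_add, Nat.add_sub_cancel' hν]
  · have : IsEmpty {h : D.ker // τ * h ∈ A} := by
      refine ⟨fun h => hνa (hiff.1 ⟨τ * h.1, h.2, ?_⟩)⟩
      rw [map_mul, hτ, MonoidHom.mem_ker.1 h.1.2, mul_one]
    simp

end

section
variable {K M : Type*} [Field K] [Field M] [Algebra K M] {vK : AddValuation K (WithTop ℤ)}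
  {vM : AddValuation M (WithTop ℤ)} [IsDiscreteValuationRing (Ov vK)]
  [IsAdicComplete (IsLocalRing.maximalIdeal (Ov vK)) (Ov vK)] {π : Ov vK} {q n : ℕ}
  {φ : PowerSeries (Ov vK) →ₐ[Ov vK] M}

/-- The image of the filtration of the units in the Galois group. -/
def LTExt.fil (h : LTExt vK vM π q n φ) (j : ℕ) : Subgroup (M ≃ₐ[K] M) :=
  (unitSub (Ov vK) j).map h.recip

lemma LTExt.recip_mem_fil (h : LTExt vK vM π q n φ) {u : (Ov vK)ˣ} {j : ℕ} (hj : j ≤ n + 1) :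
    h.recip u ∈ h.fil j ↔ u ∈ unitSub (Ov vK) j := by
  constructor
  · rintro ⟨w, hw, hwu⟩
    have : w⁻¹ * u ∈ h.recip.ker := by rw [MonoidHom.mem_ker, map_mul, map_inv, hwu]; simp
    rw [h.ker_recip] at this
    simpa using mul_mem hw (unitSub_anti hj this)
  · exact fun hu => ⟨u, hu, rfl⟩

lemma LTExt.index_fil (h : LTExt vK vM π q n φ) {j : ℕ} (hj : j ≤ n + 1) :
    (h.fil j).index = (unitSub (Ov vK) j).index :=
  Subgroup.index_map_eq _ h.recip_surjective (by rw [h.ker_recip]; exact unitSub_anti hj)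

lemma LTExt.val_diff_eq_sum (h : LTExt vK vM π q n φ) {g : M ≃ₐ[K] M} (hg : g ≠ 1) :
    vM (g (φ PowerSeries.X) - φ PowerSeries.X) =
      ((1 + ∑ j ∈ Finset.Icc 1 n, if g ∈ h.fil j then ((h.fil j).index : ℤ) else 0 : ℤ) :
        WithTop ℤ) := by
  obtain ⟨u, rfl⟩ := h.recip_surjective g
  have hu : u ∉ unitSub (Ov vK) (n + 1) := by
    rw [← h.ker_recip]
    exact hg
  have hex : ∃ j, u ∉ unitSub (Ov vK) (j + 1) := ⟨n, hu⟩
  set k := Nat.find hex with hk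
  have hk1 : u ∉ unitSub (Ov vK) (k + 1) := Nat.find_spec hex
  have hkn : k ≤ n := Nat.find_min' hex hu
  have hk0 : u ∈ unitSub (Ov vK) k := by
    rcases Nat.eq_zero_or_pos k with h0 | h0
    · rw [h0, mem_unitSub]
      simp
    · have := Nat.find_min hex (m := k - 1) (by omega)
      rw [not_not, Nat.sub_add_cancel h0] at this
      exact this
  rw [h.recip_X, h.val_diff hkn hk0 hk1, WithTop.coe_inj]
  have h1 : ∀ j ∈ Finset.Icc 1 n, (if h.recip u ∈ h.fil j then ((h.fil j).index : ℤ) else 0) =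
      if j ∈ Finset.Icc 1 k then (q : ℤ) ^ (j - 1) * (q - 1) else 0 := by
    intro j hj
    rw [Finset.mem_Icc] at hj
    rw [h.recip_mem_fil (by omega)]
    by_cases hjk : j ≤ k
    · rw [if_pos (unitSub_anti hjk hk0), if_pos (Finset.mem_Icc.2 ⟨hj.1, hjk⟩),
        h.index_fil (by omega)]
      obtain ⟨i, rfl⟩ := Nat.exists_eq_add_of_le' hj.1
      rw [index_unitSub h.base, Nat.add_sub_cancel]
      have := h.base.two_le
      push_cast [Nat.cast_sub (show 1 ≤ q by omega)]
      ring
    · rw [if_neg fun hj' => hk1 (unitSub_anti (by omega) hj'), if_neg (by simp; omega)]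
  rw [Finset.sum_congr rfl h1, ← Finset.sum_filter,
    show (Finset.Icc 1 n).filter (· ∈ Finset.Icc 1 k) = Finset.Icc 1 k by ext; simp; omega]
  clear_value k
  clear h1 hk hk1 hkn hk0
  induction k with
  | zero => simp
  | succ k ih =>
    rw [Finset.sum_Icc_succ_top (by omega), ← add_assoc, ← ih, Nat.add_sub_cancel]
    ring

lemma LTExt.isGalois [CharZero K] (h : LTExt vK vM π q n φ) : IsGalois K M := by
  have := h.isSplittingField
  have := h.tr.finiteDimensional
  have : Normal K M := Normal.of_isSplittingField ((ltH π q n).map (algebraMap (Ov vK) K))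
  exact { }

variable {p m : ℕ} [Fact p.Prime] {ε : ℤ} {T : ℕ → ℕ}

/-- The cyclic extension cut out by a character of the unit group. -/
lemma LTExt.exists_cyclic [CharZero K] (h : LTExt vK vM π q n φ) (hinv : GalInvariant K vM)
    (hv : vK (p : K) = (ε : WithTop ℤ)) (hε : 1 ≤ ε) (hm : 0 < m) (hn : n = T (m - 1))
    (hT : ∀ a, a + 1 < m → T a < T (a + 1)) (hT0 : 1 ≤ T 0)
    {χ : Additive (Ov vK)ˣ →+ AddCircle (1 : ℚ)} (hχ0 : p ^ m • χ = 0)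
    (hχ : ∀ a < m, (∀ x ∈ unitSub (Ov vK) (T a + 1), p ^ (m - 1 - a) • χ (Additive.ofMul x) = 0) ∧
      ∃ x ∈ unitSub (Ov vK) (T a), p ^ (m - 1 - a) • χ (Additive.ofMul x) ≠ 0) :
    ∃ (L : IntermediateField K M) (vL : AddValuation L (WithTop ℤ)) (σ : L ≃ₐ[K] L) (s : ℕ → ℤ),
      CycTR p m vK vL σ ε s ∧ ∀ a < m, psi p m s (T a) = s a := by
  have hpr : p.Prime := Fact.out
  have hfd := h.tr.finiteDimensional
  have hgal := h.isGalois
  have hkle : h.recip.ker ≤ (AddMonoidHom.toMultiplicativeRight χ).ker := by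
    rw [h.ker_recip, hn]
    intro x hx
    have := (hχ (m - 1) (by omega)).1 x hx
    rw [Nat.sub_self, pow_zero, one_smul] at this
    exact this
  let X : (M ≃ₐ[K] M) →* Multiplicative (AddCircle (1 : ℚ)) :=
    h.recip.liftOfSurjective h.recip_surjective ⟨_, hkle⟩
  have hX : ∀ u, X (h.recip u) = Multiplicative.ofAdd (χ (Additive.ofMul u)) := fun u =>
    MonoidHom.liftOfRightInverse_comp_apply h.recip _ _ ⟨_, hkle⟩ u
  have hXn : X.ker.Normal := inferInstance
  let L := IntermediateField.fixedField X.ker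
  have hL : IsGalois K L := IsGalois.of_fixedField_normal_subgroup X.ker
  let D : (M ≃ₐ[K] M) →* (L ≃ₐ[K] L) := AlgEquiv.restrictNormalHom L
  have hD : Function.Surjective D := AlgEquiv.restrictNormalHom_surjective (F := K) (K₁ := L) M
  have hker : D.ker = X.ker := by
    rw [show D.ker = L.fixingSubgroup from IntermediateField.restrictNormalHom_ker L,
      IntermediateField.fixingSubgroup_fixedField]
  have hcyc : IsCyclic (L ≃ₐ[K] L) := isCyclic_of_ker_eq hD X hker
  have hDpow : ∀ u k, D (h.recip u) ^ k = 1 ↔ k • χ (Additive.ofMul u) = 0 := by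
    intro u k
    rw [← map_pow, ← MonoidHom.mem_ker, hker, MonoidHom.mem_ker, map_pow, hX]
    exact Iff.rfl
  have hpm : ∀ u, p ^ m • χ (Additive.ofMul u) = 0 := fun u => by
    simpa using DFunLike.congr_fun hχ0 (Additive.ofMul u)
  have hcardC : Nat.card (L ≃ₐ[K] L) = p ^ m := by
    rw [← Subgroup.card_top]
    refine card_eq_of_exponent ?_ ?_
    · intro x _
      obtain ⟨g, rfl⟩ := hD x
      obtain ⟨u, rfl⟩ := h.recip_surjective g
      exact (hDpow u _).2 (hpm u)
    · intro _
      obtain ⟨x, -, hx⟩ := (hχ 0 hm).2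
      exact ⟨D (h.recip x), trivial, fun h' => hx ((hDpow _ _).1 h')⟩
  have hrank : Module.finrank K L = p ^ m := by rw [← IsGalois.card_aut_eq_finrank, hcardC]
  obtain ⟨vL, hKL, hLM⟩ := h.tr.tower L
  rw [hrank] at hKL
  obtain ⟨σ, hσ⟩ := hcyc.exists_generator
  obtain ⟨s, hs⟩ := hKL.exists_cycTR hL (hinv.of_extends hLM.ext) hσ hv hε
  refine ⟨L, vL, σ, s, hs, fun a ha => psi_eq_of_sum hpr.pos hT (fun _ => hT0) hs.one_le hs.strict
    (fun a ha => ?_) ha⟩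
  have hTz : ∀ a, a + 1 < m → (T a : ℤ) < (T (a + 1) : ℤ) := fun a ha => by
    exact_mod_cast hT a ha
  have hTn : T a ≤ n := by
    rw [hn]
    rcases (show a ≤ m - 1 by omega).eq_or_lt with h1 | h1
    · rw [h1]
    · exact_mod_cast (lt_of_strict hTz h1 (by omega)).le
  obtain ⟨τ, hτ⟩ := hD (σ ^ p ^ a)
  obtain ⟨ϖ, hϖ⟩ := exists_unif hKL.normF
  have hcount : ∀ j ∈ Finset.Icc 1 n, (h.fil j).index * Nat.card {g : D.ker // τ * g ∈ h.fil j} =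
      if j ≤ T a then Nat.card D.ker * p ^ numLT m (fun a => (T a : ℤ)) j else 0 := by
    intro j hj
    rw [Finset.mem_Icc] at hj
    have hle := numLT_le m (fun a => (T a : ℤ)) j
    have hiff := numLT_le_iff (i := j) (s := fun a => (T a : ℤ)) hTz ha
    rw [Nat.cast_le] at hiff
    simp only [← hiff]
    refine index_mul_card_coset hD hcardC hσ hle ?_ ?_ ha hτ
    · rintro _ ⟨u, hu, rfl⟩
      rw [hDpow]
      rcases Nat.eq_zero_or_pos (numLT m (fun a => (T a : ℤ)) j) with h0 | h0
      · rw [h0]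
        exact hpm u
      · obtain ⟨b, hb⟩ := Nat.exists_eq_add_of_le' h0
        have hbj := mt (numLT_le_iff (i := j) (s := fun a => (T a : ℤ)) hTz (a := b) (by omega)).2
          (by omega)
        rw [Nat.cast_le] at hbj
        have := (hχ b (by omega)).1 u (unitSub_anti (by omega) hu)
        rwa [hb, show m - (b + 1) = m - 1 - b by omega]
    · intro h0
      have hbj := (numLT_le_iff (i := j) (s := fun a => (T a : ℤ)) hTz h0).1 le_rfl
      rw [Nat.cast_le] at hbj
      obtain ⟨x, hx, hx'⟩ := (hχ _ h0).2
      refine ⟨h.recip x, ⟨x, unitSub_anti hbj hx, rfl⟩, fun h1 => hx' ?_⟩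
      rw [hDpow] at h1
      rwa [show m - 1 - numLT m (fun a => (T a : ℤ)) j = m - numLT m (fun a => (T a : ℤ)) j - 1 by
        omega]
  let e : (M ≃ₐ[L] M) ≃ D.ker := (IntermediateField.fixingSubgroupEquiv L).symm.toEquiv.trans
    (Equiv.subtypeEquivRight fun g => by
      rw [show D.ker = L.fixingSubgroup from IntermediateField.restrictNormalHom_ker L])
  have he : ∀ g x, (e g).1 x = g x := fun g x => rfl
  have hne : ∀ g : D.ker, τ * g ≠ 1 := by
    intro g hg
    have h1 := congrArg D hg
    rw [map_mul, MonoidHom.mem_ker.1 g.2, mul_one, map_one, hτ, ← orderOf_dvd_iff_pow_eq_one,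
      hs.orderOf_eq, Nat.pow_dvd_pow_iff_le_right hpr.one_lt] at h1
    omega
  have hherb := hKL.herbrand hLM h.tr hinv τ h.unif hϖ (a := fun g => 1 + ∑ j ∈ Finset.Icc 1 n,
    if τ * (e g).1 ∈ h.fil j then ((h.fil j).index : ℤ) else 0)
    fun g => h.val_diff_eq_sum (hne (e g))
  have hjump := hs.jump ϖ hϖ a ha 1 (by
    rw [Int.natCast_dvd_ofNat]; exact hpr.one_lt.ne' ∘ Nat.dvd_one.1)
  have hcomm : τ (algebraMap L M ϖ) = algebraMap L M (D τ ϖ) :=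
    (AlgEquiv.restrictNormal_commutes τ L ϖ).symm
  rw [one_mul, ← Nat.cast_pow, zpow_natCast, ← hτ] at hjump
  rw [hcomm, ← map_sub] at hherb
  have hfin := val_unique (hLM.ext.val hjump) hherb
  rw [Finset.sum_add_distrib, Finset.sum_comm] at hfin
  have hsum : ∀ j ∈ Finset.Icc 1 n, (∑ g : M ≃ₐ[L] M,
      if τ * (e g).1 ∈ h.fil j then ((h.fil j).index : ℤ) else 0) =
      if j ∈ Finset.Icc 1 (T a) then
        (Nat.card D.ker : ℤ) * (p : ℤ) ^ numLT m (fun a => (T a : ℤ)) j else 0 := by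
    intro j hj
    have h2 := hcount j hj
    rw [Finset.mem_Icc] at hj
    rw [Fintype.sum_equiv e _ (fun g => if τ * g.1 ∈ h.fil j then ((h.fil j).index : ℤ) else 0)
      (fun _ => rfl), ← Finset.sum_filter, Finset.sum_const, nsmul_eq_mul, mul_comm]
    rw [Nat.card_eq_fintype_card (α := {g : D.ker // τ * g ∈ h.fil j}),
      Fintype.card_subtype] at h2
    rw [show (if j ∈ Finset.Icc 1 (T a) then
        (Nat.card D.ker : ℤ) * (p : ℤ) ^ numLT m (fun a => (T a : ℤ)) j else 0) =
      ((if j ≤ T a then Nat.card D.ker * p ^ numLT m (fun a => (T a : ℤ)) j else 0 : ℕ) : ℤ) by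
        simp [hj.1], ← h2]
    push_cast
    rfl
  rw [Finset.sum_congr rfl hsum, ← Finset.sum_filter, show (Finset.Icc 1 n).filter
    (· ∈ Finset.Icc 1 (T a)) = Finset.Icc 1 (T a) by ext; simp; omega, ← Finset.mul_sum] at hfin
  have hcardker : Nat.card D.ker = Module.finrank L M := by
    rw [← Nat.card_congr e, IsGalois.card_aut_eq_finrank]
  rw [Finset.sum_const, Finset.card_univ, ← Nat.card_eq_fintype_card,
    IsGalois.card_aut_eq_finrank, hcardker, nsmul_eq_mul, mul_one] at hfin
  have hpos : (0 : ℤ) < Module.finrank L M := by exact_mod_cast hLM.pos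
  have := mul_left_cancel₀ hpos.ne' (hfin.trans (by ring : _ = (Module.finrank L M : ℤ) *
    (1 + ∑ j ∈ Finset.Icc 1 (T a), (p : ℤ) ^ numLT m (fun a => (T a : ℤ)) j)))
  linarith

end

section

section
variable {K M M' : Type*} [Field K] [Field M] [Algebra K M] [Field M'] [Algebra K M'] {p m : ℕ}
  {vK : AddValuation K (WithTop ℤ)} {vM : AddValuation M (WithTop ℤ)} {σ : M ≃ₐ[K] M} {ε : ℤ}
  {s : ℕ → ℤ}

lemma CycTR.transport (h : CycTR p m vK vM σ ε s) (e : M ≃ₐ[K] M') :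
    CycTR p m vK (vM.comap (e.symm : M' →+* M)) (e.autCongr σ) ε s := by
  have hv : ∀ x, vM.comap (e.symm : M' →+* M) x = vM (e.symm x) := fun x => rfl
  have haut : ∀ (g : M ≃ₐ[K] M) x, e.symm (e.autCongr g x) = g (e.symm x) := fun g x =>
    e.symm_apply_apply _
  have := h.gal
  refine ⟨h.prime, ⟨h.tr.normK, fun n => ?_, ⟨h.tr.pos, fun x => ?_⟩, ?_⟩, IsGalois.of_algEquiv e,
    fun g x => ?_, fun g => ?_, h.valp, h.one_le_ε, fun π hπ a ha b hb => ?_, h.one_le, h.strict⟩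
  · obtain ⟨x, hx⟩ := h.tr.normF n
    exact ⟨e x, by rw [hv, e.symm_apply_apply, hx]⟩
  · rw [hv, e.symm.commutes, h.tr.ext.2]
  · rw [← e.toLinearEquiv.finrank_eq, h.tr.rank]
  · obtain ⟨g, rfl⟩ := e.autCongr.surjective g
    rw [hv, hv, haut, h.inv]
  · obtain ⟨g, rfl⟩ := e.autCongr.surjective g
    obtain ⟨k, rfl⟩ := h.gen g
    exact ⟨k, (map_zpow e.autCongr σ k).symm⟩
  · rw [hv, ← map_zpow, map_sub, haut]
    exact h.jump _ hπ a ha b hb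

lemma CycTR.isUpperJump_iff_exists {T : ℕ → ℕ} (h : CycTR p m vK vM σ ε s)
    (hinv : GalInvariant K vM) (hT : ∀ a < m, psi p m s (T a) = s a) (u : ℤ) :
    IsUpperJump vM hinv u ↔ ∃ a < m, (T a : ℤ) = u := by
  rw [h.isUpperJump_iff hinv fun a ha => ⟨_, hT a ha⟩]
  refine exists_congr fun a => and_congr_right fun ha => ?_
  rw [← hT a ha]
  exact ⟨fun h1 => (psi_injective h.prime.pos h.one_le h.strict h1).symm, fun h1 => by rw [h1]⟩
end

section
variable {p : ℕ} [Fact p.Prime] {e : ℤ}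

lemma lam_ne_of_coprime {T : ℤ} (h1 : ((p : ℤ) - 1) * T < p * e) (h2 : Int.gcd T p = 1) (u : ℤ) :
    lam p e u ≠ T := by
  have hp : p.Prime := Fact.out
  have hp2 : (2 : ℤ) ≤ p := by exact_mod_cast hp.two_le
  rintro rfl
  rcases min_choice ((p : ℤ) * u) (u + e) with h | h
  · rw [lam, h] at h2
    have h3 := Int.dvd_coe_gcd (Dvd.intro u rfl : (p : ℤ) ∣ p * u) (dvd_refl (p : ℤ))
    rw [h2] at h3
    have := Int.le_of_dvd one_pos h3
    omega
  · have h3 := min_le_left ((p : ℤ) * u) (u + e)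
    rw [lam, h] at h1
    rw [h] at h3
    nlinarith
end

universe u
variable {p : ℕ} [Fact p.Prime] {K : Type u} [Field K] [Algebra ℚ_[p] K] [FiniteDimensional ℚ_[p] K]
  {vK : AddValuation K (WithTop ℤ)} {eK m : ℕ}

theorem exists_of_conditions (hvK : IsPadicValuation p vK eK)
    (hζ : ¬∃ ζ : K, IsPrimitiveRoot ζ p) (Ω : Type*) [Field Ω] [Algebra K Ω] [IsAlgClosure K Ω]
    (hm : 0 < m) {t : Fin m → ℤ} (ht : StrictMono t)
    (h1 : 1 ≤ t ⟨0, hm⟩ ∧ ((p : ℤ) - 1) * t ⟨0, hm⟩ < (p : ℤ) * eK ∧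
        Int.gcd (t ⟨0, hm⟩) p = 1)
    (h2 : ∀ i : Fin m, ∀ hi : (i : ℕ) + 1 < m,
        ((p : ℤ) - 1) * t i < (eK : ℤ) →
          (t ⟨(i : ℕ) + 1, hi⟩ = (p : ℤ) * t i ∨
            ((p : ℤ) * t i < t ⟨(i : ℕ) + 1, hi⟩ ∧
              ((p : ℤ) - 1) * t ⟨(i : ℕ) + 1, hi⟩ < (p : ℤ) * eK ∧
              Int.gcd (t ⟨(i : ℕ) + 1, hi⟩) p = 1)))
    (h3 : ∀ i : Fin m, ∀ hi : (i : ℕ) + 1 < m,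
        (eK : ℤ) ≤ ((p : ℤ) - 1) * t i →
          t ⟨(i : ℕ) + 1, hi⟩ = t i + eK) :
    ∃ M : IntermediateField K Ω,
      Module.finrank K ↥M = p ^ m ∧ IsGalois K ↥M ∧ IsCyclic (↥M ≃ₐ[K] ↥M) ∧
      ∃ (vM : AddValuation ↥M (WithTop ℤ)) (hGal : GalInvariant K vM),
        IsNormalized vM ∧ Extends vK vM (p ^ m) ∧
        (∀ s : ℤ, IsUpperJump vM hGal s ↔ ∃ i, t i = s) := by
  have hlf := hvK.locField
  let T : ℕ → ℕ := fun a => if ha : a < m then (t ⟨a, ha⟩).toNat else 0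
  have hTt : ∀ a (ha : a < m), (T a : ℤ) = t ⟨a, ha⟩ := by
    intro a ha
    have := ht.monotone (show (⟨0, hm⟩ : Fin m) ≤ ⟨a, ha⟩ from Nat.zero_le a)
    simp only [T, dif_pos ha]
    omega
  have hT0 : 1 ≤ T 0 := by
    have := hTt 0 hm
    omega
  have hT : ∀ a, a + 1 < m → T a < T (a + 1) := by
    intro a ha
    have := ht (show (⟨a, by omega⟩ : Fin m) < ⟨a + 1, ha⟩ from Nat.lt_succ_self a)
    rw [← hTt, ← hTt] at this
    exact_mod_cast this
  obtain ⟨χ, hχ0, hχ⟩ := hlf.exists_char hζ T m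
    (fun _ => ⟨hT0, fun u _ => by rw [hTt 0 hm]; exact lam_ne_of_coprime h1.2.1 h1.2.2 u⟩) (by
      intro a ha
      rw [hTt a (by omega), hTt (a + 1) ha]
      by_cases hlt : ((p : ℤ) - 1) * t ⟨a, by omega⟩ < eK
      · have hl : lam p eK (t ⟨a, by omega⟩) = p * t ⟨a, by omega⟩ := min_eq_left (by linarith)
        rw [hl]
        rcases h2 ⟨a, by omega⟩ ha hlt with h4 | ⟨h4, h5, h6⟩
        · exact Or.inl h4.symm
        · exact Or.inr ⟨h4.le, fun u _ => lam_ne_of_coprime h5 h6 u⟩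
      · rw [not_lt] at hlt
        left
        rw [h3 ⟨a, by omega⟩ ha hlt]
        exact min_eq_right (by linarith))
  have := isDiscreteValuationRing_Ov hlf.norm
  have := isAdicComplete_Ov hlf.norm hlf.cpl
  have : CharZero K := charZero_of_injective_algebraMap (algebraMap ℚ_[p] K).injective
  obtain ⟨π, q, hb, hπ⟩ := exists_ltBase hlf.norm hlf.fin
  obtain ⟨E, _, _, vE, φ, hE, hinv⟩ := exists_ltExt hvK hb hπ (T (m - 1))
  obtain ⟨L, vL, σ, s, hs, hψ⟩ :=
    hE.exists_cyclic hinv hlf.valp hlf.one_le hm rfl hT hT0 hχ0 hχ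
  have : FiniteDimensional K L := hs.tr.finiteDimensional
  have : IsAlgClosed Ω := IsAlgClosure.isAlgClosed K
  let f : L →ₐ[K] Ω := IsAlgClosed.lift
  let e : L ≃ₐ[K] f.fieldRange := AlgEquiv.ofInjectiveField f
  have hs' := hs.transport e
  refine ⟨f.fieldRange, hs'.tr.rank, hs'.gal, ⟨_, hs'.gen⟩, _, hs'.inv, hs'.tr.normF, hs'.tr.ext,
    fun u => ?_⟩
  rw [hs'.isUpperJump_iff_exists hs'.inv hψ]
  constructor
  · rintro ⟨a, ha, h⟩
    exact ⟨⟨a, ha⟩, by rw [← hTt, h]⟩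
  · rintro ⟨a, h⟩
    exact ⟨a, a.2, by rw [hTt a a.2, ← h]⟩

end

/-- Maus' theorem. Assume `ζ_p ∉ K`. Integers `t 0 < … < t (m-1)` are
the upper ramification jumps of some totally ramified cyclic extension `L/K` of degree
`p^m` if and only if: (i) `1 ≤ t 0 < p·e_K/(p-1)` and `gcd(t 0, p) = 1`;
(ii) if `t i < e_K/(p-1)` then `t (i+1) = p·t i`, or `p·t i < t (i+1) < p·e_K/(p-1)` and
`gcd(p, t (i+1)) = 1`; (iii) if `t i ≥ e_K/(p-1)` then `t (i+1) = t i + e_K`. -/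
theorem statement_18
    (p : ℕ) [Fact p.Prime]
    (K : Type*) [Field K] [Algebra ℚ_[p] K] [FiniteDimensional ℚ_[p] K]
    (vK : AddValuation K (WithTop ℤ)) (eK : ℕ)
    (hvK : IsPadicValuation p vK eK)
    (hζ : ¬∃ ζ : K, IsPrimitiveRoot ζ p)
    (Ω : Type*) [Field Ω] [Algebra K Ω] [IsAlgClosure K Ω]
    (m : ℕ) (hm : 0 < m) (t : Fin m → ℤ) (htmono : StrictMono t) :
    (∃ M : IntermediateField K Ω,
      Module.finrank K ↥M = p ^ m ∧ IsGalois K ↥M ∧ IsCyclic (↥M ≃ₐ[K] ↥M) ∧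
      ∃ (vM : AddValuation ↥M (WithTop ℤ)) (hGal : GalInvariant K vM),
        IsNormalized vM ∧ Extends vK vM (p ^ m) ∧
        (∀ s : ℤ, IsUpperJump vM hGal s ↔ ∃ i, t i = s)) ↔
    ((1 ≤ t ⟨0, hm⟩ ∧ ((p : ℤ) - 1) * t ⟨0, hm⟩ < (p : ℤ) * eK ∧
        Int.gcd (t ⟨0, hm⟩) p = 1) ∧
      (∀ i : Fin m, ∀ hi : (i : ℕ) + 1 < m,
        ((p : ℤ) - 1) * t i < (eK : ℤ) →
          (t ⟨(i : ℕ) + 1, hi⟩ = (p : ℤ) * t i ∨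
            ((p : ℤ) * t i < t ⟨(i : ℕ) + 1, hi⟩ ∧
              ((p : ℤ) - 1) * t ⟨(i : ℕ) + 1, hi⟩ < (p : ℤ) * eK ∧
              Int.gcd (t ⟨(i : ℕ) + 1, hi⟩) p = 1))) ∧
      (∀ i : Fin m, ∀ hi : (i : ℕ) + 1 < m,
        (eK : ℤ) ≤ ((p : ℤ) - 1) * t i →
          t ⟨(i : ℕ) + 1, hi⟩ = t i + eK)) := by
  refine ⟨?_, fun ⟨h1, h2, h3⟩ => exists_of_conditions hvK hζ Ω hm htmono h1 h2 h3⟩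
  rintro ⟨M, hrank, hgal, hcyc, vM, hGal, hnorm, hext, hJ⟩
  exact conditions_of_exists hvK hζ ⟨hvK.1, hnorm, hext, hrank⟩ hgal hcyc hGal hm htmono hJ
end PaperRam
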